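/- For every squarefree natural number s, there are infinitely many m in the set 𝒮 − s = {t − s : t ∈ 𝒮} (where 𝒮 is the set of squarefree natural numbers) such that p_{n+1} − p_n = m for infinitely many n. -/

import Mathlib

/-- `m` is a de Polignac number if `p_{n+1} - p_n = m` for infinitely many `n`. -/
def DePolignac (m : ℕ) : Prop :=
  {n : ℕ | Nat.nth Nat.Prime (n + 1) - Nat.nth Nat.Prime n = m}.Infinite

section
open Complex Filter Topology MeasureTheory

namespace Pf

lemma sum_range_char {q : ℕ} [NeZero q] {χ : DirichletCharacter ℂ q} (hχ : χ ≠ 1) :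
    ∑ k ∈ Finset.range q, χ (k : ZMod q) = 0 := by
  rw [← MulChar.sum_eq_zero_of_ne_one hχ]
  symm
  apply Finset.sum_nbij' (fun a => ZMod.val a) (fun k => (k : ZMod q))
  · intro a _; simpa using ZMod.val_lt a
  · intro a _; simp
  · intro a _; simp
  · intro a ha; simpa using ZMod.val_cast_of_lt (by simpa using ha)
  · intro a _; simp

lemma norm_sum_range_char_le {q : ℕ} [NeZero q] {χ : DirichletCharacter ℂ q} (hχ : χ ≠ 1)
    (n : ℕ) : ‖∑ k ∈ Finset.range n, χ (k : ZMod q)‖ ≤ q := by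
  induction n using Nat.strong_induction_on with
  | _ n ih =>
    rcases lt_or_ge n q with h | h
    · calc _ ≤ ∑ k ∈ Finset.range n, ‖χ (k : ZMod q)‖ := norm_sum_le _ _
        _ ≤ ∑ k ∈ Finset.range n, (1 : ℝ) := Finset.sum_le_sum fun _ _ => χ.norm_le_one _
        _ ≤ q := by simpa using h.le
    · obtain ⟨m, rfl⟩ := Nat.exists_eq_add_of_le h
      have := ih m (by have := NeZero.pos q; omega)
      rw [Finset.sum_range_add, sum_range_char hχ, zero_add]
      simpa using this

lemma sum_Icc_eq_range (f : ℕ → ℂ) (hf : f 0 = 0) (n : ℕ) :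
    ∑ k ∈ Finset.Icc 1 n, f k = ∑ k ∈ Finset.range (n+1), f k := by
  rw [Finset.sum_range_succ', hf, add_zero, ← Finset.Ico_succ_right_eq_Icc, Finset.sum_Ico_eq_sum_range]
  simp [add_comm]

lemma char_zero {q : ℕ} {χ : DirichletCharacter ℂ q} (hχ : χ ≠ 1) :
    χ ((0:ℕ) : ZMod q) = 0 := by
  rcases eq_or_ne q 1 with rfl | h
  · exact absurd (Subsingleton.elim χ 1) hχ
  · have : Nontrivial (ZMod q) := ZMod.nontrivial_iff.mpr h
    simpa using χ.map_zero

/-- partial sums -/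
noncomputable def psum {q : ℕ} (χ : DirichletCharacter ℂ q) (t : ℝ) : ℂ :=
  ∑ k ∈ Finset.Icc 1 ⌊t⌋₊, χ (k : ZMod q)

lemma norm_psum_le {q : ℕ} [NeZero q] {χ : DirichletCharacter ℂ q} (hχ : χ ≠ 1) (t : ℝ) :
    ‖psum χ t‖ ≤ q := by
  unfold psum
  rw [sum_Icc_eq_range (fun k => χ (k : ZMod q)) (char_zero hχ)]
  exact norm_sum_range_char_le hχ _

lemma norm_psum_le' {q : ℕ} {χ : DirichletCharacter ℂ q} {t : ℝ} (ht : 0 ≤ t) :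
    ‖psum χ t‖ ≤ t := by
  unfold psum
  calc _ ≤ ∑ k ∈ Finset.Icc 1 ⌊t⌋₊, ‖χ (k : ZMod q)‖ := norm_sum_le _ _
    _ ≤ ∑ k ∈ Finset.Icc 1 ⌊t⌋₊, (1 : ℝ) := Finset.sum_le_sum fun _ _ => χ.norm_le_one _
    _ ≤ t := by simpa using Nat.floor_le ht

lemma psum_measurable {q : ℕ} (χ : DirichletCharacter ℂ q) : Measurable (psum χ) := by
  unfold psum
  exact (measurable_from_nat (f := fun n => ∑ k ∈ Finset.Icc 1 n, χ (k : ZMod q))).comp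
    Nat.measurable_floor

lemma psum_eq_zero {q : ℕ} (χ : DirichletCharacter ℂ q) {t : ℝ} (ht : t < 1) : psum χ t = 0 := by
  unfold psum
  rw [Nat.floor_eq_zero.mpr ht]; simp

lemma mellin_psum {q : ℕ} (χ : DirichletCharacter ℂ q) (s : ℂ) :
    mellin (psum χ) (-s) = ∫ t in Set.Ioi (1:ℝ), psum χ t * (t : ℂ) ^ (-(s+1)) := by
  unfold mellin
  rw [← integral_Ici_eq_integral_Ioi (x := (1:ℝ)), setIntegral_eq_of_subset_of_forall_sdiff_eq_zero
    (s := Set.Ici (1:ℝ)) (t := Set.Ioi (0:ℝ)) measurableSet_Ioi]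
  · apply setIntegral_congr_fun measurableSet_Ici
    intro t _
    simp only [smul_eq_mul]
    rw [mul_comm]; congr 2; ring
  · exact Set.Ici_subset_Ioi.mpr one_pos
  · intro t ht
    rw [psum_eq_zero χ (by simpa using ht.2)]; simp

lemma LFunction_eq_mellin {q : ℕ} [NeZero q] {χ : DirichletCharacter ℂ q} (hχ : χ ≠ 1)
    {s : ℂ} (hs : 0 < s.re) :
    DirichletCharacter.LFunction χ s = s * mellin (psum χ) (-s) := by
  have hd : ∀ z : ℂ, 0 < z.re → DifferentiableAt ℂ (fun s => s * mellin (psum χ) (-s)) z := by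
    intro z hz
    apply DifferentiableAt.mul differentiableAt_id
    apply DifferentiableAt.comp (f := fun s : ℂ => -s) (g := mellin (psum χ))
    · apply mellin_differentiableAt_of_isBigO_rpow (a := 0) (b := (-z).re - 1)
      · apply LocallyIntegrable.locallyIntegrableOn
        rw [locallyIntegrable_iff]
        intro K hK
        apply Measure.integrableOn_of_bounded (M := q) hK.measure_lt_top.ne
          (psum_measurable χ).aestronglyMeasurable
        exact ae_of_all _ fun t => norm_psum_le hχ t
      · simp only [neg_zero, Real.rpow_zero]
        exact Asymptotics.isBigO_of_le' (c := q) _ fun t => by simpa using norm_psum_le hχ t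
      · simpa using hz
      · apply Asymptotics.IsBigO.trans (g := fun _ => (0:ℂ)) _ (Asymptotics.isBigO_zero _ _)
        apply Filter.EventuallyEq.isBigO
        have : Set.Iio (1:ℝ) ∈ 𝓝[>] (0:ℝ) := mem_nhdsWithin_of_mem_nhds (Iio_mem_nhds one_pos)
        filter_upwards [this] with t ht using psum_eq_zero χ ht
      · linarith
    · exact differentiableAt_id.neg
  have hopen : IsOpen {z : ℂ | 0 < z.re} := isOpen_lt continuous_const continuous_re
  refine AnalyticOnNhd.eqOn_of_preconnected_of_eventuallyEq (𝕜 := ℂ) (U := {z | 0 < z.re})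
    (z₀ := 2) (f := DirichletCharacter.LFunction χ) (g := fun s => s * mellin (psum χ) (-s))
    ?_ ?_ ?_ ?_ ?_ hs
  · exact (DirichletCharacter.differentiable_LFunction hχ).differentiableOn.analyticOnNhd hopen
  · apply DifferentiableOn.analyticOnNhd _ hopen
    exact fun z hz => (hd z hz).differentiableWithinAt
  · exact (convex_halfSpace_re_gt 0).isPreconnected
  · simp
  · have : {z : ℂ | 1 < z.re} ∈ 𝓝 (2:ℂ) :=
      (isOpen_lt continuous_const continuous_re).mem_nhds (by simp)
    filter_upwards [this] with z hz
    rw [DirichletCharacter.LFunction_eq_LSeries χ hz, mellin_psum]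
    apply LSeries_eq_mul_integral _ (r := 0) le_rfl (lt_trans one_pos hz)
      (DirichletCharacter.LSeriesSummable_of_one_lt_re χ hz)
    simp only [Real.rpow_zero]
    refine Asymptotics.isBigO_of_le' (c := q) _ fun n => ?_
    have := norm_psum_le hχ n
    simpa [psum] using this

/-- the basic L-function bound -/
lemma norm_LFunction_le {q : ℕ} [NeZero q] {χ : DirichletCharacter ℂ q} (hχ : χ ≠ 1)
    {s : ℂ} (hs : 0 < s.re) {a : ℝ} (ha : 0 ≤ a) (ha1 : a ≤ 1) (h : 1 - a < s.re) :
    ‖DirichletCharacter.LFunction χ s‖ ≤ ‖s‖ * ((q:ℝ) ^ a / (s.re + a - 1)) := by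
  rw [LFunction_eq_mellin hχ hs, norm_mul, mellin_psum]
  gcongr
  have hinteg : ∫ t in Set.Ioi (1:ℝ), (q:ℝ)^a * t ^ (-a - s.re) = (q:ℝ) ^ a / (s.re + a - 1) := by
    rw [integral_const_mul, integral_Ioi_rpow_of_lt (by linarith) one_pos]
    rw [Real.one_rpow, div_eq_mul_inv]
    congr 1
    rw [neg_one_mul, ← inv_neg]; congr 1; ring
  rw [← hinteg]
  apply norm_integral_le_of_norm_le
  · exact (integrableOn_Ioi_rpow_of_lt (by linarith) one_pos).const_mul _
  · filter_upwards [self_mem_ae_restrict measurableSet_Ioi] with t ht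
    have ht1 : (1:ℝ) < t := ht
    have ht0 : 0 < t := one_pos.trans ht1
    rw [norm_mul, norm_cpow_eq_rpow_re_of_pos ht0]
    have h1 : ‖psum χ t‖ ≤ (q:ℝ)^a * t^(1-a) := by
      calc ‖psum χ t‖ = ‖psum χ t‖ ^ a * ‖psum χ t‖ ^ (1-a) := by
            rw [← Real.rpow_add_of_nonneg (norm_nonneg _) ha (by linarith)]; simp
        _ ≤ (q:ℝ)^a * t^(1-a) := by
            gcongr
            · exact norm_psum_le hχ t
            · exact norm_psum_le' ht0.le
    calc _ ≤ ((q:ℝ)^a * t^(1-a)) * t ^ (-(s+1)).re := by gcongr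
      _ = _ := by
        rw [mul_assoc, ← Real.rpow_add ht0]; congr 2; simp; ring

end Pf
end

section
open Complex Filter Topology MeasureTheory
open DirichletCharacter (LFunction)
namespace Pf

/-! ### Corollaries of the basic bound -/

lemma norm_LFunction_le_one {q : ℕ} [NeZero q] {χ : DirichletCharacter ℂ q} (hχ : χ ≠ 1)
    {s : ℂ} (hs : 1/20 ≤ s.re) (hs4 : ‖s‖ ≤ 4) : ‖LFunction χ s‖ ≤ 80 * q := by
  have := norm_LFunction_le hχ (s := s) (by linarith) (a := 1) zero_le_one le_rfl (by linarith)
  refine this.trans ?_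
  rw [Real.rpow_one, add_sub_cancel_right, ← mul_div_assoc, div_le_iff₀ (by linarith)]
  have hq : (0:ℝ) ≤ q := Nat.cast_nonneg q
  calc ‖s‖ * q ≤ 4 * q := by gcongr
    _ = 80 * q * (1/20) := by ring
    _ ≤ _ := by gcongr

lemma norm_deriv_LFunction_le_one {q : ℕ} [NeZero q] {χ : DirichletCharacter ℂ q} (hχ : χ ≠ 1)
    {s : ℂ} (hs : ‖s - 2‖ ≤ 19/10) : ‖deriv (LFunction χ) s‖ ≤ 1600 * q := by
  have hb := norm_deriv_le_of_forall_mem_sphere_norm_le (c := s) (R := 1/20) (C := 80 * q)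
    (f := LFunction χ) (by norm_num)
    ((DirichletCharacter.differentiable_LFunction hχ).diffContOnCl) (fun z hz => by
      have hz' : ‖z - s‖ = 1/20 := by simpa [dist_eq_norm] using hz
      have h2 : ‖z - 2‖ ≤ 39/20 := by
        have := norm_add_le (z - s) (s - 2)
        rw [sub_add_sub_cancel] at this; linarith
      apply norm_LFunction_le_one hχ
      · have := (abs_re_le_norm (z - 2)).trans h2
        rw [abs_le] at this
        simp at this; linarith
      · have := norm_add_le (z - 2) 2
        rw [sub_add_cancel] at this
        have h22 : ‖(2:ℂ)‖ = 2 := by simp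
        linarith)
  refine hb.trans (le_of_eq ?_)
  ring

lemma one_le_ell {q : ℕ} [NeZero q] : 1 ≤ 1 + Real.log q := by
  have : (1:ℝ) ≤ q := by exact_mod_cast NeZero.one_le
  linarith [Real.log_nonneg this]

lemma norm_LFunction_le_log {q : ℕ} [NeZero q] {χ : DirichletCharacter ℂ q} (hχ : χ ≠ 1)
    {s : ℂ} {l : ℝ} (hl : 1 + Real.log q ≤ l) (hs : 1 - 1/(2*l) ≤ s.re) (hs3 : ‖s‖ ≤ 3) :
    ‖LFunction χ s‖ ≤ 18 * l := by
  have hl1 : 1 ≤ l := one_le_ell.trans hl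
  have hl0 : 0 < l := by linarith
  have h1 : 1/(2*l) ≤ 1/2 := by
    apply one_div_le_one_div_of_le <;> linarith
  have h2 : 1/l = 1/(2*l) + 1/(2*l) := by field_simp; norm_num
  have h3 : 0 < 1/(2*l) := by positivity
  have := norm_LFunction_le hχ (s := s) (by linarith) (a := 1/l) (by positivity)
    (by rw [div_le_one hl0]; exact hl1) (by linarith)
  refine this.trans ?_
  have hq : (q:ℝ)^(1/l) ≤ 3 := by
    have hq0 : (0:ℝ) < q := by exact_mod_cast NeZero.pos q
    rw [Real.rpow_def_of_pos hq0]
    calc Real.exp (Real.log q * (1/l)) ≤ Real.exp 1 := by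
          apply Real.exp_le_exp.mpr
          rw [mul_one_div, div_le_one hl0]; linarith
      _ ≤ 3 := by linarith [Real.exp_one_lt_d9]
  have h4 : 1/(2*l) ≤ s.re + 1/l - 1 := by linarith
  calc ‖s‖ * ((q:ℝ)^(1/l) / (s.re + 1/l - 1)) ≤ 3 * (3 / (1/(2*l))) := 
        mul_le_mul hs3 (div_le_div₀ (by norm_num) hq h3 h4)
          (div_nonneg (by positivity) (by linarith)) (by norm_num)
    _ = 18 * l := by field_simp; norm_num

lemma norm_deriv_LFunction_le_log {q : ℕ} [NeZero q] {χ : DirichletCharacter ℂ q} (hχ : χ ≠ 1)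
    {s : ℂ} {l : ℝ} (hl : 1 + Real.log q ≤ l) (hs : 1 - 1/(4*l) ≤ s.re) (hs3 : ‖s‖ ≤ 2) :
    ‖deriv (LFunction χ) s‖ ≤ 72 * l ^ 2 := by
  have hl1 : 1 ≤ l := one_le_ell.trans hl
  have hl0 : 0 < l := by linarith
  have h2 : 1/(2*l) = 1/(4*l) + 1/(4*l) := by field_simp; norm_num
  have h1 : 1/(4*l) ≤ 1/4 := by
    apply one_div_le_one_div_of_le <;> linarith
  have hb := norm_deriv_le_of_forall_mem_sphere_norm_le (c := s) (R := 1/(4*l)) (C := 18 * l)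
    (f := LFunction χ) (by positivity)
    ((DirichletCharacter.differentiable_LFunction hχ).diffContOnCl) (fun z hz => by
      have hz' : ‖z - s‖ = 1/(4*l) := by simpa [dist_eq_norm] using hz
      apply norm_LFunction_le_log hχ hl
      · have := (abs_re_le_norm (z - s))
        rw [hz', abs_le] at this
        simp only [sub_re] at this; linarith
      · have := norm_add_le (z - s) s
        rw [sub_add_cancel] at this
        linarith)
  refine hb.trans (le_of_eq ?_)
  field_simp; norm_num

lemma norm_LFunction_sub_le {q : ℕ} [NeZero q] {χ : DirichletCharacter ℂ q} (hχ : χ ≠ 1)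
    {s t : ℂ} {l : ℝ} (hl : 1 + Real.log q ≤ l) (hs : 1 - 1/(4*l) ≤ s.re) (hs3 : ‖s‖ ≤ 2)
    (ht : 1 - 1/(4*l) ≤ t.re) (ht3 : ‖t‖ ≤ 2) :
    ‖LFunction χ s - LFunction χ t‖ ≤ 72 * l ^ 2 * ‖s - t‖ := by
  apply Convex.norm_image_sub_le_of_norm_deriv_le (𝕜 := ℂ)
    (s := {z : ℂ | 1 - 1/(4*l) ≤ z.re} ∩ Metric.closedBall 0 2)
  · exact fun z _ => (DirichletCharacter.differentiable_LFunction hχ) z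
  · intro z hz
    exact norm_deriv_LFunction_le_log hχ hl hz.1 (by simpa using hz.2)
  · exact (convex_halfSpace_re_ge _).inter (convex_closedBall _ _)
  · exact ⟨ht, by simpa using ht3⟩
  · exact ⟨hs, by simpa using hs3⟩

/-! ### Product of characters -/

/-- the character `χ₁ * conj χ₂` at level `q₁ q₂` -/
noncomputable def pairChar {q₁ q₂ : ℕ} (χ₁ : DirichletCharacter ℂ q₁)
    (χ₂ : DirichletCharacter ℂ q₂) : DirichletCharacter ℂ (q₁ * q₂) :=
  DirichletCharacter.changeLevel (dvd_mul_right q₁ q₂) χ₁ *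
    (DirichletCharacter.changeLevel (dvd_mul_left q₂ q₁) χ₂)⁻¹

lemma char_eq_zero_of_not_coprime {q : ℕ} (χ : DirichletCharacter ℂ q) {n : ℕ}
    (h : ¬ Nat.Coprime n q) : χ (n : ZMod q) = 0 :=
  χ.map_nonunit (fun h' => h ((ZMod.isUnit_iff_coprime n q).mp h'))

lemma changeLevel_apply_of_coprime {q N : ℕ} (h : q ∣ N) (χ : DirichletCharacter ℂ q) {n : ℕ}
    (hn : Nat.Coprime n N) :
    DirichletCharacter.changeLevel h χ (n : ZMod N) = χ (n : ZMod q) := by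
  have := DirichletCharacter.changeLevel_eq_cast_of_dvd' χ h (a := (n:ℤ))
    (Nat.isCoprime_iff_coprime.mpr hn)
  simpa using this

lemma pairChar_apply {q₁ q₂ : ℕ} (χ₁ : DirichletCharacter ℂ q₁)
    (χ₂ : DirichletCharacter ℂ q₂) (n : ℕ) :
    pairChar χ₁ χ₂ (n : ZMod (q₁ * q₂)) = χ₁ (n : ZMod q₁) * (starRingEnd ℂ) (χ₂ (n : ZMod q₂)) := by
  by_cases h : Nat.Coprime n (q₁ * q₂)
  · unfold pairChar
    rw [MulChar.mul_apply, ← MulChar.star_apply', changeLevel_apply_of_coprime _ _ h,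
      changeLevel_apply_of_coprime _ _ h]
    rfl
  · rw [char_eq_zero_of_not_coprime _ h]
    rw [Nat.coprime_mul_iff_right, not_and_or] at h
    rcases h with h | h <;> rw [char_eq_zero_of_not_coprime _ h] <;> simp

lemma pairChar_ne_one {q₁ q₂ : ℕ} [NeZero q₁] [NeZero q₂] {χ₁ : DirichletCharacter ℂ q₁}
    {χ₂ : DirichletCharacter ℂ q₂} (h₁ : χ₁.IsPrimitive) (h₂ : χ₂.IsPrimitive)
    (hne : (⟨q₁, χ₁⟩ : Σ q, DirichletCharacter ℂ q) ≠ ⟨q₂, χ₂⟩) : pairChar χ₁ χ₂ ≠ 1 := by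
  intro h
  unfold pairChar at h
  rw [mul_inv_eq_one] at h
  have hc := congrArg DirichletCharacter.conductor h
  rw [DirichletCharacter.conductor_changeLevel, DirichletCharacter.conductor_changeLevel] at hc
  rw [DirichletCharacter.isPrimitive_def] at h₁ h₂
  rw [h₁, h₂] at hc
  subst hc
  apply hne
  congr 1
  exact DirichletCharacter.changeLevel_injective _ h

/-! ### Repulsion -/

lemma re_log_comb {a : ℝ} (ha₀ : 0 ≤ a) (ha₁ : a < 1) {z w : ℂ} (hz : ‖z‖ ≤ 1) (hw : ‖w‖ ≤ 1) :
    0 ≤ 3 * (-log (1 - a)).re + 2 * (-log (1 - z * a)).re + 2 * (-log (1 - w * a)).re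
      + 2 * (-log (1 - (z * (starRingEnd ℂ) w) * a)).re := by
  have hac₀ : ‖(a : ℂ)‖ < 1 := by
    simp only [Complex.norm_of_nonneg ha₀, ha₁]
  have key : ∀ y : ℂ, ‖y‖ ≤ 1 → ‖y * a‖ < 1 := fun y hy => by
    rw [norm_mul]; exact (mul_le_of_le_one_left (norm_nonneg _) hy).trans_lt hac₀
  have hac₁ := key z hz
  have hac₂ := key w hw
  have hac₃ := key (z * (starRingEnd ℂ) w) (by
    rw [norm_mul, Complex.norm_conj]; exact mul_le_one₀ hz (norm_nonneg _) hw)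
  rw [← ((((hasSum_re <| hasSum_taylorSeries_neg_log hac₀).mul_left 3).add
    ((hasSum_re <| hasSum_taylorSeries_neg_log hac₁).mul_left 2)).add
    ((hasSum_re <| hasSum_taylorSeries_neg_log hac₂).mul_left 2)).add
    ((hasSum_re <| hasSum_taylorSeries_neg_log hac₃).mul_left 2) |>.tsum_eq]
  refine tsum_nonneg fun n ↦ ?_
  have hz' : ‖z^n‖ ≤ 1 := by rw [norm_pow]; exact pow_le_one₀ (norm_nonneg _) hz
  have hw' : ‖w^n‖ ≤ 1 := by rw [norm_pow]; exact pow_le_one₀ (norm_nonneg _) hw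
  simp only [mul_pow, ← map_pow]
  generalize z^n = Z at *
  generalize w^n = V at *
  simp only [← ofReal_pow, div_natCast_re, re_mul_ofReal, ofReal_re]
  have e : 3 * (a ^ n / (n:ℝ)) + 2 * (Z.re * a ^ n / n) + 2 * (V.re * a ^ n / n) +
      2 * ((Z * (starRingEnd ℂ) V).re * a ^ n / n)
      = (a^n / n) * (3 + 2 * Z.re + 2 * V.re + 2 * (Z * (starRingEnd ℂ) V).re) := by ring
  rw [e]
  apply mul_nonneg (by positivity)
  have hZ : Z.re^2 + Z.im^2 ≤ 1 := by
    have := Complex.sq_norm Z; rw [Complex.normSq_apply] at this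
    nlinarith [norm_nonneg Z]
  have hV : V.re^2 + V.im^2 ≤ 1 := by
    have := Complex.sq_norm V; rw [Complex.normSq_apply] at this
    nlinarith [norm_nonneg V]
  simp only [mul_re, conj_re, conj_im]
  nlinarith [sq_nonneg (1 + Z.re + V.re), sq_nonneg (Z.im + V.im)]

lemma repulsion_LSeries {q₁ q₂ : ℕ} [NeZero q₁] [NeZero q₂] (χ₁ : DirichletCharacter ℂ q₁)
    (χ₂ : DirichletCharacter ℂ q₂) {x : ℝ} (hx : 1 < x) :
    1 ≤ ‖LSeries (fun n => (1 : DirichletCharacter ℂ 1) n) x‖ ^ 3 * ‖LFunction χ₁ x‖ ^ 2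
      * ‖LFunction χ₂ x‖ ^ 2 * ‖LFunction (pairChar χ₁ χ₂) x‖ ^ 2 := by
  have h : 1 < (x : ℂ).re := by simpa using hx
  have H₀ := DirichletCharacter.summable_neg_log_one_sub_mul_prime_cpow (N := 1) 1 h
  have H₁ := DirichletCharacter.summable_neg_log_one_sub_mul_prime_cpow χ₁ h
  have H₂ := DirichletCharacter.summable_neg_log_one_sub_mul_prime_cpow χ₂ h
  have H₃ := DirichletCharacter.summable_neg_log_one_sub_mul_prime_cpow (pairChar χ₁ χ₂) h
  have hsum₀ := (hasSum_re H₀.hasSum).summable.mul_left 3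
  have hsum₁ := (hasSum_re H₁.hasSum).summable.mul_left 2
  have hsum₂ := (hasSum_re H₂.hasSum).summable.mul_left 2
  have hsum₃ := (hasSum_re H₃.hasSum).summable.mul_left 2
  rw [DirichletCharacter.LFunction_eq_LSeries _ h, DirichletCharacter.LFunction_eq_LSeries _ h,
    DirichletCharacter.LFunction_eq_LSeries _ h]
  rw [← DirichletCharacter.LSeries_eulerProduct_exp_log _ h, ← DirichletCharacter.LSeries_eulerProduct_exp_log χ₁ h,
    ← DirichletCharacter.LSeries_eulerProduct_exp_log χ₂ h, ← DirichletCharacter.LSeries_eulerProduct_exp_log _ h]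
  simp only [← Real.exp_nat_mul, Nat.cast_ofNat, ← Real.exp_add, norm_exp, Real.one_le_exp_iff]
  rw [re_tsum H₀, re_tsum H₁, re_tsum H₂, re_tsum H₃, ← tsum_mul_left, ← tsum_mul_left,
    ← tsum_mul_left, ← tsum_mul_left,
    ← hsum₀.tsum_add hsum₁, ← (hsum₀.add hsum₁).tsum_add hsum₂,
    ← ((hsum₀.add hsum₁).add hsum₂).tsum_add hsum₃]
  apply tsum_nonneg
  intro p
  have hp : (1:ℝ) < (p:ℕ) := by exact_mod_cast p.prop.one_lt
  have hlt : ((p:ℕ) : ℝ) ^ (-x) < 1 := Real.rpow_lt_one_of_one_lt_of_neg hp (by linarith)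
  have := re_log_comb (a := ((p:ℕ) : ℝ) ^ (-x)) (by positivity) hlt
    (χ₁.norm_le_one (p : ZMod q₁)) (χ₂.norm_le_one (p : ZMod q₂))
  rw [pairChar_apply]
  have e : ((((p:ℕ) : ℝ) ^ (-x) : ℝ) : ℂ) = ((p:ℕ):ℂ) ^ (-(x:ℂ)) := by
    rw [ofReal_cpow (by positivity)]; simp
  rw [e] at this
  have o : (1 : DirichletCharacter ℂ 1) ((p:ℕ) : ZMod 1) = 1 := by
    rw [Subsingleton.elim ((p:ℕ) : ZMod 1) 1]; simp
  rw [o, one_mul]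
  exact this

end Pf
end

section
open Complex Filter Topology MeasureTheory
open DirichletCharacter (LFunction)
namespace Pf

/-! ### elementary tools -/

lemma tsum_rpow_le {s : ℝ} (hs : 1 < s) :
    ∑' n : ℕ, 1 / (n + 1 : ℝ) ^ s ≤ 1 + 1 / (s - 1) := by
  have h := ZetaAsymptotics.zeta_limit_aux1 hs
  have h2 : 0 ≤ ZetaAsymptotics.termTSum s :=
    tsum_nonneg fun n => ZetaAsymptotics.term_nonneg _ _
  have : 0 ≤ s * ZetaAsymptotics.termTSum s := mul_nonneg (by linarith) h2
  linarith

lemma summable_rpow {s : ℝ} (hs : 1 < s) : Summable fun n : ℕ => (n : ℝ) ^ (-s) :=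
  Real.summable_nat_rpow.mpr (by linarith)

/-- `∑ n^{-s} ≤ 1 + 1/(s-1)` -/
lemma tsum_rpow_neg_le {s : ℝ} (hs : 1 < s) :
    ∑' n : ℕ, (n : ℝ) ^ (-s) ≤ 1 + 1 / (s - 1) := by
  rw [(summable_rpow hs).tsum_eq_zero_add]
  have : (((0:ℕ) : ℝ)) ^ (-s) = 0 := by
    rw [Nat.cast_zero, Real.zero_rpow]; linarith
  rw [this, zero_add]
  refine le_trans (le_of_eq ?_) (tsum_rpow_le hs)
  congr 1; ext n
  rw [Real.rpow_neg (by positivity), one_div]; push_cast; rfl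

lemma norm_term_le {f : ℕ → ℂ} {b : ℕ → ℝ} (hf : ∀ n, ‖f n‖ ≤ b n) (s : ℂ) (n : ℕ) :
    ‖LSeries.term f s n‖ ≤ b n * (n:ℝ) ^ (-s.re) := by
  have hb : 0 ≤ b n := (norm_nonneg _).trans (hf n)
  rw [LSeries.norm_term_eq]
  split_ifs with h
  · positivity
  · rw [Real.rpow_neg (by positivity), div_eq_mul_inv]
    gcongr; exact hf n

lemma norm_LSeries_le_tsum {f : ℕ → ℂ} {b : ℕ → ℝ} (hf : ∀ n, ‖f n‖ ≤ b n) {s : ℂ}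
    (hs : Summable fun n : ℕ => b n * (n:ℝ) ^ (-s.re)) :
    ‖LSeries f s‖ ≤ ∑' n : ℕ, b n * (n:ℝ) ^ (-s.re) :=
  tsum_of_norm_bounded hs.hasSum (norm_term_le hf s)

lemma norm_LSeries_char_le {q : ℕ} (χ : DirichletCharacter ℂ q) {s : ℂ} (hs : 1 < s.re) :
    ‖LSeries (fun n => χ n) s‖ ≤ 1 + 1 / (s.re - 1) := by
  have := norm_LSeries_le_tsum (f := fun n => χ n) (b := fun _ => 1) (fun n => χ.norm_le_one n)
    (s := s) (by simpa using summable_rpow hs)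
  refine this.trans ?_
  simpa using tsum_rpow_neg_le hs

/-- polylogs are smaller than powers -/
lemma polylog_le (C A : ℝ) (m : ℕ) {c : ℝ} (hc : 0 < c) :
    ∀ᶠ j : ℕ in atTop, C * (1 + A * Real.log j) ^ m ≤ (j:ℝ) ^ c := by
  have h1 : (fun x : ℝ => C * (1 + A * Real.log x) ^ m) =o[atTop] fun x => x ^ c := by
    apply Asymptotics.IsLittleO.const_mul_left
    have h2 : (fun x : ℝ => 1 + A * Real.log x) =O[atTop] Real.log := by
      apply Asymptotics.IsBigO.add
      · exact (Real.isLittleO_const_log_atTop).isBigO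
      · exact (Asymptotics.isBigO_refl _ _).const_mul_left _
    refine (h2.pow m).trans_isLittleO ?_
    have := isLittleO_log_rpow_rpow_atTop (m:ℝ) hc
    refine this.congr' ?_ EventuallyEq.rfl
    filter_upwards with x
    simp
  have h2 := (h1.comp_tendsto tendsto_natCast_atTop_atTop).bound (c := 1) one_pos
  filter_upwards [h2] with j hj
  simp only [Function.comp, one_mul, Real.norm_eq_abs] at hj
  calc _ ≤ _ := le_abs_self _
    _ ≤ _ := hj
    _ = _ := abs_of_nonneg (by positivity)

/-! ### Good scales -/

/-- `j` is a good scale with exponent `A` -/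
def Good (A : ℕ) (j : ℕ) : Prop :=
  ∀ (q : ℕ) [NeZero q] (χ : DirichletCharacter ℂ q), q ≤ j ^ A → χ.IsPrimitive → χ ≠ 1 →
    (j:ℝ) ^ (-(1/3) : ℝ) ≤ ‖LFunction χ 1‖

lemma repulsion (A : ℕ) : ∀ᶠ j : ℕ in atTop, ∀ (q₁ q₂ : ℕ) [NeZero q₁] [NeZero q₂]
    (χ₁ : DirichletCharacter ℂ q₁) (χ₂ : DirichletCharacter ℂ q₂),
    q₁ ≤ j ^ A → q₂ ≤ j ^ A → χ₁.IsPrimitive → χ₂.IsPrimitive → χ₁ ≠ 1 → χ₂ ≠ 1 →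
    (⟨q₁, χ₁⟩ : Σ q, DirichletCharacter ℂ q) ≠ ⟨q₂, χ₂⟩ →
    ‖LFunction χ₁ 1‖ ≤ 2 * (j:ℝ) ^ (-(1/3) : ℝ) → ‖LFunction χ₂ 1‖ ≤ 2 * (j:ℝ) ^ (-(1/3) : ℝ) →
    False := by
  filter_upwards [polylog_le (2 * (8 * 74^4 * 324)) (2 * A) 10 (c := 1/3) (by norm_num),
    eventually_ge_atTop 1] with j hj hj1 q₁ q₂ _ _ χ₁ χ₂ hq₁ hq₂ hp₁ hp₂ hn₁ hn₂ hne hL₁ hL₂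
  have hj0 : (0:ℝ) < j := by exact_mod_cast hj1
  have hlj : 0 ≤ Real.log j := Real.log_nonneg (by exact_mod_cast hj1)
  set l : ℝ := 1 + 2 * A * Real.log j with hl
  have hl1 : 1 ≤ l := by
    have : 0 ≤ 2 * A * Real.log j := by positivity
    linarith
  set x : ℝ := (j:ℝ) ^ (-(1/3) : ℝ) with hx
  have hx0 : 0 < x := by positivity
  have hx1 : x ≤ 1 := Real.rpow_le_one_of_one_le_of_nonpos (by exact_mod_cast hj1) (by norm_num)
  have hlog : ∀ q : ℕ, [NeZero q] → q ≤ j^A → 1 + Real.log q ≤ l ∧ Real.log q ≤ A * Real.log j := by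
    intro q _ hq
    have h0 : (0:ℝ) < q := by exact_mod_cast NeZero.pos q
    have : Real.log q ≤ A * Real.log j := by
      rw [← Real.log_pow]
      exact Real.log_le_log h0 (by exact_mod_cast hq)
    have : 0 ≤ A * Real.log j := by positivity
    constructor <;> linarith
  have hA : ∀ (q : ℕ) [NeZero q] (χ : DirichletCharacter ℂ q), χ ≠ 1 → 1 + Real.log q ≤ l →
      ‖LFunction χ 1‖ ≤ 2 * x → ‖LFunction χ ((1 + x : ℝ) : ℂ)‖ ≤ 74 * l^2 * x := by
    intro q _ χ hn hq hL
    have h0 : 0 < 1/(4*l) := by positivity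
    have := norm_LFunction_sub_le hn hq (s := ((1 + x : ℝ) : ℂ)) (t := 1)
      (by simp only [ofReal_re]; linarith)
      (by rw [Complex.norm_real, Real.norm_eq_abs, abs_of_nonneg] <;> linarith)
      (by simp only [one_re]; linarith) (by simp)
    have e : ((1 + x : ℝ) : ℂ) - 1 = (x:ℂ) := by push_cast; ring
    rw [e, Complex.norm_real, Real.norm_eq_abs, abs_of_pos hx0] at this
    have h2 := norm_le_norm_add_norm_sub' (LFunction χ ((1 + x : ℝ) : ℂ)) (LFunction χ 1)
    have : 2 * x ≤ 2 * l^2 * x := by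
      have : 1 ≤ l^2 := one_le_pow₀ hl1
      nlinarith
    linarith
  have b1 := hA q₁ χ₁ hn₁ (hlog q₁ hq₁).1 hL₁
  have b2 := hA q₂ χ₂ hn₂ (hlog q₂ hq₂).1 hL₂
  have b3 : ‖LFunction (pairChar χ₁ χ₂) ((1 + x : ℝ) : ℂ)‖ ≤ 18 * l := by
    apply norm_LFunction_le_log (pairChar_ne_one hp₁ hp₂ hne)
    · push_cast
      rw [Real.log_mul (by exact_mod_cast NeZero.ne q₁) (by exact_mod_cast NeZero.ne q₂)]
      linarith [(hlog q₁ hq₁).2, (hlog q₂ hq₂).2]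
    · have h0 : 0 < 1/(2*l) := by positivity
      simp only [ofReal_re]; linarith
    · rw [Complex.norm_real, Real.norm_eq_abs, abs_of_nonneg] <;> linarith
  have b0 : ‖LSeries (fun n => (1 : DirichletCharacter ℂ 1) n) ((1 + x : ℝ) : ℂ)‖ ≤ 2 / x := by
    refine (norm_LSeries_char_le _ (by simpa using hx0)).trans ?_
    simp only [ofReal_re, add_sub_cancel_left]
    rw [le_div_iff₀ hx0, add_mul, one_div_mul_cancel hx0.ne']; linarith
  have main := repulsion_LSeries χ₁ χ₂ (x := 1 + x) (by linarith)
  have : (1:ℝ) ≤ (2/x)^3 * (74 * l^2 * x)^2 * (74 * l^2 * x)^2 * (18 * l)^2 :=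
    main.trans (by gcongr)
  have e : (2/x)^3 * (74 * l^2 * x)^2 * (74 * l^2 * x)^2 * (18 * l)^2 =
      8 * 74^4 * 324 * l^10 * x := by field_simp; ring
  rw [e] at this
  have hxi : x * (j:ℝ)^(1/3 : ℝ) = 1 := by
    rw [hx, ← Real.rpow_add hj0]; norm_num
  have h3 : 2 * (8 * 74^4 * 324) * l^10 * x ≤ (j:ℝ)^(1/3 : ℝ) * x := by gcongr
  linarith

lemma exists_good (A J : ℕ) : ∃ j, J ≤ j ∧ Good A j := by
  obtain ⟨J1, hJ1⟩ := eventually_atTop.mp (repulsion A)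
  set j0 := max (max J J1) 1 with hj0
  have hJ : J ≤ j0 := by omega
  have hJ1' : J1 ≤ j0 := by omega
  have h1 : 1 ≤ j0 := by omega
  by_cases hg : Good A j0
  · exact ⟨j0, hJ, hg⟩
  unfold Good at hg
  push Not at hg
  obtain ⟨q₁, _, χ₁, hq₁, hp₁, hn₁, hL₁⟩ := hg
  have hpos : 0 < ‖LFunction χ₁ 1‖ :=
    norm_pos_iff.mpr (DirichletCharacter.LFunction_apply_one_ne_zero hn₁)
  have hex : ∃ j : ℕ, j0 ≤ j ∧ (j:ℝ) ^ (-(1/3) : ℝ) ≤ ‖LFunction χ₁ 1‖ := by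
    have := (tendsto_rpow_neg_atTop (y := 1/3) (by norm_num)).comp
      (tendsto_natCast_atTop_atTop (R := ℝ))
    have h2 := (this.eventually (ge_mem_nhds hpos)).and (eventually_ge_atTop j0)
    obtain ⟨j, hj, hj'⟩ := h2.exists
    exact ⟨j, hj', hj⟩
  classical
  set j1 := Nat.find hex with hj1
  obtain ⟨hs1, hs2⟩ := Nat.find_spec hex
  rw [← hj1] at hs1 hs2
  refine ⟨j1, hJ.trans hs1, ?_⟩
  have hlt : j0 < j1 := by
    refine lt_of_le_of_ne hs1 fun h => ?_
    rw [← h] at hs2; linarith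
  have hmin : ‖LFunction χ₁ 1‖ < ((j1 - 1 : ℕ) : ℝ) ^ (-(1/3) : ℝ) := by
    have := Nat.find_min hex (m := j1 - 1) (by omega)
    push Not at this
    exact this (by omega)
  have hle : ((j1 - 1 : ℕ) : ℝ) ^ (-(1/3) : ℝ) ≤ 2 * (j1 : ℝ) ^ (-(1/3) : ℝ) := by
    have hp : (0:ℝ) < ((j1 - 1 : ℕ) : ℝ) := by exact_mod_cast (by omega : 0 < j1 - 1)
    have hj1p : (0:ℝ) < j1 := by exact_mod_cast (by omega : 0 < j1)
    have h8 : (j1:ℝ) ≤ 8 * ((j1 - 1 : ℕ) : ℝ) := by exact_mod_cast (by omega : j1 ≤ 8 * (j1 - 1))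
    rw [Real.rpow_neg hp.le, Real.rpow_neg hj1p.le]
    rw [← div_eq_mul_inv, inv_eq_one_div, div_le_div_iff₀ (by positivity) (by positivity), one_mul]
    calc (j1:ℝ)^(1/3:ℝ) ≤ (8 * ((j1 - 1 : ℕ) : ℝ))^(1/3:ℝ) := by gcongr
      _ = 2 * ((j1 - 1 : ℕ) : ℝ)^(1/3:ℝ) := by
        rw [Real.mul_rpow (by norm_num) hp.le]
        congr 1
        rw [show (8:ℝ) = 2^(3:ℝ) by norm_num, ← Real.rpow_mul (by norm_num)]; norm_num
  intro q₂ _ χ₂ hq₂ hp₂ hn₂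
  by_contra hcon
  push Not at hcon
  have hx : 0 < (j1 : ℝ) ^ (-(1/3) : ℝ) := by
    have : (0:ℝ) < j1 := by exact_mod_cast (by omega : 0 < j1)
    positivity
  refine hJ1 j1 (by omega) q₁ q₂ χ₁ χ₂ (hq₁.trans (Nat.pow_le_pow_left hs1 A)) hq₂ hp₁ hp₂ hn₁ hn₂
    ?_ (hmin.le.trans hle) (by linarith)
  intro heq
  have : ‖LFunction χ₁ 1‖ = ‖LFunction χ₂ 1‖ := by
    cases heq
    congr!
  linarith

end Pf
end

section
open Complex Filter Topology MeasureTheory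
open DirichletCharacter (LFunction)
open ArithmeticFunction (vonMangoldt)
open scoped Nat
namespace Pf

/-- `∑ f(n) (log n)^j / n^2` -/
noncomputable def D (f : ℕ → ℂ) (j : ℕ) : ℂ := LSeries (fun n : ℕ => (Real.log n : ℂ) ^ j * f n) 2

lemma logMul_iter (f : ℕ → ℂ) (j : ℕ) :
    (LSeries.logMul^[j] f) = fun n : ℕ => (Real.log n : ℂ) ^ j * f n := by
  induction j with
  | zero => ext n; simp
  | succ j ih =>
    rw [Function.iterate_succ_apply', ih]
    ext n
    simp only [LSeries.logMul, ← natCast_log]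
    ring

lemma iteratedDeriv_eq_D {f : ℕ → ℂ} (hf : LSeries.abscissaOfAbsConv f ≤ 1) (j : ℕ) :
    iteratedDeriv j (LSeries f) 2 = (-1) ^ j * D f j := by
  rw [LSeries_iteratedDeriv, logMul_iter]
  · rfl
  · refine lt_of_le_of_lt hf ?_
    simp only [re_ofNat]
    exact_mod_cast one_lt_two

lemma norm_D_eq_iteratedDeriv {f : ℕ → ℂ} (hf : LSeries.abscissaOfAbsConv f ≤ 1) (j : ℕ)
    {F : ℂ → ℂ} (hF : F =ᶠ[𝓝 2] LSeries f) : ‖D f j‖ = ‖iteratedDeriv j F 2‖ := by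
  rw [hF.iteratedDeriv_eq, iteratedDeriv_eq_D hf]; simp

lemma norm_D_le {f : ℕ → ℂ} (hf : LSeries.abscissaOfAbsConv f ≤ 1) (j : ℕ)
    {F : ℂ → ℂ} (hF : F =ᶠ[𝓝 2] LSeries f) {ρ C : ℝ} (hρ : 0 < ρ)
    (hd : ∀ z ∈ Metric.closedBall (2:ℂ) ρ, DifferentiableAt ℂ F z)
    (hC : ∀ z ∈ Metric.sphere (2:ℂ) ρ, ‖F z‖ ≤ C) :
    ‖D f j‖ ≤ j ! * C / ρ ^ j := by
  rw [norm_D_eq_iteratedDeriv hf j hF]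
  apply norm_iteratedDeriv_le_of_forall_mem_sphere_norm_le j hρ _ hC
  apply DifferentiableOn.diffContOnCl_ball (U := Metric.closedBall (2:ℂ) ρ)
  · exact fun z hz => (hd z hz).differentiableWithinAt
  · exact subset_rfl

/-- twisted von Mangoldt -/
noncomputable def tw {q : ℕ} (χ : DirichletCharacter ℂ q) : ℕ → ℂ := fun n => χ n * (vonMangoldt n : ℂ)

lemma vonMangoldt_le_rpow {δ : ℝ} (hδ : 0 < δ) (n : ℕ) :
    vonMangoldt n ≤ (n:ℝ) ^ δ / δ :=
  ArithmeticFunction.vonMangoldt_le_log.trans (Real.log_le_rpow_div (Nat.cast_nonneg n) hδ)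

lemma norm_tw_le {q : ℕ} (χ : DirichletCharacter ℂ q) (n : ℕ) : ‖tw χ n‖ ≤ vonMangoldt n := by
  unfold tw
  rw [norm_mul, Complex.norm_real, Real.norm_eq_abs, abs_of_nonneg ArithmeticFunction.vonMangoldt_nonneg]
  exact mul_le_of_le_one_left ArithmeticFunction.vonMangoldt_nonneg (χ.norm_le_one _)

lemma abscissa_le_one_of_bound {f : ℕ → ℂ} (h : ∀ δ : ℝ, 0 < δ → ∃ C : ℝ, ∀ n, n ≠ 0 → ‖f n‖ ≤ C * (n:ℝ) ^ δ) :
    LSeries.abscissaOfAbsConv f ≤ 1 := by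
  refine LSeries.abscissaOfAbsConv_le_of_forall_lt_LSeriesSummable (x := 1) fun y hy ↦ ?_
  obtain ⟨C, hC⟩ := h ((y-1)/2) (by linarith)
  apply LSeriesSummable_of_le_const_mul_rpow (x := 1 + (y-1)/2)
  · simp only [ofReal_re]; linarith
  · exact ⟨C, fun n hn => by simpa using hC n hn⟩

lemma abscissa_tw {q : ℕ} (χ : DirichletCharacter ℂ q) :
    LSeries.abscissaOfAbsConv (tw χ) ≤ 1 := by
  apply abscissa_le_one_of_bound
  intro δ hδ
  refine ⟨1/δ, fun n _ => (norm_tw_le χ n).trans ?_⟩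
  have := vonMangoldt_le_rpow hδ n
  rw [one_div_mul_eq_div]; exact this

lemma norm_LSeries_tw_le {q : ℕ} (χ : DirichletCharacter ℂ q) {s : ℂ} {δ : ℝ} (hδ : 0 < δ)
    (hδ1 : δ ≤ 1) (hs : 1 + 2 * δ ≤ s.re) : ‖LSeries (tw χ) s‖ ≤ 2 / δ ^ 2 := by
  have h1 : ∀ n : ℕ, (n:ℝ)^δ / δ * (n:ℝ) ^ (-s.re) ≤ 1/δ * (n:ℝ) ^ (-(1+δ)) := by
    intro n
    rcases Nat.eq_zero_or_pos n with rfl | hn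
    · rw [Nat.cast_zero, Real.zero_rpow hδ.ne']; simp; positivity
    · have hn1 : (1:ℝ) ≤ n := by exact_mod_cast hn
      rw [div_mul_eq_mul_div, one_div_mul_eq_div, ← Real.rpow_add (by linarith)]
      gcongr
      linarith
  have hsum : Summable fun n : ℕ => 1/δ * (n:ℝ) ^ (-(1+δ)) :=
    (summable_rpow (by linarith)).mul_left _
  have hsum2 := hsum.of_nonneg_of_le (fun n => by positivity) h1
  refine (norm_LSeries_le_tsum (b := fun n => (n:ℝ)^δ / δ)
    (fun n => (norm_tw_le χ n).trans (vonMangoldt_le_rpow hδ n)) hsum2).trans ?_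
  refine (hsum2.tsum_le_tsum h1 hsum).trans ?_
  rw [tsum_mul_left]
  calc 1/δ * ∑' n : ℕ, (n:ℝ) ^ (-(1+δ)) ≤ 1/δ * (1 + 1/(1 + δ - 1)) := by
        gcongr; exact tsum_rpow_neg_le (by linarith)
    _ ≤ 1/δ * (1/δ + 1/δ) := by
        gcongr
        · rw [le_div_iff₀ hδ]; linarith
        · linarith
    _ = 2 / δ^2 := by field_simp; norm_num

/-- minus the logarithmic derivative -/
noncomputable def nld {q : ℕ} [NeZero q] (χ : DirichletCharacter ℂ q) (s : ℂ) : ℂ :=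
  - deriv (LFunction χ) s / LFunction χ s

lemma nld_eq {q : ℕ} [NeZero q] (χ : DirichletCharacter ℂ q) {s : ℂ} (hs : 1 < s.re) :
    nld χ s = LSeries (tw χ) s := by
  have := DirichletCharacter.LSeries_twist_vonMangoldt_eq χ hs
  unfold nld
  rw [DirichletCharacter.LFunction_eq_LSeries χ hs,
    DirichletCharacter.deriv_LFunction_eq_deriv_LSeries χ hs, ← this]
  rfl

lemma nld_eventuallyEq {q : ℕ} [NeZero q] (χ : DirichletCharacter ℂ q) :
    nld χ =ᶠ[𝓝 2] LSeries (tw χ) := by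
  have : {z : ℂ | 1 < z.re} ∈ 𝓝 (2:ℂ) :=
      (isOpen_lt continuous_const continuous_re).mem_nhds (by simp)
  filter_upwards [this] with z hz using nld_eq χ hz

lemma nld_differentiableAt {q : ℕ} [NeZero q] {χ : DirichletCharacter ℂ q} (hχ : χ ≠ 1) {s : ℂ}
    (hs : LFunction χ s ≠ 0) : DifferentiableAt ℂ (nld χ) s := by
  have hd := DirichletCharacter.differentiable_LFunction hχ
  apply DifferentiableAt.div _ (hd s) hs
  apply DifferentiableAt.neg
  exact (hd.contDiff (n := 2)).differentiable_deriv_two s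

lemma one_add_pow_ge {j m : ℕ} (hj : 1 ≤ j) {κ : ℝ} (hκ : κ = 2 * m * Real.log j / j) (h1 : κ ≤ 2) :
    (j:ℝ) ^ m ≤ (1 + κ) ^ j := by
  have hj0 : (0:ℝ) < j := by exact_mod_cast hj
  have hlj : 0 ≤ Real.log j := Real.log_nonneg (by exact_mod_cast hj)
  have hκ0 : 0 ≤ κ := by rw [hκ]; positivity
  rw [← Real.log_le_log_iff (by positivity) (by positivity), Real.log_pow, Real.log_pow]
  have h2 := Real.le_log_one_add_of_nonneg hκ0
  have h3 : κ / 2 ≤ 2 * κ / (κ + 2) := by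
    rw [div_le_div_iff₀ (by norm_num) (by linarith)]; nlinarith
  calc m * Real.log j = j * (κ / 2) := by rw [hκ]; field_simp
    _ ≤ _ := by gcongr; linarith

lemma ball_geom {s : ℂ} {κ r : ℝ} (hκ : 0 ≤ κ) (hκ1 : κ ≤ 1) (hr : 6 * κ ≤ r^2)
    (hs : ‖s - 2‖ ≤ 1 + κ) (hs1 : r ≤ ‖s - 1‖) (hr0 : 0 ≤ r) : 1 + r^2/4 ≤ s.re := by
  have h1 : (s.re - 2)^2 + s.im^2 ≤ (1+κ)^2 := by
    have := Complex.sq_norm (s - 2); rw [Complex.normSq_apply] at this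
    simp at this
    nlinarith [norm_nonneg (s-2)]
  have h2 : r^2 ≤ (s.re - 1)^2 + s.im^2 := by
    have := Complex.sq_norm (s - 1); rw [Complex.normSq_apply] at this
    simp at this
    nlinarith [norm_nonneg (s-1)]
  nlinarith

/-- Siegel-Walfisz substitute at good scales. -/
theorem siegel_walfisz (A B : ℕ) : ∀ᶠ j : ℕ in atTop, Good A j →
    ∀ (q : ℕ) [NeZero q] (χ : DirichletCharacter ℂ q), q ≤ j ^ A → χ.IsPrimitive → χ ≠ 1 →
    ‖D (tw χ) j‖ ≤ j ! / (j:ℝ) ^ B := by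
  filter_upwards [polylog_le (12 * (B+2)) 1 1 (c := 1/5) (by norm_num),
    polylog_le 4 A 1 (c := 2/5) (by norm_num), polylog_le 144 A 2 (c := 1/15) (by norm_num),
    polylog_le 128 0 0 (c := 2/5) (by norm_num),
    eventually_ge_atTop 1] with j e1 e2 e3 e4 hj1 hgood q _ χ hq hp hn
  have hj0 : (0:ℝ) < j := by exact_mod_cast hj1
  have hj1' : (1:ℝ) ≤ j := by exact_mod_cast hj1
  have hlj : 0 ≤ Real.log j := Real.log_nonneg hj1'
  set l : ℝ := 1 + A * Real.log j with hl
  have hl1 : 1 ≤ l := by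
    have : 0 ≤ A * Real.log j := by positivity
    linarith
  have hlq : 1 + Real.log q ≤ l := by
    have h0 : (0:ℝ) < q := by exact_mod_cast NeZero.pos q
    have : Real.log q ≤ A * Real.log j := by
      rw [← Real.log_pow]
      exact Real.log_le_log h0 (by exact_mod_cast hq)
    linarith
  set r : ℝ := (j:ℝ) ^ (-(2/5) : ℝ) with hr
  have hr0 : 0 < r := by positivity
  have hr1 : r ≤ 1 := Real.rpow_le_one_of_one_le_of_nonpos hj1' (by norm_num)
  set κ : ℝ := 2 * (B+2 : ℕ) * Real.log j / j with hκ
  have hκ0 : 0 ≤ κ := by positivity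
  have hr2 : r^2 = (j:ℝ) ^ (-(4/5) : ℝ) := by
    rw [hr, ← Real.rpow_natCast, ← Real.rpow_mul hj0.le]; norm_num
  have hκr : 6 * κ ≤ r^2 := by
    have : (j:ℝ) ^ (-(4/5) : ℝ) = (j:ℝ)^(1/5:ℝ) / j := by
      rw [← Real.rpow_sub_one hj0.ne']; norm_num
    rw [hr2, this, hκ, ← mul_div_assoc]
    gcongr
    push_cast
    nlinarith
  have hr21 : r^2 ≤ 1 := pow_le_one₀ hr0.le hr1
  have hκ1 : κ ≤ 1 := by linarith
  have hrl : r ≤ 1/(4*l) := by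
    rw [le_div_iff₀ (by positivity)]
    calc r * (4 * l) ≤ r * (j:ℝ)^(2/5:ℝ) := by gcongr; simpa using e2
      _ = 1 := by rw [hr, ← Real.rpow_add hj0]; norm_num
  -- near 1
  have near : ∀ s : ℂ, ‖s - 1‖ ≤ r → (j:ℝ)^(-(1/3):ℝ)/2 ≤ ‖LFunction χ s‖ ∧
      ‖deriv (LFunction χ) s‖ ≤ 72 * l^2 := by
    intro s hs
    have hre : 1 - 1/(4*l) ≤ s.re := by
      have := (abs_re_le_norm (s - 1)).trans hs
      rw [abs_le] at this
      simp only [sub_re, one_re] at this; linarith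
    have hn2 : ‖s‖ ≤ 2 := by
      have := norm_add_le (s - 1) 1
      rw [sub_add_cancel, norm_one] at this; linarith
    refine ⟨?_, norm_deriv_LFunction_le_log hn hlq hre hn2⟩
    have h4l : 0 < 1/(4*l) := by positivity
    have h1 := norm_LFunction_sub_le hn hlq (s := 1) (t := s) (by simp only [one_re]; linarith)
      (by simp) hre hn2
    have h2 := hgood q χ hq hp hn
    have h3 := norm_le_norm_add_norm_sub (LFunction χ s) (LFunction χ 1)
    rw [norm_sub_rev] at h3
    have h4 : 72 * l^2 * ‖1 - s‖ ≤ 72 * l^2 * r := by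
      rw [norm_sub_rev]; gcongr
    have h5 : 144 * l^2 * r ≤ (j:ℝ)^(-(1/3):ℝ) := by
      calc 144 * l^2 * r ≤ (j:ℝ)^(1/15:ℝ) * r := by gcongr
        _ = _ := by rw [hr, ← Real.rpow_add hj0]; norm_num
    linarith [norm_sub_rev (LFunction χ s) (LFunction χ 1)]
  have hj13 : 0 < (j:ℝ)^(-(1/3):ℝ) := by positivity
  have hsub : ∀ z ∈ Metric.closedBall (2:ℂ) (1+κ), ‖nld χ z‖ ≤ (j:ℝ)^2 ∧ LFunction χ z ≠ 0 := by
    intro z hz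
    have hz' : ‖z - 2‖ ≤ 1 + κ := by simpa [dist_eq_norm] using hz
    rcases le_total ‖z - 1‖ r with h | h
    · obtain ⟨h1, h2⟩ := near z h
      have hpos : 0 < ‖LFunction χ z‖ := by linarith
      refine ⟨?_, norm_pos_iff.mp hpos⟩
      unfold nld
      rw [norm_div, norm_neg, div_le_iff₀ hpos]
      calc ‖deriv (LFunction χ) z‖ ≤ 72 * l^2 := h2
        _ ≤ (j:ℝ)^(1/15:ℝ) / 2 := by linarith
        _ ≤ (j:ℝ)^(5/3:ℝ) / 2 := by gcongr <;> norm_num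
        _ = (j:ℝ)^2 * ((j:ℝ)^(-(1/3):ℝ)/2) := by
          rw [← Real.rpow_natCast, ← mul_div_assoc, ← Real.rpow_add hj0]; norm_num
        _ ≤ _ := by gcongr
    · have hre := ball_geom hκ0 hκ1 hκr hz' h hr0.le
      have hre1 : 1 < z.re := by nlinarith
      refine ⟨?_, DirichletCharacter.LFunction_ne_zero_of_one_le_re χ (Or.inl hn) hre1.le⟩
      rw [nld_eq χ hre1]
      refine (norm_LSeries_tw_le χ (δ := r^2/8) (by positivity) (by linarith) (by linarith)).trans ?_
      rw [div_pow, div_div_eq_mul_div, div_le_iff₀ (by positivity), hr2]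
      have e5 : (j:ℝ)^2 * ((j:ℝ)^(-(4/5):ℝ))^2 = (j:ℝ)^(2/5:ℝ) := by
        rw [← Real.rpow_natCast, ← Real.rpow_natCast, ← Real.rpow_mul hj0.le, ← Real.rpow_add hj0]
        norm_num
      rw [e5]
      simp at e4; linarith
  have := norm_D_le (abscissa_tw χ) j (nld_eventuallyEq χ) (ρ := 1 + κ) (C := (j:ℝ)^2) (by linarith)
    (fun z hz => nld_differentiableAt hn (hsub z hz).2)
    (fun z hz => (hsub z (Metric.sphere_subset_closedBall hz)).1)
  refine this.trans ?_
  have hpw := one_add_pow_ge (m := B+2) hj1 hκ (by linarith)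
  rw [div_le_div_iff₀ (by positivity) (by positivity)]
  calc (j !:ℝ) * (j:ℝ)^2 * (j:ℝ)^B = j ! * (j:ℝ)^(B+2) := by ring
    _ ≤ _ := by gcongr

end Pf
end

section
open Complex Filter Topology MeasureTheory
open DirichletCharacter (LFunction)
open ArithmeticFunction (vonMangoldt)
open scoped Nat
namespace Pf

/-! ### Large sieve by duality -/

lemma large_sieve {ι : Type*} [DecidableEq ι] (I : Finset ι) (χ : ι → ℕ → ℂ) (hχ : ∀ i n, ‖χ i n‖ ≤ 1)
    (S : Finset ℕ) (ω : ℕ → ℝ) (hω : ∀ n ∈ S, 0 < ω n) {M E : ℝ} (hE0 : 0 ≤ E)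
    (hM : ∑ n ∈ S, ω n ≤ M)
    (hE : ∀ i ∈ I, ∀ i' ∈ I, i ≠ i' →
      ‖∑ n ∈ S, (ω n : ℂ) * (χ i n * (starRingEnd ℂ) (χ i' n))‖ ≤ E) (a : ℕ → ℂ) :
    ∑ i ∈ I, ‖∑ n ∈ S, a n * χ i n‖ ^ 2 ≤ (∑ n ∈ S, ‖a n‖ ^ 2 / ω n) * (M + I.card * E) := by
  set s : ι → ℂ := fun i => ∑ n ∈ S, a n * χ i n with hs
  set T : ℝ := ∑ i ∈ I, ‖s i‖ ^ 2 with hT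
  set v : ℕ → ℂ := fun n => ∑ i ∈ I, (starRingEnd ℂ) (s i) * χ i n with hv
  have hT0 : 0 ≤ T := Finset.sum_nonneg fun _ _ => by positivity
  have h1 : (T : ℂ) = ∑ n ∈ S, a n * v n := by
    simp only [hv, Finset.mul_sum]
    rw [Finset.sum_comm, hT]
    push_cast
    apply Finset.sum_congr rfl
    intro i _
    rw [← Complex.conj_mul']
    conv_lhs => rw [show s i = ∑ n ∈ S, a n * χ i n from rfl]
    rw [Finset.mul_sum]
    apply Finset.sum_congr rfl
    intro n _; ring
  have h2 : T ≤ ∑ n ∈ S, ‖a n‖ * ‖v n‖ := by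
    calc T = ‖(T:ℂ)‖ := by rw [Complex.norm_real, Real.norm_eq_abs, abs_of_nonneg hT0]
      _ ≤ _ := by
        rw [h1]
        refine (norm_sum_le _ _).trans (le_of_eq ?_)
        simp
  set V : ℝ := ∑ n ∈ S, ω n * ‖v n‖ ^ 2 with hV
  have h3 : T ^ 2 ≤ (∑ n ∈ S, ‖a n‖ ^ 2 / ω n) * V := by
    calc T^2 ≤ (∑ n ∈ S, ‖a n‖ * ‖v n‖)^2 := by gcongr
      _ ≤ _ := by
        apply Finset.sum_sq_le_sum_mul_sum_of_sq_le_mul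
        · intro n hn; have := hω n hn; positivity
        · intro n hn; have := hω n hn; positivity
        · intro n hn; have := hω n hn; apply le_of_eq; field_simp
  have h4 : (V : ℂ) = ∑ i ∈ I, ∑ i' ∈ I, (starRingEnd ℂ) (s i) * s i' *
      ∑ n ∈ S, (ω n : ℂ) * (χ i n * (starRingEnd ℂ) (χ i' n)) := by
    rw [hV]
    push_cast
    simp only [← Complex.mul_conj', hv, map_sum, map_mul, Complex.conj_conj]
    simp only [Finset.sum_mul_sum]
    simp only [Finset.mul_sum]
    rw [Finset.sum_comm]
    apply Finset.sum_congr rfl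
    intro i _
    rw [Finset.sum_comm]
    apply Finset.sum_congr rfl
    intro i' _
    apply Finset.sum_congr rfl
    intro n _; ring
  have hV0 : 0 ≤ V := Finset.sum_nonneg fun n hn => by have := hω n hn; positivity
  have hM0 : 0 ≤ M := (Finset.sum_nonneg fun n hn => (hω n hn).le).trans hM
  have h5 : V ≤ T * (M + I.card * E) := by
    calc V = ‖(V:ℂ)‖ := by rw [Complex.norm_real, Real.norm_eq_abs, abs_of_nonneg hV0]
      _ ≤ ∑ i ∈ I, ∑ i' ∈ I, (‖s i‖ * ‖s i'‖ * E + if i = i' then ‖s i‖^2 * M else 0) := by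
        rw [h4]
        refine (norm_sum_le _ _).trans (Finset.sum_le_sum fun i hi => ?_)
        refine (norm_sum_le _ _).trans (Finset.sum_le_sum fun i' hi' => ?_)
        rw [norm_mul, norm_mul, Complex.norm_conj]
        by_cases h : i = i'
        · subst h
          rw [if_pos rfl]
          have : ‖∑ n ∈ S, (ω n : ℂ) * (χ i n * (starRingEnd ℂ) (χ i n))‖ ≤ M := by
            refine (norm_sum_le _ _).trans (le_trans (Finset.sum_le_sum fun n hn => ?_) hM)
            rw [norm_mul, Complex.norm_real, Real.norm_eq_abs, abs_of_pos (hω n hn), norm_mul,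
              Complex.norm_conj]
            apply mul_le_of_le_one_right (hω n hn).le
            exact mul_le_one₀ (hχ i n) (norm_nonneg _) (hχ i n)
          have h6 : 0 ≤ ‖s i‖ * ‖s i‖ * E := by positivity
          calc _ ≤ ‖s i‖ * ‖s i‖ * M := by gcongr
            _ ≤ _ := by rw [← sq]; linarith
        · rw [if_neg h, add_zero]
          gcongr
          exact hE i hi i' hi' h
      _ = (∑ i ∈ I, ‖s i‖)^2 * E + T * M := by
        simp only [Finset.sum_add_distrib, Finset.sum_ite_eq]
        congr 1
        · rw [sq, Finset.sum_mul_sum, Finset.sum_mul]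
          apply Finset.sum_congr rfl
          intro i _
          rw [Finset.sum_mul]
        · rw [hT, Finset.sum_mul]
          apply Finset.sum_congr rfl
          intro i hi
          rw [if_pos hi]
      _ ≤ (I.card * T) * E + T * M := by
        gcongr
        exact sq_sum_le_card_mul_sum_sq
      _ = _ := by ring
  rcases hT0.eq_or_lt with h0 | h0
  · rw [← h0]
    apply mul_nonneg
    · exact Finset.sum_nonneg fun n hn => by have := hω n hn; positivity
    · positivity
  · have ha : 0 ≤ ∑ n ∈ S, ‖a n‖ ^ 2 / ω n :=
      Finset.sum_nonneg fun n hn => by have := hω n hn; positivity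
    have : T * T ≤ T * ((∑ n ∈ S, ‖a n‖ ^ 2 / ω n) * (M + I.card * E)) := by
      calc T * T = T^2 := by ring
        _ ≤ _ := h3
        _ ≤ (∑ n ∈ S, ‖a n‖ ^ 2 / ω n) * (T * (M + I.card * E)) := by gcongr
        _ = _ := by ring
    exact le_of_mul_le_mul_left this h0

/-- Abel summation bound -/
lemma abel_bound {f : ℕ → ℝ} {g : ℕ → ℂ} {K : ℝ} {a b : ℕ} (hab : a ≤ b) (hf : ∀ n, a ≤ n → f (n+1) ≤ f n)
    (hf0 : ∀ n, a ≤ n → 0 ≤ f n) (hK : ∀ n, ‖∑ k ∈ Finset.range n, g k‖ ≤ K) :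
    ‖∑ n ∈ Finset.Ico a b, (f n : ℂ) * g n‖ ≤ 2 * K * f a := by
  have key : ‖∑ n ∈ Finset.Ico a b, (f n : ℂ) * g n - f b * ∑ k ∈ Finset.range b, g k‖
      ≤ K * (2 * f a - f b) := by
    induction b, hab using Nat.le_induction with
    | base =>
      simp only [Finset.Ico_self, Finset.sum_empty, zero_sub, norm_neg, norm_mul, Complex.norm_real,
        Real.norm_eq_abs]
      rw [abs_of_nonneg (hf0 a le_rfl)]
      nlinarith [hK a, hf0 a le_rfl]
    | succ b hb ih =>
      rw [Finset.sum_Ico_succ_top hb]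
      have e : ∑ n ∈ Finset.Ico a b, (f n : ℂ) * g n + f b * g b
          - f (b+1) * ∑ k ∈ Finset.range (b+1), g k
          = (∑ n ∈ Finset.Ico a b, (f n : ℂ) * g n - f b * ∑ k ∈ Finset.range b, g k)
          + ((f b - f (b+1) : ℝ) : ℂ) * ∑ k ∈ Finset.range (b+1), g k := by
        rw [Finset.sum_range_succ]; push_cast; ring
      rw [e]
      refine (norm_add_le _ _).trans ?_
      rw [norm_mul, Complex.norm_real, Real.norm_eq_abs, abs_of_nonneg (by linarith [hf b hb])]
      nlinarith [hK (b+1), hf b hb]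
  have h2 : ‖(f b : ℂ) * ∑ k ∈ Finset.range b, g k‖ ≤ K * f b := by
    rw [norm_mul, Complex.norm_real, Real.norm_eq_abs, abs_of_nonneg (hf0 b hab)]
    nlinarith [hK b, hf0 b hab]
  have := norm_add_le (∑ n ∈ Finset.Ico a b, (f n : ℂ) * g n - f b * ∑ k ∈ Finset.range b, g k)
    ((f b : ℂ) * ∑ k ∈ Finset.range b, g k)
  rw [sub_add_cancel] at this
  linarith

/-- primitive nontrivial characters -/
structure PC where
  q : ℕ
  ne : NeZero q
  χ : DirichletCharacter ℂ q
  prim : χ.IsPrimitive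
  ne1 : χ ≠ 1

attribute [instance] PC.ne

lemma PC.sigma_inj : Function.Injective (fun p : PC => (⟨p.q, p.χ⟩ : Σ q, DirichletCharacter ℂ q)) := by
  rintro ⟨q, ne, χ, h1, h2⟩ ⟨q', ne', χ', h1', h2'⟩ h
  simp only at h
  cases h
  rfl

lemma PC.pair_ne_one {p p' : PC} (h : p ≠ p') : pairChar p.χ p'.χ ≠ 1 :=
  pairChar_ne_one p.prim p'.prim fun h' => h (PC.sigma_inj h')

/-- off-diagonal bound -/
lemma PC.offdiag {p p' : PC} (h : p ≠ p') {Q : ℝ} (hp : p.q ≤ Q) (hp' : p'.q ≤ Q) {σ : ℝ} (hσ : 1 ≤ σ)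
    {a : ℕ} (ha : 0 < a) (b : ℕ) :
    ‖∑ n ∈ Finset.Ico a b, (((n:ℝ)^(-σ) : ℝ) : ℂ) * (p.χ n * (starRingEnd ℂ) (p'.χ n))‖
      ≤ 2 * Q^2 / a := by
  have haR : (0:ℝ) < a := by exact_mod_cast ha
  have hQ : 0 ≤ Q := (Nat.cast_nonneg _).trans hp
  rcases lt_or_ge b a with hba | hab
  · rw [Finset.Ico_eq_empty (by omega)]; simp; positivity
  have h1 := abel_bound (f := fun n => (n:ℝ)^(-σ)) (g := fun n => pairChar p.χ p'.χ (n : ZMod (p.q * p'.q)))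
    (K := Q^2) (a := a) (b := b) hab
    (fun n hn => by
      have : (0:ℝ) < n := by exact_mod_cast (ha.trans_le hn)
      apply Real.rpow_le_rpow_of_nonpos this (by push_cast; linarith) (by linarith))
    (fun n hn => by positivity)
    (fun n => (norm_sum_range_char_le (PC.pair_ne_one h) n).trans (by
      push_cast; rw [sq]; gcongr))
  simp only [pairChar_apply] at h1
  refine h1.trans ?_
  rw [div_eq_mul_inv, ← Real.rpow_neg_one (a:ℝ)]
  gcongr
  exact_mod_cast ha

end Pf
end

section
open Complex Filter Topology MeasureTheory
open DirichletCharacter (LFunction)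
open ArithmeticFunction (vonMangoldt)
open scoped Nat
namespace Pf

/-- The large sieve for tails of Dirichlet series. -/
lemma ls_tail [DecidableEq PC] (I : Finset PC) {Q : ℝ} (hI : ∀ p ∈ I, (p.q : ℝ) ≤ Q) {σ : ℝ} (hσ : 1 < σ) {s : ℂ}
    (hs : σ ≤ s.re) {a : ℕ → ℂ} {V : ℕ} (hV : 0 < V) (ha : ∀ n, n < V → a n = 0) {A : ℝ}
    (hA : ∀ N, ∑ n ∈ Finset.range N, ‖a n‖ ^ 2 * (n:ℝ) ^ (-σ) ≤ A)
    (hL : ∀ p ∈ I, LSeriesSummable (fun n => p.χ n * a n) s) :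
    ∑ p ∈ I, ‖LSeries (fun n => p.χ n * a n) s‖ ^ 2 ≤
      A * (1 + 1 / (σ - 1) + I.card * (2 * Q ^ 2 / V)) := by
  set B := 1 + 1 / (σ - 1) + I.card * (2 * Q ^ 2 / V) with hB
  have hσ1 : 0 < σ - 1 := by linarith
  have hB0 : 0 ≤ B := by positivity
  have hlim : Tendsto (fun N => ∑ p ∈ I, ‖∑ n ∈ Finset.range N, LSeries.term (fun n => p.χ n * a n) s n‖ ^ 2)
      atTop (𝓝 (∑ p ∈ I, ‖LSeries (fun n => p.χ n * a n) s‖ ^ 2)) := by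
    apply tendsto_finsetSum
    intro p hp
    exact ((hL p hp).hasSum.tendsto_sum_nat.norm).pow 2
  refine le_of_tendsto hlim (Eventually.of_forall fun N => ?_)
  have e : ∀ p : PC, ∑ n ∈ Finset.range N, LSeries.term (fun n => p.χ n * a n) s n
      = ∑ n ∈ Finset.Ico V N, (a n / (n:ℂ) ^ s) * p.χ n := by
    intro p
    symm
    apply Finset.sum_subset_zero_on_sdiff
    · intro n hn; simp at hn ⊢; omega
    · intro n hn
      simp only [Finset.mem_sdiff, Finset.mem_range, Finset.mem_Ico, not_and, not_lt] at hn
      rw [LSeries.term_def]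
      split_ifs with h0
      · rfl
      · rw [ha n (by by_contra h; have := hn.2 (by omega); omega)]; simp
    · intro n hn
      simp only [Finset.mem_Ico] at hn
      rw [LSeries.term_def, if_neg (by omega)]; ring
  simp only [e]
  have key := large_sieve I (fun p n => p.χ n) (fun p n => p.χ.norm_le_one _) (Finset.Ico V N)
    (fun n => (n:ℝ)^(-σ)) (fun n hn => by
      simp only [Finset.mem_Ico] at hn
      have : (0:ℝ) < n := by exact_mod_cast (by omega)
      positivity) (M := 1 + 1/(σ-1)) (E := 2 * Q^2/V) (by positivity)
    (by
      refine le_trans ?_ (tsum_rpow_neg_le hσ)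
      exact (summable_rpow hσ).sum_le_tsum _ (fun n _ => by positivity))
    (fun p hp p' hp' h => PC.offdiag h (hI p hp) (hI p' hp') hσ.le hV N)
    (fun n => a n / (n:ℂ)^s)
  refine key.trans ?_
  gcongr
  refine le_trans ?_ (hA N)
  calc _ ≤ ∑ n ∈ Finset.Ico V N, ‖a n‖ ^ 2 * (n:ℝ) ^ (-σ) := by
        apply Finset.sum_le_sum
        intro n hn
        simp only [Finset.mem_Ico] at hn
        have hn0 : (1:ℝ) ≤ n := by exact_mod_cast (by omega)
        have hn0' : (0:ℝ) < n := by linarith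
        rw [norm_div, Complex.norm_natCast_cpow_of_pos (by omega), div_pow, div_div,
          div_eq_mul_inv]
        gcongr
        rw [Real.rpow_neg hn0'.le]
        apply inv_anti₀ (by positivity)
        calc (n:ℝ)^σ = ((n:ℝ)^σ)^2 * ((n:ℝ)^σ)⁻¹ := by field_simp
          _ ≤ _ := by gcongr
    _ ≤ _ := by
        apply Finset.sum_le_sum_of_subset_of_nonneg
        · intro n hn; simp at hn ⊢; omega
        · intro n _ _; positivity

/-- convolution -/
lemma conv_le {f g h : ℕ → ℝ} (hf : ∀ n, 0 ≤ f n) (hg : ∀ n, 0 ≤ g n)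
    (hh : ∀ n, n ≠ 0 → h n ≤ ∑ x ∈ n.divisorsAntidiagonal, f x.1 * g x.2) {σ : ℝ} (hσ : 0 < σ) {F G : ℝ}
    (hF : ∀ N, ∑ n ∈ Finset.range N, f n * (n:ℝ)^(-σ) ≤ F)
    (hG : ∀ N, ∑ n ∈ Finset.range N, g n * (n:ℝ)^(-σ) ≤ G) (N : ℕ) :
    ∑ n ∈ Finset.range N, h n * (n:ℝ)^(-σ) ≤ F * G := by
  have hF0 : 0 ≤ F := by simpa using hF 0
  calc ∑ n ∈ Finset.range N, h n * (n:ℝ)^(-σ)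
      ≤ ∑ n ∈ Finset.range N, ∑ x ∈ n.divisorsAntidiagonal, (f x.1 * (x.1:ℝ)^(-σ)) * (g x.2 * (x.2:ℝ)^(-σ)) := by
        apply Finset.sum_le_sum
        intro n hn
        rcases Nat.eq_zero_or_pos n with rfl | hn0
        · rw [Nat.cast_zero, Real.zero_rpow (by linarith)]; simp
        · calc h n * (n:ℝ)^(-σ) ≤ (∑ x ∈ n.divisorsAntidiagonal, f x.1 * g x.2) * (n:ℝ)^(-σ) := by
                gcongr; exact hh n hn0.ne'
            _ = _ := by
                rw [Finset.sum_mul]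
                apply Finset.sum_congr rfl
                intro x hx
                rw [Nat.mem_divisorsAntidiagonal] at hx
                rw [← hx.1]; push_cast
                rw [Real.mul_rpow (by positivity) (by positivity)]; ring
    _ = ∑ y ∈ (Finset.range N).sigma (fun n => n.divisorsAntidiagonal), (f y.2.1 * (y.2.1:ℝ)^(-σ)) * (g y.2.2 * (y.2.2:ℝ)^(-σ)) := by
        rw [Finset.sum_sigma]
    _ = ∑ x ∈ ((Finset.range N).sigma (fun n => n.divisorsAntidiagonal)).image (fun y => y.2), (f x.1 * (x.1:ℝ)^(-σ)) * (g x.2 * (x.2:ℝ)^(-σ)) := by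
        rw [Finset.sum_image]
        rintro ⟨n, x⟩ hy ⟨n', x'⟩ hy' h
        simp at hy hy' h
        subst h
        obtain rfl : n = n' := by rw [← hy.2.1, ← hy'.2.1]
        rfl
    _ ≤ ∑ x ∈ (Finset.range N) ×ˢ (Finset.range N), (f x.1 * (x.1:ℝ)^(-σ)) * (g x.2 * (x.2:ℝ)^(-σ)) := by
        apply Finset.sum_le_sum_of_subset_of_nonneg
        · intro x hx
          simp only [Finset.mem_image, Finset.mem_sigma, Finset.mem_range, Nat.mem_divisorsAntidiagonal] at hx
          obtain ⟨⟨n, y⟩, ⟨h1, h2, h3⟩, rfl⟩ := hx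
          simp only [Finset.mem_product, Finset.mem_range]
          have h4 : y.1 ≠ 0 := by rintro h; apply h3; rw [← h2, h]; simp
          have h5 : y.2 ≠ 0 := by rintro h; apply h3; rw [← h2, h]; simp
          constructor
          · exact (Nat.le_mul_of_pos_right _ (Nat.pos_of_ne_zero h5)).trans_lt (h2 ▸ h1)
          · exact (Nat.le_mul_of_pos_left _ (Nat.pos_of_ne_zero h4)).trans_lt (h2 ▸ h1)
        · intro x _ _
          have := hf x.1; have := hg x.2; positivity
    _ = (∑ n ∈ Finset.range N, f n * (n:ℝ)^(-σ)) * (∑ n ∈ Finset.range N, g n * (n:ℝ)^(-σ)) := by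
        rw [Finset.sum_mul_sum, Finset.sum_product]
    _ ≤ F * G := by
        have := hF N; have := hG N
        have h0 : 0 ≤ ∑ n ∈ Finset.range N, g n * (n:ℝ)^(-σ) :=
          Finset.sum_nonneg fun n _ => by have := hg n; positivity
        gcongr

lemma zeta_le {σ : ℝ} (hσ : 1 < σ) (N : ℕ) : ∑ n ∈ Finset.range N, (1:ℝ) * (n:ℝ)^(-σ) ≤ 1 + 1/(σ-1) := by
  simp only [one_mul]
  exact ((summable_rpow hσ).sum_le_tsum _ (fun n _ => by positivity)).trans (tsum_rpow_neg_le hσ)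

lemma card_divisors_mul_le (m n : ℕ) : (m * n).divisors.card ≤ m.divisors.card * n.divisors.card := by
  rw [Nat.divisors_mul]; exact Finset.card_mul_le

lemma tau_le {σ : ℝ} (hσ : 1 < σ) (N : ℕ) :
    ∑ n ∈ Finset.range N, (n.divisors.card : ℝ) * (n:ℝ)^(-σ) ≤ (1 + 1/(σ-1)) * (1 + 1/(σ-1)) := by
  apply conv_le (f := fun _ => 1) (g := fun _ => 1) (by simp) (by simp) _ (by linarith) (zeta_le hσ) (zeta_le hσ)
  intro n _
  simp [← Nat.map_div_right_divisors]

lemma tau_sq_le {σ : ℝ} (hσ : 1 < σ) (N : ℕ) :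
    ∑ n ∈ Finset.range N, (n.divisors.card : ℝ)^2 * (n:ℝ)^(-σ) ≤ (1 + 1/(σ-1)) ^ 4 := by
  have := conv_le (f := fun n => (n.divisors.card:ℝ)) (g := fun n => (n.divisors.card:ℝ))
    (h := fun n => (n.divisors.card:ℝ)^2) (by simp) (by simp) (fun n _ => by
      have h : (n.divisors.card:ℝ)^2 = ∑ x ∈ n.divisorsAntidiagonal, (n.divisors.card:ℝ) := by
        rw [Finset.sum_const, ← Nat.map_div_right_divisors, Finset.card_map]; simp [sq]
      rw [h]
      apply Finset.sum_le_sum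
      intro x hx
      rw [Nat.mem_divisorsAntidiagonal] at hx
      rw [← hx.1]
      exact_mod_cast card_divisors_mul_le _ _) (by linarith) (tau_le hσ) (tau_le hσ) N
  refine this.trans (le_of_eq (by ring))

lemma Lambda_sq_le {δ : ℝ} (hδ : 0 < δ) (N : ℕ) :
    ∑ n ∈ Finset.range N, (vonMangoldt n)^2 * (n:ℝ)^(-(1+δ)) ≤ 16/δ^2 * (1 + 2/δ) := by
  calc _ ≤ ∑ n ∈ Finset.range N, 16/δ^2 * (1 * (n:ℝ)^(-(1+δ/2))) := by
        apply Finset.sum_le_sum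
        intro n _
        have h1 := vonMangoldt_le_rpow (δ := δ/4) (by positivity) n
        rcases Nat.eq_zero_or_pos n with rfl | hn
        · simp; positivity
        have hn0 : (0:ℝ) < n := by exact_mod_cast hn
        calc _ ≤ ((n:ℝ)^(δ/4) / (δ/4))^2 * (n:ℝ)^(-(1+δ)) := by
              gcongr
          _ = 16/δ^2 * (((n:ℝ)^(δ/4))^2 * (n:ℝ)^(-(1+δ))) := by ring
          _ = _ := by
              rw [one_mul, ← Real.rpow_mul_natCast hn0.le, ← Real.rpow_add hn0]; congr 2; push_cast; ring
    _ ≤ _ := by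
        rw [← Finset.mul_sum]
        have := zeta_le (σ := 1 + δ/2) (by linarith) N
        gcongr
        refine this.trans (le_of_eq ?_)
        rw [show 1 + δ/2 - 1 = δ/2 by ring]; field_simp

end Pf
end

section
open Complex Filter Topology MeasureTheory
open DirichletCharacter (LFunction)
open ArithmeticFunction (vonMangoldt)
open scoped Nat
namespace Pf

/-- truncated Dirichlet series -/
noncomputable def fin (V : ℕ) (f : ℕ → ℂ) (s : ℂ) : ℂ := ∑ n ∈ Finset.range (V+1), LSeries.term f s n

def tail (V : ℕ) (f : ℕ → ℂ) : ℕ → ℂ := fun n => if n ≤ V then 0 else f n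

lemma tail_summable {V : ℕ} {f : ℕ → ℂ} {s : ℂ} (hf : LSeriesSummable f s) : LSeriesSummable (tail V f) s := by
  apply Summable.of_norm_bounded hf.norm
  intro n
  rw [LSeries.term_def, LSeries.term_def]
  unfold tail
  split_ifs <;> simp
  positivity

lemma LSeries_eq_fin_add_tail (V : ℕ) {f : ℕ → ℂ} {s : ℂ} (hf : LSeriesSummable f s) :
    LSeries f s = fin V f s + LSeries (tail V f) s := by
  unfold LSeries
  have h1 := hf.sum_add_tsum_nat_add (V+1)
  have h2 := (tail_summable (V := V) hf).sum_add_tsum_nat_add (V+1)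
  rw [← h1, ← h2]
  have e1 : ∑ i ∈ Finset.range (V+1), LSeries.term (tail V f) s i = 0 := by
    apply Finset.sum_eq_zero
    intro i hi
    have hi' : i ≤ V := by simp at hi; omega
    simp [LSeries.term_def, tail, hi']
  rw [e1, zero_add]
  unfold fin
  congr 1
  apply tsum_congr
  intro n
  have hn : ¬ (n + (V+1) ≤ V) := by omega
  simp only [LSeries.term_def, tail, if_neg hn]

lemma fin_differentiable (V : ℕ) (f : ℕ → ℂ) : Differentiable ℂ (fin V f) := by
  unfold fin
  apply Differentiable.fun_sum
  intro n _
  rcases Nat.eq_zero_or_pos n with rfl | hn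
  · simp
  · have : (fun s => LSeries.term f s n) = fun s => f n / (n:ℂ)^s := by
      ext s; rw [LSeries.term_of_ne_zero hn.ne']
    rw [this]
    have hn0 : (n:ℂ) ≠ 0 := by exact_mod_cast hn.ne'
    intro s
    apply DifferentiableAt.div (by fun_prop)
    · exact (differentiableAt_id).const_cpow (Or.inl hn0)
    · simp [Complex.cpow_eq_zero_iff, hn0]

lemma norm_fin_le {V : ℕ} {f : ℕ → ℂ} {b : ℝ} (hf : ∀ n ≤ V, ‖f n‖ ≤ b) {s : ℂ} (hs : 0 ≤ s.re) :
    ‖fin V f s‖ ≤ (V+1) * b := by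
  have hb : 0 ≤ b := (norm_nonneg _).trans (hf 0 (by omega))
  unfold fin
  refine (norm_sum_le _ _).trans ?_
  calc _ ≤ ∑ n ∈ Finset.range (V+1), b := by
        apply Finset.sum_le_sum
        intro n hn
        rw [LSeries.norm_term_eq]
        split_ifs with h
        · exact hb
        · have h1 : (1:ℝ) ≤ (n:ℝ)^s.re := Real.one_le_rpow (by exact_mod_cast Nat.pos_of_ne_zero h) hs
          exact (div_le_self (norm_nonneg _) h1).trans (hf n (by simp at hn; omega))
    _ = _ := by simp

/-- character times moebius -/
noncomputable def chm {q : ℕ} (χ : DirichletCharacter ℂ q) : ℕ → ℂ :=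
  fun n => χ n * (ArithmeticFunction.moebius n : ℂ)

lemma norm_chm_le {q : ℕ} (χ : DirichletCharacter ℂ q) (n : ℕ) : ‖chm χ n‖ ≤ 1 := by
  unfold chm
  rw [norm_mul]
  apply mul_le_one₀ (χ.norm_le_one _) (norm_nonneg _)
  have := @ArithmeticFunction.abs_moebius_le_one n
  rw [Complex.norm_intCast]
  exact_mod_cast this

/-- type I part -/
noncomputable def vT {q : ℕ} [NeZero q] (χ : DirichletCharacter ℂ q) (V : ℕ) (s : ℂ) : ℂ :=
  fin V (tw χ) s - fin V (chm χ) s * LFunction χ s * fin V (tw χ) s - deriv (LFunction χ) s * fin V (chm χ) s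

/-- divisor sum coefficient -/
noncomputable def bcoef (V : ℕ) (n : ℕ) : ℂ :=
  ∑ x ∈ n.divisorsAntidiagonal, tail V (fun m => (ArithmeticFunction.moebius m : ℂ)) x.2

lemma norm_bcoef_le (V n : ℕ) : ‖bcoef V n‖ ≤ n.divisors.card := by
  unfold bcoef
  refine (norm_sum_le _ _).trans ?_
  calc _ ≤ ∑ x ∈ n.divisorsAntidiagonal, (1:ℝ) := by
        apply Finset.sum_le_sum
        intro x _
        unfold tail
        split_ifs
        · simp
        · rw [Complex.norm_intCast]
          have := @ArithmeticFunction.abs_moebius_le_one x.2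
          exact_mod_cast this
    _ = _ := by simp [← Nat.map_div_right_divisors]

lemma bcoef_eq_zero {V n : ℕ} (h : n < V+1) : bcoef V n = 0 := by
  unfold bcoef
  apply Finset.sum_eq_zero
  intro x hx
  rw [Nat.mem_divisorsAntidiagonal] at hx
  unfold tail
  rw [if_pos]
  have : x.2 ≤ n := Nat.le_of_dvd (by omega) ⟨x.1, by rw [← hx.1]; ring⟩
  omega

lemma LSeriesSummable_chm {q : ℕ} (χ : DirichletCharacter ℂ q) {s : ℂ} (hs : 1 < s.re) :
    LSeriesSummable (chm χ) s :=
  LSeriesSummable_of_le_const_mul_rpow (x := 1) hs ⟨1, fun n _ => by simpa using norm_chm_le χ n⟩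

lemma one_sub_LM {q : ℕ} [NeZero q] (χ : DirichletCharacter ℂ q) (V : ℕ) {s : ℂ} (hs : 1 < s.re) :
    LSeriesSummable (fun n => χ n * bcoef V n) s ∧
    1 - LFunction χ s * fin V (chm χ) s = LSeries (fun n => χ n * bcoef V n) s := by
  have h1 := LSeriesSummable_chm χ hs
  have h2 := DirichletCharacter.LSeriesSummable_of_one_lt_re χ hs
  have h3 := DirichletCharacter.LSeries.mul_mu_eq_one χ hs
  have h4 : LSeries (fun n => χ n) s * LSeries (chm χ) s = 1 := h3
  have h6 := h2.convolution (tail_summable (V := V) h1)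
  have h5 := LSeries_convolution' h2 (tail_summable (V := V) h1)
  have e : ∀ {n : ℕ}, n ≠ 0 → (LSeries.convolution (fun n : ℕ => χ n) (tail V (chm χ))) n = χ n * bcoef V n := by
    intro n _
    rw [LSeries.convolution_def]
    simp only
    unfold bcoef
    rw [Finset.mul_sum]
    apply Finset.sum_congr rfl
    intro x hx
    rw [Nat.mem_divisorsAntidiagonal] at hx
    rw [← hx.1]
    push_cast
    rw [map_mul]
    unfold tail chm
    split_ifs
    · simp
    · ring
  refine ⟨(LSeriesSummable_congr s e).mp h6, ?_⟩
  rw [← LSeries_congr e s, h5, DirichletCharacter.LFunction_eq_LSeries χ hs]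
  rw [LSeries_eq_fin_add_tail V h1] at h4
  linear_combination -h4

lemma vaughan {q : ℕ} [NeZero q] (χ : DirichletCharacter ℂ q) (V : ℕ) {s : ℂ} (hs : 1 < s.re) :
    nld χ s - vT χ V s = LSeries (tail V (tw χ)) s * LSeries (fun n => χ n * bcoef V n) s := by
  rw [← (one_sub_LM χ V hs).2]
  have h1 : LSeriesSummable (tw χ) s := by
    apply LSeriesSummable_of_abscissaOfAbsConv_lt_re
    exact (abscissa_tw χ).trans_lt (by exact_mod_cast hs)
  have h2 := LSeries_eq_fin_add_tail V h1
  have h3 : nld χ s * LFunction χ s = - deriv (LFunction χ) s := by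
    unfold nld
    rw [div_mul_cancel₀]
    rw [DirichletCharacter.LFunction_eq_LSeries χ hs]
    exact DirichletCharacter.LSeries_ne_zero_of_one_lt_re χ hs
  have h4 : LSeries (tail V (tw χ)) s = nld χ s - fin V (tw χ) s := by
    rw [nld_eq χ hs, h2]; ring
  rw [h4]
  unfold vT
  linear_combination (fin V (chm χ) s) * h3

lemma vT_differentiable {q : ℕ} [NeZero q] {χ : DirichletCharacter ℂ q} (hχ : χ ≠ 1) (V : ℕ) :
    Differentiable ℂ (vT χ V) := by
  have h1 := fin_differentiable V (tw χ)
  have h2 := fin_differentiable V (chm χ)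
  have h3 := DirichletCharacter.differentiable_LFunction hχ
  have h4 : Differentiable ℂ (deriv (LFunction χ)) := (h3.contDiff (n := 2)).differentiable_deriv_two
  unfold vT
  exact (h1.sub ((h2.mul h3).mul h1)).sub (h4.mul h2)

lemma vT_bound {q : ℕ} [NeZero q] {χ : DirichletCharacter ℂ q} (hχ : χ ≠ 1) (V : ℕ) {s : ℂ}
    (hs : ‖s - 2‖ ≤ 19/10) : ‖vT χ V s‖ ≤ 1681 * q * (V+1)^3 := by
  have hre : |s.re - 2| ≤ 19/10 := by
    have := (Complex.abs_re_le_norm (s-2)).trans hs; simpa using this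
  rw [abs_le] at hre
  have hq : (1:ℝ) ≤ q := by exact_mod_cast NeZero.one_le
  have hn : ‖s‖ ≤ 4 := by
    have := norm_add_le (s-2) 2
    rw [sub_add_cancel] at this
    simp at this; linarith
  have h1 : ‖fin V (tw χ) s‖ ≤ (V+1) * (V+1) := by
    apply norm_fin_le _ (by linarith)
    intro n hn
    refine (norm_tw_le χ n).trans (ArithmeticFunction.vonMangoldt_le_log.trans ?_)
    have := Real.log_le_self (Nat.cast_nonneg (α := ℝ) n)
    have h : (n:ℝ) ≤ V := by exact_mod_cast hn
    linarith
  have h2 : ‖fin V (chm χ) s‖ ≤ (V+1) * 1 := norm_fin_le (fun n _ => norm_chm_le χ n) (by linarith)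
  have h3 := norm_LFunction_le_one hχ (s := s) (by linarith) hn
  have h4 := norm_deriv_LFunction_le_one hχ hs
  unfold vT
  refine (norm_sub_le _ _).trans ?_
  refine (add_le_add_left (norm_sub_le _ _) _).trans ?_
  rw [norm_mul, norm_mul, norm_mul]
  have hv : (0:ℝ) ≤ V := by positivity
  calc _ ≤ (V+1:ℝ)*(V+1) + ((V+1)*1) * (80*q) * ((V+1)*(V+1)) + (1600*q) * ((V+1)*1) := by gcongr
    _ ≤ _ := by
      have a1 : (V+1:ℝ)*(V+1) ≤ q * (V+1)^3 := by
        have : (V+1:ℝ)*(V+1) ≤ (V+1)^3 := by nlinarith [mul_nonneg hv hv, mul_nonneg (mul_nonneg hv hv) hv]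
        nlinarith [pow_nonneg (by linarith : (0:ℝ) ≤ V+1) 3]
      have a2 : (V+1:ℝ) ≤ (V+1)^3 := by nlinarith [mul_nonneg hv hv, mul_nonneg (mul_nonneg hv hv) hv]
      have a3 : (1600*q) * ((V+1:ℝ)*1) ≤ 1600 * q * (V+1)^3 := by nlinarith
      nlinarith

/-- sum of Cauchy estimates -/
lemma sum_cauchy {ι : Type*} (I : Finset ι) (P : ι → ℂ → ℂ) (j : ℕ) {c : ℂ} {ρ C : ℝ} (hρ : 0 < ρ)
    {U : Set ℂ} (hU : IsOpen U) (hUb : Metric.closedBall c ρ ⊆ U)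
    (hd : ∀ i ∈ I, DifferentiableOn ℂ (P i) U)
    (hC : ∀ z ∈ Metric.sphere c ρ, ∑ i ∈ I, ‖P i z‖ ≤ C) :
    ∑ i ∈ I, ‖iteratedDeriv j (P i) c‖ ≤ j ! * C / ρ ^ j := by
  have hcU : U ∈ 𝓝 c := hU.mem_nhds (hUb (by simp [hρ.le]))
  have hcd : ∀ i ∈ I, ContDiffAt ℂ j (P i) c := fun i hi =>
    (((hd i hi).analyticOnNhd hU) c (mem_of_mem_nhds hcU)).contDiffAt
  set u : ι → ℂ := fun i => if iteratedDeriv j (P i) c = 0 then 0 else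
    (‖iteratedDeriv j (P i) c‖ : ℂ) / iteratedDeriv j (P i) c with hu
  have hu1 : ∀ i, ‖u i‖ ≤ 1 := by
    intro i; simp only [hu]; split_ifs with h
    · simp
    · rw [norm_div]; simp [h]
  have hu2 : ∀ i, u i * iteratedDeriv j (P i) c = (‖iteratedDeriv j (P i) c‖ : ℂ) := by
    intro i; simp only [hu]; split_ifs with h
    · simp [h]
    · rw [div_mul_cancel₀ _ h]
  have h1 : iteratedDeriv j (fun z => ∑ i ∈ I, u i * P i z) c
      = ((∑ i ∈ I, ‖iteratedDeriv j (P i) c‖ : ℝ) : ℂ) := by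
    rw [iteratedDeriv_fun_sum (fun i hi => contDiffAt_const.mul (hcd i hi))]
    push_cast
    apply Finset.sum_congr rfl
    intro i hi
    rw [iteratedDeriv_const_mul_field, hu2]
  have h2 := norm_iteratedDeriv_le_of_forall_mem_sphere_norm_le (c := c) (R := ρ) (C := C)
    (f := fun z => ∑ i ∈ I, u i * P i z) j hρ (by
      apply DifferentiableOn.diffContOnCl
      rw [closure_ball _ hρ.ne']
      apply DifferentiableOn.fun_sum
      intro i hi
      exact ((hd i hi).mono hUb).const_mul (u i)) (fun z hz => by
      refine (norm_sum_le _ _).trans (le_trans (Finset.sum_le_sum fun i _ => ?_) (hC z hz))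
      rw [norm_mul]
      exact mul_le_of_le_one_left (norm_nonneg _) (hu1 i))
  rw [h1, Complex.norm_real, Real.norm_eq_abs, abs_of_nonneg (Finset.sum_nonneg fun _ _ => norm_nonneg _)] at h2
  exact h2

end Pf
end

section
open Complex Filter Topology MeasureTheory
open DirichletCharacter (LFunction)
open ArithmeticFunction (vonMangoldt)
open scoped Nat
namespace Pf

lemma PC.card_le (N : ℕ) (I : Finset PC) (hI : ∀ p ∈ I, p.q ≤ N) : I.card ≤ N ^ 2 := by
  classical
  have h1 : ∀ p ∈ I, p.q ∈ Finset.Icc 1 N := fun p hp => by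
    rw [Finset.mem_Icc]; exact ⟨NeZero.one_le, hI p hp⟩
  rw [Finset.card_eq_sum_card_fiberwise h1]
  calc _ ≤ ∑ q ∈ Finset.Icc 1 N, N := by
        apply Finset.sum_le_sum
        intro q hq
        rw [Finset.mem_Icc] at hq
        have : NeZero q := ⟨by omega⟩
        have h2 : (Finset.filter (fun p : PC => p.q = q) I).card ≤ Nat.card (DirichletCharacter ℂ q) := by
          have : Fintype (DirichletCharacter ℂ q) := Fintype.ofFinite _
          rw [Nat.card_eq_fintype_card, ← Finset.card_univ]
          apply Finset.card_le_card_of_injOn (fun p => if h : p.q = q then h ▸ p.χ else 1) (by simp)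
          intro p hp p' hp' h
          simp at hp hp'
          obtain ⟨_, e⟩ := hp
          obtain ⟨_, e'⟩ := hp'
          apply PC.sigma_inj
          rcases p with ⟨r, ne, χ, _, _⟩
          rcases p' with ⟨r', ne', χ', _, _⟩
          simp only at e e'
          subst e
          subst e'
          simp at h
          simp [h]
        refine h2.trans ?_
        rw [DirichletCharacter.card_eq_totient_of_hasEnoughRootsOfUnity]
        exact (Nat.totient_le q).trans hq.2
    _ = N^2 := by simp [sq]

lemma PC.finite (N : ℕ) : {p : PC | p.q ≤ N}.Finite := by
  by_contra h
  obtain ⟨t, ht, hc⟩ := Set.Infinite.exists_subset_card_eq h (N^2+1)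
  have := PC.card_le N t (fun p hp => ht hp)
  omega

/-- primitive characters up to `N` -/
noncomputable def PC.upto (N : ℕ) : Finset PC := (PC.finite N).toFinset

lemma PC.mem_upto {N : ℕ} {p : PC} : p ∈ PC.upto N ↔ p.q ≤ N := by
  simp [PC.upto]

lemma PC.card_upto (N : ℕ) : (PC.upto N).card ≤ N^2 := PC.card_le N _ fun _ hp => PC.mem_upto.mp hp

lemma bv_typeII [DecidableEq PC] {j : ℕ} (hj : 4 ≤ j) (I : Finset PC) {Q : ℝ} (hI : ∀ p ∈ I, (p.q : ℝ) ≤ Q) {V : ℕ}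
    (hV : I.card * Q ^ 2 ≤ V) {s : ℂ} (hs : 1 + 1/(j:ℝ) ≤ s.re) :
    ∑ p ∈ I, ‖nld p.χ s - vT p.χ V s‖ ≤ (j:ℝ)^12 := by
  have hj0 : (4:ℝ) ≤ j := by exact_mod_cast hj
  have hj1 : 0 < (1:ℝ)/j := by positivity
  have hs1 : 1 < s.re := by linarith
  have hB : 1 + 1 / ((1 + 1/(j:ℝ)) - 1) + I.card * (2 * Q^2/((V+1 : ℕ):ℝ)) ≤ 2 * j := by
    have h1 : 1 / ((1 + 1/(j:ℝ)) - 1) = j := by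
      rw [show (1 + 1/(j:ℝ)) - 1 = 1/j by ring]; field_simp
    have h2 : I.card * (2 * Q^2/((V+1 : ℕ):ℝ)) ≤ 2 := by
      rw [← mul_div_assoc, div_le_iff₀ (by positivity)]; push_cast; nlinarith
    rw [h1]; linarith
  have hB0 : 0 ≤ 1 + 1 / ((1 + 1/(j:ℝ)) - 1) + I.card * (2 * Q^2/((V+1 : ℕ):ℝ)) := by
    have : 0 < (1 + 1/(j:ℝ)) - 1 := by linarith
    positivity
  have e1 : ∀ p : PC, tail V (tw p.χ) = fun n : ℕ => p.χ n * tail V (fun n => (vonMangoldt n : ℂ)) n := by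
    intro p; ext n; unfold tail tw; split_ifs <;> simp
  have hΛ : ∀ p : PC, LSeriesSummable (tw p.χ) s := by
    intro p
    apply LSeriesSummable_of_abscissaOfAbsConv_lt_re
    exact (abscissa_tw p.χ).trans_lt (by exact_mod_cast hs1)
  have k1 := ls_tail I hI (σ := 1 + 1/(j:ℝ)) (by linarith) hs (a := tail V (fun n => (vonMangoldt n : ℂ)))
    (V := V+1) (by omega) (fun n hn => by unfold tail; rw [if_pos (by omega)]) (A := 48 * (j:ℝ)^3)
    (fun N => by
      refine le_trans ?_ ((Lambda_sq_le hj1 N).trans ?_)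
      · apply Finset.sum_le_sum
        intro n _
        gcongr
        unfold tail
        split_ifs
        · simp
        · rw [Complex.norm_real, Real.norm_eq_abs, abs_of_nonneg ArithmeticFunction.vonMangoldt_nonneg]
      · have : 16 / (1/(j:ℝ))^2 * (1 + 2/(1/(j:ℝ))) = 16 * (j:ℝ)^2 * (1 + 2*j) := by field_simp
        rw [this]; nlinarith [sq_nonneg (j:ℝ)])
    (fun p _ => by rw [← e1]; exact tail_summable (hΛ p))
  have k2 := ls_tail I hI (σ := 1 + 1/(j:ℝ)) (by linarith) hs (a := bcoef V)
    (V := V+1) (by omega) (fun n hn => bcoef_eq_zero hn) (A := 16 * (j:ℝ)^4)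
    (fun N => by
      refine le_trans ?_ ((tau_sq_le (σ := 1 + 1/(j:ℝ)) (by linarith) N).trans ?_)
      · apply Finset.sum_le_sum
        intro n _
        gcongr
        exact norm_bcoef_le V n
      · have : 1 + 1 / ((1 + 1/(j:ℝ)) - 1) ≤ 2 * j := by
          rw [show (1 + 1/(j:ℝ)) - 1 = 1/j by ring]; field_simp; linarith
        have h0 : 0 ≤ 1 + 1 / ((1 + 1/(j:ℝ)) - 1) := by
          rw [show (1 + 1/(j:ℝ)) - 1 = 1/j by ring]; positivity
        calc _ ≤ (2*(j:ℝ))^4 := by gcongr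
          _ = _ := by ring)
    (fun p _ => (one_sub_LM p.χ V hs1).1)
  have e2 : ∑ p ∈ I, ‖nld p.χ s - vT p.χ V s‖ = ∑ p ∈ I,
      ‖LSeries (fun n => p.χ n * tail V (fun n => (vonMangoldt n : ℂ)) n) s‖ * ‖LSeries (fun n => p.χ n * bcoef V n) s‖ := by
    apply Finset.sum_congr rfl
    intro p _
    rw [vaughan p.χ V hs1, norm_mul, e1]
  rw [e2]
  have k3 := Finset.sum_mul_sq_le_sq_mul_sq I
    (fun p => ‖LSeries (fun n => p.χ n * tail V (fun n => (vonMangoldt n : ℂ)) n) s‖)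
    (fun p => ‖LSeries (fun n => p.χ n * bcoef V n) s‖)
  apply le_of_sq_le_sq _ (by positivity)
  refine k3.trans ?_
  calc _ ≤ (48 * (j:ℝ)^3 * (2 * j)) * (16 * (j:ℝ)^4 * (2 * j)) := by
        gcongr
        · exact k1.trans (by gcongr)
        · exact k2.trans (by gcongr)
    _ = 3072 * (j:ℝ)^9 := by ring
    _ ≤ (j:ℝ)^6 * (j:ℝ)^9 := by
        gcongr
        calc (3072:ℝ) ≤ 4^6 := by norm_num
          _ ≤ _ := by gcongr
    _ = (j:ℝ)^15 := by ring
    _ ≤ (j:ℝ)^24 := by gcongr <;> first | linarith | norm_num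
    _ = _ := by ring

lemma rho_pow {j : ℕ} (hj : 4 ≤ j) : 1/9 ≤ (1 - 1/(j:ℝ))^j := by
  have hj0 : (4:ℝ) ≤ j := by exact_mod_cast hj
  have h1 : Real.exp (-(2/j)) ≤ 1 - 1/(j:ℝ) := by
    have h2 : 1 + 2/(j:ℝ) ≤ Real.exp (2/j) := by
      have := Real.add_one_le_exp (2/(j:ℝ)); linarith
    rw [Real.exp_neg]
    have h3 : (Real.exp (2/(j:ℝ)))⁻¹ ≤ (1 + 2/(j:ℝ))⁻¹ := inv_anti₀ (by positivity) h2
    refine h3.trans ?_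
    rw [inv_le_iff_one_le_mul₀ (by positivity)]
    field_simp
    nlinarith
  have h4 : Real.exp (-2) ≤ (1 - 1/(j:ℝ))^j := by
    calc Real.exp (-2) = (Real.exp (-(2/j)))^j := by
          rw [← Real.exp_nat_mul]; congr 1; field_simp
      _ ≤ _ := by gcongr
  refine le_trans ?_ h4
  rw [Real.exp_neg, one_div]
  apply inv_anti₀ (by positivity)
  have := Real.exp_one_lt_d9
  calc Real.exp 2 = Real.exp 1 ^ 2 := by rw [← Real.exp_nat_mul]; norm_num
    _ ≤ 3^2 := by gcongr; linarith
    _ = 9 := by norm_num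

lemma exp_ev (C : ℝ) {c : ℝ} (hc : 0 < c) : ∀ᶠ j : ℕ in atTop, C ≤ Real.exp (c * j) := by
  have : Tendsto (fun j : ℕ => Real.exp (c * j)) atTop atTop :=
    Real.tendsto_exp_atTop.comp (Tendsto.const_mul_atTop hc tendsto_natCast_atTop_atTop)
  exact this.eventually_ge_atTop C

/-- Sum over all characters -/
theorem bv_basic : ∀ᶠ j : ℕ in atTop, ∀ N : ℕ, (N:ℝ) ≤ Real.exp (j/90) →
    ∑ p ∈ PC.upto N, ‖D (tw p.χ) j‖ ≤ j ! * (j:ℝ)^13 := by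
  classical
  filter_upwards [eventually_ge_atTop 10, exp_ev (1681*27) (c := 1/5) (by norm_num)] with j hj hE N hN
  have hj0 : (10:ℝ) ≤ j := by exact_mod_cast hj
  set I := PC.upto N with hI
  set Q := Real.exp (j/90) with hQ
  set V := ⌈Real.exp ((j:ℝ)/10)⌉₊ with hV
  have hV1 : Real.exp ((j:ℝ)/10) ≤ V := Nat.le_ceil _
  have hV2 : (V:ℝ) + 1 ≤ 3 * Real.exp ((j:ℝ)/10) := by
    have h1 := (Nat.ceil_lt_add_one (Real.exp_pos ((j:ℝ)/10)).le).le
    have h2 : 1 ≤ Real.exp ((j:ℝ)/10) := Real.one_le_exp (by positivity)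
    rw [← hV] at h1
    linarith
  have hcard : (I.card : ℝ) ≤ Q^2 := by
    have : (I.card : ℝ) ≤ (N:ℝ)^2 := by exact_mod_cast PC.card_upto N
    exact this.trans (by gcongr)
  have hIq : ∀ p ∈ I, (p.q:ℝ) ≤ Q := fun p hp => le_trans (by exact_mod_cast PC.mem_upto.mp hp) hN
  have hVQ : I.card * Q^2 ≤ V := by
    calc _ ≤ Q^2 * Q^2 := by gcongr
      _ = Real.exp (4 * (j/90)) := by rw [hQ, ← Real.exp_nat_mul, ← Real.exp_add]; congr 1; push_cast; ring
      _ ≤ Real.exp ((j:ℝ)/10) := by apply Real.exp_le_exp.mpr; linarith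
      _ ≤ V := hV1
  have hU : IsOpen {z : ℂ | 1 < z.re} := isOpen_lt continuous_const continuous_re
  have hρ : 0 < 1 - 1/(j:ℝ) := by
    rw [sub_pos, div_lt_one (by linarith)]; linarith
  have hre : ∀ z ∈ Metric.closedBall (2:ℂ) (1 - 1/(j:ℝ)), 1 + 1/(j:ℝ) ≤ z.re := by
    intro z hz
    rw [mem_closedBall_iff_norm] at hz
    have := (Complex.abs_re_le_norm (z-2)).trans hz
    rw [abs_le] at this
    simp at this ⊢; linarith [this.1]
  have hj1 : 0 < (1:ℝ)/j := by positivity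
  have hdn : ∀ p : PC, DifferentiableOn ℂ (nld p.χ) {z : ℂ | 1 < z.re} := by
    intro p z hz
    apply (nld_differentiableAt p.ne1 _).differentiableWithinAt
    rw [DirichletCharacter.LFunction_eq_LSeries p.χ hz]
    exact DirichletCharacter.LSeries_ne_zero_of_one_lt_re p.χ hz
  have hdP : ∀ p : PC, DifferentiableOn ℂ (fun z => nld p.χ z - vT p.χ V z) {z : ℂ | 1 < z.re} := by
    intro p
    exact (hdn p).sub (vT_differentiable p.ne1 V).differentiableOn
  have kP := sum_cauchy I (fun p z => nld p.χ z - vT p.χ V z) j (c := 2) (C := (j:ℝ)^12) hρ hU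
    (fun z hz => by have := hre z hz; show 1 < z.re; linarith) (fun p _ => hdP p)
    (fun z hz => bv_typeII (by omega) I hIq hVQ (hre z (Metric.sphere_subset_closedBall hz)))
  have kT : ∀ p ∈ I, ‖iteratedDeriv j (vT p.χ V) 2‖ ≤ j ! * (1681 * Q * (3 * Real.exp ((j:ℝ)/10))^3) / (19/10)^j := by
    intro p hp
    apply norm_iteratedDeriv_le_of_forall_mem_sphere_norm_le j (by norm_num)
      (vT_differentiable p.ne1 V).diffContOnCl
    intro z hz
    rw [mem_sphere_iff_norm] at hz
    refine (vT_bound p.ne1 V hz.le).trans ?_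
    have := hIq p hp
    gcongr
  have e : ∀ p ∈ I, ‖D (tw p.χ) j‖ ≤ ‖iteratedDeriv j (fun z => nld p.χ z - vT p.χ V z) 2‖ + ‖iteratedDeriv j (vT p.χ V) 2‖ := by
    intro p hp
    rw [norm_D_eq_iteratedDeriv (abscissa_tw p.χ) j (nld_eventuallyEq p.χ)]
    have h2 : (2:ℂ) ∈ {z : ℂ | 1 < z.re} := by simp
    have h : iteratedDeriv j (nld p.χ) 2 = iteratedDeriv j (fun z => nld p.χ z - vT p.χ V z) 2 + iteratedDeriv j (vT p.χ V) 2 := by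
      rw [← iteratedDeriv_add]
      · congr 1; ext z; simp
      · exact ((hdP p).analyticOnNhd hU 2 h2).contDiffAt
      · exact (vT_differentiable p.ne1 V).contDiff.contDiffAt
    rw [h]; exact norm_add_le _ _
  have hlast : (I.card:ℝ) * (j ! * (1681 * Q * (3 * Real.exp ((j:ℝ)/10))^3) / (19/10)^j) ≤ j ! * 1 := by
    rw [← mul_div_assoc, div_le_iff₀ (by positivity)]
    have h19 : Real.exp ((3:ℝ)/5 * j) ≤ (19/10:ℝ)^j := by
      have : Real.exp (3/5 : ℝ) ≤ 19/10 := by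
        have h1 : Real.exp (3/5:ℝ) ^ 5 ≤ (19/10:ℝ)^5 := by
          rw [← Real.exp_nat_mul]
          have h2 := Real.exp_one_lt_d9
          calc Real.exp ((5:ℕ) * (3/5:ℝ)) = Real.exp 1 ^ 3 := by rw [← Real.exp_nat_mul]; norm_num
            _ ≤ (2.7182818286)^3 := by gcongr
            _ ≤ _ := by norm_num
        exact le_of_pow_le_pow_left₀ (by norm_num) (by norm_num) h1
      calc _ = (Real.exp (3/5:ℝ))^j := by rw [← Real.exp_nat_mul]; congr 1; ring
        _ ≤ _ := by gcongr
    calc _ ≤ Q^2 * (j ! * (1681 * Q * (3 * Real.exp ((j:ℝ)/10))^3)) := by gcongr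
      _ = j ! * ((1681 * 27) * (Q^3 * Real.exp ((j:ℝ)/10)^3)) := by ring
      _ ≤ j ! * (Real.exp (1/5 * j) * (Q^3 * Real.exp ((j:ℝ)/10)^3)) := by gcongr
      _ = j ! * Real.exp (1/5*j + (3 * (j/90) + 3 * (j/10))) := by
          rw [hQ, ← Real.exp_nat_mul, ← Real.exp_nat_mul, ← Real.exp_add, ← Real.exp_add]; norm_num
      _ ≤ j ! * Real.exp ((3:ℝ)/5 * j) := by gcongr; linarith
      _ ≤ j ! * 1 * (19/10)^j := by rw [mul_one]; gcongr
  calc _ ≤ ∑ p ∈ I, (‖iteratedDeriv j (fun z => nld p.χ z - vT p.χ V z) 2‖ + ‖iteratedDeriv j (vT p.χ V) 2‖) :=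
        Finset.sum_le_sum e
    _ ≤ j ! * (j:ℝ)^12 / (1 - 1/(j:ℝ))^j + I.card * (j ! * (1681 * Q * (3 * Real.exp ((j:ℝ)/10))^3) / (19/10)^j) := by
        rw [Finset.sum_add_distrib]
        apply add_le_add kP
        refine (Finset.sum_le_sum kT).trans (le_of_eq ?_)
        simp
    _ ≤ j ! * (j:ℝ)^12 * 9 + j ! * 1 := by
        apply add_le_add _ hlast
        rw [div_eq_mul_inv]
        gcongr
        rw [inv_le_comm₀ (by positivity) (by norm_num), ← one_div]
        exact rho_pow (by omega)
    _ ≤ j ! * ((j:ℝ)^12 * j) := by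
        have : (1:ℝ) ≤ (j:ℝ)^12 := one_le_pow₀ (by linarith)
        rw [mul_assoc, ← mul_add]
        gcongr
        nlinarith
    _ = _ := by ring

end Pf
end

section
open Complex Filter Topology MeasureTheory
open DirichletCharacter (LFunction)
open ArithmeticFunction (vonMangoldt)
open scoped Nat
namespace Pf

/-- Bombieri-Vinogradov type estimate along a sequence of `j`. -/
theorem bv (B : ℕ) : ∃ᶠ j : ℕ in atTop, ∀ N : ℕ, (N:ℝ) ≤ Real.exp (j/90) →
    ∑ p ∈ PC.upto N, ‖D (tw p.χ) j‖ / √(p.q) ≤ j ! / (j:ℝ)^B := by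
  set A := 2 * (B + 14) with hA
  obtain ⟨J, hJ⟩ := eventually_atTop.mp (bv_basic.and
    ((siegel_walfisz A (2 * A + B + 1)).and (eventually_ge_atTop 2)))
  rw [frequently_atTop]
  intro J'
  obtain ⟨j, hj, hg⟩ := exists_good A (max J J')
  refine ⟨j, by omega, fun N hN => ?_⟩
  obtain ⟨h1, h2, h3⟩ := hJ j (by omega)
  have h1 := h1 N hN
  have h2 := h2 hg
  have hj0 : (2:ℝ) ≤ j := by exact_mod_cast h3
  have hjp : (0:ℝ) < j := by linarith
  have hs : ∀ p : PC, 1 ≤ √(p.q:ℝ) := fun p => by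
    rw [Real.one_le_sqrt]; exact_mod_cast NeZero.one_le
  classical
  have hp : ∀ p ∈ PC.upto N, ‖D (tw p.χ) j‖ / √(p.q) ≤
      ‖D (tw p.χ) j‖ / (j:ℝ)^(B+14) + if p ∈ PC.upto (j^A) then (j ! : ℝ) / (j:ℝ)^(2*A+B+1) else 0 := by
    intro p _
    split_ifs with h
    · have := h2 p.q p.χ (PC.mem_upto.mp h) p.prim p.ne1
      have h4 : ‖D (tw p.χ) j‖ / √(p.q) ≤ ‖D (tw p.χ) j‖ := div_le_self (norm_nonneg _) (hs p)
      have h5 : 0 ≤ ‖D (tw p.χ) j‖ / (j:ℝ)^(B+14) := by positivity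
      linarith
    · rw [add_zero]
      rw [PC.mem_upto, not_le] at h
      gcongr
      apply Real.le_sqrt_of_sq_le
      rw [← pow_mul, show (B+14)*2 = A by omega]
      exact_mod_cast h.le
  refine (Finset.sum_le_sum hp).trans ?_
  rw [Finset.sum_add_distrib, ← Finset.sum_div]
  have h6 : ∑ p ∈ PC.upto N, (if p ∈ PC.upto (j^A) then (j ! : ℝ) / (j:ℝ)^(2*A+B+1) else 0)
      ≤ (j:ℝ)^(2*A) * ((j ! : ℝ) / (j:ℝ)^(2*A+B+1)) := by
    rw [← Finset.sum_filter, Finset.sum_const, nsmul_eq_mul]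
    gcongr
    have : (Finset.filter (fun p => p ∈ PC.upto (j^A)) (PC.upto N)).card ≤ (j^A)^2 :=
      PC.card_le _ _ fun p hp => PC.mem_upto.mp (Finset.mem_filter.mp hp).2
    rw [← pow_mul, mul_comm A 2] at this
    exact_mod_cast this
  calc _ ≤ j ! * (j:ℝ)^13 / (j:ℝ)^(B+14) + (j:ℝ)^(2*A) * ((j ! : ℝ) / (j:ℝ)^(2*A+B+1)) := by
        gcongr
    _ = (j ! / (j:ℝ)^B) * (2 / j) := by field_simp; ring
    _ ≤ (j ! / (j:ℝ)^B) * 1 := by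
        gcongr
        rw [div_le_one hjp]; exact hj0
    _ = _ := mul_one _

lemma abscissa_Lambda : LSeries.abscissaOfAbsConv (fun n => (vonMangoldt n : ℂ)) ≤ 1 := by
  apply abscissa_le_one_of_bound
  intro δ hδ
  refine ⟨1/δ, fun n _ => ?_⟩
  rw [Complex.norm_real, Real.norm_eq_abs, abs_of_nonneg ArithmeticFunction.vonMangoldt_nonneg]
  have := vonMangoldt_le_rpow hδ n
  rw [one_div_mul_eq_div]; exact this

open DirichletCharacter in
theorem main_term : ∃ ρ C : ℝ, 1 < ρ ∧ ∀ j : ℕ, ‖D (fun n => (vonMangoldt n : ℂ)) j - (j ! : ℂ)‖ ≤ j ! * C / ρ ^ j := by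
  set h := LFunctionTrivChar₁ 1 with hh
  have hd : Differentiable ℂ h := differentiable_LFunctionTrivChar₁ 1
  have hz : ∀ s : ℂ, s ≠ 1 → LFunctionTrivChar 1 s = riemannZeta s := by
    intro s hs
    rw [LFunctionTrivChar_eq_mul_riemannZeta hs]; simp
  have hv : ∀ s : ℂ, s ≠ 1 → h s = (s - 1) * riemannZeta s := by
    intro s hs
    rw [hh, LFunctionTrivChar₁, Function.update_of_ne hs, hz s hs]
  have hopen : IsOpen {s : ℂ | h s ≠ 0} := isOpen_ne_fun hd.continuous continuous_const
  have hsub : Metric.closedBall (2:ℂ) 1 ⊆ {s : ℂ | h s ≠ 0} := by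
    intro s hs
    rw [mem_closedBall_iff_norm] at hs
    by_cases h1 : s = 1
    · rw [h1]; exact LFunctionTrivChar₁_apply_one_ne_zero 1
    · show h s ≠ 0
      rw [hv s h1]
      apply mul_ne_zero (sub_ne_zero.mpr h1)
      apply riemannZeta_ne_zero_of_one_le_re
      have := (Complex.abs_re_le_norm (s-2)).trans hs
      rw [abs_le] at this
      simp at this; linarith [this.1]
  obtain ⟨δ, hδ, hδs⟩ := (isCompact_closedBall (2:ℂ) 1).exists_cthickening_subset_open hopen hsub
  rw [cthickening_closedBall hδ.le zero_le_one] at hδs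
  have hd2 : Differentiable ℂ (deriv h) := (hd.contDiff (n := 2)).differentiable_deriv_two
  have hG : DifferentiableOn ℂ (fun s => - deriv h s / h s) {s : ℂ | h s ≠ 0} := by
    intro s hs
    exact (((hd2 s).neg).div (hd s) hs).differentiableWithinAt
  have hcont : ContinuousOn (fun s => - deriv h s / h s) (Metric.closedBall (2:ℂ) (δ+1)) :=
    (hG.mono hδs).continuousOn
  obtain ⟨C, hC⟩ := (isCompact_closedBall (2:ℂ) (δ+1)).exists_bound_of_continuousOn hcont
  refine ⟨δ+1, C, by linarith, fun j => ?_⟩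
  have key := norm_iteratedDeriv_le_of_forall_mem_sphere_norm_le (c := 2) (R := δ+1) (C := C)
    (f := fun s => - deriv h s / h s) j (by linarith) (by
      apply DifferentiableOn.diffContOnCl
      rw [closure_ball _ (by linarith)]
      exact hG.mono hδs) (fun z hz => hC z (Metric.sphere_subset_closedBall hz))
  have hmem : {z : ℂ | 1 < z.re} ∈ 𝓝 (2:ℂ) :=
      (isOpen_lt continuous_const continuous_re).mem_nhds (by simp)
  have heq : LSeries (fun n => (vonMangoldt n : ℂ)) =ᶠ[𝓝 2]
      ((fun s : ℂ => (1 * s - 1)⁻¹) + (fun s => - deriv h s / h s)) := by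
    filter_upwards [hmem] with s hs
    have hs1 : s ≠ 1 := by rintro rfl; simp at hs
    have hζ : riemannZeta s ≠ 0 := riemannZeta_ne_zero_of_one_le_re (le_of_lt hs)
    have hdz : deriv (LFunctionTrivChar 1) s = deriv riemannZeta s := by
      apply Filter.EventuallyEq.deriv_eq
      filter_upwards [isOpen_ne.mem_nhds hs1] with w hw using hz w hw
    rw [ArithmeticFunction.LSeries_vonMangoldt_eq_deriv_riemannZeta_div hs]
    simp only [Pi.add_apply]
    rw [hv s hs1, hh, deriv_LFunctionTrivChar₁_apply_of_ne_one _ hs1, hdz, hz s hs1]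
    have : s - 1 ≠ 0 := sub_ne_zero.mpr hs1
    rw [one_mul]
    field_simp
    ring
  have h1 := iteratedDeriv_eq_D abscissa_Lambda j
  rw [heq.iteratedDeriv_eq, iteratedDeriv_add] at h1
  · rw [iteratedDeriv_eq_iterate, iter_deriv_inv_linear_sub] at h1
    norm_num at h1
    have e : iteratedDeriv j (fun s => - deriv h s / h s) 2 = (-1)^j * (D (fun n => (vonMangoldt n : ℂ)) j - j !) := by
      rw [mul_sub, ← h1]; ring
    rw [e, norm_mul] at key
    simpa using key
  · apply ContDiffAt.inv
    · fun_prop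
    · norm_num
  · exact (hG.analyticOnNhd hopen 2 (hsub (by simp))).contDiffAt

end Pf
end

section
open Complex Filter Topology MeasureTheory
open DirichletCharacter (LFunction)
open ArithmeticFunction (vonMangoldt)
open scoped Nat
namespace Pf

/-- the weight `(log n)^j / n^2` -/
noncomputable def g (j n : ℕ) : ℝ := Real.log n ^ j / (n:ℝ)^2

lemma g_nonneg (j n : ℕ) : 0 ≤ g j n := by
  unfold g; have := Real.log_natCast_nonneg n; positivity

lemma g_zero (j : ℕ) : g j 0 = 0 := by simp [g]

/-- Rankin -/
lemma log_pow_le {c : ℝ} (hc : 0 < c) (j : ℕ) {n : ℕ} (hn : n ≠ 0) :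
    Real.log n ^ j ≤ j ! / c^j * (n:ℝ)^c := by
  have hl := Real.log_natCast_nonneg n
  have h := Real.pow_div_factorial_le_exp (c * Real.log n) (by positivity) j
  rw [mul_comm c (Real.log n), ← Real.rpow_def_of_pos (by exact_mod_cast Nat.pos_of_ne_zero hn), mul_pow] at h
  rw [div_mul_eq_mul_div, le_div_iff₀ (by positivity)]
  rw [div_le_iff₀ (by positivity)] at h
  linarith

lemma g_le {c : ℝ} (hc : 0 < c) (j n : ℕ) : g j n ≤ j ! / c^j * (n:ℝ)^(c-2) := by
  rcases Nat.eq_zero_or_pos n with rfl | hn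
  · rw [g_zero]; positivity
  · have hn0 : (0:ℝ) < n := by exact_mod_cast hn
    unfold g
    rw [div_le_iff₀ (by positivity), mul_assoc, ← Real.rpow_natCast (n:ℝ) 2, ← Real.rpow_add hn0]
    have := log_pow_le hc j hn.ne'
    norm_num at this ⊢
    exact this

lemma D_eq_tsum (f : ℕ → ℂ) (j : ℕ) : D f j = ∑' n : ℕ, (g j n : ℂ) * f n := by
  unfold D LSeries
  apply tsum_congr
  intro n
  rcases Nat.eq_zero_or_pos n with rfl | hn
  · simp [g_zero]
  · rw [LSeries.term_of_ne_zero hn.ne']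
    unfold g
    push_cast
    have : (n:ℂ)^(2:ℂ) = (n:ℂ)^2 := by
      rw [← Complex.cpow_natCast]; norm_num
    rw [this]; ring

lemma summable_Lambda_g (j : ℕ) : Summable fun n => vonMangoldt n * g j n := by
  have h0 : Summable fun n : ℕ => (8 * (j ! / (1/2:ℝ)^j)) * (n:ℝ)^(-(11/8:ℝ)) := (summable_rpow (by norm_num)).mul_left _
  apply Summable.of_nonneg_of_le (fun n => mul_nonneg ArithmeticFunction.vonMangoldt_nonneg (g_nonneg j n)) _ h0
  intro n
  rcases Nat.eq_zero_or_pos n with rfl | hn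
  · rw [g_zero]; simp
  have hn0 : (0:ℝ) < n := by exact_mod_cast hn
  have h1 := vonMangoldt_le_rpow (δ := 1/8) (by norm_num) n
  have h2 := g_le (c := 1/2) (by norm_num) j n
  calc _ ≤ ((n:ℝ)^(1/8:ℝ) / (1/8)) * (j ! / (1/2:ℝ)^j * (n:ℝ)^((1/2:ℝ)-2)) := by
        apply mul_le_mul h1 h2 (g_nonneg j n) (by positivity)
    _ = (8 * (j ! / (1/2:ℝ)^j)) * ((n:ℝ)^(1/8:ℝ) * (n:ℝ)^((1/2:ℝ)-2)) := by ring
    _ = _ := by rw [← Real.rpow_add hn0]; norm_num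

/-- primes larger than `R`, with logarithmic weight -/
noncomputable def th (R n : ℕ) : ℝ := if n.Prime ∧ R < n then Real.log n else 0

lemma th_nonneg (R n : ℕ) : 0 ≤ th R n := by
  unfold th; split_ifs
  · exact Real.log_natCast_nonneg n
  · exact le_rfl

lemma th_le (R n : ℕ) : th R n ≤ vonMangoldt n := by
  unfold th; split_ifs with h
  · rw [ArithmeticFunction.vonMangoldt_apply_prime h.1]
  · exact ArithmeticFunction.vonMangoldt_nonneg

lemma summable_th_g (R j : ℕ) : Summable fun n => th R n * g j n :=
  Summable.of_nonneg_of_le (fun n => mul_nonneg (th_nonneg R n) (g_nonneg j n))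
    (fun n => mul_le_mul_of_nonneg_right (th_le R n) (g_nonneg j n)) (summable_Lambda_g j)

/-- error from prime powers and small primes -/
noncomputable def eps (R j : ℕ) : ℝ := ∑' n, (vonMangoldt n - th R n) * g j n

lemma summable_eps (R j : ℕ) : Summable fun n => (vonMangoldt n - th R n) * g j n := by
  simp only [sub_mul]
  exact (summable_Lambda_g j).sub (summable_th_g R j)

lemma eps_nonneg (R j : ℕ) : 0 ≤ eps R j :=
  tsum_nonneg fun n => mul_nonneg (sub_nonneg.mpr (th_le R n)) (g_nonneg j n)

lemma summable_pp : Summable fun n : ℕ => (if n.Prime then 0 else vonMangoldt n) * (n:ℝ)^(-(3/5):ℝ) := by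
  set f : ℕ → ℝ := fun n : ℕ => (if n.Prime then 0 else vonMangoldt n) * (n:ℝ)^(-(3/5):ℝ) with hf
  set S : Set ℕ := {n | IsPrimePow n ∧ ¬ n.Prime} with hS
  have hsupp : f = S.indicator f := by
    ext n
    by_cases h : n ∈ S
    · rw [Set.indicator_of_mem h]
    · rw [Set.indicator_of_notMem h]
      simp only [hf]
      split_ifs with h'
      · simp
      · rw [ArithmeticFunction.vonMangoldt_eq_zero_iff.mpr (fun h'' => h ⟨h'', h'⟩)]; simp
  rw [hsupp, ← summable_subtype_iff_indicator]
  have hex : ∀ n : S, ∃ x : ℕ × ℕ, x.1.Prime ∧ x.1 ^ (x.2 + 2) = n.1 := by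
    rintro ⟨n, h1, h2⟩
    obtain ⟨p, k, hp, hk, rfl⟩ := h1
    have hp' := hp.nat_prime
    refine ⟨(p, k-2), hp', ?_⟩
    have : k ≠ 1 := by rintro rfl; apply h2; simpa using hp'
    simp only
    congr 1; omega
  choose i hi1 hi2 using hex
  have hinj : Function.Injective i := by
    intro a b h
    apply Subtype.ext
    rw [← hi2 a, ← hi2 b, h]
  set r : ℝ := (2:ℝ)^(-(3/5):ℝ) with hr
  have hr1 : r < 1 := by
    rw [hr]; apply Real.rpow_lt_one_of_one_lt_of_neg <;> norm_num
  have hr0 : 0 < r := by positivity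
  have hG : Summable fun x : ℕ × ℕ => (10 * (x.1:ℝ)^(-(11/10):ℝ)) * r^x.2 :=
    Summable.mul_of_nonneg ((summable_rpow (by norm_num)).mul_left 10) (summable_geometric_of_lt_one hr0.le hr1)
      (fun n => by positivity) (fun n => by positivity)
  have hc := hG.comp_injective hinj
  apply Summable.of_nonneg_of_le _ _ hc
  · intro n
    simp only [Function.comp, hf]
    apply mul_nonneg _ (by positivity)
    split_ifs
    · exact le_rfl
    · exact ArithmeticFunction.vonMangoldt_nonneg
  · intro n
    simp only [Function.comp, hf]
    rw [if_neg n.2.2, ← hi2 n]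
    set p := (i n).1
    set k := (i n).2
    have hp : p.Prime := hi1 n
    rw [ArithmeticFunction.vonMangoldt_apply_pow (by omega)]
    have hp0 : (0:ℝ) < p := by exact_mod_cast hp.pos
    have hp2 : (2:ℝ) ≤ p := by exact_mod_cast hp.two_le
    have h1 := vonMangoldt_le_rpow (δ := 1/10) (by norm_num) p
    push_cast
    rw [← Real.rpow_natCast_mul hp0.le]
    calc _ ≤ ((p:ℝ)^(1/10:ℝ) / (1/10)) * (p:ℝ)^(((k+2:ℕ):ℝ) * (-(3/5))) := by gcongr
      _ = 10 * ((p:ℝ)^(1/10:ℝ) * (p:ℝ)^(((k+2:ℕ):ℝ) * (-(3/5)))) := by ring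
      _ = 10 * ((p:ℝ)^(-(11/10):ℝ) * ((p:ℝ)^(-(3/5):ℝ))^k) := by
          rw [← Real.rpow_add hp0, ← Real.rpow_mul_natCast hp0.le, ← Real.rpow_add hp0]
          congr 2; push_cast; ring
      _ ≤ 10 * ((p:ℝ)^(-(11/10):ℝ) * r^k) := by
          gcongr
          exact Real.rpow_le_rpow_of_nonpos (by norm_num) hp2 (by norm_num)
      _ = _ := by ring

lemma eps_le : ∃ C : ℝ, 0 < C ∧ ∀ R j : ℕ, eps R j ≤ C * (R+1) * j ! / (7/5:ℝ)^j := by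
  set f : ℕ → ℝ := fun n : ℕ => (if n.Prime then 0 else vonMangoldt n) * (n:ℝ)^(-(3/5):ℝ) with hf
  have hf0 : ∀ n, 0 ≤ f n := fun n => by
    simp only [hf]
    apply mul_nonneg _ (by positivity)
    split_ifs
    · exact le_rfl
    · exact ArithmeticFunction.vonMangoldt_nonneg
  have hfs : Summable f := summable_pp
  have hC0 : 0 ≤ ∑' n, f n := tsum_nonneg hf0
  refine ⟨(∑' n, f n) + 2, by positivity, fun R j => ?_⟩
  set K : ℝ := j ! / (7/5:ℝ)^j with hK
  have hK0 : 0 ≤ K := by positivity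
  set u : ℕ → ℝ := fun n => if n ∈ Finset.range (R+1) then 2 else 0 with hu
  have hus : HasSum u (2 * (R+1)) := by
    have : HasSum u (∑ n ∈ Finset.range (R+1), u n) := hasSum_sum_of_ne_finset_zero (fun n hn => by simp only [hu]; rw [if_neg hn])
    convert this using 1
    rw [Finset.sum_congr rfl (g := fun _ => (2:ℝ)) (fun n hn => by simp only [hu]; rw [if_pos hn])]
    simp; ring
  have hb : ∀ n, (vonMangoldt n - th R n) * g j n ≤ K * (f n + u n) := by
    intro n
    have hg := g_le (c := 7/5) (by norm_num) j n
    rw [show (7/5:ℝ) - 2 = -(3/5) by norm_num] at hg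
    have h0 := sub_nonneg.mpr (th_le R n)
    refine (mul_le_mul_of_nonneg_left hg h0).trans ?_
    rw [mul_left_comm]
    gcongr
    simp only [hf, hu, th]
    by_cases hp : n.Prime
    · rw [if_pos hp, zero_mul, zero_add]
      by_cases hR : R < n
      · rw [if_pos ⟨hp, hR⟩, ArithmeticFunction.vonMangoldt_apply_prime hp]; simp; split_ifs <;> norm_num
      · rw [if_neg (by tauto), if_pos (by simp; omega), sub_zero]
        have h1 := vonMangoldt_le_rpow (δ := 3/5) (by norm_num) n
        have hn0 : (0:ℝ) < n := by exact_mod_cast hp.pos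
        calc _ ≤ ((n:ℝ)^(3/5:ℝ) / (3/5)) * (n:ℝ)^(-(3/5):ℝ) := by gcongr
          _ = 5/3 := by rw [Real.rpow_neg hn0.le]; field_simp
          _ ≤ 2 := by norm_num
    · rw [if_neg hp, if_neg (by tauto), sub_zero]
      have : (0:ℝ) ≤ if n ∈ Finset.range (R+1) then 2 else 0 := by split_ifs <;> norm_num
      linarith
  have h1 : eps R j ≤ ∑' n, K * (f n + u n) :=
    (summable_eps R j).tsum_le_tsum hb ((hfs.add hus.summable).mul_left K)
  refine h1.trans ?_
  rw [tsum_mul_left, hfs.tsum_add hus.summable, hus.tsum_eq]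
  calc _ ≤ K * ((∑' n, f n) * (R+1) + 2 * (R+1)) := by
        gcongr
        apply le_mul_of_one_le_right hC0
        have : (0:ℝ) ≤ R := by positivity
        linarith
    _ = _ := by rw [hK]; ring

end Pf
end

section
open Complex Filter Topology MeasureTheory
open DirichletCharacter (LFunction)
open ArithmeticFunction (vonMangoldt)
open scoped Nat
namespace Pf

lemma summable_tw_g (j : ℕ) {χ : ℕ → ℂ} (hχ : ∀ n, ‖χ n‖ ≤ 1) :
    Summable fun n => (g j n : ℂ) * (χ n * (vonMangoldt n : ℂ)) := by
  apply Summable.of_norm_bounded (summable_Lambda_g j)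
  intro n
  rw [norm_mul, norm_mul, Complex.norm_real, Complex.norm_real, Real.norm_of_nonneg (g_nonneg j n),
    Real.norm_of_nonneg ArithmeticFunction.vonMangoldt_nonneg]
  have h1 := hχ n
  have h2 := g_nonneg j n
  have h3 : 0 ≤ vonMangoldt n := ArithmeticFunction.vonMangoldt_nonneg
  calc _ ≤ g j n * (1 * vonMangoldt n) := by gcongr
    _ = _ := by ring

lemma summable_th_tw (R j : ℕ) {χ : ℕ → ℂ} (hχ : ∀ n, ‖χ n‖ ≤ 1) :
    Summable fun n => (g j n : ℂ) * (χ n * (th R n : ℂ)) := by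
  apply Summable.of_norm_bounded (summable_th_g R j)
  intro n
  rw [norm_mul, norm_mul, Complex.norm_real, Complex.norm_real, Real.norm_of_nonneg (g_nonneg j n),
    Real.norm_of_nonneg (th_nonneg R n)]
  have h1 := hχ n
  have h2 := g_nonneg j n
  have h3 := th_nonneg R n
  calc _ ≤ g j n * (1 * th R n) := by gcongr
    _ = _ := by ring

lemma twist_close {N : ℕ} {R : ℕ} (hN : ∀ p, p.Prime → p ∣ N → p ≤ R) (χ : DirichletCharacter ℂ N) (j : ℕ) :
    ‖∑' n : ℕ, (g j n : ℂ) * (χ n * (th R n : ℂ)) - D (tw χ.primitiveCharacter) j‖ ≤ eps R j := by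
  rw [D_eq_tsum]
  unfold tw
  rw [← (summable_th_tw R j (χ := fun n => χ n) (fun n => DirichletCharacter.norm_le_one _ _)).tsum_sub
    (summable_tw_g j (χ := fun n => χ.primitiveCharacter n) (fun n => DirichletCharacter.norm_le_one _ _))]
  apply tsum_of_norm_bounded (summable_eps R j).hasSum
  intro n
  have hg := g_nonneg j n
  have h2 := sub_nonneg.mpr (th_le R n)
  have key : χ n * (th R n : ℂ) = χ.primitiveCharacter n * (th R n : ℂ) := by
    unfold th
    split_ifs with h
    · have hc : Nat.Coprime n N := by
        rw [Nat.Prime.coprime_iff_not_dvd h.1]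
        intro hd
        have := hN n h.1 hd
        omega
      congr 1
      conv_lhs => rw [← DirichletCharacter.changeLevel_primitiveCharacter χ]
      exact changeLevel_apply_of_coprime _ _ hc
    · simp
  rw [key, ← mul_sub, ← mul_sub, norm_mul, norm_mul, Complex.norm_real, Real.norm_of_nonneg hg,
    ← Complex.ofReal_sub, Complex.norm_real, Real.norm_eq_abs, abs_sub_comm, abs_of_nonneg h2]
  have h1 : ‖χ.primitiveCharacter n‖ ≤ 1 := DirichletCharacter.norm_le_one _ _
  calc _ ≤ g j n * (1 * (vonMangoldt n - th R n)) := by gcongr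
    _ = _ := by ring

/-- the weighted count of primes in an arithmetic progression -/
noncomputable def apS (N R j : ℕ) (a : ZMod N) : ℝ := ∑' n : ℕ, if (n : ZMod N) = a then th R n * g j n else 0

lemma ap_ortho {N : ℕ} [NeZero N] (R : ℕ) {a : ZMod N} (ha : IsUnit a) (j : ℕ) :
    (((N.totient : ℝ) * apS N R j a : ℝ) : ℂ) =
      ∑ χ : DirichletCharacter ℂ N, χ a⁻¹ * ∑' n : ℕ, (g j n : ℂ) * (χ n * (th R n : ℂ)) := by
  have hs : ∀ χ : DirichletCharacter ℂ N, Summable fun n : ℕ => χ a⁻¹ * ((g j n : ℂ) * (χ n * (th R n : ℂ))) := by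
    intro χ
    have := summable_th_tw R j (χ := fun n => χ n) (fun n => DirichletCharacter.norm_le_one _ _)
    exact this.mul_left _
  simp only [← tsum_mul_left]
  rw [← Summable.tsum_finsetSum (fun χ _ => hs χ)]
  unfold apS
  rw [← tsum_mul_left, Complex.ofReal_tsum]
  apply tsum_congr
  intro n
  have := DirichletCharacter.sum_char_inv_mul_char_eq ℂ ha (n : ZMod N)
  calc _ = (if a = (n:ZMod N) then (N.totient : ℂ) else 0) * ((g j n : ℂ) * (th R n : ℂ)) := by
        by_cases h : (n : ZMod N) = a
        · rw [if_pos h, if_pos h.symm]; push_cast; ring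
        · rw [if_neg h, if_neg (Ne.symm h)]; simp
    _ = _ := by
        rw [← this, Finset.sum_mul]
        apply Finset.sum_congr rfl
        intro χ _
        ring

open Classical in
lemma sum_prim_le {N : ℕ} [NeZero N] (j : ℕ) :
    ∑ χ ∈ Finset.univ.erase (1 : DirichletCharacter ℂ N), ‖D (tw χ.primitiveCharacter) j‖
      ≤ ∑ p ∈ (PC.upto N).filter (fun p => p.q ∣ N), ‖D (tw p.χ) j‖ := by
  have hne : ∀ χ : DirichletCharacter ℂ N, NeZero χ.conductor := fun χ => ⟨χ.conductor_ne_zero⟩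
  have hpne : ∀ χ : DirichletCharacter ℂ N, χ ≠ 1 → χ.primitiveCharacter ≠ 1 := by
    intro χ h h'
    apply h
    rw [← DirichletCharacter.changeLevel_primitiveCharacter χ, h', DirichletCharacter.changeLevel_one]
  set S := Finset.univ.erase (1 : DirichletCharacter ℂ N) with hS
  set F : S → PC := fun χ =>
    ⟨χ.1.conductor, hne χ, χ.1.primitiveCharacter, χ.1.primitiveCharacter_isPrimitive, hpne χ.1 (Finset.ne_of_mem_erase χ.2)⟩ with hF
  have hinj : Function.Injective F := by
    intro χ ψ h
    apply Subtype.ext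
    have key : ∀ (q : ℕ) (c : DirichletCharacter ℂ q) (hq : q ∣ N) (q' : ℕ) (c' : DirichletCharacter ℂ q') (hq' : q' ∣ N),
        (⟨q, c⟩ : Σ q, DirichletCharacter ℂ q) = ⟨q', c'⟩ →
        DirichletCharacter.changeLevel hq c = DirichletCharacter.changeLevel hq' c' := by
      intro q c hq q' c' hq' e
      cases e
      rfl
    rw [← DirichletCharacter.changeLevel_primitiveCharacter χ.1, ← DirichletCharacter.changeLevel_primitiveCharacter ψ.1]
    apply key
    exact congrArg (fun p : PC => (⟨p.q, p.χ⟩ : Σ q, DirichletCharacter ℂ q)) h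
  rw [← Finset.sum_attach]
  calc _ = ∑ χ ∈ S.attach, ‖D (tw (F χ).χ) j‖ := rfl
    _ = ∑ p ∈ S.attach.image F, ‖D (tw p.χ) j‖ := by
        rw [Finset.sum_image (fun x _ y _ h => hinj h)]
    _ ≤ _ := by
        apply Finset.sum_le_sum_of_subset_of_nonneg
        · intro p hp
          rw [Finset.mem_image] at hp
          obtain ⟨χ, _, rfl⟩ := hp
          rw [Finset.mem_filter, PC.mem_upto]
          have hd : χ.1.conductor ∣ N := χ.1.conductor_dvd_level
          exact ⟨Nat.le_of_dvd (Nat.pos_of_ne_zero (NeZero.ne N)) hd, hd⟩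
        · intros; positivity

open Classical in
theorem ap_bound {N : ℕ} [NeZero N] {R : ℕ} (hN : ∀ p, p.Prime → p ∣ N → p ≤ R) {a : ZMod N} (ha : IsUnit a) (j : ℕ) :
    |(N.totient : ℝ) * apS N R j a - j !| ≤ ∑ p ∈ (PC.upto N).filter (fun p => p.q ∣ N), ‖D (tw p.χ) j‖
      + ‖D (fun n => (vonMangoldt n : ℂ)) j - (j ! : ℂ)‖ + N.totient * eps R j := by
  set T : DirichletCharacter ℂ N → ℂ := fun χ => ∑' n : ℕ, (g j n : ℂ) * (χ n * (th R n : ℂ)) with hT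
  have e1 : (((N.totient : ℝ) * apS N R j a : ℝ) : ℂ) = ∑ χ : DirichletCharacter ℂ N, χ a⁻¹ * T χ := by
    exact ap_ortho R ha j
  have e2 : D (tw (1 : DirichletCharacter ℂ N).primitiveCharacter) j = D (fun n => (vonMangoldt n : ℂ)) j := by
    rw [D_eq_tsum, D_eq_tsum]
    apply tsum_congr
    intro n
    unfold tw
    rw [DirichletCharacter.primitiveCharacter_one]
    have : IsUnit ((n : ℕ) : ZMod (DirichletCharacter.conductor (1 : DirichletCharacter ℂ N))) := by
      rw [DirichletCharacter.conductor_one]; exact isUnit_of_subsingleton _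
    rw [MulChar.one_apply this, one_mul]
  have hun : IsUnit (a⁻¹) := by
    obtain ⟨u, rfl⟩ := ha
    rw [ZMod.inv_coe_unit]; exact Units.isUnit _
  have h1 : ∀ χ : DirichletCharacter ℂ N, ‖χ a⁻¹ * T χ - (if χ = 1 then (j ! : ℂ) else 0)‖ ≤
      eps R j + if χ = 1 then ‖D (fun n => (vonMangoldt n : ℂ)) j - (j ! : ℂ)‖ else ‖D (tw χ.primitiveCharacter) j‖ := by
    intro χ
    have hc := twist_close hN χ j
    split_ifs with h
    · subst h
      rw [MulChar.one_apply hun, one_mul]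
      rw [e2] at hc
      exact (norm_sub_le_norm_sub_add_norm_sub _ _ _).trans (add_le_add hc le_rfl)
    · rw [sub_zero, norm_mul]
      calc _ ≤ 1 * ‖T χ‖ := by gcongr; exact DirichletCharacter.norm_le_one _ _
        _ = ‖T χ - D (tw χ.primitiveCharacter) j + D (tw χ.primitiveCharacter) j‖ := by simp
        _ ≤ _ := (norm_add_le _ _).trans (add_le_add hc le_rfl)
  have e3 : (((N.totient : ℝ) * apS N R j a - j ! : ℝ) : ℂ) =
      ∑ χ : DirichletCharacter ℂ N, (χ a⁻¹ * T χ - (if χ = 1 then (j ! : ℂ) else 0)) := by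
    rw [Finset.sum_sub_distrib, ← e1]; simp
  rw [← Real.norm_eq_abs, ← Complex.norm_real, e3]
  refine (norm_sum_le _ _).trans ((Finset.sum_le_sum fun χ _ => h1 χ).trans ?_)
  rw [Finset.sum_add_distrib, Finset.sum_const, Finset.card_univ, ← Nat.card_eq_fintype_card,
    DirichletCharacter.card_eq_totient_of_hasEnoughRootsOfUnity, nsmul_eq_mul]
  rw [← Finset.add_sum_erase _ _ (Finset.mem_univ (1 : DirichletCharacter ℂ N)), if_pos rfl]
  have h4 : ∑ χ ∈ Finset.univ.erase (1 : DirichletCharacter ℂ N), (if χ = 1 then ‖D (fun n => (vonMangoldt n : ℂ)) j - (j ! : ℂ)‖ else ‖D (tw χ.primitiveCharacter) j‖)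
      ≤ ∑ p ∈ (PC.upto N).filter (fun p => p.q ∣ N), ‖D (tw p.χ) j‖ := by
    refine le_trans (le_of_eq ?_) (sum_prim_le j)
    apply Finset.sum_congr rfl
    intro χ hχ
    rw [if_neg (Finset.ne_of_mem_erase hχ)]
  linarith
end Pf
end

section
open Complex Filter Topology MeasureTheory
open DirichletCharacter (LFunction)
open ArithmeticFunction (vonMangoldt)
open scoped Nat
namespace Pf

/-- antiderivative of the weight -/
noncomputable def IJ : ℕ → ℝ → ℝ
  | 0 => fun x => x⁻¹
  | (J+1) => fun x => Real.log x ^ (J+1) * x⁻¹ + (J+1) * IJ J x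

lemma IJ_deriv (J : ℕ) {x : ℝ} (hx : 0 < x) : HasDerivAt (IJ J) (-(Real.log x ^ J * (x^2)⁻¹)) x := by
  induction J with
  | zero =>
    have := hasDerivAt_inv hx.ne'
    unfold IJ
    simpa using this
  | succ J ih =>
    unfold IJ
    have h1 := ((Real.hasDerivAt_log hx.ne').pow (J+1)).mul (hasDerivAt_inv hx.ne')
    have h2 := h1.add (ih.const_mul ((J:ℝ)+1))
    refine h2.congr_deriv ?_
    simp
    field_simp
    ring

lemma IJ_nonneg (J : ℕ) {x : ℝ} (hx : 1 ≤ x) : 0 ≤ IJ J x := by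
  induction J with
  | zero => unfold IJ; positivity
  | succ J ih => unfold IJ; have := Real.log_nonneg hx; positivity

lemma IJ_one (J : ℕ) : IJ J 1 = J ! := by
  induction J with
  | zero => simp [IJ]
  | succ J ih => unfold IJ; rw [ih, Nat.factorial_succ]; simp

lemma g_le_IJ (J : ℕ) {n : ℕ} (hn : 1 ≤ n) : g J n ≤ 4 * (IJ J n - IJ J (n+1:ℕ)) := by
  have hn0 : (1:ℝ) ≤ n := by exact_mod_cast hn
  obtain ⟨ξ, ⟨h1, h2⟩, h3⟩ := exists_hasDerivAt_eq_slope (IJ J) (fun x => -(Real.log x ^ J * (x^2)⁻¹))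
    (a := n) (b := (n+1:ℕ)) (by push_cast; linarith)
    (fun x hx => (IJ_deriv J (by linarith [hx.1])).continuousAt.continuousWithinAt)
    (fun x hx => IJ_deriv J (by linarith [hx.1]))
  have hd : ((n+1:ℕ):ℝ) - n = 1 := by push_cast; ring
  rw [hd, div_one] at h3
  have : IJ J n - IJ J (n+1:ℕ) = Real.log ξ ^ J * (ξ^2)⁻¹ := by linarith
  rw [this]
  unfold g
  push_cast at h2
  have hl := Real.log_natCast_nonneg n
  have hξ : 0 < ξ := by linarith
  have h4 : Real.log n ^ J ≤ Real.log ξ ^ J := by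
    apply pow_le_pow_left₀ hl
    exact Real.log_le_log (by linarith) h1.le
  have h5 : ((n:ℝ)^2)⁻¹ ≤ 4 * (ξ^2)⁻¹ := by
    rw [← div_eq_mul_inv, inv_eq_one_div, div_le_div_iff₀ (by positivity) (by positivity)]
    nlinarith
  rw [div_eq_mul_inv]
  calc _ ≤ Real.log ξ ^ J * (4 * (ξ^2)⁻¹) := by
        apply mul_le_mul h4 h5 (by positivity)
        exact (pow_nonneg hl J).trans h4
    _ = _ := by ring

lemma sum_g_le (J N : ℕ) : ∑ n ∈ Finset.range N, g J n ≤ 4 * J ! := by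
  have h : ∀ N : ℕ, ∑ n ∈ Finset.range (N+1), g J n ≤ 4 * (IJ J 1 - IJ J (N+1:ℕ)) := by
    intro N
    induction N with
    | zero => simp [g_zero]
    | succ N ih =>
      rw [Finset.sum_range_succ]
      have := g_le_IJ J (n := N+1) (by omega)
      linarith
  have h1 := h N
  rw [Finset.sum_range_succ, IJ_one] at h1
  have h2 := g_nonneg J N
  have h3 := IJ_nonneg J (x := (N+1:ℕ)) (by push_cast; linarith [N.cast_nonneg (α := ℝ)])
  linarith

lemma summable_g (J : ℕ) : Summable (g J) := summable_of_sum_range_le (g_nonneg J) (sum_g_le J)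

lemma tsum_g_le (J : ℕ) : ∑' n, g J n ≤ 4 * J ! := Real.tsum_le_of_sum_range_le (g_nonneg J) (sum_g_le J)

lemma pow_sub_le' {a b : ℝ} (ha : 0 ≤ a) (hab : a ≤ b) (J : ℕ) : b^(J+1) - a^(J+1) ≤ (J+1) * (b-a) * b^J := by
  induction J with
  | zero => simp
  | succ J ih =>
    have h2 : a * (b^(J+1) - a^(J+1)) ≤ b * (b^(J+1) - a^(J+1)) := by
      apply mul_le_mul_of_nonneg_right hab
      have := pow_le_pow_left₀ ha hab (J+1)
      linarith
    have h3 : b * (b^(J+1) - a^(J+1)) ≤ b * ((J+1) * (b-a) * b^J) := mul_le_mul_of_nonneg_left ih (ha.trans hab)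
    have h4 : a^(J+1) ≤ b^(J+1) := pow_le_pow_left₀ ha hab (J+1)
    have h5 : (b - a) * a^(J+1) ≤ (b-a) * b^(J+1) := mul_le_mul_of_nonneg_left h4 (by linarith)
    push_cast
    have e1 : b^(J+1+1) - a^(J+1+1) = b * (b^(J+1) - a^(J+1)) + (b-a) * a^(J+1) := by ring
    rw [e1]
    have e2 : b * ((J+1) * (b-a) * b^J) = (J+1) * (b-a) * b^(J+1) := by ring
    linarith

lemma var_g_le (J n : ℕ) : |g (J+1) (n+1) - g (J+1) n| ≤ 40 * (J+1)! / (19/10:ℝ)^(J+1) * ((n+1:ℕ):ℝ)^(-(11/10):ℝ) := by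
  rcases Nat.eq_zero_or_pos n with rfl | hn
  · rw [g_zero]; simp [g]; positivity
  have hn0 : (1:ℝ) ≤ n := by exact_mod_cast hn
  set a := Real.log n with ha
  set b := Real.log (n+1:ℕ) with hb
  have ha0 : 0 ≤ a := Real.log_natCast_nonneg n
  have hab : a ≤ b := Real.log_le_log (by linarith) (by push_cast; linarith)
  have hba : b - a ≤ 1/n := by
    rw [hb, ha, ← Real.log_div (by positivity) (by positivity)]
    refine (Real.log_le_sub_one_of_pos (by positivity)).trans (le_of_eq ?_)
    push_cast; field_simp; ring
  set m : ℝ := ((n+1:ℕ):ℝ) with hm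
  have hmn : m = n + 1 := by rw [hm]; push_cast; ring
  have hm2 : m ≤ 2 * n := by linarith
  have hm0 : 0 < m := by linarith
  have L1 : b^J ≤ J ! / (19/10:ℝ)^J * m^(19/10:ℝ) := log_pow_le (by norm_num) J (by omega)
  have L2 : b^(J+1) ≤ (J+1)! / (19/10:ℝ)^(J+1) * m^(19/10:ℝ) := log_pow_le (by norm_num) (J+1) (by omega)
  have hP := pow_sub_le' ha0 hab J
  have hP0 : a^(J+1) ≤ b^(J+1) := pow_le_pow_left₀ ha0 hab (J+1)
  have hb0 : 0 ≤ b := ha0.trans hab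
  set K : ℝ := (J+1)! / (19/10:ℝ)^(J+1) * m^(19/10:ℝ) with hK
  have hK0 : 0 ≤ K := by positivity
  have L1' : (J+1) * b^J ≤ 2 * K := by
    calc _ ≤ (J+1) * (J ! / (19/10:ℝ)^J * m^(19/10:ℝ)) := by gcongr
      _ = (19/10) * K := by rw [hK, Nat.factorial_succ, pow_succ]; push_cast; field_simp
      _ ≤ _ := by linarith
  have hinv : 1 / (n:ℝ) ≤ 2 / m := by
    rw [div_le_div_iff₀ (by linarith) hm0]; linarith
  have hinv2 : 1/(n:ℝ)^2 ≤ 4 / m^2 := by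
    rw [div_le_div_iff₀ (by positivity) (by positivity)]; nlinarith
  have A1 : (b^(J+1) - a^(J+1)) / n^2 ≤ 16 * K / m^3 := by
    calc _ ≤ ((J+1) * (b-a) * b^J) / n^2 := by gcongr
      _ = ((J+1) * b^J) * (b-a) * (1/(n:ℝ)^2) := by ring
      _ ≤ (2 * K) * (2/m) * (4/m^2) := by
          gcongr
          exact hba.trans hinv
      _ = _ := by field_simp; ring
  have A2 : b^(J+1) * (1/(n:ℝ)^2 - 1/m^2) ≤ 8 * K / m^3 := by
    have h1 : 1/(n:ℝ)^2 - 1/m^2 ≤ 8 / m^3 := by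
      have : 1/(n:ℝ)^2 - 1/m^2 = (2*n+1) * (1/(n:ℝ)^2) * (1/m^2) := by rw [hmn]; field_simp; ring
      rw [this]
      calc _ ≤ (2 * m) * (4/m^2) * (1/m^2) := by
            gcongr
            linarith
        _ = _ := by field_simp; ring
    have h2 : 0 ≤ 1/(n:ℝ)^2 - 1/m^2 := by
      rw [sub_nonneg]; apply one_div_le_one_div_of_le (by positivity); nlinarith
    calc _ ≤ K * (8/m^3) := mul_le_mul L2 h1 h2 hK0
      _ = _ := by ring
  have e : g (J+1) (n+1) - g (J+1) n = (b^(J+1) - a^(J+1)) / n^2 - b^(J+1) * (1/(n:ℝ)^2 - 1/m^2) := by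
    unfold g; ring
  have B1 : 0 ≤ (b^(J+1) - a^(J+1)) / n^2 := div_nonneg (by linarith) (by positivity)
  have B2 : 0 ≤ b^(J+1) * (1/(n:ℝ)^2 - 1/m^2) := by
    apply mul_nonneg (by positivity)
    rw [sub_nonneg]; apply one_div_le_one_div_of_le (by positivity); nlinarith
  have e2 : m^(-(11/10):ℝ) = m^(19/10:ℝ) / m^3 := by
    rw [eq_div_iff (by positivity), ← Real.rpow_natCast m 3, ← Real.rpow_add hm0]; norm_num
  have hfin : 40 * (J+1)! / (19/10:ℝ)^(J+1) * m^(-(11/10):ℝ) = 40 * K / m^3 := by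
    rw [e2, hK]; ring
  rw [hfin, e]
  have : 0 ≤ K/m^3 := by positivity
  rw [abs_le]
  have r1 : 16 * K / m^3 = 16 * (K/m^3) := by ring
  have r2 : 8 * K / m^3 = 8 * (K/m^3) := by ring
  have r3 : 40 * K / m^3 = 40 * (K/m^3) := by ring
  rw [r1] at A1
  rw [r2] at A2
  rw [r3]
  constructor <;> linarith

lemma var_g : ∃ C : ℝ, 0 < C ∧ ∀ J H : ℕ, Summable (fun n => |g (J+1) (n+1+H) - g (J+1) (n+H)|) ∧
    ∑' n, |g (J+1) (n+1+H) - g (J+1) (n+H)| ≤ C * (J+1)! / (19/10:ℝ)^(J+1) := by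
  have hs : Summable fun n : ℕ => ((n+1:ℕ):ℝ)^(-(11/10):ℝ) := (summable_nat_add_iff 1).mpr (summable_rpow (s := 11/10) (by norm_num))
  have h0 : 0 ≤ ∑' n : ℕ, ((n+1:ℕ):ℝ)^(-(11/10):ℝ) := tsum_nonneg fun n => by positivity
  refine ⟨40 * (∑' n : ℕ, ((n+1:ℕ):ℝ)^(-(11/10):ℝ)) + 1, by positivity, fun J H => ?_⟩
  set K : ℝ := 40 * (J+1)! / (19/10:ℝ)^(J+1) with hK
  have hK0 : 0 ≤ K := by positivity
  have hb : ∀ n, |g (J+1) (n+1+H) - g (J+1) (n+H)| ≤ K * ((n+1:ℕ):ℝ)^(-(11/10):ℝ) := by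
    intro n
    rw [show n+1+H = (n+H)+1 by ring]
    refine (var_g_le J (n+H)).trans ?_
    rw [← hK]
    gcongr K * ?_
    apply Real.rpow_le_rpow_of_nonpos (by positivity) _ (by norm_num)
    push_cast; linarith [H.cast_nonneg (α := ℝ)]
  have hsum := Summable.of_nonneg_of_le (fun n => abs_nonneg _) hb (hs.mul_left K)
  refine ⟨hsum, ?_⟩
  refine (hsum.tsum_le_tsum hb (hs.mul_left K)).trans ?_
  rw [tsum_mul_left]
  have : (40 * (∑' n : ℕ, ((n+1:ℕ):ℝ)^(-(11/10):ℝ)) + 1) * (J+1)! / (19/10:ℝ)^(J+1) =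
    K * (∑' n : ℕ, ((n+1:ℕ):ℝ)^(-(11/10):ℝ)) + (J+1)! / (19/10:ℝ)^(J+1) := by rw [hK]; ring
  rw [this]
  have : (0:ℝ) ≤ (J+1)! / (19/10:ℝ)^(J+1) := by positivity
  linarith

lemma abs_sub_le_block (f : ℕ → ℝ) (x D : ℕ) {r r' : ℕ} (hr : r ≤ D) (hr' : r' ≤ D) :
    |f (x + r) - f (x + r')| ≤ ∑ i ∈ Finset.range D, |f (x+i+1) - f (x+i)| := by
  have key : ∀ r r' : ℕ, r ≤ r' → r' ≤ D → |f (x + r') - f (x + r)| ≤ ∑ i ∈ Finset.range D, |f (x+i+1) - f (x+i)| := by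
    intro r r' h1 h2
    have : f (x + r') - f (x+r) = ∑ i ∈ Finset.Ico r r', (f (x+i+1) - f (x+i)) :=
      (Finset.sum_Ico_sub (fun i => f (x+i)) h1).symm
    rw [this]
    refine (Finset.abs_sum_le_sum_abs _ _).trans ?_
    apply Finset.sum_le_sum_of_subset_of_nonneg
    · intro i hi; rw [Finset.mem_Ico] at hi; rw [Finset.mem_range]; omega
    · intros; positivity
  rcases le_total r r' with h | h
  · rw [abs_sub_comm]; exact key _ _ h hr'
  · exact key _ _ h hr

lemma count_ap {f : ℕ → ℝ} (hf : Summable f) (hv : Summable fun n => |f (n+1) - f n|) {D : ℕ} [NeZero D] (a : ZMod D) :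
    |(∑' n : ℕ, if (n : ZMod D) = a then f n else 0) - (∑' n, f n) / D| ≤ ∑' n, |f (n+1) - f n| := by
  have hD0 : 0 < D := Nat.pos_of_ne_zero (NeZero.ne D)
  have hD : (0:ℝ) < D := by exact_mod_cast hD0
  set v : ℕ → ℝ := fun n => |f (n+1) - f n| with hvd
  have inj : ∀ r : ℕ, Function.Injective fun m : ℕ => r + D * m := fun r m m' h => by
    simp only [add_right_inj] at h; exact Nat.eq_of_mul_eq_mul_left hD0 h
  have sub : ∀ {u : ℕ → ℝ}, Summable u → ∀ r : ℕ, Summable fun m => u (r + D * m) := fun hu r => hu.comp_injective (inj r)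
  have hi : Summable fun n : ℕ => if (n : ZMod D) = a then f n else 0 := by
    apply Summable.of_norm_bounded hf.norm
    intro n; split_ifs
    · exact le_rfl
    · simp
  rw [Nat.sumByResidueClasses hi D, Nat.sumByResidueClasses hf D, Nat.sumByResidueClasses hv D]
  have hval : ∀ (r : ZMod D) (m : ℕ), ((r.val + D * m : ℕ) : ZMod D) = r := by
    intro r m; push_cast; simp
  have e1 : ∑ r : ZMod D, ∑' m : ℕ, (if ((r.val + D * m : ℕ) : ZMod D) = a then f (r.val + D * m) else 0) =
      ∑' m : ℕ, f (a.val + D * m) := by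
    rw [Finset.sum_eq_single a]
    · simp [hval]
    · intro r _ hr
      simp [hval, hr]
    · simp
  rw [e1]
  have e2 : (∑' m : ℕ, f (a.val + D * m)) - (∑ r : ZMod D, ∑' m : ℕ, f (r.val + D * m)) / D =
      (∑ r : ZMod D, (∑' m : ℕ, f (a.val + D * m) - ∑' m : ℕ, f (r.val + D * m))) / D := by
    rw [Finset.sum_sub_distrib, Finset.sum_const, Finset.card_univ, ZMod.card, nsmul_eq_mul]
    field_simp
  rw [e2, abs_div, abs_of_pos hD, div_le_iff₀ hD]
  refine (Finset.abs_sum_le_sum_abs _ _).trans ?_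
  have hb : ∀ r : ZMod D, |∑' m : ℕ, f (a.val + D * m) - ∑' m : ℕ, f (r.val + D * m)| ≤
      ∑ s : ZMod D, ∑' m : ℕ, v (s.val + D * m) := by
    intro r
    rw [← (sub hf a.val).tsum_sub (sub hf r.val)]
    rw [← Summable.tsum_finsetSum (fun s _ => sub hv _)]
    have hS : Summable fun m => ∑ s : ZMod D, v (s.val + D * m) := summable_sum fun s _ => sub hv _
    rw [← Real.norm_eq_abs]
    apply tsum_of_norm_bounded hS.hasSum
    intro m
    have := abs_sub_le_block f (D*m) D (r := a.val) (r' := r.val) (ZMod.val_lt a).le (ZMod.val_lt r).le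
    rw [Real.norm_eq_abs, add_comm a.val, add_comm r.val]
    refine this.trans (le_of_eq ?_)
    have hbij : ∑ s : ZMod D, v (s.val + D * m) = ∑ i ∈ Finset.range D, v (i + D * m) := by
      apply Finset.sum_bij (fun (s : ZMod D) _ => s.val)
      · intro s _; rw [Finset.mem_range]; exact ZMod.val_lt s
      · intro s _ t _ h; exact ZMod.val_injective D h
      · intro i hi
        rw [Finset.mem_range] at hi
        exact ⟨(i : ZMod D), Finset.mem_univ _, ZMod.val_cast_of_lt hi⟩
      · intros; rfl
    rw [hbij]
    apply Finset.sum_congr rfl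
    intro i _
    rw [hvd]
    simp only
    rw [add_comm i (D*m)]
  refine (Finset.sum_le_sum fun r _ => hb r).trans ?_
  rw [Finset.sum_const, Finset.card_univ, ZMod.card, nsmul_eq_mul, mul_comm]
end Pf
end

section
open Complex Filter Topology MeasureTheory
open ArithmeticFunction (vonMangoldt)
open scoped Nat
set_option linter.unusedSectionVars false
set_option linter.unusedVariables false
namespace Pf

/-- tensor power of a quadratic form inequality -/
def TensorLe (X Y Z : Type) [Fintype X] [Fintype Y] [Fintype Z] (ι : Type) [Fintype ι] : Prop :=
    ∀ (_ : DecidableEq ι) (μ : ι → Y → ℝ) (e : ι → X → Y → ℝ) (d : ι → Z → ℝ) (K : ι → X → Z → ℝ),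
    (∀ i y, 0 ≤ μ i y) → (∀ i z, 0 ≤ d i z) →
    (∀ i (a : X → ℝ), ∑ y, μ i y * (∑ x, a x * e i x y)^2 ≤ ∑ z, d i z * (∑ x, a x * K i x z)^2) →
    ∀ u : (ι → X) → ℝ,
    ∑ y : ι → Y, (∏ i, μ i (y i)) * (∑ c : ι → X, u c * ∏ i, e i (c i) (y i))^2 ≤
    ∑ z : ι → Z, (∏ i, d i (z i)) * (∑ c : ι → X, u c * ∏ i, K i (c i) (z i))^2

lemma tensor_le {X Y Z : Type} [Fintype X] [Fintype Y] [Fintype Z] (ι : Type) [Fintype ι] : TensorLe X Y Z ι := by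
  refine Fintype.induction_empty_option (P := fun ι _ => TensorLe X Y Z ι) ?_ ?_ ?_ ι
  · intro α β inst ev ih
    let _ : Fintype α := Fintype.ofEquiv β ev.symm
    have dα : DecidableEq α := Classical.decEq α
    intro _ μ e d K hμ hd h u
    have := ih dα (fun i => μ (ev i)) (fun i => e (ev i)) (fun i => d (ev i)) (fun i => K (ev i)) (fun i y => hμ _ _)
      (fun i y => hd _ _) (fun i a => h _ a) (fun c => u (fun b => c (ev.symm b)))
    have tr : ∀ (A : Type) [Fintype A] (F : (β → A) → ℝ), ∑ c : β → A, F c = ∑ c : α → A, F (fun b => c (ev.symm b)) := by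
      intro A _ F
      exact (Fintype.sum_equiv (Equiv.arrowCongr ev (Equiv.refl A)) _ _ (fun c => rfl)).symm
    have pr : ∀ F : β → ℝ, ∏ b, F b = ∏ a, F (ev a) := fun F => (Fintype.prod_equiv ev _ _ (fun a => rfl)).symm
    rw [tr Y, tr Z]
    simp only [tr X, pr, Equiv.symm_apply_apply]
    exact this
  · intro _ μ e d K _ _ _ u
    simp
  · intro α inst0 ih inst μ e d K hμ hd h u
    have : DecidableEq α := Classical.decEq α
    have tr : ∀ (A : Type) [Fintype A] (F : (Option α → A) → ℝ), ∑ c : Option α → A, F c =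
        ∑ a : A, ∑ c : α → A, F (fun o => o.elim a c) := by
      intro A _ F
      rw [← Fintype.sum_prod_type' (f := fun a c => F (fun o => o.elim a c))]
      apply Fintype.sum_equiv (Equiv.piOptionEquivProd (β := fun _ => A))
      intro c
      congr 1
      ext o
      cases o <;> rfl
    rw [tr Y, tr Z]
    simp only [tr X, Fintype.prod_option, Option.elim]
    have ih' := ih this (fun i => μ (some i)) (fun i => e (some i)) (fun i => d (some i)) (fun i => K (some i))
      (fun i y => hμ _ _) (fun i z => hd _ _) (fun i a => h _ a)
    set u' : X → (α → X) → ℝ := fun x c => u (fun o => o.elim x c) with hu'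
    calc ∑ y0 : Y, ∑ y : α → Y, (μ none y0 * ∏ i, μ (some i) (y i)) *
          (∑ x, ∑ c : α → X, u' x c * (e none x y0 * ∏ i, e (some i) (c i) (y i)))^2
        = ∑ y0 : Y, μ none y0 * ∑ y : α → Y, (∏ i, μ (some i) (y i)) *
          (∑ c : α → X, (∑ x, u' x c * e none x y0) * ∏ i, e (some i) (c i) (y i))^2 := by
          apply Finset.sum_congr rfl; intro y0 _
          rw [Finset.mul_sum]
          apply Finset.sum_congr rfl; intro y _
          rw [Finset.sum_comm, mul_assoc]
          congr 3
          apply Finset.sum_congr rfl; intro c _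
          rw [Finset.sum_mul]
          apply Finset.sum_congr rfl; intro x _
          ring
      _ ≤ ∑ y0 : Y, μ none y0 * ∑ z : α → Z, (∏ i, d (some i) (z i)) *
          (∑ c : α → X, (∑ x, u' x c * e none x y0) * ∏ i, K (some i) (c i) (z i))^2 := by
          apply Finset.sum_le_sum; intro y0 _
          exact mul_le_mul_of_nonneg_left (ih' _) (hμ _ _)
      _ = ∑ z : α → Z, (∏ i, d (some i) (z i)) * ∑ y0 : Y, μ none y0 *
          (∑ x, (∑ c : α → X, u' x c * ∏ i, K (some i) (c i) (z i)) * e none x y0)^2 := by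
          simp only [Finset.mul_sum]
          rw [Finset.sum_comm]
          apply Finset.sum_congr rfl; intro z _
          apply Finset.sum_congr rfl; intro y0 _
          rw [mul_left_comm]
          congr 3
          simp only [Finset.sum_mul]
          rw [Finset.sum_comm]
          apply Finset.sum_congr rfl; intro x _
          apply Finset.sum_congr rfl; intro c _
          ring
      _ ≤ ∑ z : α → Z, (∏ i, d (some i) (z i)) * ∑ z0 : Z, d none z0 *
          (∑ x, (∑ c : α → X, u' x c * ∏ i, K (some i) (c i) (z i)) * K none x z0)^2 := by
          apply Finset.sum_le_sum; intro z _
          exact mul_le_mul_of_nonneg_left (h _ _) (Finset.prod_nonneg fun i _ => hd _ _)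
      _ = _ := by
          simp only [Finset.mul_sum]
          rw [Finset.sum_comm]
          apply Finset.sum_congr rfl; intro z0 _
          apply Finset.sum_congr rfl; intro z _
          rw [← mul_assoc, mul_comm (∏ i, d (some i) (z i))]
          congr 2
          apply Finset.sum_congr rfl; intro x _
          simp only [Finset.sum_mul]
          apply Finset.sum_congr rfl; intro c _
          change _ = u' x c * (K none x z0 * ∏ i, K (some i) (c i) (z i))
          ring

section sieve
variable {ι : Type} [Fintype ι] [DecidableEq ι] {k : ℕ}

/-- the basic local functions -/
noncomputable def ev (t : ℝ) (x y : Option (Fin k)) : ℝ :=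
  match x with
  | none => 1
  | some i => (if y = some i then 1 else 0) - t

/-- the sieve function -/
noncomputable def Phi (t : ι → ℝ) (u : (ι → Option (Fin k)) → ℝ) (y : ι → Option (Fin k)) : ℝ :=
  ∑ c, u c * ∏ p, ev (t p) (c p) (y p)

/-- the change of basis -/
noncomputable def Tm (t : ℝ) (x z : Option (Fin k)) : ℝ :=
  if x = z then 1 else if z = none then -t else 0

/-- local indicator -/
noncomputable def li (z y : Option (Fin k)) : ℝ := if z = none ∨ z = y then 1 else 0

lemma li_nonneg (z y : Option (Fin k)) : 0 ≤ li z y := by unfold li; split_ifs <;> norm_num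
lemma li_le_one (z y : Option (Fin k)) : li z y ≤ 1 := by unfold li; split_ifs <;> norm_num

lemma ev_eq (t : ℝ) (x y : Option (Fin k)) : ev t x y = ∑ z, Tm t x z * li z y := by
  rw [Fintype.sum_option]
  cases x with
  | none =>
    simp [ev, Tm, li]
  | some i =>
    rw [Finset.sum_eq_single i]
    · simp [ev, Tm, li, eq_comm (a := y)]; ring
    · intro j _ hj
      have : i ≠ j := Ne.symm hj
      simp [Tm, this]
    · simp

/-- sieve weights -/
noncomputable def lam (t : ι → ℝ) (u : (ι → Option (Fin k)) → ℝ) (z : ι → Option (Fin k)) : ℝ :=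
  ∑ c, u c * ∏ p, Tm (t p) (c p) (z p)

/-- global indicator -/
noncomputable def gi (z y : ι → Option (Fin k)) : ℝ := ∏ p, li (z p) (y p)

lemma gi_nonneg (z y : ι → Option (Fin k)) : 0 ≤ gi z y := Finset.prod_nonneg fun p _ => li_nonneg _ _
lemma gi_le_one (z y : ι → Option (Fin k)) : gi z y ≤ 1 := Finset.prod_le_one (fun p _ => li_nonneg _ _) (fun p _ => li_le_one _ _)

lemma Phi_eq (t : ι → ℝ) (u : (ι → Option (Fin k)) → ℝ) (y : ι → Option (Fin k)) :
    Phi t u y = ∑ z, lam t u z * gi z y := by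
  unfold Phi lam gi
  simp only [ev_eq, Finset.prod_univ_sum, Fintype.piFinset_univ, Finset.sum_mul, Finset.mul_sum]
  rw [Finset.sum_comm]
  apply Finset.sum_congr rfl; intro z _
  apply Finset.sum_congr rfl; intro c _
  rw [Finset.prod_mul_distrib]; ring

/-- compatibility of colourings -/
def compat (c c' : ι → Option (Fin k)) : Prop := ∀ p, c p = none ∨ c' p = none ∨ c p = c' p

/-- join of colourings -/
def jn (c c' : ι → Option (Fin k)) : ι → Option (Fin k) := fun p => (c p).elim (c' p) some

lemma li_mul {x x' y : Option (Fin k)} (h : x = none ∨ x' = none ∨ x = x') :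
    li x y * li x' y = li (x.elim x' some) y := by
  unfold li
  rcases x with _ | i <;> rcases x' with _ | i' <;> simp at h ⊢
  subst h
  tauto

lemma gi_mul {c c' : ι → Option (Fin k)} (h : compat c c') (y : ι → Option (Fin k)) : gi c y * gi c' y = gi (jn c c') y := by
  unfold gi jn
  rw [← Finset.prod_mul_distrib]
  exact Finset.prod_congr rfl fun p _ => li_mul (h p)

lemma gi_mul_zero {c c' : ι → Option (Fin k)} (h : ¬ compat c c') (y : ι → Option (Fin k)) : gi c y * gi c' y = 0 := by
  unfold compat at h
  push Not at h
  obtain ⟨p, h1, h2, h3⟩ := h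
  unfold gi
  rw [← Finset.prod_mul_distrib]
  apply Finset.prod_eq_zero (Finset.mem_univ p)
  unfold li
  by_cases h4 : c p = y p
  · rw [if_neg (c := c' p = none ∨ c' p = y p)]
    · simp
    · rintro (h | h)
      · exact h2 h
      · exact h3 (h4.trans h.symm)
  · rw [if_neg (by tauto)]; simp

/-- product density of a colouring -/
noncomputable def nu (α : ι → Fin k → ℝ) (d : ι → Option (Fin k)) : ℝ := ∏ p, (d p).elim 1 (α p)

/-- product probability -/
noncomputable def pm (α : ι → Fin k → ℝ) (p : ι) (y : Option (Fin k)) : ℝ := y.elim (1 - ∑ i, α p i) (α p)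

lemma nu_eq (α : ι → Fin k → ℝ) (d : ι → Option (Fin k)) : ∑ y : ι → Option (Fin k), (∏ p, pm α p (y p)) * gi d y = nu α d := by
  unfold gi nu
  simp only [← Finset.prod_mul_distrib]
  rw [← Fintype.piFinset_univ, ← Finset.prod_univ_sum (fun _ => Finset.univ) (fun p y => pm α p y * li (d p) y)]
  apply Finset.prod_congr rfl; intro p _
  rw [Fintype.sum_option]
  rcases d p with _ | i
  · simp [pm, li]
  · simp [pm, li]

open Classical in
theorem transfer (t : ι → ℝ) (u : (ι → Option (Fin k)) → ℝ) (α : ι → Fin k → ℝ) {w : ℕ → ℝ} (hw : Summable w)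
    (y : ℕ → ι → Option (Fin k)) (M : ℝ) (Er : (ι → Option (Fin k)) → ℝ)
    (hE : ∀ d, |∑' n, w n * gi d (y n) - M * nu α d| ≤ Er d) :
    |∑' n, w n * Phi t u (y n)^2 - M * ∑ y, (∏ p, pm α p (y p)) * Phi t u y ^2| ≤
      ∑ c, ∑ c', |lam t u c| * |lam t u c'| * if compat c c' then Er (jn c c') else 0 := by
  have hs : ∀ d, Summable fun n => w n * gi d (y n) := by
    intro d
    apply Summable.of_norm_bounded hw.norm
    intro n
    rw [norm_mul, Real.norm_of_nonneg (gi_nonneg _ _)]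
    exact mul_le_of_le_one_right (norm_nonneg _) (gi_le_one _ _)
  have hsq : ∀ y, Phi t u y ^ 2 = ∑ c, ∑ c', (lam t u c * lam t u c') * if compat c c' then gi (jn c c') y else 0 := by
    intro y
    rw [Phi_eq, sq, Finset.sum_mul_sum]
    apply Finset.sum_congr rfl; intro c _
    apply Finset.sum_congr rfl; intro c' _
    split_ifs with h
    · rw [← gi_mul h]; ring
    · have := gi_mul_zero h y
      rw [mul_zero]
      calc _ = lam t u c * lam t u c' * (gi c y * gi c' y) := by ring
        _ = 0 := by rw [this, mul_zero]
  have e1 : ∑' n, w n * Phi t u (y n)^2 = ∑ c, ∑ c', (lam t u c * lam t u c') * if compat c c' then ∑' n, w n * gi (jn c c') (y n) else 0 := by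
    simp only [hsq, Finset.mul_sum]
    have hs2 : ∀ c c', Summable fun n => w n * ((lam t u c * lam t u c') * if compat c c' then gi (jn c c') (y n) else 0) := by
      intro c c'
      split_ifs with h
      · have := (hs (jn c c')).mul_left (lam t u c * lam t u c')
        refine this.congr fun n => by ring
      · simp
    rw [Summable.tsum_finsetSum (fun c _ => summable_sum fun c' _ => hs2 c c')]
    apply Finset.sum_congr rfl; intro c _
    rw [Summable.tsum_finsetSum (fun c' _ => hs2 c c')]
    apply Finset.sum_congr rfl; intro c' _
    split_ifs with h
    · rw [← tsum_mul_left]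
      apply tsum_congr; intro n; ring
    · simp
  have e2 : M * ∑ y, (∏ p, pm α p (y p)) * Phi t u y ^2 = ∑ c, ∑ c', (lam t u c * lam t u c') * if compat c c' then M * nu α (jn c c') else 0 := by
    simp only [hsq, Finset.mul_sum]
    rw [Finset.sum_comm]
    apply Finset.sum_congr rfl; intro c _
    rw [Finset.sum_comm]
    apply Finset.sum_congr rfl; intro c' _
    split_ifs with h
    · rw [← nu_eq, Finset.mul_sum, Finset.mul_sum]
      apply Finset.sum_congr rfl; intro y _; ring
    · simp
  rw [e1, e2, ← Finset.sum_sub_distrib]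
  refine (Finset.abs_sum_le_sum_abs _ _).trans (Finset.sum_le_sum fun c _ => ?_)
  rw [← Finset.sum_sub_distrib]
  refine (Finset.abs_sum_le_sum_abs _ _).trans (Finset.sum_le_sum fun c' _ => ?_)
  rw [← mul_sub, abs_mul, abs_mul]
  split_ifs with h
  · exact mul_le_mul_of_nonneg_left (hE _) (by positivity)
  · simp

end sieve
end Pf
end

section
open Complex Filter Topology MeasureTheory
open scoped Nat
set_option linter.unusedSectionVars false
set_option linter.unusedVariables false
namespace Pf
section sieve
variable {ι : Type} [Fintype ι] [DecidableEq ι] {k : ℕ}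

lemma local_eq (t : ℝ) (α : Fin k → ℝ) (a : Option (Fin k) → ℝ) :
    ∑ y, (y.elim (1 - ∑ i, α i) α : ℝ) * (∑ x, a x * ev t x y)^2 =
    (a none - t * ∑ i, a (some i))^2 + 2 * (a none - t * ∑ i, a (some i)) * ∑ i, α i * a (some i) + ∑ i, α i * a (some i)^2 := by
  set A := a none - t * ∑ i, a (some i) with hA
  have h0 : ∑ x, a x * ev t x none = A := by
    rw [Fintype.sum_option, hA]
    simp [ev, Finset.mul_sum, Finset.sum_neg_distrib, mul_comm]
    ring
  have h1 : ∀ i, ∑ x, a x * ev t x (some i) = A + a (some i) := by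
    intro i
    rw [Fintype.sum_option, hA]
    simp [ev, Finset.mul_sum, mul_comm]
    simp only [sub_mul]
    rw [Finset.sum_sub_distrib]
    simp
    ring
  rw [Fintype.sum_option]
  simp only [h0, h1, Option.elim]
  have : ∑ i, α i * (A + a (some i))^2 = (∑ i, α i) * A^2 + 2 * A * ∑ i, α i * a (some i) + ∑ i, α i * a (some i)^2 := by
    rw [Finset.sum_mul, Finset.mul_sum, ← Finset.sum_add_distrib, ← Finset.sum_add_distrib]
    apply Finset.sum_congr rfl; intro i _; ring
  rw [this]; ring

lemma local_upper {p : ℝ} (hp : 2 ≤ p) (a : Option (Fin k) → ℝ) :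
    ∑ y, (y.elim (1 - ∑ i : Fin k, 1/p) (fun _ : Fin k => 1/p) : ℝ) * (∑ x, a x * ev (1/(p-1)) x y)^2 ≤
    (1 + k/(p*(p-1))) * a none^2 + (1/(p-1)) * ∑ i, a (some i)^2 := by
  rw [local_eq]
  simp only [← Finset.mul_sum]
  set σ := ∑ i, a (some i) with hσ
  set s2 := ∑ i, a (some i)^2 with hs2
  set a0 := a none
  have h1 : 0 ≤ k * a0^2 + 2 * a0 * σ + s2 := by
    have : ∑ i : Fin k, (a0 + a (some i))^2 = k * a0^2 + 2 * a0 * σ + s2 := by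
      rw [hσ, hs2, Finset.mul_sum]
      rw [show (k:ℝ) * a0^2 = ∑ i : Fin k, a0^2 by simp, ← Finset.sum_add_distrib, ← Finset.sum_add_distrib]
      apply Finset.sum_congr rfl; intro i _; ring
    rw [← this]; exact Finset.sum_nonneg fun i _ => sq_nonneg _
  have hp0 : 0 < p := by linarith
  have hp1 : 0 < p - 1 := by linarith
  have key : (1 + k/(p*(p-1))) * a0^2 + (1/(p-1)) * s2 - ((a0 - 1/(p-1) * σ)^2 + 2 * (a0 - 1/(p-1)*σ) * (1/p * σ) + 1/p * s2)
      = (k * a0^2 + 2 * a0 * σ + s2) / (p*(p-1)) + (p-2)/(p*(p-1)^2) * σ^2 := by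
    field_simp; ring
  have h2 : 0 ≤ (k * a0^2 + 2 * a0 * σ + s2) / (p*(p-1)) := by positivity
  have h3 : 0 ≤ (p-2)/(p*(p-1)^2) * σ^2 := by
    have : 0 ≤ p - 2 := by linarith
    positivity
  linarith

/-- local projection for the prime sum -/
noncomputable def Kp (m : Fin k) (t : ℝ) (x z : Option (Fin k)) : ℝ :=
  match z with
  | none => if x = none then 1 else if x = some m then -t else 0
  | some i => if x = some i then 1 else 0

/-- local weights for the prime sum -/
noncomputable def dp (m : Fin k) (t : ℝ) (z : Option (Fin k)) : ℝ :=
  z.elim 1 (fun i => if i = m then 0 else t * (1 - k * t))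

lemma local_lower (m : Fin k) {t : ℝ} (ht : 0 ≤ t) (a : Option (Fin k) → ℝ) :
    ∑ z, dp m t z * (∑ x, a x * Kp m t x z)^2 ≤
    ∑ y, (y.elim (1 - ∑ i : Fin k, if i = m then 0 else t) (fun i : Fin k => if i = m then 0 else t) : ℝ) * (∑ x, a x * ev t x y)^2 := by
  rw [local_eq]
  rw [Fintype.sum_option]
  set a' : Fin k → ℝ := fun i => if i = m then 0 else a (some i) with ha'
  have e1 : ∑ i, a (some i) = a (some m) + ∑ i, a' i := by
    have : ∀ i, a (some i) = (if i = m then a (some m) else 0) + a' i := by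
      intro i; simp only [ha']; split_ifs with h
      · rw [h]; simp
      · simp
    rw [Finset.sum_congr rfl fun i _ => this i, Finset.sum_add_distrib]; simp
  have e2 : ∑ i, (if i = m then 0 else t) * a (some i) = t * ∑ i, a' i := by
    rw [Finset.mul_sum]; apply Finset.sum_congr rfl; intro i _; simp only [ha']; split_ifs <;> simp
  have e3 : ∑ i, (if i = m then 0 else t) * a (some i)^2 = t * ∑ i, a' i^2 := by
    rw [Finset.mul_sum]; apply Finset.sum_congr rfl; intro i _; simp only [ha']; split_ifs <;> simp
  have e4 : ∑ x, a x * Kp m t x none = a none - t * a (some m) := by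
    rw [Fintype.sum_option]; simp [Kp]; ring
  have e5 : ∀ i, ∑ x, a x * Kp m t x (some i) = a (some i) := by
    intro i; simp [Kp]
  have e6 : ∑ i, dp m t (some i) * (a (some i))^2 = t * (1 - k*t) * ∑ i, a' i^2 := by
    rw [Finset.mul_sum]; apply Finset.sum_congr rfl; intro i _; simp only [ha', dp, Option.elim]; split_ifs <;> simp
  rw [e1, e2, e3, e4]
  simp only [e5]
  rw [e6]
  have cs : (∑ i, a' i)^2 ≤ k * ∑ i, a' i^2 := by
    have := sq_sum_le_card_mul_sum_sq (s := (Finset.univ : Finset (Fin k))) (f := a')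
    simpa using this
  simp only [dp, Option.elim, one_mul]
  have := mul_le_mul_of_nonneg_left cs (sq_nonneg t)
  nlinarith

/-- fibre of a colouring -/
def fib (c : ι → Option (Fin k)) (i : Fin k) : Finset ι := Finset.univ.filter fun p => c p = some i

lemma mem_fib {c : ι → Option (Fin k)} {i : Fin k} {p : ι} : p ∈ fib c i ↔ c p = some i := by simp [fib]

lemma fib_inj : Function.Injective (fib : (ι → Option (Fin k)) → Fin k → Finset ι) := by
  intro c c' h
  ext p i
  have := congrFun h i
  have h2 : p ∈ fib c i ↔ p ∈ fib c' i := by rw [this]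
  rw [mem_fib, mem_fib] at h2
  exact h2

lemma sum_fib (c : ι → Option (Fin k)) (h : ι → ℝ) : ∑ i, ∑ p ∈ fib c i, h p = ∑ p, (c p).elim 0 (fun _ => h p) := by
  simp only [fib, Finset.sum_filter]
  rw [Finset.sum_comm]
  apply Finset.sum_congr rfl; intro p _
  cases c p <;> simp

lemma prod_fib (c : ι → Option (Fin k)) (h : ι → ℝ) : ∏ i, ∏ p ∈ fib c i, h p = ∏ p, (c p).elim 1 (fun _ => h p) := by
  simp only [fib, Finset.prod_filter]
  rw [Finset.prod_comm]
  apply Finset.prod_congr rfl; intro p _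
  cases c p <;> simp

/-- the sieve coefficients -/
noncomputable def uu (lg : ι → ℝ) (f : ℝ → ℝ) (L : ℝ) (c : ι → Option (Fin k)) : ℝ :=
  (∏ p, (c p).elim 1 (fun _ => -1)) * (∏ i, f (∑ p ∈ fib c i, lg p)) *
    if ∑ p, (c p).elim 0 (fun _ => lg p) ≤ L then 1 else 0

lemma sq_sign (c : ι → Option (Fin k)) : (∏ p, ((c p).elim 1 (fun _ => -1) : ℝ))^2 = 1 := by
  rw [← Finset.prod_pow]
  apply Finset.prod_eq_one; intro p _
  cases c p <;> simp

lemma uu_sq_le (lg : ι → ℝ) (f : ℝ → ℝ) (L : ℝ) (c : ι → Option (Fin k)) :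
    uu lg f L c ^2 ≤ ∏ i, f (∑ p ∈ fib c i, lg p)^2 := by
  unfold uu
  rw [mul_pow, mul_pow, sq_sign, one_mul, Finset.prod_pow]
  apply mul_le_of_le_one_right (sq_nonneg _)
  split_ifs <;> norm_num

/-- sum over subsets -/
noncomputable def SX (t lg : ι → ℝ) (h : ℝ → ℝ) : ℝ := ∑ S : Finset ι, h (∑ p ∈ S, lg p) * ∏ p ∈ S, t p

lemma sum_fib_le {G : Fin k → Finset ι → ℝ} (hG : ∀ i S, 0 ≤ G i S) :
    ∑ c : ι → Option (Fin k), ∏ i, G i (fib c i) ≤ ∏ i, ∑ S, G i S := by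
  rw [Finset.prod_univ_sum, Fintype.piFinset_univ]
  calc _ = ∑ T ∈ Finset.univ.image (fib : (ι → Option (Fin k)) → Fin k → Finset ι), ∏ i, G i (T i) := by
        rw [Finset.sum_image (fun x _ y _ h => fib_inj h)]
    _ ≤ _ := Finset.sum_le_sum_of_subset_of_nonneg (Finset.subset_univ _) (fun T _ _ => Finset.prod_nonneg fun i _ => hG _ _)

lemma sieve_upper {q : ι → ℝ} (hq : ∀ p, 2 ≤ q p) (hk : ∀ p, k ≤ q p) (lg : ι → ℝ) (f : ℝ → ℝ) (L : ℝ) :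
    ∑ y : ι → Option (Fin k), (∏ p, pm (fun p _ => 1/q p) p (y p)) * Phi (fun p => 1/(q p - 1)) (uu lg f L) y ^2 ≤
    (∏ p, (1 + k/(q p*(q p-1)))) * SX (fun p => 1/(q p - 1)) lg (fun x => f x^2) ^ k := by
  set d : ι → Option (Fin k) → ℝ := fun p z => z.elim (1 + k/(q p*(q p-1))) (fun _ => 1/(q p-1)) with hd
  have hq1 : ∀ p, 0 < q p - 1 := fun p => by linarith [hq p]
  have hq0 : ∀ p, 0 < q p := fun p => by linarith [hq p]
  have hd0 : ∀ p z, 0 ≤ d p z := by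
    intro p z; have := hq1 p; have := hq0 p
    cases z <;> simp only [hd, Option.elim] <;> positivity
  have h1 := tensor_le (X := Option (Fin k)) (Y := Option (Fin k)) (Z := Option (Fin k)) ι inferInstance
    (fun p y => pm (fun p _ => 1/q p) p y) (fun p x y => ev (1/(q p-1)) x y) d (fun p x z => if x = z then 1 else 0)
    (by
      intro p y
      have := hq0 p
      cases y with
      | none =>
        simp only [pm, Option.elim]
        simp
        rw [← div_eq_mul_inv]
        exact (div_le_one this).mpr (hk p)
      | some i => simp only [pm, Option.elim]; positivity) hd0
    (by
      intro p a
      refine (local_upper (hq p) a).trans (le_of_eq ?_)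
      rw [Fintype.sum_option]
      simp [hd, Finset.mul_sum])
    (uu lg f L)
  refine h1.trans ?_
  have h2 : ∀ z : ι → Option (Fin k), ∑ c : ι → Option (Fin k), uu lg f L c * ∏ p, (if c p = z p then (1:ℝ) else 0) = uu lg f L z := by
    intro z
    rw [Finset.sum_eq_single z]
    · simp
    · intro c _ hc
      obtain ⟨p, hp⟩ := Function.ne_iff.mp hc
      rw [Finset.prod_eq_zero (Finset.mem_univ p) (by rw [if_neg hp]), mul_zero]
    · simp
  simp only [h2]
  have h3 : ∀ z : ι → Option (Fin k), (∏ p, d p (z p)) * uu lg f L z^2 ≤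
      (∏ p, (1 + k/(q p*(q p-1)))) * ∏ i, (f (∑ p ∈ fib z i, lg p)^2 * ∏ p ∈ fib z i, (1/(q p-1))) := by
    intro z
    rw [Finset.prod_mul_distrib, prod_fib]
    have : ∏ p, d p (z p) ≤ (∏ p, (1 + k/(q p*(q p-1)))) * ∏ p, (z p).elim 1 (fun _ => 1/(q p-1)) := by
      rw [← Finset.prod_mul_distrib]
      apply Finset.prod_le_prod (fun p _ => hd0 _ _)
      intro p _
      have := hq1 p; have := hq0 p
      cases z p <;> simp only [hd, Option.elim]
      · simp
      · apply le_mul_of_one_le_left (by positivity)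
        have : 0 ≤ k/(q p*(q p-1)) := by positivity
        linarith
    calc _ ≤ ((∏ p, (1 + k/(q p*(q p-1)))) * ∏ p, (z p).elim 1 (fun _ => 1/(q p-1))) * ∏ i, f (∑ p ∈ fib z i, lg p)^2 := by
          apply mul_le_mul this (uu_sq_le _ _ _ _) (sq_nonneg _)
          exact (Finset.prod_nonneg fun p _ => hd0 _ _).trans this
      _ = _ := by ring
  refine (Finset.sum_le_sum fun z _ => h3 z).trans ?_
  rw [← Finset.mul_sum]
  apply mul_le_mul_of_nonneg_left
  · refine (sum_fib_le (G := fun _ S => f (∑ p ∈ S, lg p)^2 * ∏ p ∈ S, (1/(q p-1))) ?_).trans ?_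
    · intro i S
      exact mul_nonneg (sq_nonneg _) (Finset.prod_nonneg fun p _ => by have := hq1 p; positivity)
    · simp [SX]
  · exact Finset.prod_nonneg fun p _ => by have := hq1 p; have := hq0 p; positivity

/-- removing an element -/
lemma erase_bound {t lg : ι → ℝ} (ht : ∀ p, 0 ≤ t p) (hlg : ∀ p, 0 ≤ lg p) {h : ℝ → ℝ} (h0 : ∀ x, 0 ≤ h x) (ha : Antitone h) (p : ι) :
    ∑ S : Finset ι, (if p ∈ S then h (∑ p ∈ S, lg p) * ∏ p ∈ S, t p else 0) ≤ t p * SX t lg h := by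
  rw [← Finset.sum_filter]
  unfold SX
  rw [Finset.mul_sum]
  calc _ ≤ ∑ S ∈ Finset.univ.filter (fun S : Finset ι => p ∈ S), t p * (h (∑ p ∈ S.erase p, lg p) * ∏ p ∈ S.erase p, t p) := by
        apply Finset.sum_le_sum
        intro S hS
        rw [Finset.mem_filter] at hS
        rw [← Finset.mul_prod_erase S t hS.2]
        have h1 : h (∑ p ∈ S, lg p) ≤ h (∑ p ∈ S.erase p, lg p) := by
          apply ha
          rw [← Finset.add_sum_erase S lg hS.2]
          linarith [hlg p]
        have h2 : 0 ≤ ∏ p ∈ S.erase p, t p := Finset.prod_nonneg fun p _ => ht p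
        have h3 := mul_le_mul_of_nonneg_right h1 (mul_nonneg (ht p) h2)
        linarith
    _ = ∑ S ∈ (Finset.univ.filter (fun S : Finset ι => p ∈ S)).image (fun S => S.erase p), t p * (h (∑ p ∈ S, lg p) * ∏ p ∈ S, t p) := by
        rw [Finset.sum_image]
        intro S hS S' hS' e
        simp at hS hS' e
        rw [← Finset.insert_erase hS, ← Finset.insert_erase hS', e]
    _ ≤ _ := by
        apply Finset.sum_le_sum_of_subset_of_nonneg (Finset.subset_univ _)
        intro S _ _
        exact mul_nonneg (ht p) (mul_nonneg (h0 _) (Finset.prod_nonneg fun p _ => ht p))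

end sieve
end Pf
end

section
open Complex Filter Topology MeasureTheory
open scoped Nat
set_option linter.unusedSectionVars false
set_option linter.unusedVariables false
namespace Pf
section sieve
variable {ι : Type} [Fintype ι] [DecidableEq ι] {k : ℕ}

lemma expect {G ph : Fin k → Finset ι → ℝ} (hG : ∀ i S, 0 ≤ G i S) (hph : ∀ i S, 0 ≤ ph i S) {η : Fin k → ℝ}
    (h : ∀ i, ∑ S, G i S * ph i S ≤ η i * ∑ S, G i S) :
    ∑ T : Fin k → Finset ι, (∏ i, G i (T i)) * ∏ i, ph i (T i) ≤ (∏ i, η i) * ∏ i, ∑ S, G i S := by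
  simp only [← Finset.prod_mul_distrib]
  have : ∑ T : Fin k → Finset ι, ∏ i, (G i (T i) * ph i (T i)) = ∏ i, ∑ S, G i S * ph i S := by
    rw [Finset.prod_univ_sum, Fintype.piFinset_univ]
  rw [this]
  exact Finset.prod_le_prod (fun i _ => Finset.sum_nonneg fun S _ => mul_nonneg (hG _ _) (hph _ _)) fun i _ => h i

lemma expect_one {G : Fin k → Finset ι → ℝ} (hG : ∀ i S, 0 ≤ G i S) (i : Fin k) {ph : Finset ι → ℝ} (hph : ∀ S, 0 ≤ ph S) {η : ℝ}
    (h : ∑ S, G i S * ph S ≤ η * ∑ S, G i S) :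
    ∑ T : Fin k → Finset ι, (∏ i, G i (T i)) * ph (T i) ≤ η * ∏ i, ∑ S, G i S := by
  have := expect (G := G) (ph := fun j S => if j = i then ph S else 1) hG
    (by intro j S; split_ifs; exacts [hph S, zero_le_one]) (η := fun j => if j = i then η else 1)
    (by
      intro j
      split_ifs with hj
      · subst hj; exact h
      · simp)
  simpa using this

lemma expect_two {G : Fin k → Finset ι → ℝ} (hG : ∀ i S, 0 ≤ G i S) {i j : Fin k} (hij : i ≠ j) {ph : Finset ι → ℝ} (hph : ∀ S, 0 ≤ ph S) {η : ℝ}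
    (h : ∀ i, ∑ S, G i S * ph S ≤ η * ∑ S, G i S) :
    ∑ T : Fin k → Finset ι, (∏ i, G i (T i)) * (ph (T i) * ph (T j)) ≤ η^2 * ∏ i, ∑ S, G i S := by
  have := expect (G := G) (ph := fun l S => (if l = i then ph S else 1) * (if l = j then ph S else 1)) hG
    (by intro j S; have := hph S; apply mul_nonneg <;> split_ifs <;> simp [this])
    (η := fun l => (if l = i then η else 1) * (if l = j then η else 1))
    (by
      intro l
      by_cases h1 : l = i
      · have h2 : l ≠ j := h1 ▸ hij
        simp only [if_pos h1, if_neg h2, mul_one]; exact h l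
      · simp only [if_neg h1, one_mul]
        split_ifs
        · exact h l
        · simp)
  simp only [Finset.prod_mul_distrib] at this
  simpa [sq] using this

lemma exists_fib {T : Fin k → Finset ι} (h : ∀ i j, i ≠ j → Disjoint (T i) (T j)) : ∃ c : ι → Option (Fin k), fib c = T := by
  classical
  refine ⟨fun p => if h : ∃ i, p ∈ T i then some h.choose else none, ?_⟩
  ext i p
  rw [mem_fib]
  constructor
  · intro hp
    split_ifs at hp with h1
    · have := h1.choose_spec
      rw [Option.some_inj] at hp
      rwa [hp] at this
  · intro hp
    have h1 : ∃ i, p ∈ T i := ⟨i, hp⟩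
    rw [dif_pos h1]
    congr 1
    by_contra hne
    exact Finset.disjoint_left.mp (h _ _ hne) h1.choose_spec hp

lemma sum_fib_ge {F : (Fin k → Finset ι) → ℝ} (hF : ∀ T, ¬ (∀ i j, i ≠ j → Disjoint (T i) (T j)) → F T ≤ 0) :
    ∑ T, F T ≤ ∑ c : ι → Option (Fin k), F (fib c) := by
  classical
  rw [← Finset.sum_image (f := F) (fun x _ y _ h => fib_inj h)]
  rw [← Finset.sum_sdiff (Finset.subset_univ (Finset.univ.image (fib : (ι → Option (Fin k)) → Fin k → Finset ι)))]
  have : ∑ T ∈ Finset.univ \ (Finset.univ.image (fib : (ι → Option (Fin k)) → Fin k → Finset ι)), F T ≤ 0 := by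
    apply Finset.sum_nonpos
    intro T hT
    apply hF
    intro h
    obtain ⟨c, hc⟩ := exists_fib h
    simp at hT
    exact hT c hc
  linarith

/-- local sign -/
def sg (z : Option (Fin k)) : ℝ := z.elim 1 (fun _ => -1)

lemma kk_nonneg (m : Fin k) {t : ℝ} (ht : 0 ≤ t) (x z : Option (Fin k)) : 0 ≤ sg z * sg x * Kp m t x z := by
  rcases z with _ | i <;> rcases x with _ | j <;> simp only [sg, Kp, Option.elim] <;> split_ifs <;> simp_all

/-- extension by the colour m -/
def ext (m : Fin k) (z : ι → Option (Fin k)) (S : Finset ι) : ι → Option (Fin k) := fun p => if p ∈ S then some m else z p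

lemma fib_ext_ne (m : Fin k) (z : ι → Option (Fin k)) (S : Finset ι) (hS : ∀ p ∈ S, z p = none) {i : Fin k} (hi : i ≠ m) :
    fib (ext m z S) i = fib z i := by
  ext p
  rw [mem_fib, mem_fib, ext]
  by_cases hp : p ∈ S
  · simp [hp, hS p hp, Ne.symm hi]
  · simp [hp]

lemma fib_ext_eq (m : Fin k) (z : ι → Option (Fin k)) (S : Finset ι) (hz : ∀ p, z p ≠ some m) :
    fib (ext m z S) m = S := by
  ext p
  rw [mem_fib, ext]
  by_cases hp : p ∈ S
  · simp [hp]
  · simp [hp, hz p]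

lemma v_lower (m : Fin k) {t lg : ι → ℝ} (ht : ∀ p, 0 ≤ t p) {f : ℝ → ℝ} (f0 : ∀ x, 0 ≤ f x) (L : ℝ)
    (z : ι → Option (Fin k)) (hz : ∀ p, z p ≠ some m) :
    (∏ i ∈ Finset.univ.erase m, f (∑ p ∈ fib z i, lg p)) *
      ∑ S : Finset ι, (if (∀ p ∈ S, z p = none) ∧ ∑ p, (z p).elim 0 (fun _ => lg p) + ∑ p ∈ S, lg p ≤ L then f (∑ p ∈ S, lg p) * ∏ p ∈ S, t p else 0)
      ≤ (∏ p, sg (z p)) * ∑ c, uu lg f L c * ∏ p, Kp m (t p) (c p) (z p) := by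
  classical
  rw [Finset.mul_sum, Finset.mul_sum]
  have e : ∀ c, (∏ p, sg (z p)) * (uu lg f L c * ∏ p, Kp m (t p) (c p) (z p)) =
      (∏ p, (sg (z p) * sg (c p) * Kp m (t p) (c p) (z p))) * ((∏ i, f (∑ p ∈ fib c i, lg p)) *
      if ∑ p, (c p).elim 0 (fun _ => lg p) ≤ L then 1 else 0) := by
    intro c
    rw [Finset.prod_mul_distrib, Finset.prod_mul_distrib]
    unfold uu
    simp only [sg]
    ring
  simp only [e]
  have hnn : ∀ c : ι → Option (Fin k), 0 ≤ (∏ p, (sg (z p) * sg (c p) * Kp m (t p) (c p) (z p))) * ((∏ i, f (∑ p ∈ fib c i, lg p)) *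
      if ∑ p, (c p).elim 0 (fun _ => lg p) ≤ L then 1 else 0) := by
    intro c
    refine mul_nonneg (Finset.prod_nonneg fun p _ => kk_nonneg m (ht p) _ _) (mul_nonneg (Finset.prod_nonneg fun i _ => f0 _) ?_)
    split_ifs <;> norm_num
  set A : Finset (Finset ι) := Finset.univ.filter (fun S => ∀ p ∈ S, z p = none) with hA
  calc _ = ∑ S ∈ A, (∏ i ∈ Finset.univ.erase m, f (∑ p ∈ fib z i, lg p)) * (if ∑ p, (z p).elim 0 (fun _ => lg p) + ∑ p ∈ S, lg p ≤ L then f (∑ p ∈ S, lg p) * ∏ p ∈ S, t p else 0) := by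
        rw [hA, Finset.sum_filter]
        apply Finset.sum_congr rfl; intro S _
        by_cases h : ∀ p ∈ S, z p = none
        · rw [if_pos h]
          congr 1
          apply if_congr _ rfl rfl
          exact ⟨fun h' => h'.2, fun h' => ⟨h, h'⟩⟩
        · rw [if_neg h, if_neg (fun h' => h h'.1), mul_zero]
    _ ≤ ∑ S ∈ A, (∏ p, (sg (z p) * sg (ext m z S p) * Kp m (t p) (ext m z S p) (z p))) * ((∏ i, f (∑ p ∈ fib (ext m z S) i, lg p)) *
      if ∑ p, (ext m z S p).elim 0 (fun _ => lg p) ≤ L then 1 else 0) := by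
        apply Finset.sum_le_sum; intro S hS
        rw [hA, Finset.mem_filter] at hS
        have hS := hS.2
        apply le_of_eq
        have h1 : ∏ p, (sg (z p) * sg (ext m z S p) * Kp m (t p) (ext m z S p) (z p)) = ∏ p ∈ S, t p := by
          rw [← Finset.prod_subset (Finset.subset_univ S)]
          · apply Finset.prod_congr rfl; intro p hp
            simp [ext, hp, hS p hp, sg, Kp]
          · intro p _ hp
            simp only [ext, hp, if_false]
            rcases z p with _ | i <;> simp [sg, Kp]
        have h2 : ∏ i, f (∑ p ∈ fib (ext m z S) i, lg p) = f (∑ p ∈ S, lg p) * ∏ i ∈ Finset.univ.erase m, f (∑ p ∈ fib z i, lg p) := by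
          rw [← Finset.mul_prod_erase Finset.univ _ (Finset.mem_univ m), fib_ext_eq m z S hz]
          congr 1
          apply Finset.prod_congr rfl; intro i hi
          rw [fib_ext_ne m z S hS (Finset.ne_of_mem_erase hi)]
        have h3 : ∑ p, (ext m z S p).elim 0 (fun _ => lg p) = ∑ p, (z p).elim 0 (fun _ => lg p) + ∑ p ∈ S, lg p := by
          rw [← Finset.sum_subset (Finset.subset_univ S) (f := fun p => if p ∈ S then lg p else 0) (by intro p _ hp; simp [hp]) |>.trans rfl |> fun h => (Finset.sum_congr rfl (fun p hp => by simp [hp]) : ∑ p ∈ S, (if p ∈ S then lg p else 0) = ∑ p ∈ S, lg p), 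
            Finset.sum_subset (Finset.subset_univ S) (f := fun p => if p ∈ S then lg p else 0) (by intro p _ hp; simp [hp]), ← Finset.sum_add_distrib]
          apply Finset.sum_congr rfl; intro p _
          by_cases hp : p ∈ S
          · simp [ext, hp, hS p hp]
          · simp [ext, hp]
        rw [h1, h2, h3]
        split_ifs <;> ring
    _ = ∑ c ∈ A.image (ext m z), (∏ p, (sg (z p) * sg (c p) * Kp m (t p) (c p) (z p))) * ((∏ i, f (∑ p ∈ fib c i, lg p)) *
      if ∑ p, (c p).elim 0 (fun _ => lg p) ≤ L then 1 else 0) := by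
        rw [Finset.sum_image]
        intro S _ S' _ h
        rw [← fib_ext_eq m z S hz, ← fib_ext_eq m z S' hz, h]
    _ ≤ _ := Finset.sum_le_sum_of_subset_of_nonneg (Finset.subset_univ _) fun c _ _ => hnn c

lemma one_sub_sum_le_prod {A : Finset ι} {x : ι → ℝ} (h0 : ∀ p, 0 ≤ x p) (h1 : ∀ p, x p ≤ 1) :
    1 - ∑ p ∈ A, x p ≤ ∏ p ∈ A, (1 - x p) := by
  induction A using Finset.induction_on with
  | empty => simp
  | insert a s ha ih =>
    rw [Finset.sum_insert ha, Finset.prod_insert ha]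
    have h2 : ∏ p ∈ s, (1 - x p) ≤ 1 := Finset.prod_le_one (fun p _ => by linarith [h1 p]) (fun p _ => by linarith [h0 p])
    nlinarith [h0 a, h1 a]

lemma term_lower (m : Fin k) {t lg : ι → ℝ} (ht : ∀ p, 0 ≤ t p) (hkt : ∀ p, k * t p ≤ 1) (hlg : ∀ p, 0 ≤ lg p)
    {f : ℝ → ℝ} (f0 : ∀ x, 0 ≤ f x) (fa : Antitone f) {L : ℝ} (hL : 0 < L) (fL : ∀ x, L/2 < x → f x = 0)
    (z : ι → Option (Fin k)) (hz : ∀ p, z p ≠ some m) :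
    (∏ i ∈ Finset.univ.erase m, (f (∑ p ∈ fib z i, lg p)^2 * ∏ p ∈ fib z i, t p)) * SX t lg f^2 *
      (1 - (k+2) * (∑ p, (z p).elim 0 (fun _ => t p)) - 2 * (∑ p, (z p).elim 0 (fun _ => lg p)) / L) ≤
    (∏ p, dp m (t p) (z p)) * (∑ c, uu lg f L c * ∏ p, Kp m (t p) (c p) (z p))^2 := by
  classical
  set τ := ∑ p, (z p).elim 0 (fun _ => t p) with hτ
  set a := ∑ p, (z p).elim 0 (fun _ => lg p) with ha
  set v := ∑ c, uu lg f L c * ∏ p, Kp m (t p) (c p) (z p) with hv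
  have hτ0 : 0 ≤ τ := Finset.sum_nonneg fun p _ => by cases z p <;> simp [ht]
  have ha0 : 0 ≤ a := Finset.sum_nonneg fun p _ => by cases z p <;> simp [hlg]
  have hd0 : ∀ p, 0 ≤ dp m (t p) (z p) := by
    intro p; unfold dp; cases z p <;> simp only [Option.elim]
    · norm_num
    · split_ifs
      · exact le_rfl
      · exact mul_nonneg (ht p) (by linarith [hkt p])
  have hF0 : 0 ≤ ∏ i ∈ Finset.univ.erase m, (f (∑ p ∈ fib z i, lg p)^2 * ∏ p ∈ fib z i, t p) :=
    Finset.prod_nonneg fun i _ => mul_nonneg (sq_nonneg _) (Finset.prod_nonneg fun p _ => ht p)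
  by_cases hneg : 1 - (k+2) * τ - 2 * a / L ≤ 0
  · exact (mul_nonpos_of_nonneg_of_nonpos (mul_nonneg hF0 (sq_nonneg _)) hneg).trans
      (mul_nonneg (Finset.prod_nonneg fun p _ => hd0 p) (sq_nonneg _))
  push Not at hneg
  have hk0 : (0:ℝ) ≤ k := Nat.cast_nonneg k
  have haL : a ≤ L/2 := by
    by_contra hc
    push Not at hc
    have : 1 ≤ 2 * a / L := by rw [le_div_iff₀ hL]; linarith
    nlinarith
  have hτ1 : τ ≤ 1 := by
    have : 0 ≤ 2 * a / L := by positivity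
    nlinarith
  have hvl := v_lower m (lg := lg) ht f0 L z hz
  rw [← ha] at hvl
  rw [← hv] at hvl
  have hY : SX t lg f * (1 - τ) ≤ ∑ S : Finset ι, (if (∀ p ∈ S, z p = none) ∧ a + ∑ p ∈ S, lg p ≤ L then f (∑ p ∈ S, lg p) * ∏ p ∈ S, t p else 0) := by
    have h1 : ∑ p, (z p).elim 0 (fun _ => (∑ S : Finset ι, (if p ∈ S then f (∑ p ∈ S, lg p) * ∏ p ∈ S, t p else 0))) ≤ SX t lg f * τ := by
      rw [hτ, Finset.mul_sum]
      apply Finset.sum_le_sum; intro p _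
      rcases z p with _ | i
      · simp
      · simp only [Option.elim]; rw [mul_comm]; exact erase_bound ht hlg f0 fa p
    have h2 : SX t lg f ≤ (∑ S : Finset ι, (if (∀ p ∈ S, z p = none) ∧ a + ∑ p ∈ S, lg p ≤ L then f (∑ p ∈ S, lg p) * ∏ p ∈ S, t p else 0))
        + ∑ p, (z p).elim 0 (fun _ => (∑ S : Finset ι, (if p ∈ S then f (∑ p ∈ S, lg p) * ∏ p ∈ S, t p else 0))) := by
      have : ∑ p, (z p).elim 0 (fun _ => (∑ S : Finset ι, (if p ∈ S then f (∑ p ∈ S, lg p) * ∏ p ∈ S, t p else 0))) =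
          ∑ S : Finset ι, ∑ p, (z p).elim 0 (fun _ => if p ∈ S then f (∑ p ∈ S, lg p) * ∏ p ∈ S, t p else 0) := by
        rw [Finset.sum_comm]
        apply Finset.sum_congr rfl; intro p _
        cases z p <;> simp
      rw [this, ← Finset.sum_add_distrib]
      apply Finset.sum_le_sum; intro S _
      have hg : 0 ≤ f (∑ p ∈ S, lg p) * ∏ p ∈ S, t p := mul_nonneg (f0 _) (Finset.prod_nonneg fun p _ => ht p)
      have hs0 : ∀ p, 0 ≤ ((z p).elim 0 (fun _ => if p ∈ S then f (∑ p ∈ S, lg p) * ∏ p ∈ S, t p else 0) : ℝ) := by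
        intro p; cases z p <;> simp only [Option.elim]
        · exact le_rfl
        · split_ifs; exacts [hg, le_rfl]
      by_cases h3 : ∀ p ∈ S, z p = none
      · by_cases h4 : a + ∑ p ∈ S, lg p ≤ L
        · rw [if_pos ⟨h3, h4⟩]
          linarith [Finset.sum_nonneg fun p (_ : p ∈ Finset.univ) => hs0 p]
        · have h5 : f (∑ p ∈ S, lg p) * ∏ p ∈ S, t p = 0 := by rw [fL (∑ p ∈ S, lg p) (by linarith), zero_mul]
          rw [if_neg (fun h' => h4 h'.2), zero_add]
          exact h5.le.trans (Finset.sum_nonneg fun p _ => hs0 p)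
      · rw [if_neg (by tauto), zero_add]
        push Not at h3
        obtain ⟨p, hp, hzp⟩ := h3
        refine le_trans ?_ (Finset.single_le_sum (fun p _ => hs0 p) (Finset.mem_univ p))
        obtain ⟨i, hi⟩ := Option.ne_none_iff_exists'.mp hzp
        rw [hi]; simp [hp]
    linarith
  have hY0 : 0 ≤ SX t lg f := Finset.sum_nonneg fun S _ => mul_nonneg (f0 _) (Finset.prod_nonneg fun p _ => ht p)
  have hFf : 0 ≤ ∏ i ∈ Finset.univ.erase m, f (∑ p ∈ fib z i, lg p) := Finset.prod_nonneg fun i _ => f0 _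
  have hv2 : ((∏ i ∈ Finset.univ.erase m, f (∑ p ∈ fib z i, lg p)) * (SX t lg f * (1 - τ)))^2 ≤ v^2 := by
    have : v^2 = ((∏ p, sg (z p)) * v)^2 := by
      rw [mul_pow]; unfold sg; rw [sq_sign, one_mul]
    rw [this]
    apply pow_le_pow_left₀
    · exact mul_nonneg hFf (mul_nonneg hY0 (by linarith))
    · exact (mul_le_mul_of_nonneg_left hY hFf).trans hvl
  have hd : (∏ i ∈ Finset.univ.erase m, ∏ p ∈ fib z i, t p) * (1 - k * τ) ≤ ∏ p, dp m (t p) (z p) := by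
    have e1 : ∏ i ∈ Finset.univ.erase m, ∏ p ∈ fib z i, t p = ∏ p, (z p).elim 1 (fun _ => t p) := by
      rw [← prod_fib, ← Finset.mul_prod_erase Finset.univ _ (Finset.mem_univ m)]
      have : fib z m = ∅ := by
        ext p; simp [mem_fib, hz p]
      rw [this]; simp
    have e2 : ∏ p, dp m (t p) (z p) = (∏ p, (z p).elim 1 (fun _ => t p)) * ∏ p, (1 - (z p).elim 0 (fun _ => k * t p)) := by
      rw [← Finset.prod_mul_distrib]
      apply Finset.prod_congr rfl; intro p _
      have := hz p
      rcases h : z p with _ | i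
      · simp [dp]
      · rw [h] at this
        simp [dp]; intro h'; exact absurd (by rw [h']) this
    rw [e1, e2]
    apply mul_le_mul_of_nonneg_left
    · refine le_trans (le_of_eq ?_) (one_sub_sum_le_prod (fun p => ?_) (fun p => ?_))
      · rw [hτ, Finset.mul_sum]; congr 1
        apply Finset.sum_congr rfl; intro p _
        cases z p <;> simp
      · have := mul_nonneg hk0 (ht p)
        cases z p <;> simp [this, ht p]
      · cases z p <;> simp [hkt p]
    · exact Finset.prod_nonneg fun p _ => by cases z p <;> simp [ht p]
  have hρ0 : 0 ≤ ∏ i ∈ Finset.univ.erase m, ∏ p ∈ fib z i, t p := Finset.prod_nonneg fun i _ => Finset.prod_nonneg fun p _ => ht p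
  refine le_trans ?_ (mul_le_mul hd hv2 (sq_nonneg _) (Finset.prod_nonneg fun p _ => hd0 p))
  rw [Finset.prod_mul_distrib, Finset.prod_pow]
  set F := ∏ i ∈ Finset.univ.erase m, f (∑ p ∈ fib z i, lg p)
  set ρ := ∏ i ∈ Finset.univ.erase m, ∏ p ∈ fib z i, t p
  have h5 : 1 - (k+2) * τ - 2 * a / L ≤ (1 - k * τ) * (1 - τ)^2 := by
    have : 0 ≤ 2 * a / L := by positivity
    have hkτ : k * τ ≤ 1 := by nlinarith
    nlinarith [mul_nonneg hk0 hτ0, mul_nonneg (mul_nonneg hk0 hτ0) hτ0, sq_nonneg τ, mul_nonneg (mul_nonneg hk0 hτ0) (mul_nonneg hτ0 (by linarith : 0 ≤ 2 - τ))]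
  have h6 : 0 ≤ F^2 * ρ * SX t lg f^2 := by positivity
  calc _ ≤ F^2 * ρ * SX t lg f^2 * ((1 - k * τ) * (1 - τ)^2) := mul_le_mul_of_nonneg_left h5 h6
    _ = _ := by ring

theorem sieve_lower (m : Fin k) {t lg : ι → ℝ} (ht : ∀ p, 0 ≤ t p) (hkt : ∀ p, k * t p ≤ 1) (hlg : ∀ p, 0 ≤ lg p)
    {f : ℝ → ℝ} (f0 : ∀ x, 0 ≤ f x) (fa : Antitone f) {L : ℝ} (hL : 0 < L) (fL : ∀ x, L/2 < x → f x = 0)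
    {η : ℝ} (hη0 : 0 ≤ η) (hη : ∑ S : Finset ι, (f (∑ p ∈ S, lg p)^2 * ∏ p ∈ S, t p) * ∑ p ∈ S, lg p ≤ η * L * SX t lg (fun x => f x^2)) :
    SX t lg (fun x => f x^2) ^ (k-1) * SX t lg f^2 * (1 - (k * ((k+2) * ∑ p, t p^2 + 2 * η) + k^2 * ∑ p, t p^2)) ≤
    ∑ y : ι → Option (Fin k), (∏ p, pm (fun p i => if i = m then 0 else t p) p (y p)) * Phi t (uu lg f L) y ^2 := by
  classical
  have hk0 : (0:ℝ) ≤ k := Nat.cast_nonneg k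
  set X := SX t lg (fun x => f x^2) with hX
  set Y := SX t lg f with hY
  set τ := ∑ p, t p^2 with hτ
  have hτ0 : 0 ≤ τ := Finset.sum_nonneg fun p _ => sq_nonneg _
  have h1 := tensor_le (X := Option (Fin k)) (Y := Option (Fin k)) (Z := Option (Fin k)) ι inferInstance
    (fun p z => dp m (t p) z) (fun p x z => Kp m (t p) x z)
    (fun p y => pm (fun p i => if i = m then 0 else t p) p y) (fun p x y => ev (t p) x y)
    (by
      intro p z; unfold dp; cases z <;> simp only [Option.elim]
      · norm_num
      · split_ifs
        · exact le_rfl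
        · exact mul_nonneg (ht p) (by linarith [hkt p]))
    (by
      intro p y
      cases y with
      | none =>
        simp only [pm, Option.elim]
        have : ∑ i : Fin k, (if i = m then 0 else t p) ≤ ∑ i : Fin k, t p :=
          Finset.sum_le_sum fun i _ => by split_ifs; exacts [ht p, le_rfl]
        simp at this
        have := hkt p
        simp
        linarith
      | some i => simp only [pm, Option.elim]; split_ifs; exacts [le_rfl, ht p])
    (fun p a => local_lower m (ht p) a) (uu lg f L)
  refine le_trans ?_ h1
  set G : Fin k → Finset ι → ℝ := fun i S => if i = m then (if S = ∅ then 1 else 0) else f (∑ p ∈ S, lg p)^2 * ∏ p ∈ S, t p with hG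
  have hG0 : ∀ i S, 0 ≤ G i S := by
    intro i S; simp only [hG]; split_ifs
    · norm_num
    · norm_num
    · exact mul_nonneg (sq_nonneg _) (Finset.prod_nonneg fun p _ => ht p)
  have f2a : Antitone (fun x => f x^2) := fun x y hxy => pow_le_pow_left₀ (f0 y) (fa hxy) 2
  have hGm : ∀ ph : Finset ι → ℝ, ∑ S, G m S * ph S = ph ∅ := by
    intro ph; simp [hG]
  have hGs : ∑ S, G m S = 1 := by simpa using hGm (fun _ => 1)
  have hGi : ∀ i, i ≠ m → ∑ S, G i S = X := by
    intro i hi; simp [hG, hi, hX, SX]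
  have hX0 : 0 ≤ X := Finset.sum_nonneg fun S _ => mul_nonneg (sq_nonneg _) (Finset.prod_nonneg fun p _ => ht p)
  have hprod : ∏ i, ∑ S, G i S = X^(k-1) := by
    rw [← Finset.mul_prod_erase Finset.univ _ (Finset.mem_univ m), hGs, one_mul,
      Finset.prod_congr rfl (fun i hi => hGi i (Finset.ne_of_mem_erase hi)), Finset.prod_const]
    simp
  have hP0 : 0 ≤ X^(k-1) := pow_nonneg hX0 _
  -- elementary expectations
  have E1 : ∀ i p, ∑ S, G i S * (if p ∈ S then 1 else 0) ≤ t p * ∑ S, G i S := by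
    intro i p
    by_cases hi : i = m
    · subst hi; rw [hGm, hGs]; simp [ht p]
    · rw [hGi i hi, hX]
      have := erase_bound (h := fun x => f x^2) ht hlg (fun x => sq_nonneg _) f2a p
      refine le_trans (le_of_eq ?_) this
      apply Finset.sum_congr rfl; intro S _
      simp [hG, hi]
  have E2 : ∀ i, ∑ S, G i S * (∑ p ∈ S, t p) ≤ τ * ∑ S, G i S := by
    intro i
    calc _ = ∑ p, t p * ∑ S, G i S * (if p ∈ S then 1 else 0) := by
          simp only [Finset.mul_sum]
          rw [Finset.sum_comm]
          apply Finset.sum_congr rfl; intro S _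
          rw [Finset.sum_subset (Finset.subset_univ S) (f := fun p => G i S * t p * (if p ∈ S then 1 else 0)) (by intro p _ hp; simp [hp]) |>.symm.trans
            (Finset.sum_congr rfl fun p hp => by rw [if_pos hp, mul_one]) |>.symm]
          apply Finset.sum_congr rfl; intro p _; ring
      _ ≤ ∑ p, t p * (t p * ∑ S, G i S) := Finset.sum_le_sum fun p _ => mul_le_mul_of_nonneg_left (E1 i p) (ht p)
      _ = _ := by rw [hτ, Finset.sum_mul]; apply Finset.sum_congr rfl; intro p _; ring
  have E3 : ∀ i, ∑ S, G i S * (∑ p ∈ S, lg p) ≤ (η * L) * ∑ S, G i S := by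
    intro i
    by_cases hi : i = m
    · subst hi; rw [hGm, hGs]; simp; positivity
    · rw [hGi i hi]
      refine le_trans (le_of_eq ?_) hη
      apply Finset.sum_congr rfl; intro S _
      simp [hG, hi]
  set loss : (Fin k → Finset ι) → ℝ := fun T => ∑ i, ((k+2) * ∑ p ∈ T i, t p + 2 / L * ∑ p ∈ T i, lg p) +
    ∑ i, ∑ j, if i = j then 0 else ∑ p, (if p ∈ T i then (1:ℝ) else 0) * (if p ∈ T j then 1 else 0) with hloss
  have hloss1 : ∀ T, ¬ (∀ i j, i ≠ j → Disjoint (T i) (T j)) → 1 ≤ loss T := by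
    intro T hT
    push Not at hT
    obtain ⟨i, j, hij, hd⟩ := hT
    rw [Finset.not_disjoint_iff] at hd
    obtain ⟨p, hpi, hpj⟩ := hd
    have a1 : 0 ≤ ∑ i, ((k+2) * ∑ p ∈ T i, t p + 2 / L * ∑ p ∈ T i, lg p) := by
      apply Finset.sum_nonneg; intro i _
      have b1 : 0 ≤ ∑ p ∈ T i, t p := Finset.sum_nonneg fun p _ => ht p
      have b2 : 0 ≤ ∑ p ∈ T i, lg p := Finset.sum_nonneg fun p _ => hlg p
      positivity
    have a2 : ∀ i j p, 0 ≤ (if p ∈ T i then (1:ℝ) else 0) * (if p ∈ T j then 1 else 0) := by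
      intro i j p; split_ifs <;> norm_num
    have a3 : ∀ i j, 0 ≤ if i = j then 0 else ∑ p, (if p ∈ T i then (1:ℝ) else 0) * (if p ∈ T j then 1 else 0) := by
      intro i j; split_ifs
      · exact le_rfl
      · exact Finset.sum_nonneg fun p _ => a2 i j p
    have a4 : (1:ℝ) ≤ if i = j then 0 else ∑ p, (if p ∈ T i then (1:ℝ) else 0) * (if p ∈ T j then 1 else 0) := by
      rw [if_neg hij]
      refine le_trans ?_ (Finset.single_le_sum (fun p _ => a2 i j p) (Finset.mem_univ p))
      simp [hpi, hpj]
    have a5 := Finset.single_le_sum (f := fun j => if i = j then 0 else ∑ p, (if p ∈ T i then (1:ℝ) else 0) * (if p ∈ T j then 1 else 0)) (fun j _ => a3 i j) (Finset.mem_univ j)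
    have a6 := Finset.single_le_sum (f := fun i => ∑ j, if i = j then 0 else ∑ p, (if p ∈ T i then (1:ℝ) else 0) * (if p ∈ T j then 1 else 0)) (fun i _ => Finset.sum_nonneg fun j _ => a3 i j) (Finset.mem_univ i)
    simp only [hloss]
    linarith
  have hEl : ∑ T : Fin k → Finset ι, (∏ i, G i (T i)) * loss T ≤ (k * ((k+2) * τ + 2 * η) + k^2 * τ) * X^(k-1) := by
    rw [← hprod]
    set Q := ∏ i, ∑ S, G i S with hQ
    have hQ0 : 0 ≤ Q := by rw [hprod]; exact hP0
    have b1 : ∀ i, ∑ T : Fin k → Finset ι, (∏ i, G i (T i)) * ((k+2) * ∑ p ∈ T i, t p + 2 / L * ∑ p ∈ T i, lg p) ≤ ((k+2) * τ + 2 * η) * Q := by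
      intro i
      have c1 := expect_one hG0 i (ph := fun S => ∑ p ∈ S, t p) (fun S => Finset.sum_nonneg fun p _ => ht p) (E2 i)
      have c2 := expect_one hG0 i (ph := fun S => ∑ p ∈ S, lg p) (fun S => Finset.sum_nonneg fun p _ => hlg p) (E3 i)
      have : ∑ T : Fin k → Finset ι, (∏ i, G i (T i)) * ((k+2) * ∑ p ∈ T i, t p + 2 / L * ∑ p ∈ T i, lg p) =
          (k+2) * ∑ T : Fin k → Finset ι, (∏ i, G i (T i)) * ∑ p ∈ T i, t p + 2/L * ∑ T : Fin k → Finset ι, (∏ i, G i (T i)) * ∑ p ∈ T i, lg p := by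
        rw [Finset.mul_sum, Finset.mul_sum, ← Finset.sum_add_distrib]
        apply Finset.sum_congr rfl; intro T _; ring
      rw [this]
      have d1 := mul_le_mul_of_nonneg_left c1 (by positivity : (0:ℝ) ≤ k + 2)
      have d2 := mul_le_mul_of_nonneg_left c2 (by positivity : (0:ℝ) ≤ 2/L)
      have d3 : 2/L * (η * L * Q) = 2 * η * Q := by field_simp
      rw [← hQ] at d1 d2
      linarith
    have b2 : ∀ i j, ∑ T : Fin k → Finset ι, (∏ i, G i (T i)) * (if i = j then 0 else ∑ p, (if p ∈ T i then (1:ℝ) else 0) * (if p ∈ T j then 1 else 0)) ≤ τ * Q := by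
      intro i j
      by_cases hij : i = j
      · simp [hij]; positivity
      · simp only [if_neg hij, Finset.mul_sum]
        rw [Finset.sum_comm, hτ, Finset.sum_mul]
        apply Finset.sum_le_sum; intro p _
        exact expect_two hG0 hij (ph := fun S => if p ∈ S then 1 else 0) (fun S => by split_ifs <;> norm_num) (fun i => E1 i p)
    have : ∑ T : Fin k → Finset ι, (∏ i, G i (T i)) * loss T = (∑ i, ∑ T : Fin k → Finset ι, (∏ i, G i (T i)) * ((k+2) * ∑ p ∈ T i, t p + 2 / L * ∑ p ∈ T i, lg p)) +
        ∑ i, ∑ j, ∑ T : Fin k → Finset ι, (∏ i, G i (T i)) * (if i = j then 0 else ∑ p, (if p ∈ T i then (1:ℝ) else 0) * (if p ∈ T j then 1 else 0)) := by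
      simp only [hloss, mul_add, Finset.sum_add_distrib]
      congr 1
      · congr 1
        · simp only [Finset.mul_sum]; rw [Finset.sum_comm]
        · simp only [Finset.mul_sum]; rw [Finset.sum_comm]
      · rw [Finset.sum_congr rfl (fun T _ => by rw [Finset.mul_sum, Finset.sum_congr rfl (fun i _ => by rw [Finset.mul_sum])])]
        rw [Finset.sum_comm]
        apply Finset.sum_congr rfl; intro i _
        rw [Finset.sum_comm]
    rw [this]
    calc _ ≤ ∑ i : Fin k, ((k+2) * τ + 2 * η) * Q + ∑ i : Fin k, ∑ j : Fin k, τ * Q :=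
          add_le_add (Finset.sum_le_sum fun i _ => b1 i) (Finset.sum_le_sum fun i _ => Finset.sum_le_sum fun j _ => b2 i j)
      _ = _ := by simp; ring
  have hmain : ∑ T : Fin k → Finset ι, (∏ i, G i (T i)) * (1 - loss T) ≤ ∑ z : ι → Option (Fin k), (∏ i, G i (fib z i)) * (1 - loss (fib z)) :=
    sum_fib_ge (F := fun T => (∏ i, G i (T i)) * (1 - loss T)) (fun T hT =>
      mul_nonpos_of_nonneg_of_nonpos (Finset.prod_nonneg fun i _ => hG0 _ _) (by linarith [hloss1 T hT]))
  have hsum1 : ∑ T : Fin k → Finset ι, (∏ i, G i (T i)) = X^(k-1) := by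
    rw [← hprod, Finset.prod_univ_sum, Fintype.piFinset_univ]
  have hA : X^(k-1) * (1 - (k * ((k+2) * τ + 2 * η) + k^2 * τ)) ≤ ∑ z : ι → Option (Fin k), (∏ i, G i (fib z i)) * (1 - loss (fib z)) := by
    refine le_trans ?_ hmain
    simp only [mul_sub, mul_one, Finset.sum_sub_distrib]
    rw [hsum1]
    linarith
  calc _ = (X^(k-1) * (1 - (k * ((k+2) * τ + 2 * η) + k^2 * τ))) * Y^2 := by ring
    _ ≤ (∑ z : ι → Option (Fin k), (∏ i, G i (fib z i)) * (1 - loss (fib z))) * Y^2 := mul_le_mul_of_nonneg_right hA (sq_nonneg _)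
    _ ≤ _ := by
      rw [Finset.sum_mul]
      apply Finset.sum_le_sum
      intro z _
      have hd0 : ∀ p, 0 ≤ dp m (t p) (z p) := by
        intro p; unfold dp; cases z p <;> simp only [Option.elim]
        · norm_num
        · split_ifs
          · exact le_rfl
          · exact mul_nonneg (ht p) (by linarith [hkt p])
      by_cases hz : ∀ p, z p ≠ some m
      · have hfm : fib z m = ∅ := by ext p; simp [mem_fib, hz p]
        have e1 : ∏ i, G i (fib z i) = ∏ i ∈ Finset.univ.erase m, (f (∑ p ∈ fib z i, lg p)^2 * ∏ p ∈ fib z i, t p) := by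
          rw [← Finset.mul_prod_erase Finset.univ _ (Finset.mem_univ m), hfm]
          simp only [hG, if_true, one_mul]
          apply Finset.prod_congr rfl; intro i hi
          rw [if_neg (Finset.ne_of_mem_erase hi)]
        have e2 : loss (fib z) = (k+2) * (∑ p, (z p).elim 0 (fun _ => t p)) + 2 * (∑ p, (z p).elim 0 (fun _ => lg p)) / L := by
          simp only [hloss]
          rw [Finset.sum_add_distrib, ← Finset.mul_sum, ← Finset.mul_sum, sum_fib, sum_fib]
          have : ∑ i, ∑ j, (if i = j then 0 else ∑ p, (if p ∈ fib z i then (1:ℝ) else 0) * (if p ∈ fib z j then 1 else 0)) = 0 := by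
            apply Finset.sum_eq_zero; intro i _
            apply Finset.sum_eq_zero; intro j _
            split_ifs with hij
            · rfl
            · apply Finset.sum_eq_zero; intro p _
              simp only [mem_fib]
              by_cases hh : z p = some i
              · rw [if_neg (c := z p = some j)]
                · simp
                · rw [hh]; simpa using hij
              · simp [hh]
          rw [this]; ring
        have := term_lower m ht hkt hlg f0 fa hL fL z hz
        rw [e1, e2]
        refine le_trans (le_of_eq ?_) this
        rw [hY]; ring
      · push Not at hz
        obtain ⟨p, hp⟩ := hz
        have : ∏ i, G i (fib z i) = 0 := by
          apply Finset.prod_eq_zero (Finset.mem_univ m)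
          have hne : fib z m ≠ ∅ := Finset.ne_empty_of_mem (mem_fib.mpr hp)
          simp [hG, hne]
        rw [this, zero_mul, zero_mul]
        exact mul_nonneg (Finset.prod_nonneg fun p _ => hd0 p) (sq_nonneg _)

end sieve
end Pf
end

section
open Complex Filter Topology MeasureTheory
open scoped Nat
set_option linter.unusedSectionVars false
set_option linter.unusedVariables false
namespace Pf

/-- primes in an interval -/
def Pr (a b : ℕ) : Finset ℕ := (Finset.Ioc a b).filter Nat.Prime

lemma mem_Pr {a b p : ℕ} : p ∈ Pr a b ↔ p.Prime ∧ a < p ∧ p ≤ b := by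
  simp [Pr]; tauto

/-- sums over subsets of primes -/
noncomputable def PS (Q : Finset ℕ) (τ : ℕ → ℝ) (y : ℝ) : ℝ :=
  ∑ S ∈ Q.powerset, if ∑ p ∈ S, Real.log p ≤ y then ∏ p ∈ S, τ p else 0

lemma log_nat_nonneg (n : ℕ) : 0 ≤ Real.log n := Real.log_natCast_nonneg n

lemma PS_insert {Q : Finset ℕ} {a : ℕ} (ha : a ∉ Q) (τ : ℕ → ℝ) (y : ℝ) :
    PS (insert a Q) τ y = PS Q τ y + τ a * PS Q τ (y - Real.log a) := by
  unfold PS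
  rw [Finset.sum_powerset_insert ha, Finset.mul_sum]
  congr 1
  apply Finset.sum_congr rfl; intro S hS
  have haS : a ∉ S := fun h => ha (Finset.mem_powerset.mp hS h)
  rw [Finset.sum_insert haS, Finset.prod_insert haS]
  by_cases h : Real.log a + ∑ p ∈ S, Real.log p ≤ y
  · rw [if_pos h, if_pos (by linarith)]
  · rw [if_neg h, if_neg (by intro h'; apply h; linarith), mul_zero]

lemma PS_nonneg {Q : Finset ℕ} {τ : ℕ → ℝ} (hτ : ∀ p ∈ Q, 0 ≤ τ p) (y : ℝ) : 0 ≤ PS Q τ y := by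
  apply Finset.sum_nonneg; intro S hS
  split_ifs
  · exact Finset.prod_nonneg fun p hp => hτ p (Finset.mem_powerset.mp hS hp)
  · exact le_rfl

lemma PS_mono {Q : Finset ℕ} {τ : ℕ → ℝ} (hτ : ∀ p ∈ Q, 0 ≤ τ p) {y y' : ℝ} (h : y ≤ y') : PS Q τ y ≤ PS Q τ y' := by
  apply Finset.sum_le_sum; intro S hS
  have : 0 ≤ ∏ p ∈ S, τ p := Finset.prod_nonneg fun p hp => hτ p (Finset.mem_powerset.mp hS hp)
  split_ifs with h1 h2 h2
  · exact le_rfl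
  · exact absurd (h1.trans h) h2
  · exact this
  · exact le_rfl

lemma PS_union_le {A Q : Finset ℕ} (hd : Disjoint A Q) {τ : ℕ → ℝ} (hA : ∀ p ∈ A, 0 ≤ τ p) (hQ : ∀ p ∈ Q, 0 ≤ τ p) (y : ℝ) :
    PS (A ∪ Q) τ y ≤ (∏ p ∈ A, (1 + τ p)) * PS Q τ y := by
  induction A using Finset.induction_on with
  | empty => simp
  | insert a s ha ih =>
    rw [Finset.disjoint_insert_left] at hd
    have h0 := hA a (Finset.mem_insert_self _ _)
    have hs : ∀ p ∈ s, 0 ≤ τ p := fun p hp => hA p (Finset.mem_insert_of_mem hp)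
    have ih := ih hd.2 hs
    have hu : ∀ p ∈ s ∪ Q, 0 ≤ τ p := fun p hp => (Finset.mem_union.mp hp).elim (hs p) (hQ p)
    rw [Finset.insert_union, PS_insert (by simp [ha, hd.1]), Finset.prod_insert ha]
    have h1 := PS_mono hu (show y - Real.log a ≤ y by linarith [log_nat_nonneg a])
    calc _ ≤ PS (s ∪ Q) τ y + τ a * PS (s ∪ Q) τ y := by gcongr
      _ = (1 + τ a) * PS (s ∪ Q) τ y := by ring
      _ ≤ (1 + τ a) * ((∏ p ∈ s, (1 + τ p)) * PS Q τ y) := by gcongr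
      _ = _ := by ring

lemma le_PS_union {A Q : Finset ℕ} (hd : Disjoint A Q) {τ : ℕ → ℝ} (hA : ∀ p ∈ A, 0 ≤ τ p) (hQ : ∀ p ∈ Q, 0 ≤ τ p) (y : ℝ) :
    (∏ p ∈ A, (1 + τ p)) * PS Q τ y ≤ PS (A ∪ Q) τ (y + ∑ p ∈ A, Real.log p) := by
  induction A using Finset.induction_on with
  | empty => simp
  | insert a s ha ih =>
    rw [Finset.disjoint_insert_left] at hd
    have h0 := hA a (Finset.mem_insert_self _ _)
    have hs : ∀ p ∈ s, 0 ≤ τ p := fun p hp => hA p (Finset.mem_insert_of_mem hp)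
    have ih := ih hd.2 hs
    have hu : ∀ p ∈ s ∪ Q, 0 ≤ τ p := fun p hp => (Finset.mem_union.mp hp).elim (hs p) (hQ p)
    rw [Finset.insert_union, PS_insert (by simp [ha, hd.1]), Finset.prod_insert ha, Finset.sum_insert ha]
    rw [show y + (Real.log a + ∑ p ∈ s, Real.log p) - Real.log a = y + ∑ p ∈ s, Real.log p by ring]
    have h1 := PS_mono hu (show y + ∑ p ∈ s, Real.log p ≤ y + (Real.log a + ∑ p ∈ s, Real.log p) by linarith [log_nat_nonneg a])
    calc _ = (1 + τ a) * ((∏ p ∈ s, (1 + τ p)) * PS Q τ y) := by ring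
      _ ≤ (1 + τ a) * PS (s ∪ Q) τ (y + ∑ p ∈ s, Real.log p) := by gcongr
      _ = PS (s ∪ Q) τ (y + ∑ p ∈ s, Real.log p) + τ a * PS (s ∪ Q) τ (y + ∑ p ∈ s, Real.log p) := by ring
      _ ≤ _ := by gcongr

lemma PS_add_le {Q : Finset ℕ} {x δ : ℕ → ℝ} (hx : ∀ p ∈ Q, 0 ≤ x p) (hδ : ∀ p ∈ Q, 0 ≤ δ p) (y : ℝ) :
    PS Q (fun p => x p + δ p) y ≤ (∏ p ∈ Q, (1 + δ p)) * PS Q x y := by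
  induction Q using Finset.induction_on generalizing y with
  | empty => simp [PS]
  | insert a s ha ih =>
    have hxa := hx a (Finset.mem_insert_self _ _)
    have hda := hδ a (Finset.mem_insert_self _ _)
    have hxs : ∀ p ∈ s, 0 ≤ x p := fun p hp => hx p (Finset.mem_insert_of_mem hp)
    have hds : ∀ p ∈ s, 0 ≤ δ p := fun p hp => hδ p (Finset.mem_insert_of_mem hp)
    have ih := ih hxs hds
    rw [PS_insert ha, PS_insert ha, Finset.prod_insert ha]
    have h1 := PS_mono hxs (show y - Real.log a ≤ y by linarith [log_nat_nonneg a])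
    have h2 := PS_nonneg hxs (y - Real.log a)
    have hP : 0 ≤ ∏ p ∈ s, (1 + δ p) := Finset.prod_nonneg fun p hp => by linarith [hds p hp]
    calc _ ≤ (∏ p ∈ s, (1 + δ p)) * PS s x y + (x a + δ a) * ((∏ p ∈ s, (1 + δ p)) * PS s x (y - Real.log a)) := by
          gcongr
          · exact ih y
          · exact ih _
      _ = (∏ p ∈ s, (1 + δ p)) * (PS s x y + (x a + δ a) * PS s x (y - Real.log a)) := by ring
      _ ≤ (∏ p ∈ s, (1 + δ p)) * ((1 + δ a) * (PS s x y + x a * PS s x (y - Real.log a))) := by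
          apply mul_le_mul_of_nonneg_left _ hP
          nlinarith [mul_nonneg hda (mul_nonneg hxa h2), mul_le_mul_of_nonneg_left h1 hda]
      _ = _ := by ring

lemma sum_log_eq {S : Finset ℕ} (hS : ∀ p ∈ S, p.Prime) : ∑ p ∈ S, Real.log p = Real.log (∏ p ∈ S, p : ℕ) := by
  rw [Nat.cast_prod, Real.log_prod]
  intro p hp
  exact_mod_cast (hS p hp).ne_zero

lemma prod_primes_inj {S T : Finset ℕ} (hS : ∀ p ∈ S, p.Prime) (hT : ∀ p ∈ T, p.Prime) (h : ∏ p ∈ S, p = ∏ p ∈ T, p) : S = T := by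
  rw [← Nat.primeFactors_prod hS, ← Nat.primeFactors_prod hT, h]

lemma PS_inv_upper (a R : ℕ) {y : ℝ} (hy : 0 ≤ y) : PS (Pr a R) (fun p => 1/(p:ℝ)) y ≤ 1 + y := by
  have hpr : ∀ S ∈ (Pr a R).powerset, ∀ p ∈ S, p.Prime := fun S hS p hp => (mem_Pr.mp (Finset.mem_powerset.mp hS hp)).1
  have h1 : PS (Pr a R) (fun p => 1/(p:ℝ)) y = ∑ n ∈ (((Pr a R).powerset.filter (fun S : Finset ℕ => ∑ p ∈ S, Real.log p ≤ y)).image (fun S : Finset ℕ => ∏ p ∈ S, p)), ((n:ℝ))⁻¹ := by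
    rw [Finset.sum_image, Finset.sum_filter]
    · unfold PS
      apply Finset.sum_congr rfl; intro S _
      split_ifs
      · simp
      · rfl
    · intro S hS T hT h
      simp only [Finset.coe_filter, Set.mem_ofPred_eq] at hS hT
      exact prod_primes_inj (hpr S hS.1) (hpr T hT.1) h
  have h2 := harmonic_floor_le_one_add_log (Real.exp y) (Real.one_le_exp hy)
  rw [Real.log_exp] at h2
  refine le_trans ?_ h2
  rw [h1, harmonic_eq_sum_Icc]
  push_cast
  apply Finset.sum_le_sum_of_subset_of_nonneg
  · intro n hn
    simp only [Finset.mem_image, Finset.mem_filter] at hn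
    obtain ⟨S, ⟨hS, hl⟩, rfl⟩ := hn
    rw [sum_log_eq (hpr S hS)] at hl
    have hpos : 0 < ∏ p ∈ S, p := Finset.prod_pos fun p hp => (hpr S hS p hp).pos
    rw [Finset.mem_Icc]
    refine ⟨hpos, Nat.le_floor ?_⟩
    rwa [← Real.log_le_iff_le_exp (by exact_mod_cast hpos)]
  · intro n _ _; positivity

lemma sum_inv_sq_le (N : ℕ) : ∑ b ∈ Finset.Icc 1 N, (1:ℝ)/(b:ℝ)^2 ≤ 2 := by
  rcases Nat.eq_zero_or_pos N with rfl | hN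
  · simp
  have : ∑ b ∈ Finset.Icc 1 N, (1:ℝ)/(b:ℝ)^2 ≤ 2 - 1/(N:ℝ) := by
    induction N, hN using Nat.le_induction with
    | base => simp; norm_num
    | succ n hn ih =>
      rw [Finset.sum_Icc_succ_top (by omega)]
      have hn' : (0:ℝ) < n := by exact_mod_cast hn
      have : (1:ℝ)/((n+1:ℕ):ℝ)^2 ≤ 1/(n:ℝ) - 1/((n+1:ℕ):ℝ) := by
        push_cast
        rw [div_sub_div _ _ (by positivity) (by positivity), div_le_div_iff₀ (by positivity) (by positivity)]
        nlinarith
      linarith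
  have : (0:ℝ) ≤ 1/(N:ℝ) := by positivity
  linarith

lemma PS_inv_lower {R : ℕ} {y : ℝ} (hy : 0 ≤ y) (hR : Real.exp y ≤ R) : y/2 ≤ PS (Pr 0 R) (fun p => 1/(p:ℝ)) y := by
  set N := ⌊Real.exp y⌋₊ with hN
  have hNR : N ≤ R := by
    rw [hN]; exact Nat.floor_le_of_le hR
  set Sq := (Finset.Icc 1 N).filter Squarefree with hSq
  have h1 : ∑ n ∈ Sq, (n:ℝ)⁻¹ ≤ PS (Pr 0 R) (fun p => 1/(p:ℝ)) y := by
    unfold PS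
    rw [← Finset.sum_filter]
    calc _ = ∑ n ∈ Sq, ∏ p ∈ n.primeFactors, 1/(p:ℝ) := by
          apply Finset.sum_congr rfl; intro n hn
          rw [hSq, Finset.mem_filter] at hn
          conv_lhs => rw [← Nat.prod_primeFactors_of_squarefree hn.2]
          simp
      _ = ∑ S ∈ Sq.image Nat.primeFactors, ∏ p ∈ S, 1/(p:ℝ) := by
          rw [Finset.sum_image]
          intro n hn m hm h
          rw [hSq, Finset.coe_filter] at hn hm
          rw [← Nat.prod_primeFactors_of_squarefree hn.2, ← Nat.prod_primeFactors_of_squarefree hm.2, h]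
      _ ≤ _ := by
          apply Finset.sum_le_sum_of_subset_of_nonneg
          · intro S hS
            rw [Finset.mem_image] at hS
            obtain ⟨n, hn, rfl⟩ := hS
            rw [hSq, Finset.mem_filter, Finset.mem_Icc] at hn
            rw [Finset.mem_filter, Finset.mem_powerset]
            constructor
            · intro p hp
              have hpp := Nat.prime_of_mem_primeFactors hp
              exact mem_Pr.mpr ⟨hpp, hpp.pos, (Nat.le_of_mem_primeFactors hp).trans (hn.1.2.trans hNR)⟩
            · rw [sum_log_eq (fun p hp => Nat.prime_of_mem_primeFactors hp), Nat.prod_primeFactors_of_squarefree hn.2]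
              rw [Real.log_le_iff_le_exp (by exact_mod_cast hn.1.1)]
              exact (Nat.cast_le.mpr hn.1.2).trans (Nat.floor_le (Real.exp_pos y).le)
          · intro S _ _; exact Finset.prod_nonneg fun p _ => by positivity
  have h2 := log_le_harmonic_floor (Real.exp y) (Real.exp_pos y).le
  rw [Real.log_exp, ← hN, harmonic_eq_sum_Icc] at h2
  push_cast at h2
  have h3 : ∑ n ∈ Finset.Icc 1 N, (n:ℝ)⁻¹ ≤ (∑ b ∈ Finset.Icc 1 N, (1:ℝ)/(b:ℝ)^2) * ∑ n ∈ Sq, (n:ℝ)⁻¹ := by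
    rw [Finset.sum_mul_sum, ← Finset.sum_product']
    calc _ ≤ ∑ n ∈ (Finset.Icc 1 N ×ˢ Sq).image (fun x : ℕ × ℕ => x.1^2 * x.2), ((n:ℕ):ℝ)⁻¹ := by
          apply Finset.sum_le_sum_of_subset_of_nonneg
          · intro n hn
            rw [Finset.mem_Icc] at hn
            obtain ⟨a, b, ha, hb, hab, hsq⟩ := Nat.sq_mul_squarefree_of_pos (n := n) (by omega)
            rw [Finset.mem_image]
            refine ⟨(b, a), ?_, hab⟩
            rw [Finset.mem_product, hSq, Finset.mem_filter, Finset.mem_Icc, Finset.mem_Icc]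
            have e1 : a ≤ n := by rw [← hab]; exact Nat.le_mul_of_pos_left _ (by positivity)
            have e2 : b ≤ n := by rw [← hab, sq, mul_assoc]; exact Nat.le_mul_of_pos_right _ (by positivity)
            exact ⟨⟨hb, e2.trans hn.2⟩, ⟨ha, e1.trans hn.2⟩, hsq⟩
          · intro n _ _; positivity
      _ ≤ ∑ x ∈ Finset.Icc 1 N ×ˢ Sq, (((x.1^2 * x.2 : ℕ)):ℝ)⁻¹ := Finset.sum_image_le_of_nonneg (f := fun n : ℕ => (n:ℝ)⁻¹) (fun _ _ => by positivity)
      _ = _ := by apply Finset.sum_congr rfl; intro x _; push_cast; rw [mul_inv]; simp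
  have h4 : 0 ≤ ∑ n ∈ Sq, (n:ℝ)⁻¹ := Finset.sum_nonneg fun n _ => by positivity
  have h5 := mul_le_mul_of_nonneg_right (sum_inv_sq_le N) h4
  linarith

end Pf
end

section
open Complex Filter Topology MeasureTheory
open scoped Nat
set_option linter.unusedSectionVars false
set_option linter.unusedVariables false
namespace Pf

lemma totient_prod_primes {S : Finset ℕ} (hS : ∀ p ∈ S, p.Prime) : Nat.totient (∏ p ∈ S, p) = ∏ p ∈ S, (p - 1) := by
  induction S using Finset.induction_on with
  | empty => simp
  | insert a s ha ih =>
    have hs : ∀ p ∈ s, p.Prime := fun p hp => hS p (Finset.mem_insert_of_mem hp)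
    have hap := hS a (Finset.mem_insert_self _ _)
    rw [Finset.prod_insert ha, Finset.prod_insert ha, Nat.totient_mul, Nat.totient_prime hap, ih hs]
    apply Nat.Coprime.prod_right
    intro p hp
    exact (Nat.coprime_primes hap (hs p hp)).mpr (fun h => ha (h ▸ hp))

/-- the local weight -/
noncomputable def tp (p : ℕ) : ℝ := 1 / ((p:ℝ) - 1)

lemma tp_pos {p : ℕ} (hp : 2 ≤ p) : 0 < tp p := by
  unfold tp
  have : (2:ℝ) ≤ p := by exact_mod_cast hp
  apply one_div_pos.mpr; linarith

lemma tp_nonneg_Pr {a b p : ℕ} (hp : p ∈ Pr a b) : 0 ≤ tp p := (tp_pos (mem_Pr.mp hp).1.two_le).le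

lemma totient_mul_prod {S : Finset ℕ} (hS : ∀ p ∈ S, p.Prime) :
    (Nat.totient (∏ p ∈ S, p) : ℝ) * ∏ p ∈ S, (1 + tp p) = ((∏ p ∈ S, p : ℕ) : ℝ) := by
  rw [totient_prod_primes hS]
  push_cast
  rw [← Finset.prod_mul_distrib]
  apply Finset.prod_congr rfl; intro p hp
  have h2 := (hS p hp).two_le
  have h2' : (2:ℝ) ≤ p := by exact_mod_cast h2
  rw [Nat.cast_sub (by omega), tp]
  have : (p:ℝ) - 1 ≠ 0 := by linarith
  push_cast
  field_simp
  ring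

lemma inv_totient_eq {S : Finset ℕ} (hS : ∀ p ∈ S, p.Prime) :
    1 / (Nat.totient (∏ p ∈ S, p) : ℝ) = ∏ p ∈ S, tp p := by
  rw [totient_prod_primes hS, Nat.cast_prod, one_div, ← Finset.prod_inv_distrib]
  apply Finset.prod_congr rfl; intro p hp
  rw [Nat.cast_sub (hS p hp).one_le, tp, one_div, Nat.cast_one]

lemma sum_tele (a b : ℕ) (ha : 1 ≤ a) (hab : a ≤ b) : ∑ n ∈ Finset.Ioc a b, 1/((n:ℝ)*(n-1)) = 1/(a:ℝ) - 1/b := by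
  induction b, hab using Nat.le_induction with
  | base => simp
  | succ n hn ih =>
    rw [Finset.sum_Ioc_succ_top (by omega), ih]
    have h1 : (0:ℝ) < n := by exact_mod_cast (by omega : 0 < n)
    have h2 : (0:ℝ) < a := by exact_mod_cast (by omega : 0 < a)
    push_cast
    rw [show (n:ℝ) + 1 - 1 = n by ring]
    field_simp
    ring

lemma sum_Pr_le {a : ℕ} (b : ℕ) (ha : 1 ≤ a) : ∑ p ∈ Pr a b, 1/((p:ℝ)*(p-1)) ≤ 1/(a:ℝ) := by
  have h1 : ∀ n : ℕ, 0 ≤ 1/((n:ℝ)*(n-1)) := by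
    intro n
    rcases Nat.eq_zero_or_pos n with rfl | hn
    · simp
    · have : (1:ℝ) ≤ n := by exact_mod_cast hn
      have : 0 ≤ (n:ℝ) * (n-1) := mul_nonneg (by linarith) (by linarith)
      positivity
  rcases le_or_gt a b with hab | hab
  · calc _ ≤ ∑ n ∈ Finset.Ioc a b, 1/((n:ℝ)*(n-1)) :=
          Finset.sum_le_sum_of_subset_of_nonneg (Finset.filter_subset _ _) fun n _ _ => h1 n
      _ = _ := sum_tele a b ha hab
      _ ≤ _ := by have : (0:ℝ) ≤ 1/b := by positivity
                  linarith
  · have : Pr a b = ∅ := by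
      unfold Pr; rw [Finset.Ioc_eq_empty (by omega)]; simp
    rw [this]; simp

lemma prod_Pr_le {a : ℕ} (b : ℕ) (ha : 1 ≤ a) {c : ℝ} (hc : 0 ≤ c) : ∏ p ∈ Pr a b, (1 + c/((p:ℝ)*(p-1))) ≤ Real.exp (c/a) := by
  calc _ ≤ ∏ p ∈ Pr a b, Real.exp (c * (1/((p:ℝ)*(p-1)))) := by
        apply Finset.prod_le_prod
        · intro p hp
          have : (2:ℝ) ≤ p := by exact_mod_cast (mem_Pr.mp hp).1.two_le
          have : 0 ≤ (p:ℝ) * (p-1) := mul_nonneg (by linarith) (by linarith)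
          positivity
        · intro p _
          have := Real.add_one_le_exp (c * (1/((p:ℝ)*(p-1))))
          rw [mul_one_div] at this ⊢
          linarith
    _ = Real.exp (c * ∑ p ∈ Pr a b, 1/((p:ℝ)*(p-1))) := by rw [← Real.exp_sum, Finset.mul_sum]
    _ ≤ _ := by
        apply Real.exp_le_exp.mpr
        have := mul_le_mul_of_nonneg_left (sum_Pr_le b ha) hc
        rwa [mul_one_div] at this

lemma sum_tp_sq_le {a : ℕ} (b : ℕ) (ha : 1 ≤ a) : ∑ p ∈ Pr a b, tp p^2 ≤ 2/(a:ℝ) := by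
  calc _ ≤ ∑ p ∈ Pr a b, 2 * (1/((p:ℝ)*(p-1))) := by
        apply Finset.sum_le_sum; intro p hp
        have h2 : (2:ℝ) ≤ p := by exact_mod_cast (mem_Pr.mp hp).1.two_le
        have h3 : 0 < (p:ℝ) - 1 := by linarith
        unfold tp
        rw [div_pow, one_pow, mul_one_div, div_le_div_iff₀ (by positivity) (by positivity)]
        nlinarith
    _ = 2 * ∑ p ∈ Pr a b, 1/((p:ℝ)*(p-1)) := by rw [Finset.mul_sum]
    _ ≤ 2 * (1/(a:ℝ)) := by gcongr; exact sum_Pr_le b ha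
    _ = _ := by ring

lemma PS_mono_tau {Q : Finset ℕ} {τ τ' : ℕ → ℝ} (hτ : ∀ p ∈ Q, 0 ≤ τ p) (h : ∀ p ∈ Q, τ p ≤ τ' p) (y : ℝ) : PS Q τ y ≤ PS Q τ' y := by
  apply Finset.sum_le_sum; intro S hS
  have hS := Finset.mem_powerset.mp hS
  split_ifs
  · exact Finset.prod_le_prod (fun p hp => hτ p (hS hp)) (fun p hp => h p (hS hp))
  · exact le_rfl

lemma Pr_union {a b : ℕ} (h : a ≤ b) : Pr 0 b = Pr 0 a ∪ Pr a b := by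
  ext p; simp only [Finset.mem_union, mem_Pr]
  constructor
  · rintro ⟨h1, h2, h3⟩
    by_cases hp : p ≤ a
    · exact Or.inl ⟨h1, h2, hp⟩
    · exact Or.inr ⟨h1, by omega, h3⟩
  · rintro (⟨h1, h2, h3⟩ | ⟨h1, h2, h3⟩)
    · exact ⟨h1, h2, by omega⟩
    · exact ⟨h1, h1.pos, h3⟩

lemma Pr_disj (a b : ℕ) : Disjoint (Pr 0 a) (Pr a b) := by
  rw [Finset.disjoint_left]; intro p hp hp'
  rw [mem_Pr] at hp hp'; omega

/-- the Mertens factor -/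
noncomputable def VV (a : ℕ) : ℝ := ∏ p ∈ Pr 0 a, (1 + tp p)

lemma VV_pos (a : ℕ) : 0 < VV a := Finset.prod_pos fun p hp => by linarith [tp_nonneg_Pr hp]

lemma G_lower {a R : ℕ} (h : a ≤ R) {y : ℝ} (hy : 0 ≤ y) (hR : Real.exp y ≤ R) : y / 2 ≤ VV a * PS (Pr a R) tp y := by
  refine (PS_inv_lower hy hR).trans ?_
  refine (PS_mono_tau (τ' := tp) (fun p _ => by positivity) (fun p hp => ?_) y).trans ?_
  · have h2 : (2:ℝ) ≤ p := by exact_mod_cast (mem_Pr.mp hp).1.two_le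
    unfold tp
    exact one_div_le_one_div_of_le (by linarith) (by linarith)
  · rw [Pr_union h]
    exact PS_union_le (Pr_disj a R) (fun p hp => tp_nonneg_Pr hp) (fun p hp => tp_nonneg_Pr hp) y

lemma Pr_zero (b : ℕ) : Pr 0 b = Pr 1 b := by
  ext p; simp only [mem_Pr]
  constructor
  · rintro ⟨h1, h2, h3⟩; exact ⟨h1, h1.one_lt, h3⟩
  · rintro ⟨h1, h2, h3⟩; exact ⟨h1, h1.pos, h3⟩

lemma G_upper {a R : ℕ} (h : a ≤ R) {y : ℝ} (hy : 0 ≤ y) :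
    VV a * PS (Pr a R) tp y ≤ 3 * (1 + y + ∑ p ∈ Pr 0 a, Real.log p) := by
  refine (le_PS_union (Pr_disj a R) (fun p hp => tp_nonneg_Pr hp) (fun p hp => tp_nonneg_Pr hp) y).trans ?_
  rw [← Pr_union h]
  set y' := y + ∑ p ∈ Pr 0 a, Real.log p
  have hy' : 0 ≤ y' := add_nonneg hy (Finset.sum_nonneg fun p _ => log_nat_nonneg p)
  have h1 : PS (Pr 0 R) tp y' = PS (Pr 0 R) (fun p => 1/(p:ℝ) + 1/((p:ℝ)*(p-1))) y' := by
    unfold PS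
    apply Finset.sum_congr rfl; intro S hS
    split_ifs
    · apply Finset.prod_congr rfl; intro p hp
      have h2 : (2:ℝ) ≤ p := by exact_mod_cast (mem_Pr.mp (Finset.mem_powerset.mp hS hp)).1.two_le
      have : (p:ℝ) - 1 ≠ 0 := by linarith
      unfold tp; field_simp; ring
    · rfl
  rw [h1]
  refine (PS_add_le (fun p _ => by positivity) (fun p hp => ?_) y').trans ?_
  · have h2 : (2:ℝ) ≤ p := by exact_mod_cast (mem_Pr.mp hp).1.two_le
    have : 0 ≤ (p:ℝ) * (p-1) := mul_nonneg (by linarith) (by linarith)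
    positivity
  · have h3 : ∏ p ∈ Pr 0 R, (1 + 1/((p:ℝ)*(p-1))) ≤ 3 := by
      rw [Pr_zero]
      refine (prod_Pr_le R le_rfl zero_le_one).trans ?_
      have := Real.exp_one_lt_d9
      norm_num
      linarith
    have h4 := PS_inv_upper 0 R hy'
    have h5 : 0 ≤ PS (Pr 0 R) (fun p => 1/(p:ℝ)) y' := PS_nonneg (fun p _ => by positivity) _
    calc _ ≤ 3 * (1 + y') := mul_le_mul h3 h4 h5 (by norm_num)
      _ = _ := by simp only [y']; ring

/-- total Mertens bound -/
lemma prod_tp_le {R : ℕ} (hR : 3 ≤ R) (a : ℕ) (K : ℕ) : ∏ p ∈ Pr a R, (1 + K * tp p) ≤ (1 + Real.log R)^(6*K) := by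
  have hR' : (3:ℝ) ≤ R := by exact_mod_cast hR
  have hlog : 1 ≤ Real.log R := by
    rw [Real.le_log_iff_exp_le (by linarith)]
    linarith [Real.exp_one_lt_d9]
  set σ := 1 + 1/Real.log R with hσ
  have hσ1 : 1 < σ := by rw [hσ]; have : 0 < 1/Real.log R := by positivity
                         linarith
  have h1 : ∏ p ∈ Pr a R, (1 + (p:ℝ)^(-σ)) ≤ 1 + Real.log R := by
    have e : ∏ p ∈ Pr a R, (1 + (p:ℝ)^(-σ)) = ∑ S ∈ (Pr a R).powerset, ∏ p ∈ S, (p:ℝ)^(-σ) := by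
      rw [Finset.prod_one_add]
    have hpr : ∀ S ∈ (Pr a R).powerset, ∀ p ∈ S, p.Prime := fun S hS p hp => (mem_Pr.mp (Finset.mem_powerset.mp hS hp)).1
    rw [e]
    calc _ = ∑ n ∈ (Pr a R).powerset.image (fun S => ∏ p ∈ S, p), (n:ℝ)^(-σ) := by
          rw [Finset.sum_image]
          · apply Finset.sum_congr rfl; intro S _
            rw [Nat.cast_prod, Real.finsetProd_rpow]
            intro p _; positivity
          · intro S hS T hT h
            exact prod_primes_inj (hpr S hS) (hpr T hT) h
      _ ≤ ∑' n : ℕ, (n:ℝ)^(-σ) := (summable_rpow hσ1).sum_le_tsum _ (fun n _ => by positivity)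
      _ ≤ 1 + 1/(σ-1) := tsum_rpow_neg_le hσ1
      _ = _ := by rw [hσ]; simp
  have h2 : ∀ p ∈ Pr a R, 1 + K * tp p ≤ (1 + (p:ℝ)^(-σ))^(6*K) := by
    intro p hp
    rw [mem_Pr] at hp
    have hp2 : (2:ℝ) ≤ p := by exact_mod_cast hp.1.two_le
    have hpR : (p:ℝ) ≤ R := by exact_mod_cast hp.2.2
    have hp0 : (0:ℝ) < p := by linarith
    set x := (p:ℝ)^(-σ) with hx
    have hx0 : 0 < x := by positivity
    have e1 : 1/(p:ℝ) ≤ 3 * x := by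
      have : (1/(p:ℝ)) = x * (p:ℝ)^(1/Real.log R) := by
        rw [hx, ← Real.rpow_add hp0, hσ, show -(1 + 1/Real.log R) + 1/Real.log R = -1 by ring, Real.rpow_neg_one, one_div]
      rw [this, mul_comm]
      apply mul_le_mul_of_nonneg_right _ hx0.le
      rw [Real.rpow_def_of_pos hp0]
      calc _ ≤ Real.exp 1 := by
            apply Real.exp_le_exp.mpr
            rw [mul_one_div, div_le_one (by linarith)]
            exact Real.log_le_log hp0 hpR
        _ ≤ 3 := by linarith [Real.exp_one_lt_d9]
    have e2 : 1 + tp p ≤ (1 + 1/(p:ℝ))^2 := by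
      unfold tp
      have : (0:ℝ) < p - 1 := by linarith
      rw [show 1 + 1/((p:ℝ)-1) = p/(p-1) by field_simp; ring, show (1 + 1/(p:ℝ))^2 = (p+1)^2/p^2 by field_simp,
        div_le_div_iff₀ this (by positivity)]
      nlinarith
    have e3 : 1 + 3 * x ≤ (1+x)^3 := by nlinarith [sq_nonneg x, pow_pos hx0 3]
    calc 1 + K * tp p ≤ (1 + tp p)^K := one_add_mul_le_pow (by linarith [tp_pos hp.1.two_le]) K
      _ ≤ ((1 + 1/(p:ℝ))^2)^K := by
          apply pow_le_pow_left₀ _ e2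
          linarith [tp_pos hp.1.two_le]
      _ ≤ (((1+x)^3)^2)^K := by gcongr; linarith
      _ = _ := by rw [← pow_mul, ← pow_mul]; congr 1; ring
  calc _ ≤ ∏ p ∈ Pr a R, (1 + (p:ℝ)^(-σ))^(6*K) := by
        apply Finset.prod_le_prod _ h2
        intro p hp
        have := tp_nonneg_Pr hp
        positivity
    _ = (∏ p ∈ Pr a R, (1 + (p:ℝ)^(-σ)))^(6*K) := by rw [Finset.prod_pow]
    _ ≤ _ := by
        apply pow_le_pow_left₀ _ h1
        exact Finset.prod_nonneg fun p _ => by positivity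

end Pf
end

section
open Complex Filter Topology MeasureTheory
open scoped Nat
set_option linter.unusedSectionVars false
set_option linter.unusedVariables false
namespace Pf

/-- the dyadic step function -/
noncomputable def ff (l : ℕ) (x0 x : ℝ) : ℝ := ∑ i ∈ Finset.range (l+1), (1/2:ℝ)^i * if x ≤ 2^i * x0 then 1 else 0

lemma ff_nonneg (l : ℕ) (x0 x : ℝ) : 0 ≤ ff l x0 x := by
  apply Finset.sum_nonneg; intro i _; split_ifs <;> simp

lemma ff_anti (l : ℕ) (x0 : ℝ) : Antitone (ff l x0) := by
  intro x y hxy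
  apply Finset.sum_le_sum; intro i _
  apply mul_le_mul_of_nonneg_left _ (by positivity)
  split_ifs with h1 h2 h2
  · exact le_rfl
  · exact absurd (hxy.trans h1) h2
  · norm_num
  · exact le_rfl

lemma sum_half_le (n : ℕ) : ∑ i ∈ Finset.range n, (1/2:ℝ)^i ≤ 2 := by
  have := sum_geometric_two_le n
  simpa using this

lemma ff_le_two (l : ℕ) (x0 x : ℝ) : ff l x0 x ≤ 2 := by
  refine le_trans ?_ (sum_half_le (l+1))
  apply Finset.sum_le_sum; intro i _
  apply mul_le_of_le_one_right (by positivity)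
  split_ifs <;> norm_num

lemma ff_zero {l : ℕ} {x0 x : ℝ} (h0 : 0 ≤ x0) (hx : 2^l * x0 < x) : ff l x0 x = 0 := by
  apply Finset.sum_eq_zero; intro i hi
  rw [Finset.mem_range] at hi
  rw [if_neg, mul_zero]
  rw [not_le]
  refine lt_of_le_of_lt ?_ hx
  apply mul_le_mul_of_nonneg_right _ h0
  exact pow_le_pow_right₀ (by norm_num) (by omega)

lemma sq_sum_aux (n : ℕ) (b : ℕ → ℝ) (hb : ∀ i, b i = 0 ∨ b i = 1) :
    (∑ i ∈ Finset.range n, (1/2:ℝ)^i * b i)^2 ≤ 4 * ∑ i ∈ Finset.range n, (1/4:ℝ)^i * b i := by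
  induction n generalizing b with
  | zero => simp
  | succ n ih =>
    have hb0 : ∀ i, 0 ≤ b i := fun i => by rcases hb i with h | h <;> simp [h]
    have hb1 : ∀ i, b i ≤ 1 := fun i => by rcases hb i with h | h <;> simp [h]
    rcases hb 0 with h | h
    · rw [Finset.sum_range_succ', Finset.sum_range_succ', h]
      have e1 : ∑ i ∈ Finset.range n, (1/2:ℝ)^(i+1) * b (i+1) = 1/2 * ∑ i ∈ Finset.range n, (1/2:ℝ)^i * b (i+1) := by
        rw [Finset.mul_sum]; apply Finset.sum_congr rfl; intro i _; ring
      have e2 : ∑ i ∈ Finset.range n, (1/4:ℝ)^(i+1) * b (i+1) = 1/4 * ∑ i ∈ Finset.range n, (1/4:ℝ)^i * b (i+1) := by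
        rw [Finset.mul_sum]; apply Finset.sum_congr rfl; intro i _; ring
      rw [e1, e2]
      have := ih (fun i => b (i+1)) (fun i => hb (i+1))
      nlinarith
    · have e1 : ∑ i ∈ Finset.range (n+1), (1/2:ℝ)^i * b i ≤ 2 := by
        refine le_trans ?_ (sum_half_le (n+1))
        exact Finset.sum_le_sum fun i _ => mul_le_of_le_one_right (by positivity) (hb1 i)
      have e0 : 0 ≤ ∑ i ∈ Finset.range (n+1), (1/2:ℝ)^i * b i := Finset.sum_nonneg fun i _ => mul_nonneg (by positivity) (hb0 i)
      have e2 : 1 ≤ ∑ i ∈ Finset.range (n+1), (1/4:ℝ)^i * b i := by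
        have := Finset.single_le_sum (f := fun i => (1/4:ℝ)^i * b i) (fun i _ => mul_nonneg (by positivity) (hb0 i)) (Finset.mem_range.mpr (Nat.succ_pos n))
        simpa [h] using this
      nlinarith

lemma ff_sq_le (l : ℕ) (x0 x : ℝ) : ff l x0 x^2 ≤ 4 * ∑ i ∈ Finset.range (l+1), (1/4:ℝ)^i * if x ≤ 2^i * x0 then 1 else 0 := by
  apply sq_sum_aux
  intro i; split_ifs <;> simp

lemma one_le_ff (l : ℕ) {x0 x : ℝ} (hx : x ≤ x0) : 1 ≤ ff l x0 x := by
  have := Finset.single_le_sum (f := fun i => (1/2:ℝ)^i * if x ≤ 2^i * x0 then 1 else 0) (fun i _ => by split_ifs <;> simp) (Finset.mem_range.mpr (Nat.succ_pos l))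
  simpa [hx, ff] using this

lemma sum_subtype_powerset {P : Finset ℕ} (F : Finset ℕ → ℝ) : ∑ S : Finset P, F (S.map (Function.Embedding.subtype _)) = ∑ S ∈ P.powerset, F S := by
  classical
  apply Finset.sum_bij (fun S _ => S.map (Function.Embedding.subtype _))
  · intro S _
    rw [Finset.mem_powerset]
    intro p hp
    simp at hp
    exact hp.1
  · intro S _ T _ h
    exact Finset.map_injective _ h
  · intro S hS
    rw [Finset.mem_powerset] at hS
    refine ⟨S.subtype (fun x => x ∈ P), Finset.mem_univ _, ?_⟩
    rw [Finset.subtype_map]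
    exact Finset.filter_true_of_mem hS
  · intro S _; rfl

lemma SX_eq {P : Finset ℕ} (h : ℝ → ℝ) : SX (fun p : P => tp p) (fun p : P => Real.log (p:ℕ)) h =
    ∑ S ∈ P.powerset, h (∑ p ∈ S, Real.log p) * ∏ p ∈ S, tp p := by
  rw [← sum_subtype_powerset]
  unfold SX
  apply Finset.sum_congr rfl; intro S _
  simp

lemma Y_lower {a R l : ℕ} (haR : a ≤ R) {x0 : ℝ} (h0 : 0 ≤ x0) (hR : Real.exp (2^l * x0) ≤ R) :
    (l+1) * x0 / 2 ≤ VV a * SX (fun p : Pr a R => tp p) (fun p => Real.log (p:ℕ)) (ff l x0) := by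
  rw [SX_eq]
  have e : ∑ S ∈ (Pr a R).powerset, ff l x0 (∑ p ∈ S, Real.log p) * ∏ p ∈ S, tp p =
      ∑ i ∈ Finset.range (l+1), (1/2:ℝ)^i * PS (Pr a R) tp (2^i * x0) := by
    unfold ff PS
    simp only [Finset.sum_mul, Finset.mul_sum]
    rw [Finset.sum_comm]
    apply Finset.sum_congr rfl; intro i _
    apply Finset.sum_congr rfl; intro S _
    split_ifs <;> ring
  rw [e, Finset.mul_sum]
  calc _ = ∑ i ∈ Finset.range (l+1), x0/2 := by simp; ring
    _ ≤ _ := by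
      apply Finset.sum_le_sum; intro i hi
      rw [Finset.mem_range] at hi
      have h1 : (2:ℝ)^i * x0 ≤ 2^l * x0 := by
        apply mul_le_mul_of_nonneg_right _ h0
        exact pow_le_pow_right₀ (by norm_num) (by omega)
      have := G_lower haR (y := 2^i * x0) (by positivity) ((Real.exp_le_exp.mpr h1).trans hR)
      have h2 := mul_le_mul_of_nonneg_left this (by positivity : (0:ℝ) ≤ (1/2)^i)
      calc x0/2 = (1/2)^i * (2^i * x0/2) := by
            rw [one_div, inv_pow]; field_simp
        _ ≤ _ := h2
        _ = _ := by ring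

lemma sq_sum_bound {a R l : ℕ} {x0 : ℝ} (F : Finset ℕ → ℝ) (hF : ∀ S, 0 ≤ F S) :
    ∑ S ∈ (Pr a R).powerset, (ff l x0 (∑ p ∈ S, Real.log p)^2 * ∏ p ∈ S, tp p) * F S ≤
      4 * ∑ i ∈ Finset.range (l+1), (1/4:ℝ)^i * ∑ S ∈ (Pr a R).powerset, (if ∑ p ∈ S, Real.log p ≤ 2^i * x0 then ∏ p ∈ S, tp p else 0) * F S := by
  simp only [Finset.mul_sum]
  rw [Finset.sum_comm]
  apply Finset.sum_le_sum; intro S hS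
  have h1 : 0 ≤ ∏ p ∈ S, tp p := Finset.prod_nonneg fun p hp => tp_nonneg_Pr (Finset.mem_powerset.mp hS hp)
  have h2 := mul_le_mul_of_nonneg_right (ff_sq_le l x0 (∑ p ∈ S, Real.log p)) (mul_nonneg h1 (hF S))
  calc _ = ff l x0 (∑ p ∈ S, Real.log p)^2 * ((∏ p ∈ S, tp p) * F S) := by ring
    _ ≤ _ := h2
    _ = _ := by
      rw [Finset.mul_sum, Finset.sum_mul]
      apply Finset.sum_congr rfl; intro i _
      split_ifs <;> ring

lemma G_upper' {a R : ℕ} (haR : a ≤ R) {x0 : ℝ} (h0 : 0 ≤ x0) (hx0 : 1 + ∑ p ∈ Pr 0 a, Real.log p ≤ x0) (i : ℕ) :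
    VV a * PS (Pr a R) tp (2^i * x0) ≤ 6 * (2^i * x0) := by
  refine (G_upper haR (by positivity)).trans ?_
  have : x0 ≤ 2^i * x0 := le_mul_of_one_le_left h0 (one_le_pow₀ (by norm_num))
  linarith

lemma X_upper {a R l : ℕ} (haR : a ≤ R) {x0 : ℝ} (h0 : 0 ≤ x0) (hx0 : 1 + ∑ p ∈ Pr 0 a, Real.log p ≤ x0) :
    VV a * SX (fun p : Pr a R => tp p) (fun p => Real.log (p:ℕ)) (fun x => ff l x0 x^2) ≤ 48 * x0 := by
  rw [SX_eq]
  have h1 := sq_sum_bound (a := a) (R := R) (l := l) (x0 := x0) (fun _ => 1) (fun _ => zero_le_one)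
  simp only [mul_one] at h1
  have h2 := mul_le_mul_of_nonneg_left h1 (VV_pos a).le
  refine h2.trans ?_
  calc _ = 4 * ∑ i ∈ Finset.range (l+1), (1/4:ℝ)^i * (VV a * PS (Pr a R) tp (2^i * x0)) := by
        simp only [Finset.mul_sum, PS]
        apply Finset.sum_congr rfl; intro i _
        apply Finset.sum_congr rfl; intro S _
        ring
    _ ≤ 4 * ∑ i ∈ Finset.range (l+1), (1/4:ℝ)^i * (6 * (2^i * x0)) := by
        apply mul_le_mul_of_nonneg_left _ (by norm_num)
        apply Finset.sum_le_sum; intro i _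
        exact mul_le_mul_of_nonneg_left (G_upper' haR h0 hx0 i) (by positivity)
    _ = 24 * x0 * ∑ i ∈ Finset.range (l+1), (1/2:ℝ)^i := by
        rw [Finset.mul_sum, Finset.mul_sum]
        apply Finset.sum_congr rfl; intro i _
        rw [show (1/2:ℝ)^i = (1/4)^i * 2^i by rw [← mul_pow]; norm_num]; ring
    _ ≤ 24 * x0 * 2 := by gcongr; exact sum_half_le _
    _ = _ := by ring

lemma H_upper {a R l : ℕ} (haR : a ≤ R) {x0 : ℝ} (h0 : 0 ≤ x0) (hx0 : 1 + ∑ p ∈ Pr 0 a, Real.log p ≤ x0) :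
    VV a * ∑ S : Finset (Pr a R), (ff l x0 (∑ p ∈ S, Real.log (p:ℕ))^2 * ∏ p ∈ S, tp p) * ∑ p ∈ S, Real.log (p:ℕ) ≤ 24 * (l+1) * x0^2 := by
  have e : ∑ S : Finset (Pr a R), (ff l x0 (∑ p ∈ S, Real.log (p:ℕ))^2 * ∏ p ∈ S, tp p) * ∑ p ∈ S, Real.log (p:ℕ) =
      ∑ S ∈ (Pr a R).powerset, (ff l x0 (∑ p ∈ S, Real.log p)^2 * ∏ p ∈ S, tp p) * ∑ p ∈ S, Real.log p := by
    rw [← sum_subtype_powerset]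
    apply Finset.sum_congr rfl; intro S _
    simp
  rw [e]
  have h1 := sq_sum_bound (a := a) (R := R) (l := l) (x0 := x0) (fun S => ∑ p ∈ S, Real.log p) (fun S => Finset.sum_nonneg fun p _ => log_nat_nonneg p)
  refine (mul_le_mul_of_nonneg_left h1 (VV_pos a).le).trans ?_
  have h3 : ∀ i, ∑ S ∈ (Pr a R).powerset, (if ∑ p ∈ S, Real.log p ≤ 2^i * x0 then ∏ p ∈ S, tp p else 0) * ∑ p ∈ S, Real.log p ≤ (2^i * x0) * PS (Pr a R) tp (2^i * x0) := by
    intro i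
    unfold PS
    rw [Finset.mul_sum]
    apply Finset.sum_le_sum; intro S hS
    have h1 : 0 ≤ ∏ p ∈ S, tp p := Finset.prod_nonneg fun p hp => tp_nonneg_Pr (Finset.mem_powerset.mp hS hp)
    split_ifs with h
    · rw [mul_comm]; exact mul_le_mul_of_nonneg_right h h1
    · simp
  have hV := (VV_pos a).le
  calc _ ≤ VV a * (4 * ∑ i ∈ Finset.range (l+1), (1/4:ℝ)^i * ((2^i * x0) * PS (Pr a R) tp (2^i * x0))) := by
        gcongr with i _
        exact h3 i
    _ = 4 * ∑ i ∈ Finset.range (l+1), (1/4:ℝ)^i * ((2^i * x0) * (VV a * PS (Pr a R) tp (2^i * x0))) := by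
        simp only [Finset.mul_sum]
        apply Finset.sum_congr rfl; intro i _
        ring
    _ ≤ 4 * ∑ i ∈ Finset.range (l+1), (1/4:ℝ)^i * ((2^i * x0) * (6 * (2^i * x0))) := by
        apply mul_le_mul_of_nonneg_left _ (by norm_num)
        apply Finset.sum_le_sum; intro i _
        exact mul_le_mul_of_nonneg_left (mul_le_mul_of_nonneg_left (G_upper' haR h0 hx0 i) (by positivity)) (by positivity)
    _ = 4 * ∑ i ∈ Finset.range (l+1), 6 * x0^2 := by
        congr 1
        apply Finset.sum_congr rfl; intro i _
        have : (1/4:ℝ)^i * 2^i * 2^i = 1 := by rw [← mul_pow, ← mul_pow]; norm_num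
        linear_combination 6 * x0^2 * this
    _ = _ := by simp; ring

lemma X_lower {a R l : ℕ} (haR : a ≤ R) {x0 : ℝ} (h0 : 0 ≤ x0) (hR : Real.exp x0 ≤ R) :
    x0 / 2 ≤ VV a * SX (fun p : Pr a R => tp p) (fun p => Real.log (p:ℕ)) (fun x => ff l x0 x^2) := by
  refine (G_lower haR h0 hR).trans ?_
  apply mul_le_mul_of_nonneg_left _ (VV_pos a).le
  rw [SX_eq]
  apply Finset.sum_le_sum; intro S hS
  have h1 : 0 ≤ ∏ p ∈ S, tp p := Finset.prod_nonneg fun p hp => tp_nonneg_Pr (Finset.mem_powerset.mp hS hp)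
  split_ifs with h
  · apply le_mul_of_one_le_left h1
    exact one_le_pow₀ (one_le_ff l h)
  · exact mul_nonneg (sq_nonneg _) h1

lemma one_le_SX {a R l : ℕ} {x0 : ℝ} (h0 : 0 ≤ x0) {n : ℕ} :
    1 ≤ SX (fun p : Pr a R => tp p) (fun p => Real.log (p:ℕ)) (fun x => ff l x0 x^n) := by
  rw [SX_eq]
  have := Finset.single_le_sum (f := fun S : Finset ℕ => ff l x0 (∑ p ∈ S, Real.log p)^n * ∏ p ∈ S, tp p) (s := (Pr a R).powerset)
    (fun S hS => mul_nonneg (pow_nonneg (ff_nonneg _ _ _) _) (Finset.prod_nonneg fun p hp => tp_nonneg_Pr (Finset.mem_powerset.mp hS hp))) (Finset.empty_mem_powerset _)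
  refine le_trans ?_ this
  simp
  exact one_le_pow₀ (one_le_ff l h0)

end Pf
end

section
open Complex Filter Topology MeasureTheory
open scoped Nat
set_option linter.unusedSectionVars false
set_option linter.unusedVariables false
namespace Pf

/-- sieve level cutoff -/
noncomputable def Rj (j : ℕ) : ℕ := ⌊Real.exp ((j:ℝ)/200)⌋₊
noncomputable def xj (l j : ℕ) : ℝ := ((j:ℝ)/200) / (384 * 2^l * (l+1))
noncomputable def uj (a l j : ℕ) : (Pr a (Rj j) → Option (Fin (2^l))) → ℝ :=
  uu (fun p => Real.log (p:ℕ)) (ff l (xj l j)) ((j:ℝ)/200)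
noncomputable def Ph (a l j : ℕ) (y : Pr a (Rj j) → Option (Fin (2^l))) : ℝ :=
  Phi (fun p : Pr a (Rj j) => tp p) (uj a l j) y
noncomputable def T1 (a l j : ℕ) : ℝ :=
  ∑ y, (∏ p, pm (fun (p : Pr a (Rj j)) (_ : Fin (2^l)) => 1/((p:ℕ):ℝ)) p (y p)) * Ph a l j y ^2
noncomputable def T2 (a l j : ℕ) (m : Fin (2^l)) : ℝ :=
  ∑ y, (∏ p, pm (fun (p : Pr a (Rj j)) (i : Fin (2^l)) => if i = m then 0 else tp p) p (y p)) * Ph a l j y ^2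

lemma xj_nonneg (l j : ℕ) : 0 ≤ xj l j := by unfold xj; positivity

lemma xj_tendsto (l : ℕ) : Tendsto (xj l) atTop atTop := by
  have : xj l = fun j : ℕ => (j:ℝ) * (1/(200 * (384 * 2^l * (l+1)))) := by
    ext j; unfold xj; field_simp
  rw [this]
  exact Tendsto.atTop_mul_const (by positivity) tendsto_natCast_atTop_atTop

lemma le_Rj {j : ℕ} {x : ℝ} (hx : x ≤ (j:ℝ)/200 - 1) (hj : 200 ≤ j) : Real.exp x ≤ Rj j := by
  have h1 : Real.exp ((j:ℝ)/200) < Rj j + 1 := Nat.lt_floor_add_one _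
  have h2 : Real.exp x ≤ Real.exp ((j:ℝ)/200 - 1) := Real.exp_le_exp.mpr hx
  have h3 : Real.exp ((j:ℝ)/200) = Real.exp ((j:ℝ)/200 - 1) * Real.exp 1 := by rw [← Real.exp_add]; ring_nf
  have h4 : 2 ≤ Real.exp 1 := by have := Real.add_one_le_exp 1; linarith
  have h5 : 1 ≤ Real.exp ((j:ℝ)/200 - 1) := by
    apply Real.one_le_exp
    have : (200:ℝ) ≤ j := by exact_mod_cast hj
    linarith
  nlinarith

set_option maxHeartbeats 1000000 in
lemma main_comparison {a l : ℕ} (hlr : (10000000000:ℝ) ≤ (l:ℝ)+1) (ha : 8 * 2^l * (2 * 2^l + 2) ≤ a) :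
    ∀ᶠ j : ℕ in atTop, (2:ℝ)^l/4 ≤ ∑ m, T2 a l j m - 16 * (j+1) * T1 a l j / VV a := by
  have e1 : ∀ᶠ j : ℕ in atTop, 1 + ∑ p ∈ Pr 0 a, Real.log p ≤ xj l j := (xj_tendsto l).eventually_ge_atTop _
  have e2 : ∀ᶠ j : ℕ in atTop, (a:ℝ) ≤ xj l j := (xj_tendsto l).eventually_ge_atTop _
  filter_upwards [e1, e2, eventually_ge_atTop 400] with j h1 h2 hj
  set k : ℕ := 2^l with hk
  have hkr : ((k:ℕ):ℝ) = 2^l := by rw [hk]; push_cast; rfl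
  have hk1 : (1:ℝ) ≤ k := by rw [hkr]; exact one_le_pow₀ (by norm_num)
  have hjr : (400:ℝ) ≤ j := by exact_mod_cast hj
  have har : 8 * (k:ℝ) * (2*k+2) ≤ a := by rw [hkr]; exact_mod_cast ha
  have ha1r : (1:ℝ) ≤ a := by nlinarith
  have ha1 : 1 ≤ a := by
    have : (1:ℝ) ≤ a := ha1r
    exact_mod_cast this
  have hx : (k:ℝ) * xj l j = ((j:ℝ)/200) / (384 * (l+1)) := by
    rw [hkr]; unfold xj; field_simp
  have hx0 := xj_nonneg l j
  have hkx : (k:ℝ) * xj l j ≤ (j:ℝ)/200/2 := by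
    rw [hx]; apply div_le_div_of_nonneg_left (by positivity) (by norm_num); nlinarith
  have hxk : xj l j ≤ k * xj l j := le_mul_of_one_le_left hx0 hk1
  have hR2 : Real.exp (2^l * xj l j) ≤ Rj j := by
    rw [← hkr]; apply le_Rj _ (by omega); linarith
  have hR1 : Real.exp (xj l j) ≤ Rj j := by
    apply le_Rj _ (by omega); linarith
  have haR : a ≤ Rj j := by
    have : (a:ℝ) ≤ Rj j := by
      have := Real.add_one_le_exp (xj l j); linarith
    exact_mod_cast this
  have hp2 : ∀ p : Pr a (Rj j), (2:ℝ) ≤ ((p:ℕ):ℝ) := fun p => by exact_mod_cast (mem_Pr.mp p.2).1.two_le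
  have hpa : ∀ p : Pr a (Rj j), (a:ℝ) + 1 ≤ ((p:ℕ):ℝ) := fun p => by exact_mod_cast (mem_Pr.mp p.2).2.1
  have hV := VV_pos a
  have Yl := Y_lower (l := l) haR hx0 hR2
  have Xu := X_upper (l := l) haR hx0 h1
  have Hu := H_upper (l := l) haR hx0 h1
  have Xl := X_lower (l := l) haR hx0 hR1
  have X1 := one_le_SX (a := a) (R := Rj j) (l := l) hx0 (n := 2)
  have Y1 := one_le_SX (a := a) (R := Rj j) (l := l) hx0 (n := 1)
  simp only [pow_one] at Y1
  set X := SX (fun p : Pr a (Rj j) => tp p) (fun p => Real.log (p:ℕ)) (fun x => ff l (xj l j) x^2) with hX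
  have Yl' : (l+1) * xj l j / 2 ≤ VV a * SX (fun p : Pr a (Rj j) => tp p) (fun p => Real.log (p:ℕ)) (ff l (xj l j)) := Yl
  set Y := SX (fun p : Pr a (Rj j) => tp p) (fun p => Real.log (p:ℕ)) (ff l (xj l j)) with hY
  have Y1' : 1 ≤ Y := Y1
  have hu : T1 a l j ≤ 2 * X^k := by
    have := sieve_upper (k := k) (q := fun p : Pr a (Rj j) => ((p:ℕ):ℝ)) hp2 (fun p => by have := hpa p; nlinarith) (fun p => Real.log (p:ℕ)) (ff l (xj l j)) ((j:ℝ)/200)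
    refine le_trans this ?_
    apply mul_le_mul_of_nonneg_right _ (by positivity)
    rw [Finset.prod_coe_sort (Pr a (Rj j)) (fun p : ℕ => 1 + (k:ℝ)/((p:ℝ)*((p:ℝ)-1)))]
    refine (prod_Pr_le _ ha1 (by positivity)).trans ?_
    have : Real.exp ((k:ℝ)/a) ≤ Real.exp (1/2) := by
      apply Real.exp_le_exp.mpr
      rw [div_le_iff₀ (by exact_mod_cast ha1)]
      nlinarith
    refine this.trans ?_
    have h3 : Real.exp (1/2) ^2 = Real.exp 1 := by rw [← Real.exp_nat_mul]; norm_num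
    have := Real.exp_one_lt_d9
    nlinarith [Real.exp_pos (1/2)]
  have hτ : ∑ p : Pr a (Rj j), tp p^2 ≤ 2/a := by
    rw [Finset.sum_coe_sort (Pr a (Rj j)) (fun p : ℕ => tp p^2)]
    exact sum_tp_sq_le _ ha1
  have ht0 : ∀ p : Pr a (Rj j), 0 ≤ tp p := fun p => tp_nonneg_Pr p.2
  have hlow : ∀ m, X^(k-1) * Y^2 / 2 ≤ T2 a l j m := by
    intro m
    have := sieve_lower (k := k) m (t := fun p : Pr a (Rj j) => tp p) (lg := fun p => Real.log (p:ℕ)) ht0 (fun p => by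
      have := hpa p
      unfold tp
      rw [mul_one_div, div_le_one (by linarith)]
      nlinarith) (fun p => log_nat_nonneg _) (f := ff l (xj l j)) (ff_nonneg _ _) (ff_anti _ _) (L := (j:ℝ)/200) (by linarith)
      (fun x hx => ff_zero hx0 (by rw [← hkr]; linarith)) (η := 1/(8*k)) (by positivity) (by
        have e : ((j:ℝ)/200) = 384 * k * (l+1) * xj l j := by
          rw [hkr]; unfold xj; field_simp
        have : VV a * ∑ S : Finset (Pr a (Rj j)), (ff l (xj l j) (∑ p ∈ S, Real.log (p:ℕ))^2 * ∏ p ∈ S, tp p) * ∑ p ∈ S, Real.log (p:ℕ) ≤ VV a * (1/(8*k) * ((j:ℝ)/200) * X) := by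
          refine Hu.trans ?_
          rw [e]
          have : VV a * (1/(8*(k:ℝ)) * (384 * k * (l+1) * xj l j) * X) = 48 * (l+1) * xj l j * (VV a * X) := by
            field_simp; ring
          rw [this]
          have : 0 ≤ 48 * (l+1) * xj l j := by positivity
          have := mul_le_mul_of_nonneg_left Xl this
          refine le_trans (le_of_eq ?_) this
          ring
        exact le_of_mul_le_mul_left this hV)
    refine le_trans ?_ this
    have hl2 : (k * ((k+2) * ∑ p : Pr a (Rj j), tp p^2 + 2 * (1/(8*k))) + (k:ℝ)^2 * ∑ p : Pr a (Rj j), tp p^2) ≤ 1/2 := by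
      have e : (k * ((k+2) * ∑ p : Pr a (Rj j), tp p^2 + 2 * (1/(8*k))) + (k:ℝ)^2 * ∑ p : Pr a (Rj j), tp p^2) = k*(2*k+2) * (∑ p : Pr a (Rj j), tp p^2) + 1/4 := by
        field_simp; ring
      rw [e]
      have h3 : (k:ℝ)*(2*k+2) * (∑ p : Pr a (Rj j), tp p^2) ≤ k*(2*k+2) * (2/a) := mul_le_mul_of_nonneg_left hτ (by positivity)
      have h4 : (k:ℝ)*(2*k+2) * (2/a) ≤ 1/4 := by
        rw [mul_div_assoc', div_le_iff₀ (by exact_mod_cast ha1)]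
        linarith
      linarith
    have hXY : 0 ≤ X^(k-1) * Y^2 := by positivity
    rw [div_eq_mul_inv]
    apply mul_le_mul_of_nonneg_left _ hXY
    linarith
  have hsum : (k:ℝ) * (X^(k-1) * Y^2 / 2) ≤ ∑ m, T2 a l j m := by
    have := Finset.sum_le_sum (s := Finset.univ) (fun m _ => hlow m)
    simp only [Finset.sum_const, Finset.card_univ, Fintype.card_fin, nsmul_eq_mul] at this
    exact this
  have hXk : X^k = X^(k-1) * X := by
    rw [← pow_succ]; congr 1
    have : 0 < k := by rw [hk]; positivity
    omega
  have key : 32 * (j+1) * X / VV a ≤ k * Y^2 / 4 := by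
    rw [div_le_iff₀ hV]
    have a1 : 32 * ((j:ℝ)+1) * X * VV a ≤ 32 * (j+1) * (48 * xj l j) := by
      rw [mul_assoc, mul_comm X]; gcongr
    have a2 : ((l+1) * xj l j / 2)^2 ≤ (VV a * Y)^2 := by
      apply pow_le_pow_left₀ (by positivity) Yl'
    have a3 : 32 * ((j:ℝ)+1) * (48 * xj l j) ≤ k / 4 * ((l+1) * xj l j / 2)^2 := by
      have : (k:ℝ) / 4 * ((l+1) * xj l j / 2)^2 = xj l j * ((l+1)/16 * ((l+1) * (k * xj l j))) := by ring
      rw [this, hx]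
      have : ((l:ℝ)+1) * ((j:ℝ)/200/(384*(l+1))) = j/76800 := by field_simp; norm_num
      rw [this]
      have : 32 * ((j:ℝ)+1) * 48 ≤ (l+1)/16 * (j/76800) := by nlinarith
      nlinarith
    have : 32 * ((j:ℝ)+1) * X * VV a ≤ (k * Y^2/4 * VV a) * VV a := by
      calc _ ≤ _ := a1
        _ ≤ _ := a3
        _ ≤ k/4 * (VV a * Y)^2 := by gcongr
        _ = _ := by ring
    nlinarith
  have hX1 : 1 ≤ X^(k-1) := one_le_pow₀ X1
  have b1 : 16 * (j+1) * T1 a l j / VV a ≤ X^(k-1) * (32 * (j+1) * X / VV a) := by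
    rw [mul_div_assoc', div_le_div_iff_of_pos_right hV]
    calc 16 * ((j:ℝ)+1) * T1 a l j ≤ 16 * (j+1) * (2 * X^k) := by gcongr
      _ = _ := by rw [hXk]; ring
  have b2 := mul_le_mul_of_nonneg_left key (by positivity : 0 ≤ X^(k-1))
  have b3 : (k:ℝ)/4 ≤ X^(k-1) * (k * Y^2/4) := by
    have : 1 ≤ X^(k-1) * Y^2 := by nlinarith
    nlinarith
  rw [← hkr]
  have : (k:ℝ) * (X^(k-1) * Y^2 / 2) = 2 * (X^(k-1) * (k * Y^2/4)) := by ring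
  linarith

end Pf
end

section
open Complex Filter Topology MeasureTheory
open scoped Nat
set_option linter.unusedSectionVars false
set_option linter.unusedVariables false
namespace Pf

variable {ι : Type} [Fintype ι] [DecidableEq ι] {k : ℕ}

/-- log-size of a colouring -/
noncomputable def ls (lg : ι → ℝ) (c : ι → Option (Fin k)) : ℝ := ∑ p, (c p).elim 0 (fun _ => lg p)

lemma sum_prod_pi {X : Type} [Fintype X] (F : ι → X → ℝ) : ∑ c : ι → X, ∏ p, F p (c p) = ∏ p, ∑ x, F p x := by
  classical
  rw [Finset.prod_univ_sum, Fintype.piFinset_univ]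

lemma abs_uu_le {lg : ι → ℝ} {f : ℝ → ℝ} (f0 : ∀ x, 0 ≤ f x) (f2 : ∀ x, f x ≤ 2) (L : ℝ) (c : ι → Option (Fin k)) :
    |uu lg f L c| ≤ 2^k * if ls lg c ≤ L then 1 else 0 := by
  unfold uu
  rw [abs_mul, abs_mul, Finset.abs_prod, Finset.abs_prod]
  have h1 : ∏ p, |((c p).elim 1 (fun _ => -1) : ℝ)| = 1 := by
    apply Finset.prod_eq_one; intro p _
    cases c p <;> simp
  have h2 : ∏ i : Fin k, |f (∑ p ∈ fib c i, lg p)| ≤ 2^k := by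
    calc _ ≤ ∏ i : Fin k, (2:ℝ) := by
          apply Finset.prod_le_prod (fun i _ => abs_nonneg _)
          intro i _; rw [abs_of_nonneg (f0 _)]; exact f2 _
      _ = _ := by simp
  rw [h1, one_mul]
  apply mul_le_mul h2 _ (abs_nonneg _) (by positivity)
  unfold ls
  split_ifs <;> simp

lemma sum_abs_Tm_le {t : ℝ} (ht : 0 ≤ t) (z : Option (Fin k)) : ∑ x, |Tm t x z| ≤ 1 + k * t := by
  rw [Fintype.sum_option]
  have hk : (0:ℝ) ≤ k * t := by positivity
  cases z with
  | none => simp [Tm, abs_of_nonneg ht]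
  | some i =>
    have : ∀ x, |Tm t (some x) (some i)| = if x = i then 1 else 0 := by
      intro x; unfold Tm; by_cases h : x = i <;> simp [h]
    simp only [this]
    simp [Tm, hk]

lemma lam_le {t lg : ι → ℝ} (ht : ∀ p, 0 ≤ t p) (hlg : ∀ p, 0 ≤ lg p) {f : ℝ → ℝ} (f0 : ∀ x, 0 ≤ f x) (f2 : ∀ x, f x ≤ 2) (L : ℝ)
    (z : ι → Option (Fin k)) :
    |lam t (uu lg f L) z| ≤ (2^k * ∏ p, (1 + k * t p)) * if ls lg z ≤ L then 1 else 0 := by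
  unfold lam
  calc _ ≤ ∑ c, |uu lg f L c * ∏ p, Tm (t p) (c p) (z p)| := Finset.abs_sum_le_sum_abs _ _
    _ ≤ ∑ c : ι → Option (Fin k), ((2:ℝ)^k * if ls lg z ≤ L then 1 else 0) * ∏ p, |Tm (t p) (c p) (z p)| := by
        apply Finset.sum_le_sum; intro c _
        rw [abs_mul, Finset.abs_prod]
        by_cases h : ∃ p, Tm (t p) (c p) (z p) = 0
        · obtain ⟨p, hp⟩ := h
          rw [Finset.prod_eq_zero (Finset.mem_univ p) (by rw [hp, abs_zero])]
          simp
        · push Not at h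
          apply mul_le_mul_of_nonneg_right _ (Finset.prod_nonneg fun _ _ => abs_nonneg _)
          refine (abs_uu_le f0 f2 L c).trans ?_
          apply mul_le_mul_of_nonneg_left _ (by positivity)
          have : ls lg z ≤ ls lg c := by
            apply Finset.sum_le_sum; intro p _
            have := h p
            cases hz : z p with
            | none =>
              cases hc : c p
              · simp
              · simpa using hlg p
            | some i =>
              rw [hz] at this
              have e : c p = some i := by
                by_contra hne
                apply this
                simp [Tm, hne]
              rw [e]
          split_ifs with h1 h2
          · exact le_refl _
          · exact absurd (this.trans h1) h2
          · norm_num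
          · norm_num
    _ = (2^k * if ls lg z ≤ L then 1 else 0) * ∏ p, ∑ x, |Tm (t p) x (z p)| := by
        rw [← Finset.mul_sum, sum_prod_pi (fun p x => |Tm (t p) x (z p)|)]
    _ ≤ (2^k * if ls lg z ≤ L then 1 else 0) * ∏ p, (1 + k * t p) := by
        apply mul_le_mul_of_nonneg_left
        · exact Finset.prod_le_prod (fun p _ => Finset.sum_nonneg fun _ _ => abs_nonneg _) (fun p _ => sum_abs_Tm_le (ht p) _)
        · split_ifs <;> positivity
    _ = _ := by ring

lemma count_ls {t lg : ι → ℝ} (hlt : ∀ p, Real.exp (-lg p) ≤ t p) (L : ℝ) :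
    ∑ c : ι → Option (Fin k), (if ls lg c ≤ L then (1:ℝ) else 0) ≤ Real.exp L * ∏ p, (1 + k * t p) := by
  calc _ ≤ ∑ c : ι → Option (Fin k), Real.exp L * ∏ p, (c p).elim 1 (fun _ => Real.exp (-lg p)) := by
        apply Finset.sum_le_sum; intro c _
        have e : Real.exp L * ∏ p, (c p).elim 1 (fun _ => Real.exp (-lg p)) = Real.exp (L - ls lg c) := by
          rw [sub_eq_add_neg, Real.exp_add, ls, ← Finset.sum_neg_distrib, Real.exp_sum]
          congr 1
          apply Finset.prod_congr rfl; intro p _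
          cases c p <;> simp
        rw [e]
        split_ifs with h
        · exact Real.one_le_exp (by linarith)
        · exact (Real.exp_pos _).le
    _ = Real.exp L * ∏ p, (1 + k * Real.exp (-lg p)) := by
        rw [← Finset.mul_sum, sum_prod_pi (fun p (x : Option (Fin k)) => x.elim 1 (fun _ => Real.exp (-lg p)))]
        congr 1
        apply Finset.prod_congr rfl; intro p _
        rw [Fintype.sum_option]; simp
    _ ≤ _ := by
        apply mul_le_mul_of_nonneg_left _ (Real.exp_pos _).le
        apply Finset.prod_le_prod
        · intro p _; positivity
        · intro p _
          have := hlt p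
          gcongr

open Classical in
lemma err_le {t lg : ι → ℝ} (ht : ∀ p, 0 ≤ t p) (hlg : ∀ p, 0 ≤ lg p) {f : ℝ → ℝ} (f0 : ∀ x, 0 ≤ f x) (f2 : ∀ x, f x ≤ 2) (L : ℝ)
    {Er : (ι → Option (Fin k)) → ℝ} (hE : ∀ d, 0 ≤ Er d) :
    ∑ c, ∑ c', |lam t (uu lg f L) c| * |lam t (uu lg f L) c'| * (if compat c c' then Er (jn c c') else 0) ≤
    (2^k * ∏ p, (1 + k * t p))^2 * ∑ c, ∑ c', (if ls lg c ≤ L ∧ ls lg c' ≤ L ∧ compat c c' then Er (jn c c') else 0) := by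
  rw [Finset.mul_sum]
  apply Finset.sum_le_sum; intro c _
  rw [Finset.mul_sum]
  apply Finset.sum_le_sum; intro c' _
  have h1 := lam_le ht hlg f0 f2 L c
  have h2 := lam_le ht hlg f0 f2 L c'
  set A := 2^k * ∏ p, (1 + k * t p)
  have h3 := mul_le_mul h1 h2 (abs_nonneg _) ((abs_nonneg _).trans h1)
  have h4 : (0:ℝ) ≤ if compat c c' then Er (jn c c') else 0 := by split_ifs; exacts [hE _, le_refl _]
  refine (mul_le_mul_of_nonneg_right h3 h4).trans (le_of_eq ?_)
  by_cases a1 : ls lg c ≤ L <;> by_cases a2 : ls lg c' ≤ L <;> by_cases a3 : compat c c' <;> simp only [a1, a2, a3, if_true, if_false, true_and, false_and, and_true, and_false] <;> ring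

lemma ls_nonneg {lg : ι → ℝ} (hlg : ∀ p, 0 ≤ lg p) (c : ι → Option (Fin k)) : 0 ≤ ls lg c := by
  apply Finset.sum_nonneg; intro p _
  cases c p
  · simp
  · exact hlg p

lemma ls_jn_le {lg : ι → ℝ} (hlg : ∀ p, 0 ≤ lg p) (c c' : ι → Option (Fin k)) : ls lg (jn c c') ≤ ls lg c + ls lg c' := by
  unfold ls jn
  rw [← Finset.sum_add_distrib]
  apply Finset.sum_le_sum; intro p _
  have := hlg p
  cases c p <;> cases c' p <;> simp [this]

open Classical in
lemma sum_pairs (s0 s1 : ι → ℝ) :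
    ∑ c : ι → Option (Fin k), ∑ c' : ι → Option (Fin k), (if compat c c' then ∏ p, (jn c c' p).elim (s0 p) (fun _ => s1 p) else 0) =
    ∏ p, (s0 p + 3 * k * s1 p) := by
  let F : ι → Option (Fin k) → Option (Fin k) → ℝ := fun p x x' => if x = none ∨ x' = none ∨ x = x' then (x.elim x' some).elim (s0 p) (fun _ => s1 p) else 0
  have e : ∀ c c' : ι → Option (Fin k), (if compat c c' then ∏ p, (jn c c' p).elim (s0 p) (fun _ => s1 p) else 0) = ∏ p, F p (c p) (c' p) := by
    intro c c'
    split_ifs with h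
    · apply Finset.prod_congr rfl; intro p _
      simp only [F]
      rw [if_pos (h p)]; rfl
    · unfold compat at h
      rw [not_forall] at h
      obtain ⟨p, hp⟩ := h
      symm
      apply Finset.prod_eq_zero (Finset.mem_univ p)
      simp only [F]
      rw [if_neg hp]
  simp only [e]
  calc _ = ∑ c : ι → Option (Fin k), ∏ p, ∑ x', F p (c p) x' := by
        apply Finset.sum_congr rfl; intro c _
        exact sum_prod_pi (fun p x' => F p (c p) x')
    _ = ∏ p, ∑ x, ∑ x', F p x x' := sum_prod_pi (fun p x => ∑ x', F p x x')
    _ = _ := by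
        apply Finset.prod_congr rfl; intro p _
        rw [Fintype.sum_option]
        simp only [Fintype.sum_option, F]
        simp [Finset.sum_add_distrib]
        ring

end Pf
end

section
open Complex Filter Topology MeasureTheory
open scoped Nat
set_option linter.unusedSectionVars false
set_option linter.unusedVariables false
namespace Pf

/-- primorial modulus -/
def Wa (a : ℕ) : ℕ := ∏ p ∈ Pr 0 a, p

/-- the modulus of a colouring -/
def Dd {a R k : ℕ} (d : Pr a R → Option (Fin k)) : ℕ := ∏ p, (d p).elim 1 (fun _ => (p:ℕ))

variable {a R k : ℕ}

lemma prime_of_Pr (p : Pr a R) : (p:ℕ).Prime := (mem_Pr.mp p.2).1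
lemma lt_of_Pr (p : Pr a R) : a < (p:ℕ) := (mem_Pr.mp p.2).2.1
lemma le_of_Pr (p : Pr a R) : (p:ℕ) ≤ R := (mem_Pr.mp p.2).2.2

lemma Wa_pos (a : ℕ) : 0 < Wa a := Finset.prod_pos fun p hp => (mem_Pr.mp hp).1.pos
lemma Dd_pos (d : Pr a R → Option (Fin k)) : 0 < Dd d := by
  apply Finset.prod_pos; intro p _
  cases d p
  · simp
  · exact (prime_of_Pr p).pos

lemma coprime_elim {p q : Pr a R} (hpq : p ≠ q) (x y : Option (Fin k)) :
    Nat.Coprime (x.elim 1 (fun _ => (p:ℕ))) (y.elim 1 (fun _ => (q:ℕ))) := by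
  cases x <;> cases y <;> simp
  exact (Nat.coprime_primes (prime_of_Pr p) (prime_of_Pr q)).mpr (fun h => hpq (Subtype.ext h))

lemma coprime_W (p : Pr a R) : Nat.Coprime (Wa a) p := by
  apply Nat.Coprime.prod_left
  intro q hq
  apply (Nat.coprime_primes (mem_Pr.mp hq).1 (prime_of_Pr p)).mpr
  have := (mem_Pr.mp hq).2.2
  have := lt_of_Pr p
  omega

lemma coprime_W_elim (p : Pr a R) (x : Option (Fin k)) : Nat.Coprime (Wa a) (x.elim 1 (fun _ => (p:ℕ))) := by
  cases x
  · simp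
  · exact coprime_W p

lemma coprime_W_Dd (d : Pr a R → Option (Fin k)) : Nat.Coprime (Wa a) (Dd d) :=
  Nat.Coprime.prod_right fun p _ => coprime_W_elim p _

lemma prime_dvd_W {a p : ℕ} (hp : p.Prime) : p ∣ Wa a ↔ p ≤ a := by
  constructor
  · intro h
    obtain ⟨q, hq, hd⟩ := (Prime.dvd_finsetProd_iff hp.prime _).mp h
    have := (Nat.prime_dvd_prime_iff_eq hp (mem_Pr.mp hq).1).mp hd
    rw [this]; exact (mem_Pr.mp hq).2.2
  · intro h
    exact Finset.dvd_prod_of_mem (fun p => p) (mem_Pr.mpr ⟨hp, hp.pos, h⟩)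

lemma prime_dvd_Dd {d : Pr a R → Option (Fin k)} {p : ℕ} (hp : p.Prime) (h : p ∣ Dd d) : ∃ q : Pr a R, (q:ℕ) = p ∧ d q ≠ none := by
  obtain ⟨q, hq, hd⟩ := (Prime.dvd_finsetProd_iff hp.prime _).mp h
  refine ⟨q, ?_, ?_⟩
  · cases hdq : d q with
    | none => rw [hdq] at hd; simp at hd; exact absurd hd hp.one_lt.ne'
    | some i => rw [hdq] at hd; exact ((Nat.prime_dvd_prime_iff_eq hp (prime_of_Pr q)).mp hd).symm
  · intro h; rw [h] at hd; simp at hd; exact absurd hd hp.one_lt.ne'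

lemma prime_dvd_WD_le {d : Pr a R → Option (Fin k)} (haR : a ≤ R) {p : ℕ} (hp : p.Prime) (h : p ∣ Wa a * Dd d) : p ≤ R := by
  rcases hp.dvd_mul.mp h with h | h
  · exact ((prime_dvd_W hp).mp h).trans haR
  · obtain ⟨q, hq, _⟩ := prime_dvd_Dd hp h
    rw [← hq]; exact le_of_Pr q

lemma exp_ls (d : Pr a R → Option (Fin k)) : Real.exp (ls (fun p : Pr a R => Real.log (p:ℕ)) d) = Dd d := by
  rw [ls, Real.exp_sum, Dd, Nat.cast_prod]
  apply Finset.prod_congr rfl; intro p _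
  cases d p
  · simp
  · simp
    exact Real.exp_log (by exact_mod_cast (prime_of_Pr p).pos)

lemma totient_prod_coprime {ι : Type} (S : Finset ι) (s : ι → ℕ) (h : ∀ i ∈ S, ∀ j ∈ S, i ≠ j → Nat.Coprime (s i) (s j)) :
    (∏ i ∈ S, s i).totient = ∏ i ∈ S, (s i).totient := by
  classical
  induction S using Finset.induction_on with
  | empty => simp
  | insert i S hi ih =>
    rw [Finset.prod_insert hi, Finset.prod_insert hi, Nat.totient_mul, ih]
    · intro x hx y hy; exact h x (Finset.mem_insert_of_mem hx) y (Finset.mem_insert_of_mem hy)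
    · apply Nat.Coprime.prod_right
      intro j hj
      exact h i (Finset.mem_insert_self _ _) j (Finset.mem_insert_of_mem hj) (fun e => hi (e ▸ hj))

lemma inv_totient_Dd (d : Pr a R → Option (Fin k)) : 1 / ((Dd d).totient : ℝ) = ∏ p, (d p).elim 1 (fun _ => tp p) := by
  rw [Dd, totient_prod_coprime _ _ (fun i _ j _ hij => coprime_elim hij _ _), Nat.cast_prod, one_div, ← Finset.prod_inv_distrib]
  apply Finset.prod_congr rfl; intro p _
  cases d p
  · simp
  · simp only [Option.elim, Nat.totient_prime (prime_of_Pr p), tp, one_div]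
    rw [Nat.cast_sub (prime_of_Pr p).one_le]; simp

lemma inv_totient_WD (d : Pr a R → Option (Fin k)) : 1 / ((Wa a * Dd d).totient : ℝ) = 1/((Wa a).totient:ℝ) * ∏ p, (d p).elim 1 (fun _ => tp p) := by
  rw [Nat.totient_mul (coprime_W_Dd d), ← inv_totient_Dd]
  push_cast
  rw [one_div_mul_one_div]

lemma inv_Dd (d : Pr a R → Option (Fin k)) : 1 / (Dd d : ℝ) = ∏ p, (d p).elim 1 (fun _ => 1/((p:ℕ):ℝ)) := by
  rw [Dd, Nat.cast_prod, one_div, ← Finset.prod_inv_distrib]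
  apply Finset.prod_congr rfl; intro p _
  cases d p <;> simp

open Classical in
lemma q_bound (d : Pr a R → Option (Fin k)) {q : ℕ} (hq : 0 < q) (h : q ∣ Wa a * Dd d) :
    1 ≤ √(Wa a) / √q * ∏ p, (d p).elim (if (p:ℕ) ∣ q then 0 else 1) (fun _ => if (p:ℕ) ∣ q then √((p:ℕ):ℝ) else 1) := by
  have e : ∀ p : Pr a R, (d p).elim (if (p:ℕ) ∣ q then 0 else 1) (fun _ => if (p:ℕ) ∣ q then √((p:ℕ):ℝ) else 1) =
      √((Nat.gcd q ((d p).elim 1 (fun _ => (p:ℕ))) : ℕ) : ℝ) := by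
    intro p
    cases hp : d p with
    | none =>
      have : ¬ (p:ℕ) ∣ q := by
        intro hd
        rcases (prime_of_Pr p).dvd_mul.mp (hd.trans h) with h1 | h1
        · have := (prime_dvd_W (prime_of_Pr p)).mp h1
          have := lt_of_Pr p; omega
        · obtain ⟨p', h2, h3⟩ := prime_dvd_Dd (prime_of_Pr p) h1
          rw [Subtype.ext h2] at h3
          exact h3 hp
      simp [this]
    | some i =>
      simp only [Option.elim]
      split_ifs with hd
      · rw [Nat.gcd_eq_right hd]
      · have : Nat.gcd q p = 1 := ((Nat.Prime.coprime_iff_not_dvd (prime_of_Pr p)).mpr hd).symm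
        rw [this]; simp
  simp only [e]
  have h1 : q ∣ Wa a * ∏ p, Nat.gcd q ((d p).elim 1 (fun _ => (p:ℕ))) := by
    have h2 : q.gcd (Dd d) = ∏ p, Nat.gcd q ((d p).elim 1 (fun _ => (p:ℕ))) := by
      unfold Dd
      have : ∀ S : Finset (Pr a R), q.gcd (∏ p ∈ S, (d p).elim 1 (fun _ => (p:ℕ))) = ∏ p ∈ S, Nat.gcd q ((d p).elim 1 (fun _ => (p:ℕ))) := by
        intro S
        induction S using Finset.induction_on with
        | empty => simp
        | insert i S hi ih =>
          rw [Finset.prod_insert hi, Finset.prod_insert hi, Nat.Coprime.gcd_mul, ih]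
          apply Nat.Coprime.prod_right
          intro j hj
          exact coprime_elim (fun e : i = j => hi (e ▸ hj)) _ _
      exact this _
    rw [← h2]
    have h3 : q ∣ q.gcd (Wa a) * q.gcd (Dd d) := by
      rw [← Nat.Coprime.gcd_mul _ (coprime_W_Dd d)]
      exact Nat.dvd_gcd dvd_rfl h
    exact h3.trans (mul_dvd_mul_right (Nat.gcd_dvd_right _ _) _)
  have h4 : (q:ℝ) ≤ Wa a * ∏ p, ((Nat.gcd q ((d p).elim 1 (fun _ => (p:ℕ))) : ℕ):ℝ) := by
    have := Nat.le_of_dvd (Nat.mul_pos (Wa_pos a) (Finset.prod_pos fun p _ => Nat.gcd_pos_of_pos_left _ hq)) h1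
    exact_mod_cast this
  have h5 := Real.sqrt_le_sqrt h4
  rw [Real.sqrt_mul (by positivity)] at h5
  have h6 : ∏ p, √((Nat.gcd q ((d p).elim 1 (fun _ => (p:ℕ))) : ℕ):ℝ) = √(∏ p, ((Nat.gcd q ((d p).elim 1 (fun _ => (p:ℕ))) : ℕ):ℝ)) := by
    have : ∀ S : Finset (Pr a R), ∏ p ∈ S, √((Nat.gcd q ((d p).elim 1 (fun _ => (p:ℕ))) : ℕ):ℝ) = √(∏ p ∈ S, ((Nat.gcd q ((d p).elim 1 (fun _ => (p:ℕ))) : ℕ):ℝ)) := by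
      intro S
      induction S using Finset.induction_on with
      | empty => simp
      | insert i S hi ih => rw [Finset.prod_insert hi, Finset.prod_insert hi, Real.sqrt_mul (by positivity), ih]
    exact this _
  rw [h6, div_mul_eq_mul_div, one_le_div (Real.sqrt_pos.mpr (by exact_mod_cast hq))]
  exact h5

open Classical in
/-- the colour of n at p -/
noncomputable def yy (h : Fin k → ℕ) (n : ℕ) (p : Pr a R) : Option (Fin k) :=
  if H : ∃ i, (p:ℕ) ∣ n + h i then some H.choose else none

lemma h_unique {h : Fin k → ℕ} (hinj : Function.Injective h) (ha : ∀ i, h i ≤ a) {p : Pr a R} {n : ℕ} {i i' : Fin k}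
    (h1 : (p:ℕ) ∣ n + h i) (h2 : (p:ℕ) ∣ n + h i') : i = i' := by
  apply hinj
  have e : (h i) ≡ (h i') [MOD (p:ℕ)] := by
    apply Nat.ModEq.add_left_cancel' n
    exact ((Nat.modEq_zero_iff_dvd).mpr h1).trans ((Nat.modEq_zero_iff_dvd).mpr h2).symm
  have := lt_of_Pr p
  exact Nat.ModEq.eq_of_lt_of_lt e ((ha i).trans_lt this) ((ha i').trans_lt this)

lemma yy_eq_some {h : Fin k → ℕ} (hinj : Function.Injective h) (ha : ∀ i, h i ≤ a) {p : Pr a R} {n : ℕ} {i : Fin k} :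
    yy h n p = some i ↔ (p:ℕ) ∣ n + h i := by
  unfold yy
  constructor
  · intro H
    split_ifs at H with h1
    simp at H
    rw [← H]; exact h1.choose_spec
  · intro H
    have h1 : ∃ i, (p:ℕ) ∣ n + h i := ⟨i, H⟩
    rw [dif_pos h1]
    congr 1
    exact h_unique hinj ha h1.choose_spec H

lemma residue {h : Fin k → ℕ} (hinj : Function.Injective h) (ha : ∀ i, h i ≤ a) (b : ℕ) (d : Pr a R → Option (Fin k)) :
    ∃ r : ℕ, (∀ n : ℕ, (n : ZMod (Wa a * Dd d)) = (r : ZMod (Wa a * Dd d)) ↔ (n ≡ b [MOD Wa a] ∧ ∀ p, d p = none ∨ d p = yy h n p)) ∧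
      ∀ m, Nat.Coprime (b + h m) (Wa a) → (∀ p, d p ≠ some m) → IsUnit ((r + h m : ℕ) : ZMod (Wa a * Dd d)) := by
  classical
  let s : Option (Pr a R) → ℕ := fun o => o.elim (Wa a) (fun p => (d p).elim 1 (fun _ => (p:ℕ)))
  let c : Option (Pr a R) → ℕ := fun o => o.elim b (fun p => (d p).elim 0 (fun i => ((p:ℕ)-1) * h i))
  have hco : ∀ x y : Option (Pr a R), x ≠ y → Nat.Coprime (s x) (s y) := by
    intro x y hxy
    cases x with
    | none => cases y with
      | none => exact absurd rfl hxy
      | some q => exact coprime_W_elim q _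
    | some p => cases y with
      | none => exact (coprime_W_elim p _).symm
      | some q => exact coprime_elim (fun e => hxy (by rw [e])) _ _
  have hs0 : ∀ x, s x ≠ 0 := by
    intro x
    cases x with
    | none => exact (Wa_pos a).ne'
    | some p =>
      simp only [s, Option.elim]
      cases d p
      · simp
      · exact (prime_of_Pr p).ne_zero
  obtain ⟨r, hr⟩ := Nat.chineseRemainderOfFinset c s Finset.univ (fun x _ => hs0 x) (fun x _ y _ hxy => hco x y hxy)
  have hprod : ∏ o, s o = Wa a * Dd d := by
    rw [Fintype.prod_option]; rfl
  have hmod : ∀ n : ℕ, (n : ZMod (Wa a * Dd d)) = (r : ZMod (Wa a * Dd d)) ↔ ∀ o, n ≡ r [MOD s o] := by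
    intro n
    rw [ZMod.natCast_eq_natCast_iff, ← hprod]
    constructor
    · intro H o
      exact H.of_dvd (Finset.dvd_prod_of_mem s (Finset.mem_univ o))
    · intro H
      rw [Nat.modEq_iff_dvd]
      push_cast
      apply Fintype.prod_dvd_of_coprime
      · intro x y hxy
        exact Nat.isCoprime_iff_coprime.mpr (hco x y hxy)
      · intro o
        exact (Nat.modEq_iff_dvd).mp (H o)
  have hrp : ∀ p i, d p = some i → (p:ℕ) ∣ r + h i := by
    intro p i hp
    have := hr (some p) (Finset.mem_univ _)
    simp only [s, c, Option.elim, hp] at this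
    have h2 := this.add_right (h i)
    have h3 : ((p:ℕ)-1) * h i + h i = p * h i := by
      have := (prime_of_Pr p).one_le
      obtain ⟨x, hx⟩ := Nat.exists_eq_add_of_le this
      rw [hx]; simp; ring
    rw [h3] at h2
    exact (Nat.modEq_zero_iff_dvd).mp (h2.trans ((Nat.modEq_zero_iff_dvd).mpr (dvd_mul_right _ _)))
  refine ⟨r, ?_, ?_⟩
  · intro n
    rw [hmod, Option.forall]
    apply and_congr
    · have := hr none (Finset.mem_univ _)
      exact ⟨fun H => H.trans this, fun H => H.trans this.symm⟩
    · apply forall_congr'; intro p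
      cases hp : d p with
      | none => simp [s, hp, Nat.modEq_one]
      | some i =>
        simp only [s, Option.elim, hp]
        rw [eq_comm (a := some i) (b := yy h n p), yy_eq_some hinj ha]
        have h1 := hrp p i hp
        constructor
        · intro H
          right
          have h2 := H.add_right (h i)
          exact (Nat.modEq_zero_iff_dvd).mp (h2.trans ((Nat.modEq_zero_iff_dvd).mpr h1))
        · rintro (H | H)
          · simp at H
          · apply Nat.ModEq.add_right_cancel' (h i)
            exact ((Nat.modEq_zero_iff_dvd).mpr H).trans ((Nat.modEq_zero_iff_dvd).mpr h1).symm
  · intro m hm hd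
    rw [ZMod.isUnit_iff_coprime]
    apply Nat.Coprime.mul_right
    · have h1 : r ≡ b [MOD Wa a] := hr none (Finset.mem_univ _)
      have h2 := (h1.add_right (h m)).gcd_eq
      rw [Nat.Coprime, h2]; exact hm
    · apply Nat.Coprime.prod_right
      intro p _
      cases hp : d p with
      | none => simp
      | some i =>
        simp only [Option.elim]
        apply Nat.Coprime.symm
        rw [Nat.Prime.coprime_iff_not_dvd (prime_of_Pr p)]
        intro H
        apply hd p
        rw [hp, h_unique hinj ha (hrp p i hp) H]

end Pf
end

section
open Complex Filter Topology MeasureTheory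
open ArithmeticFunction (vonMangoldt)
open scoped Nat
set_option linter.unusedSectionVars false
set_option linter.unusedVariables false
namespace Pf

variable {a R k : ℕ}

open Classical in
lemma gi_eq {ι : Type} [Fintype ι] (d y : ι → Option (Fin k)) : gi d y = if ∀ p, d p = none ∨ d p = y p then 1 else 0 := by
  unfold gi
  split_ifs with h
  · apply Finset.prod_eq_one; intro p _
    simp only [li]; rw [if_pos (h p)]
  · rw [not_forall] at h
    obtain ⟨p, hp⟩ := h
    apply Finset.prod_eq_zero (Finset.mem_univ p)
    simp only [li]; rw [if_neg hp]

/-- first weight -/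
noncomputable def w1 (a b H J n : ℕ) : ℝ := if n ≡ b [MOD Wa a] then g J (n+H) else 0
/-- second weight -/
noncomputable def w2 (a b R j h n : ℕ) : ℝ := if n ≡ b [MOD Wa a] then th R (n+h) * g j (n+h) else 0

lemma summable_w1 (a b H J : ℕ) : Summable (w1 a b H J) := by
  apply Summable.of_norm_bounded ((summable_nat_add_iff H).mpr (summable_g J))
  intro n
  unfold w1
  split_ifs
  · rw [Real.norm_of_nonneg (g_nonneg _ _)]
  · simp [g_nonneg]

lemma summable_w2 (a b R j h : ℕ) : Summable (w2 a b R j h) := by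
  apply Summable.of_norm_bounded ((summable_nat_add_iff h).mpr (summable_th_g R j))
  intro n
  have := mul_nonneg (th_nonneg R (n+h)) (g_nonneg j (n+h))
  unfold w2
  split_ifs
  · rw [Real.norm_of_nonneg this]
  · simpa using this

lemma est1 {h : Fin k → ℕ} (hinj : Function.Injective h) (ha : ∀ i, h i ≤ a) (b H J : ℕ)
    (hv : Summable (fun n => |g J (n+1+H) - g J (n+H)|)) (d : Pr a R → Option (Fin k)) :
    |∑' n, w1 a b H J n * gi d (yy h n) - (∑' n, g J (n+H)) / Wa a * nu (fun (p : Pr a R) (_ : Fin k) => 1/((p:ℕ):ℝ)) d| ≤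
      ∑' n, |g J (n+1+H) - g J (n+H)| := by
  classical
  obtain ⟨r, hr, -⟩ := residue hinj ha b d
  have : NeZero (Wa a * Dd d) := ⟨(Nat.mul_pos (Wa_pos a) (Dd_pos d)).ne'⟩
  have h1 := count_ap (f := fun n => g J (n+H)) ((summable_nat_add_iff H).mpr (summable_g J)) hv (D := Wa a * Dd d) (r : ZMod (Wa a * Dd d))
  have e1 : ∀ n, w1 a b H J n * gi d (yy h n) = if (n : ZMod (Wa a * Dd d)) = r then g J (n+H) else 0 := by
    intro n
    rw [gi_eq]
    unfold w1
    by_cases h2 : (n : ZMod (Wa a * Dd d)) = r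
    · rw [if_pos h2, if_pos ((hr n).mp h2).1, if_pos ((hr n).mp h2).2, mul_one]
    · rw [if_neg h2]
      rw [hr] at h2
      by_cases h3 : n ≡ b [MOD Wa a]
      · rw [if_neg (fun h4 => h2 ⟨h3, h4⟩), mul_zero]
      · rw [if_neg h3, zero_mul]
  simp only [e1]
  have e2 : (∑' n, g J (n+H)) / Wa a * nu (fun (p : Pr a R) (_ : Fin k) => 1/((p:ℕ):ℝ)) d = (∑' n, g J (n+H)) / ((Wa a * Dd d : ℕ):ℝ) := by
    have : nu (fun (p : Pr a R) (_ : Fin k) => 1/((p:ℕ):ℝ)) d = 1/(Dd d:ℝ) := (inv_Dd d).symm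
    rw [this]; push_cast; field_simp
  rw [e2]
  exact h1

open Classical in
/-- the error term for the prime weights -/
noncomputable def Er2 (R j N : ℕ) : ℝ :=
  1/(N.totient:ℝ) * (∑ p ∈ (PC.upto N).filter (fun p => p.q ∣ N), ‖D (tw p.χ) j‖ + ‖D (fun n => (vonMangoldt n:ℂ)) j - (j ! : ℂ)‖) + eps R j

lemma Er2_nonneg (R j N : ℕ) : 0 ≤ Er2 R j N := by
  have := eps_nonneg R j
  unfold Er2
  have : 0 ≤ ∑ p ∈ (PC.upto N).filter (fun p => p.q ∣ N), ‖D (tw p.χ) j‖ := Finset.sum_nonneg fun _ _ => norm_nonneg _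
  positivity

lemma apS_shift {N : ℕ} (R j r h : ℕ) (hh : h ≤ R) :
    apS N R j ((r + h : ℕ) : ZMod N) = ∑' n : ℕ, if (n : ZMod N) = r then th R (n+h) * g j (n+h) else 0 := by
  unfold apS
  have hs : Summable (fun n : ℕ => if (n : ZMod N) = ((r+h:ℕ) : ZMod N) then th R n * g j n else 0) := by
    apply Summable.of_norm_bounded (summable_th_g R j)
    intro n
    have := mul_nonneg (th_nonneg R n) (g_nonneg j n)
    split_ifs
    · rw [Real.norm_of_nonneg this]
    · simpa using this
  rw [← hs.sum_add_tsum_nat_add h]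
  rw [Finset.sum_eq_zero, zero_add]
  · apply tsum_congr; intro n
    push_cast
    simp
  · intro n hn
    rw [Finset.mem_range] at hn
    have : th R n = 0 := by
      unfold th; rw [if_neg]; rintro ⟨_, h1⟩; omega
    simp [this]

lemma est2 {h : Fin k → ℕ} (hinj : Function.Injective h) (ha : ∀ i, h i ≤ a) (haR : a ≤ R) (b j : ℕ) (m : Fin k)
    (hb : Nat.Coprime (b + h m) (Wa a)) (d : Pr a R → Option (Fin k)) :
    |∑' n, w2 a b R j (h m) n * gi d (yy h n) - (j ! / ((Wa a).totient:ℝ)) * nu (fun (p : Pr a R) (i : Fin k) => if i = m then 0 else tp p) d| ≤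
      Er2 R j (Wa a * Dd d) := by
  classical
  by_cases hm : ∃ p, d p = some m
  · obtain ⟨p, hp⟩ := hm
    have e1 : ∀ n, w2 a b R j (h m) n * gi d (yy h n) = 0 := by
      intro n
      rw [gi_eq]
      by_cases h1 : ∀ p, d p = none ∨ d p = yy h n p
      · have h2 := h1 p
        rw [hp] at h2
        simp at h2
        have h3 := (yy_eq_some hinj ha).mp h2.symm
        have : th R (n + h m) = 0 := by
          unfold th
          rw [if_neg]
          rintro ⟨h4, h5⟩
          have := (Nat.prime_dvd_prime_iff_eq (prime_of_Pr p) h4).mp h3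
          have := le_of_Pr p
          omega
        simp [w2, this]
      · rw [if_neg h1, mul_zero]
    have e2 : nu (fun (p : Pr a R) (i : Fin k) => if i = m then 0 else tp p) d = 0 := by
      apply Finset.prod_eq_zero (Finset.mem_univ p)
      rw [hp]; simp
    simp only [e1, e2]
    simpa using Er2_nonneg _ _ _
  · push Not at hm
    obtain ⟨r, hr, hu⟩ := residue hinj ha b d
    have : NeZero (Wa a * Dd d) := ⟨(Nat.mul_pos (Wa_pos a) (Dd_pos d)).ne'⟩
    have h1 := ap_bound (N := Wa a * Dd d) (R := R) (fun p hp hd => prime_dvd_WD_le haR hp hd) (hu m hb hm) j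
    rw [apS_shift _ _ _ _ ((ha m).trans haR)] at h1
    have e1 : ∀ n, w2 a b R j (h m) n * gi d (yy h n) = if (n : ZMod (Wa a * Dd d)) = r then th R (n+h m) * g j (n+h m) else 0 := by
      intro n
      rw [gi_eq]
      unfold w2
      by_cases h2 : (n : ZMod (Wa a * Dd d)) = r
      · rw [if_pos h2, if_pos ((hr n).mp h2).1, if_pos ((hr n).mp h2).2, mul_one]
      · rw [if_neg h2]
        rw [hr] at h2
        by_cases h3 : n ≡ b [MOD Wa a]
        · rw [if_neg (fun h4 => h2 ⟨h3, h4⟩), mul_zero]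
        · rw [if_neg h3, zero_mul]
    simp only [e1]
    have e2 : nu (fun (p : Pr a R) (i : Fin k) => if i = m then 0 else tp p) d = ∏ p, (d p).elim 1 (fun _ => tp p) := by
      apply Finset.prod_congr rfl; intro p _
      have := hm p
      cases hp : d p with
      | none => simp
      | some i =>
        rw [hp] at this
        simp at this
        simp [this]
    have hpos : (0:ℝ) < (Wa a * Dd d).totient := by
      exact_mod_cast Nat.totient_pos.mpr (Nat.mul_pos (Wa_pos a) (Dd_pos d))
    have e3 : (j ! / ((Wa a).totient:ℝ)) * nu (fun (p : Pr a R) (i : Fin k) => if i = m then 0 else tp p) d = j ! / ((Wa a * Dd d).totient : ℝ) := by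
      rw [e2, div_eq_mul_one_div _ ((Wa a * Dd d).totient : ℝ), inv_totient_WD]; ring
    rw [e3]
    set S := ∑' n : ℕ, if (n : ZMod (Wa a * Dd d)) = r then th R (n+h m) * g j (n+h m) else 0
    set N := Wa a * Dd d
    have e4 : S - j ! / (N.totient:ℝ) = 1/(N.totient:ℝ) * ((N.totient:ℝ) * S - j !) := by field_simp
    rw [e4, abs_mul, abs_of_pos (by positivity)]
    refine (mul_le_mul_of_nonneg_left h1 (by positivity)).trans (le_of_eq ?_)
    unfold Er2
    field_simp

end Pf
end

section
open Complex Filter Topology MeasureTheory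
open ArithmeticFunction (vonMangoldt)
open scoped Nat
set_option linter.unusedSectionVars false
set_option linter.unusedVariables false
namespace Pf

variable {a R k : ℕ}

noncomputable def PP (a R K : ℕ) : ℝ := ∏ p : Pr a R, (1 + K * tp p)

lemma PP_nonneg (a R K : ℕ) : 0 ≤ PP a R K := Finset.prod_nonneg fun p _ => by
  have := tp_nonneg_Pr p.2; positivity

lemma PP_le (hR : 3 ≤ R) (a K : ℕ) : PP a R K ≤ (1 + Real.log R)^(6*K) := by
  unfold PP
  rw [Finset.prod_coe_sort (Pr a R) (fun p : ℕ => 1 + (K:ℝ) * tp p)]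
  exact prod_tp_le hR a K

lemma s_bound (hka : 36 * k^2 ≤ a) (p : Pr a R) : 3 * (k:ℝ) * (tp p * √((p:ℕ):ℝ)) ≤ 1 := by
  have h1 : 36 * (k:ℝ)^2 ≤ ((p:ℕ):ℝ) := by
    have := lt_of_Pr p
    have : 36 * k^2 ≤ (p:ℕ) := by omega
    exact_mod_cast this
  have h2 : (2:ℝ) ≤ ((p:ℕ):ℝ) := by exact_mod_cast (prime_of_Pr p).two_le
  have h3 : 6 * (k:ℝ) ≤ √((p:ℕ):ℝ) := by
    apply Real.le_sqrt_of_sq_le; nlinarith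
  have h4 := Real.sq_sqrt (show (0:ℝ) ≤ ((p:ℕ):ℝ) by positivity)
  have h5 := Real.sqrt_nonneg ((p:ℕ):ℝ)
  unfold tp
  have h6 : (0:ℝ) < ((p:ℕ):ℝ) - 1 := by linarith
  rw [show 3 * (k:ℝ) * (1/(((p:ℕ):ℝ) - 1) * √((p:ℕ):ℝ)) = (3 * k * √((p:ℕ):ℝ)) / (((p:ℕ):ℝ) - 1) by ring, div_le_one h6]
  nlinarith

open Classical in
lemma Er2_le (d : Pr a R → Option (Fin k)) (j Nm : ℕ) (hN : Wa a * Dd d ≤ Nm) :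
    Er2 R j (Wa a * Dd d) ≤ 1/((Wa a).totient:ℝ) *
      (√(Wa a) * ∑ p ∈ PC.upto Nm, ‖D (tw p.χ) j‖ / √(p.q) * (∏ x, (d x).elim (if (x:ℕ) ∣ p.q then 0 else 1) (fun _ => tp x * if (x:ℕ) ∣ p.q then √((x:ℕ):ℝ) else 1))
       + ‖D (fun n => (vonMangoldt n:ℂ)) j - (j ! : ℂ)‖ * ∏ x, (d x).elim 1 (fun _ => tp x)) + eps R j := by
  unfold Er2
  rw [inv_totient_WD]
  apply add_le_add _ (le_refl _)
  rw [mul_assoc]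
  apply mul_le_mul_of_nonneg_left _ (by positivity)
  rw [mul_add]
  apply add_le_add _ (by rw [mul_comm])
  have htp : ∀ x : Pr a R, 0 ≤ tp x := fun x => tp_nonneg_Pr x.2
  have ht0 : 0 ≤ ∏ x, (d x).elim 1 (fun _ => tp x) := by
    apply Finset.prod_nonneg; intro x _
    cases d x
    · simp
    · exact htp x
  have nn : ∀ q : ℕ, 0 ≤ ∏ x, (d x).elim (if (x:ℕ) ∣ q then (0:ℝ) else 1) (fun _ => tp x * if (x:ℕ) ∣ q then √((x:ℕ):ℝ) else 1) := by
    intro q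
    apply Finset.prod_nonneg; intro x _
    have := htp x
    cases d x
    · simp only [Option.elim]; split_ifs <;> norm_num
    · simp only [Option.elim]; split_ifs <;> positivity
  rw [Finset.mul_sum, Finset.mul_sum]
  calc _ ≤ ∑ p ∈ (PC.upto (Wa a * Dd d)).filter (fun p => p.q ∣ Wa a * Dd d), √(Wa a) * (‖D (tw p.χ) j‖ / √(p.q) * (∏ x, (d x).elim (if (x:ℕ) ∣ p.q then 0 else 1) (fun _ => tp x * if (x:ℕ) ∣ p.q then √((x:ℕ):ℝ) else 1))) := by
        apply Finset.sum_le_sum; intro p hp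
        rw [Finset.mem_filter] at hp
        have hq : 0 < p.q := Nat.pos_of_dvd_of_pos hp.2 (Nat.mul_pos (Wa_pos a) (Dd_pos d))
        have h1 := q_bound d hq hp.2
        have e : (∏ x, (d x).elim (if (x:ℕ) ∣ p.q then 0 else 1) (fun _ => tp x * if (x:ℕ) ∣ p.q then √((x:ℕ):ℝ) else 1)) =
            (∏ x, (d x).elim 1 (fun _ => tp x)) * ∏ x, (d x).elim (if (x:ℕ) ∣ p.q then 0 else 1) (fun _ => if (x:ℕ) ∣ p.q then √((x:ℕ):ℝ) else 1) := by
          rw [← Finset.prod_mul_distrib]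
          apply Finset.prod_congr rfl; intro x _
          cases d x <;> simp
        rw [e]
        have h2 := mul_le_mul_of_nonneg_left h1 (mul_nonneg ht0 (norm_nonneg (D (tw p.χ) j)))
        rw [mul_one] at h2
        refine h2.trans (le_of_eq ?_)
        ring
    _ ≤ _ := by
        apply Finset.sum_le_sum_of_subset_of_nonneg
        · intro p hp
          rw [Finset.mem_filter] at hp
          exact PC.mem_upto.mpr ((PC.mem_upto.mp hp.1).trans hN)
        · intro p _ _
          have := nn p.q
          positivity

open Classical in
lemma pairs_Er2 (hka : 36 * k^2 ≤ a) (L : ℝ) (j : ℕ) :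
    ∑ c : Pr a R → Option (Fin k), ∑ c' : Pr a R → Option (Fin k),
      (if ls (fun p : Pr a R => Real.log (p:ℕ)) c ≤ L ∧ ls (fun p : Pr a R => Real.log (p:ℕ)) c' ≤ L ∧ compat c c' then Er2 R j (Wa a * Dd (jn c c')) else 0) ≤
    1/((Wa a).totient:ℝ) * (√(Wa a) * ∑ p ∈ PC.upto ⌊Wa a * Real.exp (2*L)⌋₊, ‖D (tw p.χ) j‖ / √(p.q) * PP a R (3*k)
      + ‖D (fun n => (vonMangoldt n:ℂ)) j - (j ! : ℂ)‖ * PP a R (3*k)) + eps R j * (Real.exp L * PP a R k)^2 := by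
  set lg : Pr a R → ℝ := fun p => Real.log (p:ℕ) with hlg
  have hlg0 : ∀ p, 0 ≤ lg p := fun p => log_nat_nonneg _
  set Nm := ⌊Wa a * Real.exp (2*L)⌋₊ with hNm
  have htp : ∀ x : Pr a R, 0 ≤ tp x := fun x => tp_nonneg_Pr x.2
  set F : PC → (Pr a R → Option (Fin k)) → ℝ := fun p d => ∏ x, (d x).elim (if (x:ℕ) ∣ p.q then 0 else 1) (fun _ => tp x * if (x:ℕ) ∣ p.q then √((x:ℕ):ℝ) else 1) with hF
  set G : (Pr a R → Option (Fin k)) → ℝ := fun d => ∏ x, (d x).elim 1 (fun _ => tp x) with hG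
  have hF0 : ∀ p d, 0 ≤ F p d := by
    intro q d
    apply Finset.prod_nonneg; intro x _
    have := htp x
    cases d x
    · simp only [Option.elim]; split_ifs <;> norm_num
    · simp only [Option.elim]; split_ifs <;> positivity
  have hG0 : ∀ d, 0 ≤ G d := by
    intro d
    apply Finset.prod_nonneg; intro x _
    cases d x
    · simp
    · exact htp x
  set E0 := ‖D (fun n => (vonMangoldt n:ℂ)) j - (j ! : ℂ)‖ with hE0
  have hE00 : 0 ≤ E0 := norm_nonneg _
  have heps := eps_nonneg R j
  set I : (Pr a R → Option (Fin k)) → ℝ := fun c => if ls lg c ≤ L then 1 else 0 with hI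
  have hI0 : ∀ c, 0 ≤ I c := fun c => by simp only [hI]; split_ifs <;> norm_num
  have step : ∀ c c' : Pr a R → Option (Fin k), (if ls lg c ≤ L ∧ ls lg c' ≤ L ∧ compat c c' then Er2 R j (Wa a * Dd (jn c c')) else 0) ≤
      1/((Wa a).totient:ℝ) * (√(Wa a) * ∑ p ∈ PC.upto Nm, ‖D (tw p.χ) j‖ / √(p.q) * (if compat c c' then F p (jn c c') else 0)
       + E0 * (if compat c c' then G (jn c c') else 0)) + eps R j * (I c * I c') := by
    intro c c'
    split_ifs with h1 h2 h3
    · have hle : Wa a * Dd (jn c c') ≤ Nm := by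
        rw [hNm]
        apply Nat.le_floor
        push_cast
        apply mul_le_mul_of_nonneg_left _ (by positivity)
        rw [← exp_ls]
        apply Real.exp_le_exp.mpr
        have := ls_jn_le hlg0 c c'
        linarith [h1.1, h1.2.1]
      have := Er2_le (R := R) (jn c c') j Nm hle
      have e : I c * I c' = 1 := by simp [hI, h1.1, h1.2.1]
      rw [e, mul_one]
      exact this
    · exact absurd h1.2.2 h2
    · have := hI0 c
      have := hI0 c'
      have := hG0 (jn c c')
      have : 0 ≤ ∑ p ∈ PC.upto Nm, ‖D (tw p.χ) j‖ / √(p.q) * F p (jn c c') := Finset.sum_nonneg fun p _ => mul_nonneg (by positivity) (hF0 _ _)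
      positivity
    · have := hI0 c
      have := hI0 c'
      simp only [mul_zero, Finset.sum_const_zero, add_zero, zero_add]
      positivity
  have hFs : ∀ p : PC, ∑ c : Pr a R → Option (Fin k), ∑ c' : Pr a R → Option (Fin k), (if compat c c' then F p (jn c c') else 0) ≤ PP a R (3*k) := by
    intro p
    simp only [hF]
    rw [sum_pairs]
    apply Finset.prod_le_prod
    · intro x _
      have := htp x
      split_ifs <;> positivity
    · intro x _
      have h1 := htp x
      have h2 := s_bound hka x
      push_cast
      have h3 : 0 ≤ 3 * (k:ℝ) * tp x := by positivity
      split_ifs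
      · linarith
      · rw [mul_one]
  have hGs : ∑ c : Pr a R → Option (Fin k), ∑ c' : Pr a R → Option (Fin k), (if compat c c' then G (jn c c') else 0) = PP a R (3*k) := by
    simp only [hG]
    rw [sum_pairs]
    unfold PP
    push_cast; rfl
  have hIs : ∑ c, I c ≤ Real.exp L * PP a R k := by
    apply count_ls (k := k) (t := fun p : Pr a R => tp p)
    intro p
    have h2 : (2:ℝ) ≤ ((p:ℕ):ℝ) := by exact_mod_cast (prime_of_Pr p).two_le
    rw [Real.exp_neg, hlg, Real.exp_log (by linarith), tp, ← one_div]
    apply one_div_le_one_div_of_le <;> linarith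
  calc _ ≤ ∑ c, ∑ c', (1/((Wa a).totient:ℝ) * (√(Wa a) * ∑ p ∈ PC.upto Nm, ‖D (tw p.χ) j‖ / √(p.q) * (if compat c c' then F p (jn c c') else 0)
       + E0 * (if compat c c' then G (jn c c') else 0)) + eps R j * (I c * I c')) :=
        Finset.sum_le_sum fun c _ => Finset.sum_le_sum fun c' _ => step c c'
    _ = 1/((Wa a).totient:ℝ) * (√(Wa a) * ∑ p ∈ PC.upto Nm, ‖D (tw p.χ) j‖ / √(p.q) * (∑ c, ∑ c', if compat c c' then F p (jn c c') else 0)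
       + E0 * (∑ c, ∑ c', if compat c c' then G (jn c c') else 0)) + eps R j * (∑ c, I c)^2 := by
        have e3 : (∑ c, I c)^2 = ∑ c, ∑ c', I c * I c' := by rw [sq, Finset.sum_mul_sum]
        rw [e3]
        have e4 : ∑ p ∈ PC.upto Nm, ‖D (tw p.χ) j‖ / √(p.q) * (∑ c, ∑ c', if compat c c' then F p (jn c c') else 0) =
            ∑ c, ∑ c', ∑ p ∈ PC.upto Nm, ‖D (tw p.χ) j‖ / √(p.q) * (if compat c c' then F p (jn c c') else 0) := by
          simp only [Finset.mul_sum]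
          rw [Finset.sum_comm]
          apply Finset.sum_congr rfl; intro c _
          rw [Finset.sum_comm]
        rw [e4]
        simp only [Finset.sum_add_distrib, ← Finset.mul_sum]
    _ ≤ _ := by
        rw [hGs]
        have h6 : 0 ≤ ∑ c, I c := Finset.sum_nonneg fun c _ => hI0 c
        have h7 : ∑ p ∈ PC.upto Nm, ‖D (tw p.χ) j‖ / √(p.q) * (∑ c, ∑ c', if compat c c' then F p (jn c c') else 0) ≤ ∑ p ∈ PC.upto Nm, ‖D (tw p.χ) j‖ / √(p.q) * PP a R (3*k) :=
          Finset.sum_le_sum fun p _ => mul_le_mul_of_nonneg_left (hFs p) (by positivity)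
        have h8 : (∑ c, I c)^2 ≤ (Real.exp L * PP a R k)^2 := pow_le_pow_left₀ h6 hIs 2
        gcongr

open Classical in
lemma pairs_const (L V : ℝ) (hV : 0 ≤ V) :
    ∑ c : Pr a R → Option (Fin k), ∑ c' : Pr a R → Option (Fin k),
      (if ls (fun p : Pr a R => Real.log (p:ℕ)) c ≤ L ∧ ls (fun p : Pr a R => Real.log (p:ℕ)) c' ≤ L ∧ compat c c' then V else 0) ≤
    V * (Real.exp L * PP a R k)^2 := by
  set lg : Pr a R → ℝ := fun p => Real.log (p:ℕ) with hlg
  set I : (Pr a R → Option (Fin k)) → ℝ := fun c => if ls lg c ≤ L then 1 else 0 with hI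
  have hI0 : ∀ c, 0 ≤ I c := fun c => by simp only [hI]; split_ifs <;> norm_num
  have hIs : ∑ c, I c ≤ Real.exp L * PP a R k := by
    apply count_ls (k := k) (t := fun p : Pr a R => tp p)
    intro p
    have h2 : (2:ℝ) ≤ ((p:ℕ):ℝ) := by exact_mod_cast (prime_of_Pr p).two_le
    rw [Real.exp_neg, hlg, Real.exp_log (by linarith), tp, ← one_div]
    apply one_div_le_one_div_of_le <;> linarith
  have h6 : 0 ≤ ∑ c, I c := Finset.sum_nonneg fun c _ => hI0 c
  calc _ ≤ ∑ c, ∑ c', V * (I c * I c') := by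
        apply Finset.sum_le_sum; intro c _
        apply Finset.sum_le_sum; intro c' _
        have := hI0 c
        have := hI0 c'
        split_ifs with h
        · simp [hI, h.1, h.2.1]
        · positivity
    _ = V * (∑ c, I c)^2 := by
        rw [sq, Finset.sum_mul_sum]
        simp only [Finset.mul_sum]
    _ ≤ _ := mul_le_mul_of_nonneg_left (pow_le_pow_left₀ h6 hIs 2) hV

end Pf
end

section
open Complex Filter Topology MeasureTheory
open ArithmeticFunction (vonMangoldt)
open scoped Nat
set_option linter.unusedSectionVars false
set_option linter.unusedVariables false
namespace Pf

lemma small_geo {r : ℝ} (h0 : 0 ≤ r) (h1 : r < 1) (C : ℝ) (m : ℕ) {δ : ℝ} (hδ : 0 < δ) :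
    ∀ᶠ j : ℕ in atTop, C * (1+(j:ℝ))^m * r^j ≤ δ := by
  have h := tendsto_pow_const_mul_const_pow_of_abs_lt_one m (abs_lt.mpr ⟨by linarith, h1⟩ : |r| < 1)
  have h2 := h.const_mul (|C| * 2^m)
  rw [mul_zero] at h2
  filter_upwards [h2.eventually_lt_const hδ, eventually_ge_atTop 1] with j hj h3
  refine le_trans ?_ hj.le
  have h3' : (1:ℝ) ≤ j := by exact_mod_cast h3
  have : (1+(j:ℝ))^m ≤ (2*j)^m := pow_le_pow_left₀ (by positivity) (by linarith) m
  calc C * (1+(j:ℝ))^m * r^j ≤ |C| * (2*j)^m * r^j := by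
        have := le_abs_self C
        gcongr
    _ = _ := by rw [mul_pow]; ring

lemma small_pol (C : ℝ) (m : ℕ) {δ : ℝ} (hδ : 0 < δ) :
    ∀ᶠ j : ℕ in atTop, C * (1+(j:ℝ))^m / (j:ℝ)^(m+1) ≤ δ := by
  have h : Tendsto (fun j : ℕ => |C| * 2^m / (j:ℝ)) atTop (𝓝 0) := tendsto_const_div_atTop_nhds_zero_nat _
  filter_upwards [h.eventually_lt_const hδ, eventually_ge_atTop 1] with j hj h3
  refine le_trans ?_ hj.le
  have h3' : (1:ℝ) ≤ j := by exact_mod_cast h3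
  have : (1+(j:ℝ))^m ≤ (2*j)^m := pow_le_pow_left₀ (by positivity) (by linarith) m
  calc C * (1+(j:ℝ))^m / (j:ℝ)^(m+1) ≤ |C| * (2*j)^m / (j:ℝ)^(m+1) := by
        have := le_abs_self C
        gcongr
    _ = _ := by rw [mul_pow]; field_simp; ring

noncomputable def S1 (a l j b : ℕ) (h : Fin (2^l) → ℕ) : ℝ := ∑' n, w1 a b a (j+1) n * Ph a l j (yy h n)^2
noncomputable def S2 (a l j b : ℕ) (h : Fin (2^l) → ℕ) (m : Fin (2^l)) : ℝ := ∑' n, w2 a b (Rj j) j (h m) n * Ph a l j (yy h n)^2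

lemma Rj_le (j : ℕ) : (Rj j : ℝ) ≤ Real.exp ((j:ℝ)/200) := Nat.floor_le (Real.exp_pos _).le

lemma exp_div (j : ℕ) (c : ℝ) : Real.exp ((j:ℝ)*c) = Real.exp c ^ j := by rw [← Real.exp_nat_mul]

lemma PP_le' {j : ℕ} (hR : 3 ≤ Rj j) (a K : ℕ) : PP a (Rj j) K ≤ (1+(j:ℝ))^(6*K) := by
  refine (PP_le hR a K).trans ?_
  apply pow_le_pow_left₀
  · have := log_nat_nonneg (Rj j); linarith
  · have h1 : Real.log (Rj j) ≤ (j:ℝ)/200 := by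
      rw [Real.log_le_iff_le_exp (by exact_mod_cast (by omega : 0 < Rj j))]
      exact Rj_le j
    have : (0:ℝ) ≤ j := by positivity
    linarith

lemma ev_Rj (c : ℕ) : ∀ᶠ j : ℕ in atTop, c ≤ Rj j := by
  have h := exp_ev (c : ℝ) (c := 1/200) (by norm_num)
  filter_upwards [h] with j hj
  apply Nat.le_floor
  rw [show (j:ℝ)/200 = 1/200*j by ring]; exact hj

lemma bound1 (k : ℕ) (C : ℝ) (hC : 0 ≤ C) {δ : ℝ} (hδ : 0 < δ) : ∀ᶠ j : ℕ in atTop, ∀ x V : ℝ, 0 ≤ x → x ≤ (1+(j:ℝ))^(6*k) →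
    V ≤ C * (j+1)! / (19/10:ℝ)^(j+1) → (2^k * x)^2 * (V * (Real.exp ((j:ℝ)/200) * x)^2) ≤ δ * j ! := by
  have hr : Real.exp (1/100) / (19/10) < 1 := by
    have := Real.exp_bound_div_one_sub_of_interval (x := 1/100) (by norm_num) (by norm_num)
    rw [div_lt_one (by norm_num)]
    refine this.trans_lt (by norm_num)
  filter_upwards [small_geo (by positivity) hr (C * 4^k) (24*k+1) hδ] with j hj x V hx0 hx hV
  have hj0 : (0:ℝ) ≤ j := by positivity
  have e1 : (2^k * x)^2 * (V * (Real.exp ((j:ℝ)/200) * x)^2) = V * (4^k * x^4 * Real.exp (1/100)^j) := by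
    rw [← exp_div, show (j:ℝ) * (1/100) = (j:ℝ)/200 + (j:ℝ)/200 by ring, Real.exp_add, show (4:ℝ) = 2^2 by norm_num, ← pow_mul]
    ring
  rw [e1]
  have hV' : V ≤ C * (1+j) * j ! / (19/10:ℝ)^j := by
    refine hV.trans ?_
    rw [Nat.factorial_succ]
    push_cast
    rw [pow_succ]
    have : C * (((j:ℝ)+1) * j !) / ((19/10:ℝ)^j * (19/10)) ≤ C * (((j:ℝ)+1) * j !) / (19/10:ℝ)^j := by
      apply div_le_div_of_nonneg_left (by positivity) (by positivity)
      have : (0:ℝ) < (19/10:ℝ)^j := by positivity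
      linarith
    refine this.trans (le_of_eq ?_); ring
  calc V * (4^k * x^4 * Real.exp (1/100)^j) ≤ (C * (1+j) * j ! / (19/10:ℝ)^j) * (4^k * ((1+(j:ℝ))^(6*k))^4 * Real.exp (1/100)^j) := by
        gcongr
    _ = (C * 4^k * (1+(j:ℝ))^(24*k+1) * (Real.exp (1/100) / (19/10))^j) * j ! := by
        rw [div_pow (Real.exp (1/100)) (19/10) j, ← pow_mul, show 6*k*4 = 24*k by ring, pow_succ]
        generalize ((19/10:ℝ))^j = z
        ring
    _ ≤ _ := by gcongr

lemma bound2 (k : ℕ) (C : ℝ) (hC : 0 ≤ C) {ρ : ℝ} (hρ : 1 < ρ) (W : ℝ) {δ : ℝ} (hδ : 0 < δ) : ∀ᶠ j : ℕ in atTop, ∀ x y Q E0 ep ph : ℝ, 0 ≤ x → x ≤ (1+(j:ℝ))^(6*k) →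
    0 ≤ y → y ≤ (1+(j:ℝ))^(6*(3*k)) → 0 ≤ ph → ph ≤ 1 → 0 ≤ Q → Q ≤ j ! / (j:ℝ)^(30*k+1) → 0 ≤ E0 → E0 ≤ j ! * C / ρ^j →
    ep ≤ C * (Rj j + 1) * j ! / (7/5:ℝ)^j →
    (2^k * x)^2 * (ph * (√W * (Q * y) + E0 * y) + ep * (Real.exp ((j:ℝ)/200) * x)^2) ≤ δ * j ! := by
  have hr : Real.exp (3/200) / (7/5) < 1 := by
    have := Real.exp_bound_div_one_sub_of_interval (x := 3/200) (by norm_num) (by norm_num)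
    rw [div_lt_one (by norm_num)]
    refine this.trans_lt (by norm_num)
  have hρ1 : ρ⁻¹ < 1 := inv_lt_one_of_one_lt₀ hρ
  have hρ0 : 0 < ρ := by linarith
  filter_upwards [small_geo (by positivity) hr (2 * C * 4^k) (24*k) (show 0 < δ/3 by linarith),
    small_geo (by positivity) hρ1 (C * 4^k) (30*k) (show 0 < δ/3 by linarith),
    small_pol (4^k * √W) (30*k) (show 0 < δ/3 by linarith)] with j b3 b2 b1 x y Q E0 ep ph hx0 hx hy0 hy hp0 hp hQ0 hQ hE0 hE hep
  have hj0 : (0:ℝ) ≤ j := by positivity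
  have e1 : (2^k * x)^2 * (ph * (√W * (Q * y) + E0 * y) + ep * (Real.exp ((j:ℝ)/200) * x)^2) =
     ph * (4^k * √W * Q * (x^2*y)) + ph * (4^k * E0 * (x^2*y)) + ep * (4^k * x^4 * Real.exp (1/100)^j) := by
    rw [← exp_div, show (j:ℝ) * (1/100) = (j:ℝ)/200 + (j:ℝ)/200 by ring, Real.exp_add, show (4:ℝ) = 2^2 by norm_num, ← pow_mul]
    ring
  rw [e1]
  have hxy : x^2 * y ≤ (1+(j:ℝ))^(30*k) := by
    calc x^2*y ≤ ((1+(j:ℝ))^(6*k))^2 * (1+(j:ℝ))^(6*(3*k)) := by gcongr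
      _ = _ := by rw [← pow_mul, ← pow_add]; congr 1; ring
  have hxy0 : 0 ≤ x^2*y := by positivity
  have c1 : ph * (4^k * √W * Q * (x^2*y)) ≤ δ/3 * j ! := by
    calc ph * (4^k * √W * Q * (x^2*y)) ≤ 1 * (4^k * √W * (j ! / (j:ℝ)^(30*k+1)) * (1+(j:ℝ))^(30*k)) := by gcongr
      _ = (4^k * √W * (1+(j:ℝ))^(30*k) / (j:ℝ)^(30*k+1)) * j ! := by ring
      _ ≤ _ := by gcongr
  have c2 : ph * (4^k * E0 * (x^2*y)) ≤ δ/3 * j ! := by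
    calc ph * (4^k * E0 * (x^2*y)) ≤ 1 * (4^k * (j ! * C / ρ^j) * (1+(j:ℝ))^(30*k)) := by gcongr
      _ = (C * 4^k * (1+(j:ℝ))^(30*k) * ρ⁻¹^j) * j ! := by rw [inv_pow]; ring
      _ ≤ _ := by gcongr
  have c3 : ep * (4^k * x^4 * Real.exp (1/100)^j) ≤ δ/3 * j ! := by
    have h1 : (Rj j : ℝ) + 1 ≤ 2 * Real.exp (1/200)^j := by
      rw [← exp_div, show (j:ℝ) * (1/200) = (j:ℝ)/200 by ring]
      have := Rj_le j
      have : 1 ≤ Real.exp ((j:ℝ)/200) := Real.one_le_exp (by positivity)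
      linarith
    calc ep * (4^k * x^4 * Real.exp (1/100)^j) ≤ (C * (2 * Real.exp (1/200)^j) * j ! / (7/5:ℝ)^j) * (4^k * ((1+(j:ℝ))^(6*k))^4 * Real.exp (1/100)^j) := by
          gcongr
          exact hep.trans (by gcongr)
      _ = (2 * C * 4^k * (1+(j:ℝ))^(24*k) * (Real.exp (3/200) / (7/5))^j) * j ! := by
          rw [show (3/200:ℝ) = 1/200 + 1/100 by norm_num, Real.exp_add, div_pow (Real.exp (1/200)*Real.exp (1/100)) (7/5) j, mul_pow (Real.exp (1/200)), ← pow_mul, show 6*k*4 = 24*k by ring]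
          generalize ((7/5:ℝ))^j = z
          ring
      _ ≤ _ := by gcongr
  linarith

theorem errors {a l : ℕ} (hka : 36 * (2^l)^2 ≤ a) {δ : ℝ} (hδ : 0 < δ) :
    ∃ᶠ j : ℕ in atTop, ∀ (b : ℕ) (h : Fin (2^l) → ℕ), Function.Injective h → (∀ i, h i ≤ a) →
      |S1 a l j b h - (∑' n, g (j+1) (n+a)) / Wa a * T1 a l j| ≤ δ * j ! ∧
      ∀ m, Nat.Coprime (b + h m) (Wa a) → |S2 a l j b h m - j ! / ((Wa a).totient:ℝ) * T2 a l j m| ≤ δ * j ! := by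
  classical
  obtain ⟨C1, hC1, hv⟩ := var_g
  obtain ⟨C2, hC2, he⟩ := eps_le
  obtain ⟨ρ, C3, hρ, hm⟩ := main_term
  have hfr := bv (30 * 2^l + 1)
  have hW := exp_ev (Wa a : ℝ) (c := 1/900) (by norm_num)
  refine (hfr.and_eventually (hW.and ((ev_Rj 3).and ((ev_Rj a).and ((bound1 (2^l) C1 hC1.le hδ).and
    (bound2 (2^l) (max C2 |C3|) (le_max_of_le_left hC2.le) hρ (Wa a) hδ)))))).mono ?_
  rintro j ⟨hbv, hWj, hR3, hRa, hb1, hb2⟩ b h hinj ha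
  have htp : ∀ x : Pr a (Rj j), 0 ≤ tp x := fun x => tp_nonneg_Pr x.2
  have hP0 := PP_nonneg a (Rj j) (2^l)
  have hP := PP_le' hR3 a (2^l)
  have hPe : PP a (Rj j) (2^l) = ∏ p : Pr a (Rj j), (1 + ((2^l:ℕ):ℝ) * tp p) := rfl
  constructor
  · obtain ⟨hs, hV⟩ := hv j a
    set V := ∑' n, |g (j+1) (n+1+a) - g (j+1) (n+a)| with hVd
    have hV0 : 0 ≤ V := tsum_nonneg fun n => abs_nonneg _
    have h1 := transfer (fun p : Pr a (Rj j) => tp p) (uj a l j) (fun (p : Pr a (Rj j)) (_ : Fin (2^l)) => 1/((p:ℕ):ℝ))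
      (summable_w1 a b a (j+1)) (fun n => yy h n) ((∑' n, g (j+1) (n+a)) / Wa a) (fun _ => V) (fun d => est1 hinj ha b a (j+1) hs d)
    refine le_trans h1 ?_
    refine (err_le htp (fun p => log_nat_nonneg _) (ff_nonneg l (xj l j)) (ff_le_two l (xj l j)) ((j:ℝ)/200) (fun _ => hV0)).trans ?_
    refine (mul_le_mul_of_nonneg_left (pairs_const ((j:ℝ)/200) V hV0) (sq_nonneg _)).trans ?_
    rw [← hPe]
    exact hb1 _ V hP0 hP hV
  · intro m hb
    have h1 := transfer (fun p : Pr a (Rj j) => tp p) (uj a l j) (fun (p : Pr a (Rj j)) (i : Fin (2^l)) => if i = m then 0 else tp p)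
      (summable_w2 a b (Rj j) j (h m)) (fun n => yy h n) (j ! / ((Wa a).totient:ℝ)) (fun d => Er2 (Rj j) j (Wa a * Dd d)) (fun d => est2 hinj ha hRa b j m hb d)
    refine le_trans h1 ?_
    have h2 := err_le (k := 2^l) (t := fun p : Pr a (Rj j) => tp p) (lg := fun p : Pr a (Rj j) => Real.log (p:ℕ)) htp (fun p => log_nat_nonneg _) (f := ff l (xj l j)) (ff_nonneg l (xj l j)) (ff_le_two l (xj l j)) ((j:ℝ)/200)
      (Er := fun d => Er2 (Rj j) j (Wa a * Dd d)) (fun d => Er2_nonneg _ _ _)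
    refine le_trans h2 ?_
    refine (mul_le_mul_of_nonneg_left (pairs_Er2 hka ((j:ℝ)/200) j) (sq_nonneg _)).trans ?_
    rw [← hPe, ← Finset.sum_mul]
    have hQ := hbv ⌊Wa a * Real.exp (2 * ((j:ℝ)/200))⌋₊ (by
      refine (Nat.floor_le (by positivity)).trans ?_
      calc (Wa a:ℝ) * Real.exp (2 * ((j:ℝ)/200)) ≤ Real.exp (1/900 * j) * Real.exp (2 * ((j:ℝ)/200)) := by gcongr
        _ = _ := by rw [← Real.exp_add]; congr 1; ring)
    have hph : 1 / ((Wa a).totient:ℝ) ≤ 1 := by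
      have : 0 < (Wa a).totient := Nat.totient_pos.mpr (Wa_pos a)
      have : (1:ℝ) ≤ (Wa a).totient := by exact_mod_cast this
      exact (div_le_one (by linarith)).mpr this
    refine hb2 _ _ _ _ _ _ hP0 hP (PP_nonneg _ _ _) (PP_le' hR3 a (3*2^l)) (by positivity) hph (Finset.sum_nonneg fun p _ => by positivity) hQ (norm_nonneg _) ?_ ?_
    · refine (hm j).trans ?_
      have hρ0 : 0 < ρ := by linarith
      gcongr
      exact (le_abs_self _).trans (le_max_right _ _)
    · refine (he (Rj j) j).trans ?_
      gcongr
      exact le_max_left _ _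

end Pf
end

section
open Complex Filter Topology MeasureTheory
open ArithmeticFunction (vonMangoldt)
open scoped Nat
set_option linter.unusedSectionVars false
set_option linter.unusedVariables false
namespace Pf

lemma th_g_le {n a h R j : ℕ} (ha : h ≤ a) (hna : a ≤ n) (hn : 0 < n) : th R (n+h) * g j (n+h) ≤ 4 * g (j+1) (n+a) := by
  have h0 : 0 ≤ Real.log ((n+h:ℕ):ℝ) := Real.log_natCast_nonneg _
  have hn' : (0:ℝ) < n := by exact_mod_cast hn
  have hlog : Real.log ((n+h:ℕ):ℝ) ≤ Real.log ((n+a:ℕ):ℝ) := by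
    apply Real.log_le_log
    · push_cast; positivity
    · exact_mod_cast (by omega : n + h ≤ n + a)
  have h1 : th R (n+h) ≤ Real.log ((n+h:ℕ):ℝ) := by
    unfold th; split_ifs
    · exact le_rfl
    · exact h0
  refine (mul_le_mul_of_nonneg_right h1 (g_nonneg _ _)).trans ?_
  unfold g
  have h2 : Real.log ((n+h:ℕ):ℝ) * (Real.log ((n+h:ℕ):ℝ)^j / ((n+h:ℕ):ℝ)^2) = Real.log ((n+h:ℕ):ℝ)^(j+1) / ((n+h:ℕ):ℝ)^2 := by ring
  rw [h2]
  have h3 : Real.log ((n+h:ℕ):ℝ)^(j+1) ≤ Real.log ((n+a:ℕ):ℝ)^(j+1) := pow_le_pow_left₀ h0 hlog _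
  have h5 : ((n+a:ℕ):ℝ) ≤ 2 * ((n+h:ℕ):ℝ) := by exact_mod_cast (by omega : n + a ≤ 2 * (n+h))
  have hp : (0:ℝ) < ((n+h:ℕ):ℝ) := by exact_mod_cast (by omega : 0 < n + h)
  have hq : (0:ℝ) < ((n+a:ℕ):ℝ) := by exact_mod_cast (by omega : 0 < n + a)
  have h4 : ((n+a:ℕ):ℝ)^2 ≤ 4 * ((n+h:ℕ):ℝ)^2 := by nlinarith
  have h6 : 0 ≤ Real.log ((n+h:ℕ):ℝ)^(j+1) := pow_nonneg h0 _
  rw [← mul_div_assoc, div_le_div_iff₀ (by positivity) (by positivity)]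
  nlinarith [mul_le_mul h3 h4 (by positivity) (h6.trans h3)]

lemma pointwise {a k b n0 R j : ℕ} {h : Fin k → ℕ} (ha : ∀ i, h i ≤ a) (hR : n0 + 2 * a ≤ R)
    (H : ∀ n, n0 ≤ n → n ≡ b [MOD Wa a] → ∀ i i', (n + h i).Prime → (n + h i').Prime → i = i') (n : ℕ) :
    ∑ m, w2 a b R j (h m) n ≤ 4 * w1 a b a (j+1) n := by
  classical
  unfold w1 w2
  by_cases hb : n ≡ b [MOD Wa a]
  · simp only [hb, if_true]
    have hg := g_nonneg (j+1) (n+a)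
    by_cases hm : ∃ m, (n + h m).Prime ∧ R < n + h m
    · obtain ⟨m, hp, hRm⟩ := hm
      have := ha m
      rw [Finset.sum_eq_single m]
      · exact th_g_le (ha m) (by omega) (by omega)
      · intro i _ hi
        have : ¬ ((n + h i).Prime ∧ R < n + h i) := fun h1 => hi (H n (by omega) hb i m h1.1 hp)
        rw [th, if_neg this, zero_mul]
      · simp
    · push Not at hm
      rw [Finset.sum_eq_zero]
      · linarith
      · intro i _
        have : ¬ ((n + h i).Prime ∧ R < n + h i) := fun h1 => absurd h1.2 (not_lt.mpr (hm i h1.1))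
        rw [th, if_neg this, zero_mul]
  · simp [hb]

lemma summable_mul_Ph {w : ℕ → ℝ} (hw : Summable w) (hw0 : ∀ n, 0 ≤ w n) (a l j : ℕ) (h : Fin (2^l) → ℕ) :
    Summable (fun n => w n * Ph a l j (yy h n)^2) := by
  classical
  apply Summable.of_nonneg_of_le (fun n => mul_nonneg (hw0 n) (sq_nonneg _)) (fun n => ?_)
    (hw.mul_right (∑ y, Ph a l j y ^2))
  apply mul_le_mul_of_nonneg_left _ (hw0 n)
  exact Finset.single_le_sum (f := fun y => Ph a l j y^2) (fun y _ => sq_nonneg _) (Finset.mem_univ _)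

lemma w1_nonneg (a b H J n : ℕ) : 0 ≤ w1 a b H J n := by
  unfold w1; split_ifs
  exacts [g_nonneg _ _, le_rfl]

lemma w2_nonneg (a b R j h n : ℕ) : 0 ≤ w2 a b R j h n := by
  unfold w2; split_ifs
  exacts [mul_nonneg (th_nonneg _ _) (g_nonneg _ _), le_rfl]

lemma T1_nonneg {a l : ℕ} (ha : 2^l ≤ a) (j : ℕ) : 0 ≤ T1 a l j := by
  classical
  unfold T1
  apply Finset.sum_nonneg; intro y _
  apply mul_nonneg _ (sq_nonneg _)
  apply Finset.prod_nonneg; intro p _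
  have hp : a < (p:ℕ) := (mem_Pr.mp p.2).2.1
  rcases y p with _ | i
  · simp only [pm, Option.elim, Finset.sum_const, Finset.card_univ, Fintype.card_fin, nsmul_eq_mul]
    have h1 : ((2^l:ℕ):ℝ) ≤ ((p:ℕ):ℝ) := by exact_mod_cast (by omega : 2^l ≤ (p:ℕ))
    have h2 : (0:ℝ) < ((p:ℕ):ℝ) := by exact_mod_cast (by omega : 0 < (p:ℕ))
    rw [mul_one_div, sub_nonneg, div_le_one h2]
    exact h1
  · simp only [pm, Option.elim]; positivity

lemma S_le {a l b n0 j : ℕ} {h : Fin (2^l) → ℕ} (ha : ∀ i, h i ≤ a) (hR : n0 + 2 * a ≤ Rj j)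
    (H : ∀ n, n0 ≤ n → n ≡ b [MOD Wa a] → ∀ i i', (n + h i).Prime → (n + h i').Prime → i = i') :
    ∑ m, S2 a l j b h m ≤ 4 * S1 a l j b h := by
  unfold S1 S2
  have s1 := summable_mul_Ph (summable_w1 a b a (j+1)) (w1_nonneg _ _ _ _) a l j h
  have s2 := fun m => summable_mul_Ph (summable_w2 a b (Rj j) j (h m)) (w2_nonneg _ _ _ _ _) a l j h
  rw [← Summable.tsum_finsetSum (fun m _ => s2 m), ← tsum_mul_left]
  refine Summable.tsum_le_tsum (fun n => ?_) (summable_sum fun m _ => s2 m) (s1.mul_left 4)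
  rw [← Finset.sum_mul, ← mul_assoc]
  exact mul_le_mul_of_nonneg_right (pointwise ha hR H n) (sq_nonneg _)

theorem two_primes {a l : ℕ} (hlr : (10000000000:ℝ) ≤ (l:ℝ)+1) (ha1 : 8 * 2^l * (2 * 2^l + 2) ≤ a) (ha2 : 36 * (2^l)^2 ≤ a)
    (b : ℕ) (h : Fin (2^l) → ℕ) (hinj : Function.Injective h) (ha : ∀ i, h i ≤ a) (hb : ∀ i, Nat.Coprime (b + h i) (Wa a)) (n0 : ℕ) :
    ∃ n, n0 ≤ n ∧ n ≡ b [MOD Wa a] ∧ ∃ i i', i ≠ i' ∧ (n + h i).Prime ∧ (n + h i').Prime := by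
  by_contra hcon
  have H : ∀ n, n0 ≤ n → n ≡ b [MOD Wa a] → ∀ i i', (n + h i).Prime → (n + h i').Prime → i = i' := by
    intro n h1 h2 i i' h3 h4
    by_contra h5
    exact hcon ⟨n, h1, h2, i, i', h5, h3, h4⟩
  have hph : (0:ℝ) < ((Wa a).totient : ℝ) := by exact_mod_cast Nat.totient_pos.mpr (Wa_pos a)
  have hW0 : (0:ℝ) < (Wa a : ℝ) := by exact_mod_cast Wa_pos a
  have hV := VV_pos a
  have hWV : ((Wa a).totient : ℝ) * VV a = Wa a := totient_mul_prod fun p hp => (mem_Pr.mp hp).1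
  obtain ⟨K, hK⟩ : ∃ K : ℝ, K = 2^l := ⟨_, rfl⟩
  have hK1 : 1 ≤ K := by rw [hK]; exact one_le_pow₀ (by norm_num)
  obtain ⟨P, hP⟩ : ∃ P : ℝ, P = ((Wa a).totient : ℝ) := ⟨_, rfl⟩
  rw [← hP] at hph hWV
  have hδ : 0 < K / (8 * P * (4 + K)) := by positivity
  obtain ⟨j, hj, hmc, hR⟩ := ((errors ha2 hδ).and_eventually ((main_comparison hlr ha1).and (ev_Rj (n0 + 2*a)))).exists
  obtain ⟨e1, e2⟩ := hj b h hinj ha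
  have e2' := fun m => (abs_le.mp (e2 m (hb m))).1
  have e1' := (abs_le.mp e1).2
  rw [← hP] at e2'
  have hS := S_le ha hR H
  have hk : 2^l ≤ a := by
    have : 1 ≤ 2^l := Nat.one_le_two_pow
    nlinarith
  have hT1 := T1_nonneg hk j
  obtain ⟨δ, hδd⟩ : ∃ δ, δ = K / (8 * P * (4 + K)) := ⟨_, rfl⟩
  rw [← hδd] at e1' e2' hδ
  have hf : (0:ℝ) < (j !:ℝ) := by exact_mod_cast Nat.factorial_pos j
  have hsum : (j !:ℝ) / P * ∑ m, T2 a l j m - K * (δ * (j !:ℝ)) ≤ ∑ m, S2 a l j b h m := by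
    have : ∑ m : Fin (2^l), ((j !:ℝ) / P * T2 a l j m - δ * (j !:ℝ)) ≤ ∑ m, S2 a l j b h m :=
      Finset.sum_le_sum fun m _ => by have := e2' m; linarith
    rw [Finset.sum_sub_distrib, ← Finset.mul_sum] at this
    simp only [Finset.sum_const, Finset.card_univ, Fintype.card_fin, nsmul_eq_mul] at this
    rw [hK]
    push_cast at this
    exact this
  have hM : ∑' n, g (j+1) (n+a) ≤ 4 * ((j+1) * (j !:ℝ)) := by
    have h1 := (summable_g (j+1)).sum_add_tsum_nat_add a
    have h2 : 0 ≤ ∑ i ∈ Finset.range a, g (j+1) i := Finset.sum_nonneg fun i _ => g_nonneg _ _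
    have h3 := tsum_g_le (j+1)
    rw [Nat.factorial_succ] at h3
    push_cast at h3
    linarith
  have hS1 : S1 a l j b h ≤ 4 * ((j+1) * (j !:ℝ)) / Wa a * T1 a l j + δ * (j !:ℝ) := by
    have : (∑' n, g (j+1) (n+a)) / Wa a * T1 a l j ≤ 4 * ((j+1) * (j !:ℝ)) / Wa a * T1 a l j := by gcongr
    linarith
  have e3 : 4 * (4 * ((j+1) * (j !:ℝ)) / Wa a * T1 a l j) = (j !:ℝ) / P * (16 * (j+1) * T1 a l j / VV a) := by
    rw [← hWV]; field_simp; ring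
  rw [← hK] at hmc
  have e4 : (j !:ℝ) / P * (K/4) ≤ (j !:ℝ) / P * (∑ m, T2 a l j m - 16 * (j+1) * T1 a l j / VV a) :=
    mul_le_mul_of_nonneg_left hmc (by positivity)
  rw [mul_sub] at e4
  have e5 : (j !:ℝ) / P * (K/4) ≤ (4 + K) * (δ * (j !:ℝ)) := by linarith
  have e6 : (4 + K) * (δ * (j !:ℝ)) = (j !:ℝ) / P * (K/8) := by
    rw [hδd]; field_simp
  have e7 : 0 < (j !:ℝ) / P * (K/8) := by positivity
  have e8 : (j !:ℝ) / P * (K/4) = 2 * ((j !:ℝ) / P * (K/8)) := by ring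
  linarith

end Pf
end

section
open Filter Topology
open scoped Nat
set_option linter.unusedSectionVars false
set_option linter.unusedVariables false
namespace Pf

lemma card_class {m : ℕ} (hm : 0 < m) (B N : ℕ) {F : Finset ℕ} (hF : F ⊆ Finset.Ico B (B+N))
    (h : ∀ x ∈ F, ∀ x' ∈ F, x ≡ x' [MOD m]) : F.card ≤ N / m + 1 := by
  rw [← Finset.card_range (N/m+1)]
  apply Finset.card_le_card_of_injOn (fun x => (x - B) / m)
  · intro x hx
    have := Finset.mem_Ico.mp (hF hx)
    simp only [Finset.coe_range, Set.mem_Iio]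
    exact Nat.lt_succ_of_le (Nat.div_le_div_right (by omega))
  · intro x hx x' hx' he
    have h1 := Finset.mem_Ico.mp (hF hx)
    have h2 := Finset.mem_Ico.mp (hF hx')
    have h3 : (x - B) ≡ (x' - B) [MOD m] := by
      apply Nat.ModEq.add_right_cancel' B
      rw [Nat.sub_add_cancel h1.1, Nat.sub_add_cancel h2.1]
      exact h x hx x' hx'
    have h4 := Nat.div_add_mod (x - B) m
    have h5 := Nat.div_add_mod (x' - B) m
    have h3' : (x - B) % m = (x' - B) % m := h3
    have he' : (x - B) / m = (x' - B) / m := he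
    rw [he', h3', h5] at h4
    omega

lemma greedy {s k y Q : ℕ} (hs : Squarefree s) (hk : 1 ≤ k) (hy : 4 * k = y) (hQ : Q = (y !)^2) (Z : Finset ℕ) (hZ : Z.card ≤ k) (X0 : ℕ) :
    ∃ x, X0 ≤ x ∧ ∀ z ∈ Z, Squarefree (Q * (x - z) + s) := by
  classical
  have hs0 : 0 < s := Nat.pos_of_ne_zero hs.ne_zero
  obtain ⟨N, hN⟩ : ∃ N, N = 4 * k^2 * (Q * X0 + Q + s) + 1 := ⟨_, rfl⟩
  obtain ⟨S, hS⟩ : ∃ S, S = Nat.sqrt (Q * (X0 + N) + s) := ⟨_, rfl⟩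
  let bad : ℕ → ℕ → Finset ℕ := fun z p => (Finset.Ico X0 (X0+N)).filter fun x => p.Prime ∧ z ≤ x ∧ p * p ∣ Q * (x - z) + s
  have hbad : ∀ z, ∀ p ∈ Finset.Ioc y S, (bad z p).card ≤ N / p^2 + 1 := by
    intro z p hp
    have hpy := (Finset.mem_Ioc.mp hp).1
    apply card_class (by positivity [(by omega : 0 < p)]) X0 N (Finset.filter_subset _ _)
    intro x hx x' hx'
    obtain ⟨-, pp, hz, hd⟩ := Finset.mem_filter.mp hx
    obtain ⟨-, -, hz', hd'⟩ := Finset.mem_filter.mp hx'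
    have hcop : Nat.Coprime (p^2) Q := by
      rw [hQ]
      apply Nat.Coprime.pow
      rw [pp.coprime_iff_not_dvd, pp.dvd_factorial]
      omega
    have h1 : Q * (x - z) + s ≡ Q * (x' - z) + s [MOD p^2] := by
      rw [sq]
      exact ((Nat.modEq_zero_iff_dvd).mpr hd).trans ((Nat.modEq_zero_iff_dvd).mpr hd').symm
    have h2 := Nat.ModEq.cancel_left_of_coprime (by rw [hcop.gcd_eq_one]) (Nat.ModEq.add_right_cancel' s h1)
    have h3 := Nat.ModEq.add_right z h2
    rwa [Nat.sub_add_cancel hz, Nat.sub_add_cancel hz'] at h3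
  have hex : ∃ x ∈ Finset.Ico X0 (X0+N), x ∉ Z.biUnion fun z => (Finset.Ioc y S).biUnion (bad z) := by
    by_contra hcon
    push Not at hcon
    have h1 : N ≤ (Z.biUnion fun z => (Finset.Ioc y S).biUnion (bad z)).card := by
      have := Finset.card_le_card (show Finset.Ico X0 (X0+N) ⊆ _ from hcon)
      simpa using this
    have h2 : (Z.biUnion fun z => (Finset.Ioc y S).biUnion (bad z)).card ≤ k * ∑ p ∈ Finset.Ioc y S, (N / p^2 + 1) := by
      refine (Finset.card_biUnion_le_card_mul _ _ (∑ p ∈ Finset.Ioc y S, (N / p^2 + 1)) ?_).trans (Nat.mul_le_mul_right _ hZ)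
      intro z _
      exact Finset.card_biUnion_le.trans (Finset.sum_le_sum (hbad z))
    have h3 : ((∑ p ∈ Finset.Ioc y S, (N / p^2 + 1) : ℕ) : ℝ) ≤ N / y + S := by
      rw [Nat.cast_sum]
      have e : ∀ p ∈ Finset.Ioc y S, ((N / p^2 + 1 : ℕ) : ℝ) ≤ N * ((p:ℝ)^2)⁻¹ + 1 := by
        intro p _
        push_cast
        have : ((N / p^2 : ℕ) : ℝ) ≤ (N:ℝ) / ((p^2 : ℕ):ℝ) := Nat.cast_div_le
        push_cast at this
        rw [← div_eq_mul_inv]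
        linarith
      refine (Finset.sum_le_sum e).trans ?_
      rw [Finset.sum_add_distrib, ← Finset.mul_sum]
      have c1 : ∑ p ∈ Finset.Ioc y S, ((p:ℝ)^2)⁻¹ ≤ (y:ℝ)⁻¹ := by
        rcases le_total y S with h | h
        · have := sum_Ioc_inv_sq_le_sub (α := ℝ) (k := y) (by omega) h
          have : (0:ℝ) ≤ (S:ℝ)⁻¹ := by positivity
          linarith
        · rw [Finset.Ioc_eq_empty (by omega)]; simp
      have c2 : ∑ p ∈ Finset.Ioc y S, (1:ℝ) ≤ S := by
        simp
      rw [div_eq_mul_inv]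
      exact add_le_add (mul_le_mul_of_nonneg_left c1 (by positivity)) c2
    have h4 : (N:ℝ) ≤ k * (N / y + S) := by
      have : (N:ℝ) ≤ ((k * ∑ p ∈ Finset.Ioc y S, (N / p^2 + 1) : ℕ) : ℝ) := by exact_mod_cast h1.trans h2
      rw [Nat.cast_mul] at this
      exact this.trans (mul_le_mul_of_nonneg_left h3 (by positivity))
    have hkr : (1:ℝ) ≤ k := by exact_mod_cast hk
    have h5 : (k:ℝ) * (N / y + S) = N/4 + k * S := by
      rw [← hy]; push_cast; field_simp
    have h6 : (S:ℝ)^2 ≤ Q * (X0 + N) + s := by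
      rw [hS]; exact_mod_cast Nat.sqrt_le' _
    have hN1 : (N:ℝ) = 4 * k^2 * (Q * X0 + Q + s) + 1 := by rw [hN]; push_cast; ring
    have hN2 : (1:ℝ) ≤ N := by rw [hN1]; have : (0:ℝ) ≤ 4 * k^2 * (Q * X0 + Q + s) := by positivity
                               linarith
    have h7 : (Q:ℝ) * (X0 + N) + s ≤ (Q * X0 + Q + s) * N := by
      have : (0:ℝ) ≤ (Q * X0 + s) * (N - 1) := mul_nonneg (by positivity) (by linarith)
      nlinarith
    have h8 : 4 * ((k:ℝ) * S)^2 < N^2 := by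
      calc 4 * ((k:ℝ) * S)^2 = 4 * (k:ℝ)^2 * (S:ℝ)^2 := by ring
        _ ≤ 4 * (k:ℝ)^2 * (((Q:ℝ) * X0 + Q + s) * N) := by gcongr; exact h6.trans h7
        _ = ((N:ℝ) - 1) * N := by rw [hN1]; ring
        _ < (N:ℝ)^2 := by nlinarith
    have h9 : (k:ℝ) * S < N/2 := by nlinarith
    linarith
  obtain ⟨x, hx, hxb⟩ := hex
  have hxI := Finset.mem_Ico.mp hx
  refine ⟨x, hxI.1, fun z hz => ?_⟩
  rw [Nat.squarefree_iff_prime_squarefree]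
  intro p pp hd
  rcases le_or_gt p y with hpy | hpy
  · have h1 : p * p ∣ Q := by
      rw [hQ, sq]
      have := (pp.dvd_factorial).mpr hpy
      exact Nat.mul_dvd_mul this this
    have h2 : p * p ∣ s := (Nat.dvd_add_right (h1.mul_right _)).mp hd
    exact (Nat.squarefree_iff_prime_squarefree.mp hs) p pp h2
  · rcases le_or_gt z x with hzx | hzx
    · apply hxb
      simp only [Finset.mem_biUnion, Finset.mem_Ioc]
      refine ⟨z, hz, p, ⟨hpy, ?_⟩, Finset.mem_filter.mpr ⟨hx, pp, hzx, hd⟩⟩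
      rw [hS, Nat.le_sqrt]
      refine (Nat.le_of_dvd (by omega) hd).trans ?_
      have : Q * (x - z) ≤ Q * (X0 + N) := Nat.mul_le_mul_left _ (by omega)
      omega
    · rw [Nat.sub_eq_zero_of_le hzx.le, mul_zero, zero_add] at hd
      exact (Nat.squarefree_iff_prime_squarefree.mp hs) p pp hd

lemma tuple {s k y Q : ℕ} (hs : Squarefree s) (hk : 1 ≤ k) (hy : 4 * k = y) (hQ : Q = (y !)^2) (M m : ℕ) (hm : m ≤ k) :
    ∃ Z : Finset ℕ, Z.card = m ∧ ∀ z ∈ Z, ∀ z' ∈ Z, z < z' → M < z' - z ∧ Squarefree (Q * (z' - z) + s) := by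
  classical
  induction m with
  | zero => exact ⟨∅, rfl, by simp⟩
  | succ m ih =>
    obtain ⟨Z, hc, hZ⟩ := ih (by omega)
    obtain ⟨x, hx, hsq⟩ := greedy hs hk hy hQ Z (by omega) (Z.sup id + M + 1)
    have hlt : ∀ z ∈ Z, z + M < x := fun z hz => by
      have : z ≤ Z.sup id := Finset.le_sup (f := id) hz
      omega
    refine ⟨insert x Z, ?_, ?_⟩
    · rw [Finset.card_insert_of_notMem, hc]
      intro h; have := hlt x h; omega
    · intro z hz z' hz' hzz
      rw [Finset.mem_insert] at hz hz'
      rcases hz with rfl | hz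
      · rcases hz' with rfl | hz'
        · omega
        · have := hlt z' hz'; omega
      · rcases hz' with rfl | hz'
        · have := hlt z hz
          exact ⟨by omega, hsq z hz⟩
        · exact hZ z hz z' hz' hzz

lemma avoid {k p : ℕ} (hkp : k < p) (h : Fin k → ℕ) : ∃ r, ∀ i, ¬ p ∣ r + h i := by
  classical
  have : ∃ r ∈ Finset.range p, r ∉ (Finset.univ : Finset (Fin k)).image fun i => (p - h i % p) % p := by
    apply Finset.exists_mem_notMem_of_card_lt_card
    refine Finset.card_image_le.trans_lt ?_
    simpa using hkp
  obtain ⟨r, hr, hn⟩ := this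
  refine ⟨r, fun i hd => hn (Finset.mem_image.mpr ⟨i, Finset.mem_univ _, ?_⟩)⟩
  have hrp := Finset.mem_range.mp hr
  have h1 : h i % p < p := Nat.mod_lt _ (by omega)
  have h2 : p ∣ r + h i % p := by
    rw [Nat.dvd_iff_mod_eq_zero] at hd ⊢
    rw [← hd, Nat.add_mod, Nat.mod_mod, ← Nat.add_mod]
  obtain ⟨c, hc⟩ := h2
  have hc2 : c < 2 := by
    by_contra h; have : p * 2 ≤ p * c := Nat.mul_le_mul_left _ (by omega)
    omega
  interval_cases c
  · have e1 : r = 0 := by omega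
    have e2 : h i % p = 0 := by omega
    simp [e1, e2]
  · have : p - h i % p = r := by omega
    simp only [this]; exact Nat.mod_eq_of_lt hrp

lemma choose_b {k y Q Hm : ℕ} (hk : 1 ≤ k) (hy : 4 * k = y) (hQ : Q = (y !)^2) (h : Fin k → ℕ) (hd : ∀ i, Q ∣ h i) (hH : ∀ i, h i ≤ Hm) (a : ℕ)
    (ha : ∀ e ≤ Hm, Nat.nth Nat.Prime (Hm + e) ≤ a) :
    ∃ b, (∀ i, Nat.Coprime (b + h i) (Wa a)) ∧ ∀ e ≤ Hm, (∀ i, h i ≠ e) → ∃ p, p.Prime ∧ p ≤ a ∧ p ∣ Wa a ∧ p ∣ b + e := by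
  classical
  have hr : ∀ p, ∃ r, p.Prime → (∀ i, ¬ p ∣ r + h i) ∧ ∀ e ≤ Hm, (∀ i, h i ≠ e) → p = Nat.nth Nat.Prime (Hm + e) → p ∣ r + e := by
    intro p
    by_cases pp : p.Prime
    swap
    · exact ⟨0, fun h => absurd h pp⟩
    by_cases he : ∃ e ≤ Hm, (∀ i, h i ≠ e) ∧ p = Nat.nth Nat.Prime (Hm + e)
    · obtain ⟨e, he1, he2, he3⟩ := he
      have hpH : Hm + e + 2 ≤ p := by rw [he3]; exact Nat.add_two_le_nth_prime _
      refine ⟨p - e, fun _ => ⟨fun i hdv => ?_, fun e' _ _ he' => ?_⟩⟩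
      · have h1 := hH i
        have h2 := he2 i
        rcases Nat.lt_or_gt_of_ne h2 with h3 | h3
        · exact absurd (Nat.le_of_dvd (by omega) hdv) (by omega)
        · have e1 : p - e + h i = p + (h i - e) := by omega
          rw [e1, Nat.dvd_add_right (dvd_refl p)] at hdv
          exact absurd (Nat.le_of_dvd (by omega) hdv) (by omega)
      · have : e = e' := by
          have := Nat.nth_injective Nat.infinite_setOfPred_prime (he3.symm.trans he')
          omega
        rw [← this, Nat.sub_add_cancel (by omega)]
    · have : ∃ r, ∀ i, ¬ p ∣ r + h i := by
        rcases le_or_gt p y with hpy | hpy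
        · refine ⟨1, fun i hdv => ?_⟩
          have : p ∣ h i := by
            refine dvd_trans ?_ (hd i)
            rw [hQ]
            exact dvd_pow ((pp.dvd_factorial).mpr hpy) (by norm_num)
          exact pp.one_lt.ne' (Nat.dvd_one.mp ((Nat.dvd_add_left this).mp hdv))
        · exact avoid (by omega) h
      obtain ⟨r, hr⟩ := this
      exact ⟨r, fun _ => ⟨hr, fun e h1 h2 h3 => absurd ⟨e, h1, h2, h3⟩ he⟩⟩
  choose r hr using hr
  obtain ⟨b, hb⟩ := Nat.chineseRemainderOfFinset r id (Pr 0 a) (fun p hp => (mem_Pr.mp hp).1.ne_zero)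
    (fun p hp q hq hpq => (Nat.coprime_primes (mem_Pr.mp hp).1 (mem_Pr.mp hq).1).mpr hpq)
  have hb' : ∀ p, p.Prime → p ≤ a → ∀ e, (p ∣ b + e ↔ p ∣ r p + e) := fun p pp hpa e =>
    (Nat.ModEq.add_right e (hb p (mem_Pr.mpr ⟨pp, pp.pos, hpa⟩))).dvd_iff (dvd_refl p)
  refine ⟨b, fun i => ?_, fun e he hne => ?_⟩
  · apply Nat.coprime_of_dvd
    intro p pp h1 h2
    have hpa := (prime_dvd_W pp).mp h2
    exact ((hr p pp).1 i) ((hb' p pp hpa _).mp h1)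
  · have pp : (Nat.nth Nat.Prime (Hm + e)).Prime := Nat.prime_nth_prime _
    refine ⟨_, pp, ha e he, (prime_dvd_W pp).mpr (ha e he), ?_⟩
    rw [hb' _ pp (ha e he)]
    exact (hr _ pp).2 e he hne rfl

lemma gaps_infinite {D : Set ℕ} (H : ∀ n0, ∃ n q, n0 ≤ q ∧ Nat.nth Nat.Prime n = q ∧ Nat.nth Nat.Prime (n+1) - Nat.nth Nat.Prime n ∈ D) (hD : D.Finite) :
    ∃ d ∈ D, DePolignac d := by
  by_contra hcon
  push Not at hcon
  have hf : (⋃ d ∈ D, {n : ℕ | Nat.nth Nat.Prime (n + 1) - Nat.nth Nat.Prime n = d}).Finite := by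
    apply hD.biUnion
    intro d hd
    exact Set.not_infinite.mp (hcon d hd)
  obtain ⟨B, hB⟩ := hf.bddAbove
  obtain ⟨n, q, h1, h2, h3⟩ := H (Nat.nth Nat.Prime (B+1))
  have h4 : n ≤ B := hB (Set.mem_biUnion h3 rfl)
  have h5 : Nat.nth Nat.Prime n < Nat.nth Nat.Prime (B+1) := Nat.nth_strictMono Nat.infinite_setOfPred_prime (by omega)
  omega

lemma next_prime {q q' : ℕ} (hq : q.Prime) (hq' : q'.Prime) (hlt : q < q') :
    ∃ n, Nat.nth Nat.Prime n = q ∧ (Nat.nth Nat.Prime (n+1)).Prime ∧ q < Nat.nth Nat.Prime (n+1) ∧ Nat.nth Nat.Prime (n+1) ≤ q' := by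
  have h1 := Nat.nth_count hq
  have h2 := Nat.nth_count hq'
  refine ⟨Nat.count Nat.Prime q, h1, Nat.prime_nth_prime _, ?_, ?_⟩
  · conv_lhs => rw [← h1]
    exact Nat.nth_strictMono Nat.infinite_setOfPred_prime (by omega)
  · conv_rhs => rw [← h2]
    apply (Nat.nth_strictMono Nat.infinite_setOfPred_prime).monotone
    exact Nat.count_strict_mono hq hlt

theorem key (s : ℕ) (hs : Squarefree s) (M : ℕ) : ∃ m, M < m ∧ Squarefree (m + s) ∧ DePolignac m := by
  classical
  obtain ⟨l, hl⟩ := exists_nat_ge (10000000000:ℝ)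
  have hlr : (10000000000:ℝ) ≤ (l:ℝ) + 1 := by linarith
  clear hl
  have hk : 1 ≤ 2^l := Nat.one_le_two_pow
  obtain ⟨y, hy⟩ : ∃ y, 4 * 2^l = y := ⟨_, rfl⟩
  obtain ⟨Q, hQ⟩ : ∃ Q, Q = (y !)^2 := ⟨_, rfl⟩
  have hQ0 : 0 < Q := by rw [hQ]; positivity
  obtain ⟨Z, hZc, hZ⟩ := tuple hs hk hy hQ M (2^l) le_rfl
  let h : Fin (2^l) → ℕ := fun i => Q * Z.orderEmbOfFin hZc i
  have hinj : Function.Injective h := by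
    intro i j hij
    exact (Z.orderEmbOfFin hZc).injective (Nat.eq_of_mul_eq_mul_left hQ0 hij)
  obtain ⟨Hm, hHm⟩ : ∃ Hm, ∀ i, h i ≤ Hm := ⟨Finset.univ.sup h, fun i => Finset.le_sup (Finset.mem_univ i)⟩
  obtain ⟨a, ha⟩ : ∃ a, a = Nat.nth Nat.Prime (Hm + Hm) + Hm + 8 * 2^l * (2 * 2^l + 2) + 36 * (2^l)^2 := ⟨_, rfl⟩
  have ha1 : 8 * 2^l * (2 * 2^l + 2) ≤ a := by rw [ha]; exact (Nat.le_add_left _ _).trans (Nat.le_add_right _ _)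
  have ha2 : 36 * (2^l)^2 ≤ a := by rw [ha]; exact Nat.le_add_left _ _
  have ha3 : Nat.nth Nat.Prime (Hm + Hm) + Hm ≤ a := by rw [ha, add_assoc (_ + _)]; exact Nat.le_add_right _ _
  clear ha
  have hmono : Monotone (Nat.nth Nat.Prime) := (Nat.nth_strictMono Nat.infinite_setOfPred_prime).monotone
  obtain ⟨b, hb1, hb2⟩ := choose_b hk hy hQ h (fun i => dvd_mul_right _ _) hHm a (fun e he =>
    (hmono (by omega : Hm + e ≤ Hm + Hm)).trans (by omega))
  have hD : {d | ∃ i j, h i < h j ∧ h j - h i = d}.Finite := by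
    apply (Set.finite_range (fun x : Fin (2^l) × Fin (2^l) => h x.2 - h x.1)).subset
    rintro d ⟨i, j, -, rfl⟩
    exact ⟨(i, j), rfl⟩
  obtain ⟨d, ⟨i, j, hij, rfl⟩, hdP⟩ := gaps_infinite (D := {d | ∃ i j, h i < h j ∧ h j - h i = d}) (by
    intro n0
    obtain ⟨n, hn0, hnb, i, j, hij, hpi, hpj⟩ := two_primes hlr ha1 ha2 b h hinj (fun i => (hHm i).trans (by omega)) hb1 (n0 + a + 1)
    have hmain : ∀ i j, h i < h j → (n + h i).Prime → (n + h j).Prime → ∃ m q, n0 ≤ q ∧ Nat.nth Nat.Prime m = q ∧ Nat.nth Nat.Prime (m+1) - Nat.nth Nat.Prime m ∈ {d | ∃ i j, h i < h j ∧ h j - h i = d} := by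
      intro i j hij hpi hpj
      obtain ⟨m, e1, e2, e3, e4⟩ := next_prime hpi hpj (by omega)
      refine ⟨m, n + h i, by omega, e1, ?_⟩
      have hj := hHm j
      obtain ⟨e, he⟩ : ∃ e, Nat.nth Nat.Prime (m+1) = n + e := ⟨_, (Nat.add_sub_cancel' (by omega : n ≤ _)).symm⟩
      rw [he] at e2 e3 e4
      by_cases hne : ∀ i, h i ≠ e
      · obtain ⟨p, pp, hpa, hpW, hpd⟩ := hb2 e (by omega) hne
        have hmod : p ∣ n + e := ((Nat.ModEq.add_right e hnb).dvd_iff hpW).mpr hpd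
        have := (Nat.prime_dvd_prime_iff_eq pp e2).mp hmod
        omega
      · push Not at hne
        obtain ⟨i', hi'⟩ := hne
        exact ⟨i, i', by omega, by rw [he, e1]; omega⟩
    rcases Nat.lt_or_gt_of_ne (fun he => hij (hinj he) : h i ≠ h j) with hlt | hlt
    · exact hmain i j hlt hpi hpj
    · exact hmain j i hlt hpj hpi) hD
  have hlt : Z.orderEmbOfFin hZc i < Z.orderEmbOfFin hZc j := lt_of_mul_lt_mul_left hij (Nat.zero_le Q)
  have e := hZ _ (Z.orderEmbOfFin_mem hZc i) _ (Z.orderEmbOfFin_mem hZc j) hlt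
  have e1 : h j - h i = Q * (Z.orderEmbOfFin hZc j - Z.orderEmbOfFin hZc i) := (Nat.mul_sub _ _ _).symm
  refine ⟨h j - h i, ?_, ?_, hdP⟩
  · rw [e1]; exact e.1.trans_le (Nat.le_mul_of_pos_left _ hQ0)
  · rw [e1]; exact e.2

end Pf
end

/-- For every squarefree `s`, the shifted set of squarefree numbers `𝒮 - s`
contains infinitely many de Polignac numbers. -/
theorem squarefree_shift_contains_infinitely_many_de_polignac_numbers
    (s : ℕ) (hs : Squarefree s) :
    {m : ℕ | (∃ t : ℕ, Squarefree t ∧ m + s = t) ∧ DePolignac m}.Infinite := by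
  apply Set.infinite_of_forall_exists_gt
  intro M
  obtain ⟨m, h1, h2, h3⟩ := Pf.key s hs M
  exact ⟨m, ⟨⟨_, h2, rfl⟩, h3⟩, h1⟩
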